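/- There are infinitely many primes p such that the integer p(p² − 1)/2 has at most 20 distinct prime divisors. -/

import Mathlib

section
namespace PSLSieve

open Finset

/-- The additive character `x ↦ exp(2πix)`. -/
noncomputable def ee (x : ℝ) : ℂ := Complex.exp (2 * Real.pi * x * Complex.I)

lemma ee_add (x y : ℝ) : ee (x + y) = ee x * ee y := by
  unfold ee; rw [← Complex.exp_add]; congr 1; push_cast; ring

lemma ee_norm (x : ℝ) : ‖ee x‖ = 1 := by
  unfold ee
  have := Complex.norm_exp_ofReal_mul_I (2 * Real.pi * x)
  push_cast at this; exact this

lemma ee_zero : ee 0 = 1 := by simp [ee]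

lemma ee_int (n : ℤ) : ee n = 1 := by
  unfold ee
  rw [Complex.exp_eq_one_iff]
  exact ⟨n, by push_cast; ring⟩

lemma ee_conj (x : ℝ) : (starRingEnd ℂ) (ee x) = ee (-x) := by
  unfold ee
  rw [← Complex.exp_conj]; congr 1
  have h2 : (starRingEnd ℂ) 2 = 2 := map_ofNat _ 2
  simp [h2]

lemma ee_nat_mul (a : ℕ) (x : ℝ) : ee (a * x) = ee x ^ a := by
  unfold ee; rw [← Complex.exp_nat_mul]; congr 1; push_cast; ring

lemma ee_fract (x : ℝ) : ee (Int.fract x) = ee x := by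
  have : x = Int.fract x + (⌊x⌋ : ℝ) := (Int.fract_add_floor x).symm
  conv_rhs => rw [this, ee_add, ee_int, mul_one]

lemma ee_sub_one_norm_ge {t d : ℝ} (hd : 0 ≤ d) (h1 : d ≤ t) (h2 : d ≤ 1 - t) :
    4 * d ≤ ‖ee t - 1‖ := by
  have h0 : ee t = Complex.exp (Complex.I * ((2 * Real.pi * t : ℝ) : ℂ)) := by
    unfold ee; congr 1; push_cast; ring
  rw [h0, Complex.norm_exp_I_mul_ofReal_sub_one, Real.norm_eq_abs]
  have hpi := Real.pi_pos
  have hs : 2 * d ≤ Real.sin (Real.pi * t) := by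
    rcases le_total t (1/2) with h | h
    · have := Real.mul_le_sin (x := Real.pi * t) (by nlinarith) (by nlinarith)
      have e : 2 / Real.pi * (Real.pi * t) = 2 * t := by field_simp
      linarith
    · have := Real.mul_le_sin (x := Real.pi * (1 - t)) (by nlinarith) (by nlinarith)
      have e : 2 / Real.pi * (Real.pi * (1-t)) = 2 * (1-t) := by field_simp
      have e2 : Real.sin (Real.pi * (1 - t)) = Real.sin (Real.pi * t) := by
        rw [show Real.pi * (1 - t) = Real.pi - Real.pi * t by ring, Real.sin_pi_sub]
      linarith
  have e3 : 2 * Real.pi * t / 2 = Real.pi * t := by ring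
  rw [e3]
  calc 4 * d ≤ 2 * Real.sin (Real.pi * t) := by linarith
    _ ≤ _ := le_abs_self _

lemma geom_ee_bound (K : ℕ) {t d : ℝ} (hd : 0 < d) (h1 : d ≤ t) (h2 : d ≤ 1 - t) :
    ‖∑ a ∈ range K, ee (a * t)‖ ^ 2 ≤ 1 / (4 * d ^ 2) := by
  have hge := ee_sub_one_norm_ge hd.le h1 h2
  have hne : ee t ≠ 1 := by
    intro h; rw [h] at hge; simp at hge; linarith
  have hs : ∑ a ∈ range K, ee (a * t) = (ee t ^ K - 1) / (ee t - 1) := by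
    rw [← geom_sum_eq hne]; exact sum_congr rfl fun a _ => ee_nat_mul a t
  rw [hs, norm_div]
  have hnum : ‖ee t ^ K - 1‖ ≤ 2 := by
    calc _ ≤ ‖ee t ^ K‖ + ‖(1:ℂ)‖ := norm_sub_le _ _
      _ = 2 := by rw [norm_pow, ee_norm]; norm_num
  have : ‖ee t ^ K - 1‖ / ‖ee t - 1‖ ≤ 2 / (4 * d) := by gcongr
  calc _ ≤ (2 / (4 * d)) ^ 2 := by gcongr
    _ = _ := by field_simp; norm_num

lemma sum_inv_sq_sep {ι : Type*} (S : Finset ι) (t : ι → ℝ) {δ : ℝ} (hδ : 0 < δ)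
    (ht : ∀ j ∈ S, δ ≤ t j) (hsep : ∀ i ∈ S, ∀ j ∈ S, i ≠ j → δ ≤ |t i - t j|) :
    ∑ j ∈ S, 1 / (t j) ^ 2 ≤ 2 / δ ^ 2 := by
  classical
  let b : ι → ℕ := fun j => ⌊t j / δ⌋₊
  have hb1 : ∀ j ∈ S, 1 ≤ b j := fun j hj => by
    apply Nat.le_floor; rw [le_div_iff₀ hδ]; simpa using ht j hj
  have hble : ∀ j ∈ S, (b j : ℝ) * δ ≤ t j := fun j hj => by
    rw [← le_div_iff₀ hδ]; exact Nat.floor_le (div_nonneg (hδ.le.trans (ht j hj)) hδ.le)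
  have hblt : ∀ j ∈ S, t j < ((b j : ℝ) + 1) * δ := fun j hj => by
    rw [← div_lt_iff₀ hδ]; exact Nat.lt_floor_add_one _
  have hinj : Set.InjOn b S := by
    intro i hi j hj hij
    by_contra hne
    have h1 := hsep i hi j hj hne
    have a1 := hble i hi; have a2 := hblt i hi
    have a3 := hble j hj; have a4 := hblt j hj
    rw [hij] at a1 a2
    have : |t i - t j| < δ := by rw [abs_lt]; constructor <;> nlinarith
    linarith
  have step : ∑ j ∈ S, 1 / (t j) ^ 2 ≤ ∑ j ∈ S, ((b j : ℝ) ^ 2)⁻¹ * (1 / δ ^ 2) := by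
    apply sum_le_sum
    intro j hj
    have hb := hb1 j hj
    have hbpos : (0:ℝ) < b j := by exact_mod_cast hb
    have : ((b j : ℝ) * δ) ^ 2 ≤ t j ^ 2 := by
      have := hble j hj; gcongr
    calc 1 / (t j) ^ 2 ≤ 1 / ((b j : ℝ) * δ) ^ 2 := by
          apply one_div_le_one_div_of_le (by positivity) this
      _ = _ := by field_simp
  refine step.trans ?_
  rw [← sum_mul]
  have h2 : ∑ j ∈ S, ((b j : ℝ) ^ 2)⁻¹ ≤ 2 := by
    rw [← sum_image (f := fun n : ℕ => ((n : ℝ) ^ 2)⁻¹) hinj]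
    have hsub : S.image b ⊆ Ioo 0 ((S.image b).sup id + 1) := by
      intro n hn
      rw [mem_Ioo]
      refine ⟨?_, Nat.lt_succ_of_le (le_sup (f := id) hn)⟩
      obtain ⟨j, hj, rfl⟩ := mem_image.mp hn
      exact hb1 j hj
    calc _ ≤ ∑ n ∈ Ioo 0 ((S.image b).sup id + 1), ((n : ℝ) ^ 2)⁻¹ :=
          sum_le_sum_of_subset_of_nonneg hsub (fun _ _ _ => by positivity)
      _ ≤ 2 / ((0 : ℕ) + 1) := sum_Ioo_inv_sq_le 0 _
      _ = 2 := by norm_num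
  calc _ ≤ 2 * (1 / δ ^ 2) := by gcongr
    _ = _ := by ring

/-- row sums of the Fejér kernel at well spaced points -/
lemma row_sum {ι : Type*} [DecidableEq ι] (S : Finset ι) (α : ι → ℝ) {δ : ℝ} (hδ : 0 < δ)
    (hsep : ∀ i ∈ S, ∀ j ∈ S, i ≠ j → ∀ n : ℤ, δ ≤ |α i - α j - n|) (K : ℕ) (hK : 1 ≤ K * δ)
    (i : ι) (hi : i ∈ S) :
    ∑ j ∈ S, ‖∑ a ∈ range K, ee (a * (α i - α j))‖ ^ 2 ≤ 2 * K ^ 2 := by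
  have hper : ∀ j (a : ℕ), ee (a * (α i - α j)) = ee (a * Int.fract (α i - α j)) := by
    intro j a
    rw [ee_nat_mul, ee_nat_mul, ee_fract]
  rw [← add_sum_erase S _ hi]
  have hdiag : ‖∑ a ∈ range K, ee (a * (α i - α i))‖ ^ 2 = K ^ 2 := by
    simp [ee_zero]
  rw [hdiag]
  set t : ι → ℝ := fun j => Int.fract (α i - α j) with ht
  have htf : ∀ j, t j = α i - α j - ⌊α i - α j⌋ := fun j => (Int.self_sub_floor _).symm
  have ht1 : ∀ j ∈ S.erase i, δ ≤ t j := by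
    intro j hj
    rw [mem_erase] at hj
    have := hsep i hi j hj.2 (Ne.symm hj.1) ⌊α i - α j⌋
    rwa [← htf, abs_of_nonneg (Int.fract_nonneg _)] at this
  have ht2 : ∀ j ∈ S.erase i, δ ≤ 1 - t j := by
    intro j hj
    rw [mem_erase] at hj
    have := hsep i hi j hj.2 (Ne.symm hj.1) (⌊α i - α j⌋ + 1)
    have e : α i - α j - ((⌊α i - α j⌋ + 1 : ℤ) : ℝ) = -(1 - t j) := by
      rw [htf]; push_cast; ring
    rw [e, abs_neg, abs_of_nonneg] at this
    · exact this
    · have := Int.fract_lt_one (α i - α j); simp only [ht]; linarith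
  have hsp : ∀ j ∈ S.erase i, ∀ l ∈ S.erase i, j ≠ l → δ ≤ |t j - t l| := by
    intro j hj l hl hjl
    rw [mem_erase] at hj hl
    have := hsep l hl.2 j hj.2 (Ne.symm hjl) (⌊α i - α j⌋ - ⌊α i - α l⌋)
    have e : α l - α j - ((⌊α i - α j⌋ - ⌊α i - α l⌋ : ℤ) : ℝ) = t j - t l := by
      rw [htf, htf]; push_cast; ring
    rwa [e] at this
  have b1 := sum_inv_sq_sep (S.erase i) t hδ ht1 hsp
  have b2 := sum_inv_sq_sep (S.erase i) (fun j => 1 - t j) hδ ht2 (by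
    intro j hj l hl hjl
    have := hsp l hl j hj (Ne.symm hjl)
    rwa [show 1 - t j - (1 - t l) = t l - t j by ring])
  have hterm : ∀ j ∈ S.erase i, ‖∑ a ∈ range K, ee (a * (α i - α j))‖ ^ 2
      ≤ 1 / 4 * (1 / t j ^ 2) + 1 / 4 * (1 / (1 - t j) ^ 2) := by
    intro j hj
    have p1 := ht1 j hj
    have p2 := ht2 j hj
    have : ∑ a ∈ range K, ee (a * (α i - α j)) = ∑ a ∈ range K, ee (a * t j) :=
      sum_congr rfl fun a _ => hper j a
    rw [this]
    rcases le_total (t j) (1 - t j) with h | h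
    · have := geom_ee_bound K (hδ.trans_le p1) le_rfl h
      have q : 0 ≤ 1 / 4 * (1 / (1 - t j) ^ 2) := by positivity
      have e : 1 / (4 * t j ^ 2) = 1 / 4 * (1 / t j ^ 2) := by ring
      linarith
    · have := geom_ee_bound K (hδ.trans_le p2) h le_rfl
      have q : 0 ≤ 1 / 4 * (1 / (t j) ^ 2) := by positivity
      have e : 1 / (4 * (1 - t j) ^ 2) = 1 / 4 * (1 / (1 - t j) ^ 2) := by
        rw [one_div_mul_one_div]
      linarith
  have hsum := sum_le_sum hterm
  rw [sum_add_distrib, ← mul_sum, ← mul_sum] at hsum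
  have hKδ : 1 / δ ^ 2 ≤ (K:ℝ) ^ 2 := by
    rw [div_le_iff₀ (by positivity)]
    nlinarith
  have : (2:ℝ) / δ ^ 2 = 2 * (1 / δ ^ 2) := by ring
  linarith

/-- Dual additive large sieve. -/
lemma dual_additive {ι : Type*} [DecidableEq ι] (S : Finset ι) (α : ι → ℝ) {δ : ℝ} (hδ : 0 < δ)
    (hsep : ∀ i ∈ S, ∀ j ∈ S, i ≠ j → ∀ n : ℤ, δ ≤ |α i - α j - n|) (K N m : ℕ) (hK : 1 ≤ K * δ)
    (hKN : 2 * N ≤ K) (hK0 : 0 < K) (c : ι → ℂ) :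
    ∑ n ∈ range N, ‖∑ i ∈ S, c i * ee ((m + n : ℝ) * α i)‖ ^ 2 ≤ 4 * K * ∑ i ∈ S, ‖c i‖ ^ 2 := by
  classical
  let F : ℤ → ℂ := fun x => ∑ i ∈ S, c i * ee ((x : ℝ) * α i)
  -- step 1: majorise by Fejér
  have s1 : (K / 2 : ℝ) * ∑ n ∈ range N, ‖∑ i ∈ S, c i * ee ((m + n : ℝ) * α i)‖ ^ 2
      ≤ ∑ a ∈ range K, ∑ b ∈ range K, ‖F (m + a - b)‖ ^ 2 := by
    have h1 : ∀ n ∈ range N, (K / 2 : ℝ) * ‖∑ i ∈ S, c i * ee ((m + n : ℝ) * α i)‖ ^ 2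
        ≤ ∑ b ∈ range (K - N), ‖F (m + (b + n : ℕ) - b)‖ ^ 2 := by
      intro n hn
      have : ∀ b ∈ range (K - N), ‖F (m + (b + n : ℕ) - b)‖ ^ 2
          = ‖∑ i ∈ S, c i * ee ((m + n : ℝ) * α i)‖ ^ 2 := by
        intro b hb
        simp only [F]
        congr 3; ext i; congr 3; push_cast; ring
      rw [sum_congr rfl this, sum_const, card_range, nsmul_eq_mul]
      gcongr
      have hN : N ≤ K := by omega
      rw [Nat.cast_sub hN]
      have : (2:ℝ) * N ≤ K := by exact_mod_cast hKN
      linarith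
    rw [mul_sum]
    refine (sum_le_sum h1).trans ?_
    rw [← sum_product', ← sum_product']
    have hinj : Set.InjOn (fun x : ℕ × ℕ => ((x.2 + x.1, x.2) : ℕ × ℕ))
        (range N ×ˢ range (K - N) : Finset (ℕ × ℕ)) := by
      rintro ⟨a, b⟩ - ⟨a', b'⟩ - h
      simp only [Prod.mk.injEq] at h ⊢
      omega
    rw [← sum_image (f := fun x : ℕ × ℕ => ‖F (m + (x.1 : ℕ) - x.2)‖ ^ 2) hinj]
    apply sum_le_sum_of_subset_of_nonneg
    · intro x hx
      obtain ⟨⟨a, b⟩, hab, rfl⟩ := mem_image.mp hx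
      simp only [mem_product, mem_range] at hab ⊢
      omega
    · intros; positivity
  -- step 2: expand
  have s2 : ((∑ a ∈ range K, ∑ b ∈ range K, ‖F (m + a - b)‖ ^ 2 : ℝ) : ℂ)
      = ∑ i ∈ S, ∑ j ∈ S, c i * (starRingEnd ℂ) (c j) * ee (m * (α i - α j)) *
        ((‖∑ a ∈ range K, ee (a * (α i - α j))‖ ^ 2 : ℝ) : ℂ) := by
    have e1 : ∀ x : ℤ, ((‖F x‖ ^ 2 : ℝ) : ℂ)
        = ∑ i ∈ S, ∑ j ∈ S, c i * (starRingEnd ℂ) (c j) * ee (x * (α i - α j)) := by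
      intro x
      rw [← Complex.normSq_eq_norm_sq, ← Complex.mul_conj]
      simp only [F, map_sum, sum_mul_sum, map_mul, ee_conj]
      refine sum_congr rfl fun i _ => sum_congr rfl fun j _ => ?_
      have : ee (x * (α i - α j)) = ee (x * α i) * ee (-(x * α j)) := by
        rw [← ee_add]; congr 1; ring
      rw [this]; ring
    have e2 : ∀ i j, ((‖∑ a ∈ range K, ee (a * (α i - α j))‖ ^ 2 : ℝ) : ℂ)
        = ∑ a ∈ range K, ∑ b ∈ range K, ee (((a:ℝ) - b) * (α i - α j)) := by
      intro i j
      rw [← Complex.normSq_eq_norm_sq, ← Complex.mul_conj]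
      simp only [map_sum, sum_mul_sum, ee_conj]
      refine sum_congr rfl fun a _ => sum_congr rfl fun b _ => ?_
      rw [← ee_add]; congr 1; ring
    push_cast at e1 e2 ⊢
    simp_rw [e1, e2, mul_sum]
    have sw : ∀ f : ℕ → ℕ → ι → ι → ℂ, ∑ a ∈ range K, ∑ b ∈ range K, ∑ i ∈ S, ∑ j ∈ S, f a b i j
        = ∑ i ∈ S, ∑ j ∈ S, ∑ a ∈ range K, ∑ b ∈ range K, f a b i j := by
      intro f
      calc _ = ∑ a ∈ range K, ∑ i ∈ S, ∑ j ∈ S, ∑ b ∈ range K, f a b i j := by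
            refine sum_congr rfl fun a _ => ?_
            rw [sum_comm]; refine sum_congr rfl fun i _ => ?_
            rw [sum_comm]
        _ = _ := by
            rw [sum_comm]; refine sum_congr rfl fun i _ => ?_
            rw [sum_comm]
    rw [sw]
    refine sum_congr rfl fun i _ => sum_congr rfl fun j _ => sum_congr rfl fun a _ =>
      sum_congr rfl fun b _ => ?_
    have : ee (((m + a - b : ℤ) : ℝ) * (α i - α j))
        = ee (m * (α i - α j)) * ee (((a:ℝ) - b) * (α i - α j)) := by
      rw [← ee_add]; congr 1; push_cast; ring
    rw [this]; ring
  have s3 : (∑ a ∈ range K, ∑ b ∈ range K, ‖F (m + a - b)‖ ^ 2 : ℝ)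
      ≤ ∑ i ∈ S, ∑ j ∈ S, (‖c i‖ ^ 2 / 2 + ‖c j‖ ^ 2 / 2) *
        ‖∑ a ∈ range K, ee (a * (α i - α j))‖ ^ 2 := by
    have hnn : 0 ≤ (∑ a ∈ range K, ∑ b ∈ range K, ‖F (m + a - b)‖ ^ 2 : ℝ) := by positivity
    rw [← Complex.norm_of_nonneg hnn, s2]
    refine (norm_sum_le _ _).trans (sum_le_sum fun i _ => (norm_sum_le _ _).trans
      (sum_le_sum fun j _ => ?_))
    rw [norm_mul, norm_mul, norm_mul, ee_norm, RCLike.norm_conj, Complex.norm_of_nonneg (by positivity),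
      mul_one]
    gcongr
    nlinarith [sq_nonneg (‖c i‖ - ‖c j‖)]
  have hsymm : ∀ i j, ‖∑ a ∈ range K, ee (a * (α i - α j))‖ ^ 2
      = ‖∑ a ∈ range K, ee (a * (α j - α i))‖ ^ 2 := by
    intro i j
    rw [← RCLike.norm_conj (∑ a ∈ range K, ee (a * (α i - α j)))]
    congr 2
    rw [map_sum]
    refine sum_congr rfl fun a _ => ?_
    rw [ee_conj]; congr 1; ring
  have s4 : ∑ i ∈ S, ∑ j ∈ S, (‖c i‖ ^ 2 / 2 + ‖c j‖ ^ 2 / 2) *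
        ‖∑ a ∈ range K, ee (a * (α i - α j))‖ ^ 2 =
      ∑ i ∈ S, ‖c i‖ ^ 2 * ∑ j ∈ S, ‖∑ a ∈ range K, ee (a * (α i - α j))‖ ^ 2 := by
    simp_rw [add_mul, sum_add_distrib]
    have : ∑ i ∈ S, ∑ j ∈ S, ‖c j‖ ^ 2 / 2 * ‖∑ a ∈ range K, ee (a * (α i - α j))‖ ^ 2
      = ∑ i ∈ S, ∑ j ∈ S, ‖c i‖ ^ 2 / 2 * ‖∑ a ∈ range K, ee (a * (α i - α j))‖ ^ 2 := by
      rw [sum_comm]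
      refine sum_congr rfl fun i _ => sum_congr rfl fun j _ => ?_
      rw [hsymm]
    rw [this, ← sum_add_distrib]
    refine sum_congr rfl fun i _ => ?_
    rw [← sum_add_distrib, mul_sum]
    refine sum_congr rfl fun j _ => ?_
    ring
  have s5 : ∑ i ∈ S, ‖c i‖ ^ 2 * ∑ j ∈ S, ‖∑ a ∈ range K, ee (a * (α i - α j))‖ ^ 2
      ≤ ∑ i ∈ S, ‖c i‖ ^ 2 * (2 * K ^ 2) := by
    refine sum_le_sum fun i hi => ?_
    gcongr
    exact row_sum S α hδ hsep K hK i hi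
  rw [← sum_mul] at s5
  have hKp : (0:ℝ) < K := by exact_mod_cast hK0
  have fin : (K / 2 : ℝ) * ∑ n ∈ range N, ‖∑ i ∈ S, c i * ee ((m + n : ℝ) * α i)‖ ^ 2
      ≤ (K / 2 : ℝ) * (4 * K * ∑ i ∈ S, ‖c i‖ ^ 2) := by
    refine s1.trans (s3.trans (s4.le.trans (s5.trans (le_of_eq ?_))))
    ring
  exact le_of_mul_le_mul_left fin (by positivity)

end PSLSieve
end

section
namespace PSLSieve

open Finset

lemma sum_zmod_range (r : ℕ) [NeZero r] (f : ZMod r → ℂ) :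
    ∑ a : ZMod r, f a = ∑ a ∈ range r, f (a : ZMod r) := by
  refine sum_bij' (fun a _ => a.val) (fun a _ => (a : ZMod r)) ?_ ?_ ?_ ?_ ?_
  · intro a _; simpa using ZMod.val_lt a
  · intro a _; simp
  · intro a _; simp
  · intro a ha; exact ZMod.val_cast_of_lt (by simpa using ha)
  · intro a _; simp

lemma char_orth (r : ℕ) [NeZero r] (χ χ' : DirichletCharacter ℂ r) :
    ∑ a : ZMod r, χ a * (starRingEnd ℂ) (χ' a) = if χ = χ' then (r.totient : ℂ) else 0 := by
  have h : ∀ a, χ a * (starRingEnd ℂ) (χ' a) = (χ * χ'⁻¹) a := by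
    intro a
    rw [MulChar.mul_apply, ← MulChar.star_apply']; rfl
  simp_rw [h]
  split_ifs with hc
  · subst hc
    rw [mul_inv_cancel, MulChar.sum_one_eq_card_units, ZMod.card_units_eq_totient]
  · apply MulChar.sum_eq_zero_of_ne_one
    rwa [Ne, mul_inv_eq_one]

lemma gauss_norm_sq (r : ℕ) [NeZero r] (χ : DirichletCharacter ℂ r) (hχ : χ.IsPrimitive) :
    ‖gaussSum χ (ZMod.stdAddChar (N := r))‖ ^ 2 = r := by
  classical
  set e := ZMod.stdAddChar (N := r) with he
  have hconj : ∀ x : ZMod r, (starRingEnd ℂ) (e x) = e (-x) := by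
    intro x
    rw [AddChar.map_neg_eq_conj]
  have h1 : ∀ n : ZMod r, gaussSum χ (e.mulShift n) * (starRingEnd ℂ) (gaussSum χ (e.mulShift n))
      = ∑ a : ZMod r, ∑ b : ZMod r, χ a * (starRingEnd ℂ) (χ b) * e (n * (a - b)) := by
    intro n
    simp only [gaussSum, map_sum, sum_mul_sum, map_mul, AddChar.mulShift_apply, hconj]
    refine sum_congr rfl fun a _ => sum_congr rfl fun b _ => ?_
    have : e (n * (a - b)) = e (n * a) * e (-(n * b)) := by
      rw [← AddChar.map_add_eq_mul]; congr 1; ring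
    rw [this]; ring
  have h2 : ∑ n : ZMod r, gaussSum χ (e.mulShift n) * (starRingEnd ℂ) (gaussSum χ (e.mulShift n))
      = r * r.totient := by
    simp_rw [h1]
    rw [sum_comm, sum_congr rfl (fun a _ => sum_comm)]
    have hep : e.IsPrimitive := ZMod.isPrimitive_stdAddChar r
    simp_rw [← mul_sum, AddChar.sum_mulShift _ hep, sub_eq_zero]
    simp only [mul_ite, mul_zero, ZMod.card, Nat.cast_ite, Nat.cast_zero]
    simp only [sum_ite_eq, mem_univ, if_true]
    rw [← sum_mul, char_orth, if_pos rfl, mul_comm]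
  have h3 : ∀ n : ZMod r, gaussSum χ (e.mulShift n) * (starRingEnd ℂ) (gaussSum χ (e.mulShift n))
      = (χ n * (starRingEnd ℂ) (χ n)) * (gaussSum χ e * (starRingEnd ℂ) (gaussSum χ e)) := by
    intro n
    rw [gaussSum_mulShift_of_isPrimitive e hχ n, ← MulChar.star_apply']
    simp only [map_mul, RCLike.star_def, Complex.conj_conj]; ring
  simp_rw [h3] at h2
  rw [← sum_mul, char_orth, if_pos rfl, Complex.mul_conj, Complex.normSq_eq_norm_sq] at h2
  have hr : (r.totient : ℂ) ≠ 0 := by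
    have := Nat.totient_pos.mpr (NeZero.pos r)
    exact_mod_cast this.ne'
  have h4 : ((‖gaussSum χ e‖ ^ 2 : ℝ) : ℂ) = r := by
    apply mul_left_cancel₀ hr
    rw [h2]; ring
  exact_mod_cast h4

lemma std_ee (r : ℕ) [NeZero r] (n a : ℕ) :
    ZMod.stdAddChar (N := r) ((n : ZMod r) * (a : ZMod r)) = ee ((n : ℝ) * ((a : ℝ) / r)) := by
  have := ZMod.stdAddChar_coe (N := r) ((n * a : ℕ) : ℤ)
  push_cast at this
  rw [this]; unfold ee; congr 1; push_cast; ring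

lemma char_expand (r : ℕ) [NeZero r] (χ : DirichletCharacter ℂ r) (hχ : χ.IsPrimitive) (n : ℕ) :
    (starRingEnd ℂ) (χ n) * gaussSum χ (ZMod.stdAddChar (N := r)) =
      ∑ a ∈ range r, χ a * ee ((n : ℝ) * ((a : ℝ) / r)) := by
  have h := gaussSum_mulShift_of_isPrimitive (ZMod.stdAddChar (N := r)) hχ (n : ZMod r)
  rw [← MulChar.star_apply', gaussSum] at h
  simp only [AddChar.mulShift_apply, RCLike.star_def] at h
  rw [← h, sum_zmod_range]
  exact sum_congr rfl fun a _ => by rw [std_ee]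

lemma frac_sep {r r' a a' R : ℕ} (hr : 0 < r) (hr' : 0 < r') (hrR : r ≤ 2 * R) (hrR' : r' ≤ 2 * R)
    (ha : a < r) (ha' : a' < r') (hc : a.Coprime r) (hc' : a'.Coprime r') (hne : (r, a) ≠ (r', a'))
    (n : ℤ) : 1 / (4 * (R : ℝ) ^ 2) ≤ |(a : ℝ) / r - a' / r' - n| := by
  have hrp : (0:ℝ) < r := by exact_mod_cast hr
  have hrp' : (0:ℝ) < r' := by exact_mod_cast hr'
  have e : (a : ℝ) / r - a' / r' - n = ((a * r' - a' * r - n * r * r' : ℤ) : ℝ) / (r * r') := by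
    push_cast; field_simp
  have hnz : (a * r' - a' * r - n * r * r' : ℤ) ≠ 0 := by
    intro h
    have d1 : (r : ℤ) ∣ a * r' := ⟨a' + n * r', by linarith⟩
    have d2 : (r' : ℤ) ∣ a' * r := ⟨a - n * r, by linarith⟩
    have d1' : r ∣ a * r' := by exact_mod_cast d1
    have d2' : r' ∣ a' * r := by exact_mod_cast d2
    have e1 := Nat.Coprime.dvd_of_dvd_mul_left hc.symm d1'
    have e2 := Nat.Coprime.dvd_of_dvd_mul_left hc'.symm d2'
    have hrr := Nat.dvd_antisymm e1 e2
    subst hrr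
    have hz : ((a : ℤ) - a' - n * r) * r = 0 := by linarith
    have hr0 : (r : ℤ) ≠ 0 := by exact_mod_cast hr.ne'
    have hz2 := (mul_eq_zero.mp hz).resolve_right hr0
    have hn : n = 0 := by
      have b1 : n * r < 1 * r := by push_cast; linarith [(by exact_mod_cast ha : (a:ℤ) < r), (by positivity : (0:ℤ) ≤ a')]
      have b2 : (-1) * (r:ℤ) < n * r := by linarith [(by exact_mod_cast ha' : (a':ℤ) < r), (by positivity : (0:ℤ) ≤ a)]
      have hrz : (0:ℤ) < r := by exact_mod_cast hr
      have := lt_of_mul_lt_mul_right b1 hrz.le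
      have := lt_of_mul_lt_mul_right b2 hrz.le
      omega
    apply hne
    subst hn
    have : a = a' := by omega
    rw [this]
  rw [e, abs_div, abs_of_pos (by positivity : (0:ℝ) < r * r')]
  have h1 : (1:ℝ) ≤ |((a * r' - a' * r - n * r * r' : ℤ) : ℝ)| := by
    rw [← Int.cast_abs]; exact_mod_cast Int.one_le_abs hnz
  have hb : (r:ℝ) * r' ≤ 4 * (R:ℝ) ^ 2 := by
    have a1 : (r:ℝ) ≤ 2 * R := by exact_mod_cast hrR
    have a2 : (r':ℝ) ≤ 2 * R := by exact_mod_cast hrR'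
    nlinarith
  have hR : (0:ℝ) < 4 * (R:ℝ)^2 := by nlinarith [mul_pos hrp hrp']
  rw [div_le_div_iff₀ hR (by positivity)]
  nlinarith

/-- Dual multiplicative large sieve. -/
lemma dual_mult (R N m : ℕ) (hR : 1 ≤ R) (S : Finset (Σ r : ℕ, DirichletCharacter ℂ r))
    (hS : ∀ x ∈ S, 0 < x.1 ∧ x.1 ≤ 2 * R ∧ x.2.IsPrimitive)
    (c : (Σ r : ℕ, DirichletCharacter ℂ r) → ℂ) :
    ∑ n ∈ range N, ‖∑ x ∈ S, c x * x.2 ((m + n : ℕ) : ZMod x.1)‖ ^ 2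
      ≤ (8 * N + 16 * (R : ℝ) ^ 2) * ∑ x ∈ S, ‖c x‖ ^ 2 := by
  classical
  let G : (Σ r : ℕ, DirichletCharacter ℂ r) → ℂ := fun x =>
    if h : x.1 = 0 then 1 else
      haveI : NeZero x.1 := ⟨h⟩
      gaussSum x.2 (ZMod.stdAddChar (N := x.1))
  have hG : ∀ x ∈ S, ‖G x‖ ^ 2 = x.1 := by
    intro x hx
    obtain ⟨h0, -, hp⟩ := hS x hx
    have : NeZero x.1 := ⟨h0.ne'⟩
    simp only [G, h0.ne', dite_false]
    exact gauss_norm_sq x.1 x.2 hp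
  have hG0 : ∀ x ∈ S, G x ≠ 0 := by
    intro x hx h
    have := hG x hx
    rw [h] at this
    have h0 : (0:ℝ) < x.1 := by exact_mod_cast (hS x hx).1
    simp at this; rw [← this] at h0; simp at h0
  let T : Finset (ℕ × ℕ) := ((Icc 1 (2*R)) ×ˢ range (2*R)).filter (fun p => p.2 < p.1 ∧ p.2.Coprime p.1)
  let b : (Σ r : ℕ, DirichletCharacter ℂ r) → ℂ := fun x => (starRingEnd ℂ) (c x) / G x
  let d : ℕ × ℕ → ℂ := fun p => ∑ x ∈ S with x.1 = p.1, b x * x.2 (p.2 : ZMod x.1)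
  have hTr : ∀ r ∈ Icc 1 (2*R), ∀ f : ℕ → ℂ, (∀ a, ¬ a.Coprime r → f a = 0) →
      ∑ a ∈ range (2*R) with (a < r ∧ a.Coprime r), f a = ∑ a ∈ range r, f a := by
    intro r hr f hf
    apply sum_subset_zero_on_sdiff
    · intro a ha; simp at ha ⊢; exact ha.2.1
    · intro a ha
      simp only [mem_sdiff, mem_filter, mem_range, not_and, mem_Icc] at ha hr
      exact hf a (ha.2 (by omega) ha.1)
    · intros; rfl
  have hchar0 : ∀ x : (Σ r : ℕ, DirichletCharacter ℂ r), ∀ a : ℕ, ¬ a.Coprime x.1 →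
      x.2 (a : ZMod x.1) = 0 := by
    intro x a ha
    apply MulChar.map_nonunit
    rwa [ZMod.isUnit_iff_coprime]
  -- expansion
  have hexp : ∀ n : ℕ, ‖∑ x ∈ S, c x * x.2 (n : ZMod x.1)‖
      = ‖∑ p ∈ T, d p * ee ((n : ℝ) * ((p.2 : ℝ) / p.1))‖ := by
    intro n
    rw [← RCLike.norm_conj (∑ x ∈ S, c x * x.2 (n : ZMod x.1)), map_sum]
    congr 1
    have h1 : ∀ x ∈ S, (starRingEnd ℂ) (c x * x.2 (n : ZMod x.1))
        = ∑ a ∈ range x.1, b x * x.2 (a : ZMod x.1) * ee ((n : ℝ) * ((a : ℝ) / x.1)) := by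
      intro x hx
      obtain ⟨h0, -, hp⟩ := hS x hx
      have : NeZero x.1 := ⟨h0.ne'⟩
      have hGx : G x = gaussSum x.2 (ZMod.stdAddChar (N := x.1)) := by
        simp only [G, h0.ne', dite_false]
      have := char_expand x.1 x.2 hp n
      rw [← hGx] at this
      simp_rw [mul_assoc]
      rw [← mul_sum, ← this, map_mul]
      simp only [b]
      field_simp [hG0 x hx]
    rw [sum_congr rfl h1]
    have h2 : ∑ p ∈ T, d p * ee ((n : ℝ) * ((p.2 : ℝ) / p.1))
        = ∑ r ∈ Icc 1 (2*R), ∑ a ∈ range (2*R) with (a < r ∧ a.Coprime r),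
            d (r, a) * ee ((n : ℝ) * ((a : ℝ) / r)) := by
      simp only [T, sum_filter, sum_product]
    rw [h2, ← sum_fiberwise_of_maps_to (t := Icc 1 (2*R)) (g := fun x => x.1)
      (fun x hx => by simp; exact ⟨(hS x hx).1, (hS x hx).2.1⟩)]
    refine sum_congr rfl fun r hr => ?_
    rw [hTr r hr]
    · simp only [d]
      simp_rw [sum_mul]
      rw [sum_comm]
      refine sum_congr rfl fun x hx => ?_
      rw [mem_filter] at hx
      obtain ⟨-, rfl⟩ := hx
      rfl
    · intro a ha
      simp only [d]
      rw [sum_eq_zero, zero_mul]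
      intro x hx
      rw [mem_filter] at hx
      rw [hchar0 x a (by rw [hx.2]; exact ha), mul_zero]
  -- Parseval
  have hpars : ∑ p ∈ T, ‖d p‖ ^ 2 ≤ ∑ x ∈ S, ‖c x‖ ^ 2 := by
    have h2 : ∑ p ∈ T, ‖d p‖ ^ 2
        ≤ ∑ r ∈ Icc 1 (2*R), ∑ a ∈ range r, ‖d (r, a)‖ ^ 2 := by
      have : ∑ p ∈ T, ‖d p‖ ^ 2 = ∑ r ∈ Icc 1 (2*R), ∑ a ∈ range (2*R) with (a < r ∧ a.Coprime r),
          ‖d (r, a)‖ ^ 2 := by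
        simp only [T, sum_filter, sum_product]
      rw [this]
      refine sum_le_sum fun r hr => ?_
      apply sum_le_sum_of_subset_of_nonneg
      · intro a ha; simp at ha ⊢; exact ha.2.1
      · intros; positivity
    refine h2.trans ?_
    rw [← sum_fiberwise_of_maps_to (s := S) (t := Icc 1 (2*R)) (g := fun x => x.1)
      (fun x hx => by simp; exact ⟨(hS x hx).1, (hS x hx).2.1⟩)]
    refine sum_le_sum fun r hr => ?_
    have hr0 : 0 < r := by simp at hr; omega
    have : NeZero r := ⟨hr0.ne'⟩
    have hkey : ((∑ a ∈ range r, ‖d (r, a)‖ ^ 2 : ℝ) : ℂ)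
        = ∑ x ∈ S with x.1 = r, ((‖b x‖ ^ 2 * r.totient : ℝ) : ℂ) := by
      have e1 : ∀ a : ℕ, ((‖d (r, a)‖ ^ 2 : ℝ) : ℂ) = ∑ x ∈ S with x.1 = r, ∑ y ∈ S with y.1 = r,
          b x * (starRingEnd ℂ) (b y) * (x.2 (a : ZMod x.1) * (starRingEnd ℂ) (y.2 (a : ZMod y.1))) := by
        intro a
        rw [← Complex.normSq_eq_norm_sq, ← Complex.mul_conj]
        simp only [d, map_sum, sum_mul_sum, map_mul]
        refine sum_congr rfl fun i _ => sum_congr rfl fun j _ => ?_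
        ring
      rw [Complex.ofReal_sum, sum_congr rfl (fun a _ => e1 a), sum_comm]
      refine sum_congr rfl fun x hx => ?_
      rw [sum_comm]
      simp_rw [← mul_sum]
      have e2 : ∀ y ∈ S.filter (fun y => y.1 = r), ∑ a ∈ range r, x.2 (a : ZMod x.1) * (starRingEnd ℂ) (y.2 (a : ZMod y.1))
          = if x = y then (r.totient : ℂ) else 0 := by
        intro y hy
        obtain ⟨rx, χ⟩ := x
        obtain ⟨ry, χ'⟩ := y
        simp only [mem_filter] at hx hy
        obtain ⟨-, rfl⟩ := hx
        obtain ⟨-, rfl⟩ := hy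
        have := char_orth ry χ χ'
        rw [sum_zmod_range ry (fun a => χ a * (starRingEnd ℂ) (χ' a))] at this
        rw [this]
        simp
      rw [sum_congr rfl (fun y hy => by rw [e2 y hy])]
      simp only [mul_ite, mul_zero, sum_ite_eq]
      rw [if_pos hx, Complex.mul_conj, Complex.normSq_eq_norm_sq]
      push_cast; ring
    rw [← Complex.ofReal_sum] at hkey
    rw [Complex.ofReal_injective hkey]
    refine sum_le_sum fun x hx => ?_
    rw [mem_filter] at hx
    simp only [b, norm_div, RCLike.norm_conj, div_pow]
    rw [hG x hx.1, hx.2]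
    have hrp : (0:ℝ) < r := by exact_mod_cast hr0
    have : (r.totient : ℝ) ≤ r := by exact_mod_cast Nat.totient_le r
    rw [div_mul_eq_mul_div, div_le_iff₀ hrp]
    gcongr
  have hRp : (0:ℝ) < R := by exact_mod_cast hR
  have main := dual_additive T (fun p => (p.2 : ℝ) / p.1) (δ := 1 / (4 * (R:ℝ)^2)) (by positivity)
    (by
      intro i hi j hj hij n
      simp only [T, mem_filter, mem_product, mem_Icc, mem_range] at hi hj
      exact frac_sep (by omega) (by omega) (by omega) (by omega) hi.2.1 hj.2.1 hi.2.2 hj.2.2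
        (by simpa [Prod.ext_iff] using hij) n)
    (2 * N + 4 * R ^ 2) N m
    (by push_cast; rw [mul_one_div, le_div_iff₀ (by positivity)]; nlinarith [(by positivity : (0:ℝ) ≤ N)])
    (by omega) (by positivity) d
  have hl : ∑ n ∈ range N, ‖∑ x ∈ S, c x * x.2 ((m + n : ℕ) : ZMod x.1)‖ ^ 2
      = ∑ n ∈ range N, ‖∑ p ∈ T, d p * ee ((m + n : ℝ) * ((p.2 : ℝ) / p.1))‖ ^ 2 := by
    refine sum_congr rfl fun n _ => ?_
    rw [hexp]; push_cast; rfl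
  rw [hl]
  refine main.trans ?_
  push_cast
  calc _ ≤ 4 * (2 * (N:ℝ) + 4 * (R:ℝ) ^ 2) * ∑ x ∈ S, ‖c x‖ ^ 2 := by gcongr
    _ = _ := by ring

end PSLSieve
end

section
namespace PSLSieve

open Finset

lemma dyadic_sum (U : ℕ) (w f : ℕ → ℝ) (hf : ∀ n, 0 ≤ f n)
    (hw : ∀ m n, U ≤ m → m ≤ n → w n ≤ w m) (J : ℕ) :
    ∑ n ∈ Ico U (2 ^ J * U), w n * f n ≤
      ∑ j ∈ range J, w (2 ^ j * U) * ∑ n ∈ range (2 ^ j * U), f (2 ^ j * U + n) := by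
  induction J with
  | zero => simp
  | succ J ih =>
    have h1 : U ≤ 2 ^ J * U := Nat.le_mul_of_pos_left _ (by positivity)
    have h2 : 2 ^ J * U ≤ 2 ^ (J+1) * U := by rw [pow_succ]; nlinarith
    rw [← sum_Ico_consecutive _ h1 h2, sum_range_succ]
    gcongr
    have : 2 ^ (J+1) * U - 2 ^ J * U = 2 ^ J * U := by
      rw [pow_succ, mul_right_comm]; omega
    rw [sum_Ico_eq_sum_range, this, mul_sum]
    refine sum_le_sum fun n _ => ?_
    exact mul_le_mul_of_nonneg_right (hw _ _ h1 (by omega)) (hf _)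

lemma one_sub_two_rpow {s : ℝ} (h0 : 0 < s) (h1 : s ≤ 1) : s / 2 ≤ 1 - (2:ℝ) ^ (-s) := by
  have hc : ConvexOn ℝ Set.univ (fun x : ℝ => (2:ℝ) ^ (-x)) := by
    have := (convexOn_exp).comp_linearMap (LinearMap.lsmul ℝ ℝ (-Real.log 2))
    have e : (fun x : ℝ => (2:ℝ) ^ (-x)) = Real.exp ∘ (LinearMap.lsmul ℝ ℝ (-Real.log 2)) := by
      ext x; rw [Real.rpow_def_of_pos (by norm_num)]; simp
    rw [e]; simpa using this
  have := hc.2 (Set.mem_univ (0:ℝ)) (Set.mem_univ (1:ℝ)) (sub_nonneg.mpr h1) h0.le (by ring)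
  simp at this
  rw [Real.rpow_neg_one] at this
  linarith

lemma geom_rpow_le {s : ℝ} (h0 : 0 < s) (h1 : s ≤ 1) (J : ℕ) :
    ∑ j ∈ range J, ((2:ℝ) ^ j) ^ (-s) ≤ 2 / s := by
  have e : ∀ j : ℕ, ((2:ℝ) ^ j) ^ (-s) = ((2:ℝ) ^ (-s)) ^ j := by
    intro j
    rw [← Real.rpow_natCast, ← Real.rpow_natCast, ← Real.rpow_mul (by norm_num),
      ← Real.rpow_mul (by norm_num), mul_comm]
  simp_rw [e]
  have hq := one_sub_two_rpow h0 h1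
  have hq0 : (0:ℝ) < 2 ^ (-s) := by positivity
  have hlt : (2:ℝ) ^ (-s) < 1 := by linarith
  have := (summable_geometric_of_lt_one hq0.le hlt).sum_le_tsum (range J) (fun j _ => by positivity)
  rw [tsum_geometric_of_lt_one hq0.le hlt] at this
  refine this.trans ?_
  rw [inv_eq_one_div, div_le_div_iff₀ (by linarith) h0]
  linarith

lemma weighted_dual (R U : ℕ) (hR : 1 ≤ R) (hU : 1 ≤ U) (S : Finset (Σ r : ℕ, DirichletCharacter ℂ r))
    (hS : ∀ x ∈ S, 0 < x.1 ∧ x.1 ≤ 2 * R ∧ x.2.IsPrimitive)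
    (c : (Σ r : ℕ, DirichletCharacter ℂ r) → ℂ) {s : ℝ} (h0 : 0 < s) (h1 : s ≤ 1) (N : ℕ) :
    ∑ n ∈ Ico U N, (n:ℝ) ^ (-1 - s) * ‖∑ x ∈ S, c x * x.2 (n : ZMod x.1)‖ ^ 2
      ≤ (16 / s + 32 * R ^ 2 / U) * ∑ x ∈ S, ‖c x‖ ^ 2 := by
  have hN : N ≤ 2 ^ N * U := by
    have : N ≤ 2 ^ N := Nat.lt_two_pow_self.le
    nlinarith
  set f : ℕ → ℝ := fun n => ‖∑ x ∈ S, c x * x.2 (n : ZMod x.1)‖ ^ 2 with hf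
  have hUp : (0:ℝ) < U := by exact_mod_cast hU
  set T := ∑ x ∈ S, ‖c x‖ ^ 2
  have hT : 0 ≤ T := by positivity
  calc ∑ n ∈ Ico U N, (n:ℝ) ^ (-1 - s) * f n
      ≤ ∑ n ∈ Ico U (2 ^ N * U), (n:ℝ) ^ (-1 - s) * f n := by
        apply sum_le_sum_of_subset_of_nonneg
        · exact Ico_subset_Ico_right hN
        · intros; positivity
    _ ≤ ∑ j ∈ range N, ((2 ^ j * U : ℕ):ℝ) ^ (-1 - s) * ∑ n ∈ range (2 ^ j * U), f (2 ^ j * U + n) := by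
        apply dyadic_sum U (fun n => (n:ℝ) ^ (-1 - s)) f (fun n => by positivity)
        intro m n hm hmn
        have : (0:ℝ) < m := by exact_mod_cast (by omega : 0 < m)
        exact Real.rpow_le_rpow_of_nonpos this (by exact_mod_cast hmn) (by linarith)
    _ ≤ ∑ j ∈ range N, (8 * ((2:ℝ)^j) ^ (-s) + 16 * R ^ 2 / U * ((1/2:ℝ)^j)) * T := by
        refine sum_le_sum fun j _ => ?_
        have hd := dual_mult R (2 ^ j * U) (2 ^ j * U) hR S hS c
        have hx : (1:ℝ) ≤ ((2 ^ j * U : ℕ) : ℝ) := by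
          exact_mod_cast Nat.one_le_iff_ne_zero.mpr (by positivity)
        set X : ℝ := ((2 ^ j * U : ℕ) : ℝ) with hX
        have hXp : 0 < X := by linarith
        calc X ^ (-1 - s) * ∑ n ∈ range (2 ^ j * U), f (2 ^ j * U + n)
            ≤ X ^ (-1 - s) * ((8 * X + 16 * (R : ℝ) ^ 2) * T) := by gcongr
          _ = (8 * (X ^ (-1-s) * X) + 16 * R ^ 2 * X ^ (-1 - s)) * T := by ring
          _ ≤ _ := by
            apply mul_le_mul_of_nonneg_right _ hT
            apply add_le_add
            · refine mul_le_mul_of_nonneg_left ?_ (by norm_num)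
              have : X ^ (-1 - s) * X = X ^ (-s) := by
                rw [← Real.rpow_add_one hXp.ne']; congr 1; ring
              rw [this]
              apply Real.rpow_le_rpow_of_nonpos (by positivity) _ (by linarith)
              rw [hX]; push_cast
              have : (1:ℝ) ≤ U := by exact_mod_cast hU
              nlinarith [(by positivity : (0:ℝ) < 2 ^ j)]
            · have : X ^ (-1 - s) ≤ X ^ (-1 : ℝ) := Real.rpow_le_rpow_of_exponent_le hx (by linarith)
              rw [Real.rpow_neg_one] at this
              calc 16 * (R:ℝ) ^ 2 * X ^ (-1 - s) ≤ 16 * (R:ℝ) ^ 2 * X⁻¹ := by gcongr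
                _ = _ := by rw [hX]; push_cast; rw [one_div, inv_pow]; field_simp
    _ = (8 * ∑ j ∈ range N, ((2:ℝ)^j) ^ (-s) + 16 * R ^ 2 / U * ∑ j ∈ range N, ((1/2:ℝ)^j)) * T := by
        rw [← sum_mul, sum_add_distrib, ← mul_sum, ← mul_sum]
    _ ≤ (8 * (2 / s) + 16 * R ^ 2 / U * 2) * T := by
        gcongr
        · exact geom_rpow_le h0 h1 N
        · exact sum_geometric_two_le N
    _ = _ := by ring

/-- Large sieve inequality with weights, finite version. -/
lemma large_sieve_fin (R U : ℕ) (hR : 1 ≤ R) (hU : 1 ≤ U) (S : Finset (Σ r : ℕ, DirichletCharacter ℂ r))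
    (hS : ∀ x ∈ S, 0 < x.1 ∧ x.1 ≤ 2 * R ∧ x.2.IsPrimitive)
    (a : ℕ → ℂ) {s : ℝ} (h0 : 0 < s) (h1 : s ≤ 1) (N : ℕ) :
    ∑ x ∈ S, ‖∑ n ∈ Ico U N, a n * x.2 (n : ZMod x.1)‖ ^ 2
      ≤ (16 / s + 32 * R ^ 2 / U) * ∑ n ∈ Ico U N, ‖a n‖ ^ 2 * (n:ℝ) ^ (1 + s) := by
  set B : (Σ r : ℕ, DirichletCharacter ℂ r) → ℂ := fun x => ∑ n ∈ Ico U N, a n * x.2 (n : ZMod x.1)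
  set T := ∑ x ∈ S, ‖B x‖ ^ 2 with hT
  set A := ∑ n ∈ Ico U N, ‖a n‖ ^ 2 * (n:ℝ) ^ (1 + s)
  have hw := weighted_dual R U hR hU S hS (fun x => (starRingEnd ℂ) (B x)) h0 h1 N
  set K : ℝ := 16 / s + 32 * R ^ 2 / U with hK
  have hK0 : 0 ≤ K := by positivity
  simp only [RCLike.norm_conj] at hw
  have e1 : (T : ℂ) = ∑ n ∈ Ico U N, a n * ∑ x ∈ S, (starRingEnd ℂ) (B x) * x.2 (n : ZMod x.1) := by
    rw [hT]; push_cast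
    have : ∀ x ∈ S, ((‖B x‖ : ℂ)) ^ 2 = ∑ n ∈ Ico U N, a n * ((starRingEnd ℂ) (B x) * x.2 (n : ZMod x.1)) := by
      intro x _
      rw [← Complex.mul_conj']
      conv_lhs => rw [show B x = ∑ n ∈ Ico U N, a n * x.2 (n : ZMod x.1) from rfl]
      rw [sum_mul]
      exact sum_congr rfl fun n _ => by ring
    rw [sum_congr rfl this, sum_comm]
    simp_rw [mul_sum]
  have hT0 : 0 ≤ T := by positivity
  have e2 : T ≤ ∑ n ∈ Ico U N, (‖a n‖ * (n:ℝ) ^ ((1 + s)/2)) *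
      ((n:ℝ) ^ ((-1-s)/2) * ‖∑ x ∈ S, (starRingEnd ℂ) (B x) * x.2 (n : ZMod x.1)‖) := by
    rw [← Complex.norm_of_nonneg hT0, e1]
    refine (norm_sum_le _ _).trans (sum_le_sum fun n hn => ?_)
    have hn : (0:ℝ) < n := by
      rw [mem_Ico] at hn; exact_mod_cast (by omega : 0 < n)
    have : (n:ℝ) ^ ((1 + s)/2) * (n:ℝ) ^ ((-1-s)/2) = 1 := by
      rw [← Real.rpow_add hn]; ring_nf; try simp
    rw [norm_mul]
    apply le_of_eq
    calc _ = ‖a n‖ * ((n:ℝ) ^ ((1 + s)/2) * (n:ℝ) ^ ((-1-s)/2)) * ‖∑ x ∈ S, (starRingEnd ℂ) (B x) * x.2 (n : ZMod x.1)‖ := by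
          rw [this]; ring
      _ = _ := by ring
  have e3 : T ^ 2 ≤ A * (K * T) := by
    calc T ^ 2 ≤ _ := pow_le_pow_left₀ hT0 e2 2
      _ ≤ _ := sum_mul_sq_le_sq_mul_sq _ _ _
      _ ≤ A * (K * T) := by
        have q1 : ∀ n : ℕ, ∀ t : ℝ, ((n:ℝ) ^ (t/2)) ^ 2 = (n:ℝ) ^ t := by
          intro n t
          rw [← Real.rpow_natCast, ← Real.rpow_mul (by positivity)]; congr 1; push_cast; ring
        simp_rw [mul_pow, q1]
        have : 0 ≤ A := by positivity
        exact mul_le_mul_of_nonneg_left hw this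
  rcases hT0.eq_or_lt with h | h
  · rw [← h]; positivity
  · have : T * T ≤ (K * A) * T := by nlinarith
    exact le_of_mul_le_mul_right this h

/-- Large sieve inequality with weights. -/
lemma large_sieve (R U : ℕ) (hR : 1 ≤ R) (hU : 1 ≤ U) (S : Finset (Σ r : ℕ, DirichletCharacter ℂ r))
    (hS : ∀ x ∈ S, 0 < x.1 ∧ x.1 ≤ 2 * R ∧ x.2.IsPrimitive)
    (a : ℕ → ℂ) (ha : ∀ n < U, a n = 0) (hs : Summable a) {s : ℝ} (h0 : 0 < s) (h1 : s ≤ 1)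
    (hs2 : Summable fun n : ℕ => ‖a n‖ ^ 2 * (n:ℝ) ^ (1 + s)) :
    ∑ x ∈ S, ‖∑' n, a n * x.2 (n : ZMod x.1)‖ ^ 2
      ≤ (16 / s + 32 * R ^ 2 / U) * ∑' n : ℕ, ‖a n‖ ^ 2 * (n:ℝ) ^ (1 + s) := by
  have hIco : ∀ (f : ℕ → ℂ) (N : ℕ), (∀ n < U, f n = 0) → ∑ n ∈ Ico U N, f n = ∑ n ∈ range N, f n := by
    intro f N hf
    apply sum_subset_zero_on_sdiff
    · intro n; simp
    · intro n hn
      simp only [mem_sdiff, mem_range, mem_Ico, not_and, not_lt] at hn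
      apply hf; by_contra h; have := hn.2 (by omega); omega
    · intros; rfl
  have hlim : Filter.Tendsto (fun N => ∑ x ∈ S, ‖∑ n ∈ Ico U N, a n * x.2 (n : ZMod x.1)‖ ^ 2)
      Filter.atTop (nhds (∑ x ∈ S, ‖∑' n, a n * x.2 (n : ZMod x.1)‖ ^ 2)) := by
    refine tendsto_finsetSum _ fun x _ => ?_
    refine Filter.Tendsto.pow (Filter.Tendsto.norm ?_) 2
    have hsum : Summable fun n : ℕ => a n * x.2 (n : ZMod x.1) := by
      refine Summable.of_norm_bounded hs.norm fun n => ?_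
      rw [norm_mul]
      exact mul_le_of_le_one_right (norm_nonneg _) (DirichletCharacter.norm_le_one _ _)
    have := hsum.hasSum.tendsto_sum_nat
    refine this.congr fun N => ?_
    rw [hIco]
    intro n hn; rw [ha n hn, zero_mul]
  refine le_of_tendsto hlim (Filter.Eventually.of_forall fun N => ?_)
  refine (large_sieve_fin R U hR hU S hS a h0 h1 N).trans ?_
  gcongr
  exact hs2.sum_le_tsum _ (fun n _ => by positivity)

end PSLSieve
end

section
namespace PSLSieve

open Finset

/-- number of divisors as a real number -/
noncomputable def tau (n : ℕ) : ℝ := (n.divisors.card : ℝ)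

lemma tau_nonneg (n : ℕ) : 0 ≤ tau n := Nat.cast_nonneg _

lemma one_le_tau {n : ℕ} (hn : n ≠ 0) : 1 ≤ tau n := by
  unfold tau
  have : 0 < n.divisors.card := card_pos.mpr ⟨1, by simp [hn]⟩
  exact_mod_cast this

lemma tau_mul_le (a b : ℕ) : tau (a * b) ≤ tau a * tau b := by
  classical
  unfold tau
  rw [Nat.divisors_mul]
  exact_mod_cast Finset.card_mul_le

lemma tau_le_of_dvd {a b : ℕ} (hb : b ≠ 0) (h : a ∣ b) : tau a ≤ tau b := by
  unfold tau
  exact_mod_cast card_le_card (Nat.divisors_subset_of_dvd hb h)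

lemma tau_sq_free {n : ℕ} (h : Squarefree n) : tau n = 2 ^ n.primeFactors.card := by
  unfold tau
  have h0 : n ≠ 0 := h.ne_zero
  rw [Nat.card_divisors h0]
  push_cast
  rw [prod_congr rfl (g := fun _ => (2:ℝ))]
  · simp
  · intro p hp
    have hp' := Nat.prime_of_mem_primeFactors hp
    have : n.factorization p = 1 := by
      have h1 := h.natFactorization_le_one p
      have h2 := (hp'.factorization_pos_of_dvd h0 (Nat.dvd_of_mem_primeFactors hp))
      omega
    rw [this]; norm_num

lemma totient_mul_tau (m : ℕ) (hm : m ≠ 0) : (m : ℝ) ≤ tau m * m.totient := by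
  have h : (∑ d ∈ m.divisors, d.totient) ≤ ∑ d ∈ m.divisors, m.totient := by
    refine sum_le_sum fun d hd => ?_
    apply Nat.le_of_dvd (Nat.totient_pos.mpr (Nat.pos_of_ne_zero hm))
    exact Nat.totient_dvd_of_dvd (Nat.dvd_of_mem_divisors hd)
  rw [Nat.sum_totient, sum_const, smul_eq_mul] at h
  unfold tau
  exact_mod_cast h

/-- moment recursion for the divisor function with completely multiplicative weights -/
lemma tau_moment_step (w : ℕ → ℝ) (hw : ∀ n, 0 ≤ w n) (hmul : ∀ a b, w (a * b) = w a * w b)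
    (j N : ℕ) :
    ∑ n ∈ Icc 1 N, tau n ^ (j+1) * w n ≤ (∑ n ∈ Icc 1 N, tau n ^ j * w n) ^ 2 := by
  have h1 : ∀ n ∈ Icc 1 N, tau n ^ (j+1) * w n ≤
      ∑ p ∈ n.divisorsAntidiagonal, (tau p.1 ^ j * w p.1) * (tau p.2 ^ j * w p.2) := by
    intro n hn
    have hn0 : n ≠ 0 := by simp at hn; omega
    have : tau n ^ (j+1) * w n = ∑ p ∈ n.divisorsAntidiagonal, tau n ^ j * w n := by
      rw [sum_const, nsmul_eq_mul, ← Nat.map_div_right_divisors, card_map, pow_succ]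
      change _ = tau n * _
      ring
    rw [this]
    refine sum_le_sum fun p hp => ?_
    have hp := (Nat.mem_divisorsAntidiagonal.mp hp).1
    rw [← hp, hmul]
    calc tau (p.1 * p.2) ^ j * (w p.1 * w p.2) ≤ (tau p.1 * tau p.2) ^ j * (w p.1 * w p.2) := by
          have := hw p.1; have := hw p.2
          have := tau_mul_le p.1 p.2
          have := tau_nonneg (p.1 * p.2)
          gcongr
      _ = _ := by rw [mul_pow]; ring
  refine (sum_le_sum h1).trans ?_
  rw [sq, sum_mul_sum, ← sum_product', sum_sigma']
  have hinj : Set.InjOn (fun x : (Σ _ : ℕ, ℕ × ℕ) => x.2)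
      ((Icc 1 N).sigma fun n => n.divisorsAntidiagonal : Finset (Σ _ : ℕ, ℕ × ℕ)) := by
    rintro ⟨n, p⟩ hx ⟨n', p'⟩ hx' h
    simp only [coe_sigma, Set.mem_sigma_iff, mem_coe, Nat.mem_divisorsAntidiagonal] at hx hx' h
    subst h
    have : n = n' := hx.2.1.symm.trans hx'.2.1
    subst this; rfl
  rw [← sum_image (f := fun p : ℕ × ℕ => (tau p.1 ^ j * w p.1) * (tau p.2 ^ j * w p.2)) hinj]
  apply sum_le_sum_of_subset_of_nonneg
  · intro p hp
    obtain ⟨⟨n, q⟩, hx, rfl⟩ := mem_image.mp hp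
    simp only [mem_sigma, mem_Icc, Nat.mem_divisorsAntidiagonal, mem_product] at hx ⊢
    obtain ⟨⟨h1, h2⟩, h3, h4⟩ := hx
    have a1 : q.1 ≠ 0 := by rintro h; rw [h] at h3; simp at h3; omega
    have a2 : q.2 ≠ 0 := by rintro h; rw [h] at h3; simp at h3; omega
    have b1 : q.1 ≤ n := by rw [← h3]; exact Nat.le_mul_of_pos_right _ (by omega)
    have b2 : q.2 ≤ n := by rw [← h3]; exact Nat.le_mul_of_pos_left _ (by omega)
    omega
  · intro p _ _
    have := hw p.1; have := hw p.2
    have := tau_nonneg p.1; have := tau_nonneg p.2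
    positivity

lemma tau_moment (w : ℕ → ℝ) (hw : ∀ n, 0 ≤ w n) (hmul : ∀ a b, w (a * b) = w a * w b)
    (j N : ℕ) :
    ∑ n ∈ Icc 1 N, tau n ^ j * w n ≤ (∑ n ∈ Icc 1 N, w n) ^ (2 ^ j) := by
  induction j with
  | zero => simp
  | succ j ih =>
    refine (tau_moment_step w hw hmul j N).trans ?_
    have h0 : 0 ≤ ∑ n ∈ Icc 1 N, tau n ^ j * w n :=
      sum_nonneg fun n _ => mul_nonneg (pow_nonneg (tau_nonneg n) _) (hw n)
    rw [pow_succ 2 j, pow_mul]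
    exact pow_le_pow_left₀ h0 ih 2

lemma tau_moment_inv (j N : ℕ) :
    ∑ n ∈ Icc 1 N, tau n ^ j / n ≤ (1 + Real.log N) ^ (2 ^ j) := by
  have h := tau_moment (fun n => ((n:ℝ))⁻¹) (fun n => by positivity)
    (fun a b => by push_cast; rw [mul_inv]) j N
  simp_rw [div_eq_mul_inv]
  refine h.trans ?_
  have := harmonic_le_one_add_log N
  rw [harmonic_eq_sum_Icc] at this
  push_cast at this
  gcongr

lemma rpow_telescope {s : ℝ} (hs : 0 < s) (n : ℕ) (hn : 1 ≤ n) :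
    ((n + 1 : ℕ) : ℝ) ^ (-1 - s) ≤ ((n:ℝ) ^ (-s) - ((n + 1 : ℕ) : ℝ) ^ (-s)) / s := by
  have hn0 : (0:ℝ) < n := by exact_mod_cast hn
  set x : ℝ := ((n + 1 : ℕ) : ℝ) with hx
  have hxn : x = n + 1 := by rw [hx]; push_cast; ring
  have hx0 : 0 < x := by linarith
  have h1 : (n:ℝ) = x * (1 - 1/x) := by field_simp; linarith
  have hu : 0 < 1 - 1/x := by
    rw [sub_pos, div_lt_one hx0]; linarith
  have h2 : 1 + s / x ≤ (1 - 1/x) ^ (-s) := by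
    rw [Real.rpow_def_of_pos hu]
    have l1 := Real.log_le_sub_one_of_pos hu
    have l2 := Real.add_one_le_exp (Real.log (1 - 1/x) * -s)
    have : s / x = s * (1/x) := by ring
    nlinarith
  have h3 : (n:ℝ) ^ (-s) = x ^ (-s) * (1 - 1/x) ^ (-s) := by
    rw [← Real.mul_rpow hx0.le hu.le, ← h1]
  have h4 : x ^ (-1 - s) = x ^ (-s) / x := by
    rw [show -1 - s = -s - 1 by ring, Real.rpow_sub_one hx0.ne']
  rw [h3, h4, le_div_iff₀ hs]
  have h5 : 0 < x ^ (-s) := by positivity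
  have : x ^ (-s) / x * s = x ^ (-s) * (1 + s/x) - x ^ (-s) := by field_simp; ring
  rw [this]
  gcongr

lemma sum_rpow_le {s : ℝ} (hs : 0 < s) (N : ℕ) :
    ∑ n ∈ Icc 1 N, (n:ℝ) ^ (-1 - s) ≤ 1 + 1 / s := by
  have key : ∀ N : ℕ, 1 ≤ N → ∑ n ∈ Icc 1 N, (n:ℝ) ^ (-1 - s) ≤ 1 + (1 - (N:ℝ) ^ (-s)) / s := by
    intro N hN
    induction N, hN using Nat.le_induction with
    | base => simp
    | succ n hn ih =>
      rw [sum_Icc_succ_top (by omega)]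
      have := rpow_telescope hs n hn
      have e : 1 + (1 - ((n + 1 : ℕ) : ℝ) ^ (-s)) / s = 1 + (1 - (n:ℝ) ^ (-s)) / s
        + ((n:ℝ) ^ (-s) - ((n + 1 : ℕ) : ℝ) ^ (-s)) / s := by ring
      linarith
  rcases Nat.eq_zero_or_pos N with h | h
  · subst h; simp; positivity
  · refine (key N h).trans ?_
    have : 0 ≤ (N:ℝ) ^ (-s) := by positivity
    gcongr; linarith

lemma tau_moment_rpow {s : ℝ} (hs : 0 < s) (j N : ℕ) :
    ∑ n ∈ Icc 1 N, tau n ^ j * (n:ℝ) ^ (-1 - s) ≤ (1 + 1 / s) ^ (2 ^ j) := by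
  refine (tau_moment (fun n => (n:ℝ) ^ (-1 - s)) (fun n => by positivity)
    (fun a b => by push_cast; rw [Real.mul_rpow (by positivity) (by positivity)]) j N).trans ?_
  have : 0 ≤ ∑ n ∈ Icc 1 N, (n:ℝ) ^ (-1 - s) := by positivity
  exact pow_le_pow_left₀ this (sum_rpow_le hs N) _

lemma tau_zero : tau 0 = 0 := by simp [tau]

/-- bounding sums over `ℕ` by sums over `Icc 1 N`. -/
lemma summable_of_Icc {f : ℕ → ℝ} (h0 : ∀ n, 0 ≤ f n) (hz : f 0 = 0) {B : ℝ}
    (h : ∀ N, ∑ n ∈ Icc 1 N, f n ≤ B) : Summable f ∧ ∑' n, f n ≤ B := by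
  have hr : ∀ N, ∑ n ∈ range N, f n ≤ B := by
    intro N
    have : ∑ n ∈ range N, f n ≤ ∑ n ∈ range (N+1), f n :=
      sum_le_sum_of_subset_of_nonneg (range_mono (by omega)) (fun _ _ _ => h0 _)
    refine this.trans ?_
    rw [range_eq_Ico, sum_eq_sum_Ico_succ_bot (by omega), hz, zero_add]
    exact h N
  have hs := summable_of_sum_range_le h0 hr
  exact ⟨hs, hs.tsum_le_of_sum_range_le hr⟩

lemma tau_tsum {s : ℝ} (hs : 0 < s) (j : ℕ) :
    Summable (fun n : ℕ => tau n ^ j * (n:ℝ) ^ (-1 - s)) ∧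
      ∑' n : ℕ, tau n ^ j * (n:ℝ) ^ (-1 - s) ≤ (1 + 1 / s) ^ (2 ^ j) := by
  apply summable_of_Icc
  · intro n; have := tau_nonneg n; positivity
  · have : (0:ℝ) ^ (-1 - s) = 0 := Real.zero_rpow (by linarith)
    simp [this]
  · exact tau_moment_rpow hs j

/-- divisor bound -/
lemma pow_omega_le (A : ℝ) (hA : 1 ≤ A) (ε : ℝ) (hε : 0 < ε) :
    ∃ C : ℝ, 0 < C ∧ ∀ r : ℕ, r ≠ 0 → A ^ r.primeFactors.card ≤ C * (r:ℝ) ^ ε := by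
  obtain ⟨P, hP⟩ : ∃ P : ℕ, ∀ p : ℕ, P ≤ p → A ≤ (p:ℝ) ^ ε := by
    have := (tendsto_rpow_atTop hε).comp tendsto_natCast_atTop_atTop
    exact Filter.eventually_atTop.mp (this.eventually_ge_atTop A)
  refine ⟨A ^ P, by positivity, fun r hr => ?_⟩
  classical
  have hsplit : A ^ r.primeFactors.card = A ^ (r.primeFactors.filter (· < P)).card *
      A ^ (r.primeFactors.filter (¬ · < P)).card := by
    rw [← pow_add, card_filter_add_card_filter_not]
  rw [hsplit]
  gcongr
  · calc _ ≤ (range P).card := card_le_card (fun p hp => by simp at hp ⊢; exact hp.2)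
      _ = P := card_range P
  · calc A ^ (r.primeFactors.filter (¬ · < P)).card = ∏ p ∈ r.primeFactors.filter (¬ · < P), A := by
          rw [prod_const]
      _ ≤ ∏ p ∈ r.primeFactors.filter (¬ · < P), (p:ℝ) ^ ε := by
          refine prod_le_prod (fun _ _ => by linarith) fun p hp => hP p ?_
          simp at hp; exact hp.2
      _ = (∏ p ∈ r.primeFactors.filter (¬ · < P), (p:ℝ)) ^ ε := by
          rw [Real.finsetProd_rpow]; intros; positivity
      _ ≤ (r:ℝ) ^ ε := by
          gcongr
          have h1 : (∏ p ∈ r.primeFactors.filter (¬ · < P), p) ∣ r :=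
            (prod_dvd_prod_of_subset _ _ _ (filter_subset _ _)).trans (Nat.prod_primeFactors_dvd r)
          have h2 := Nat.le_of_dvd (Nat.pos_of_ne_zero hr) h1
          rw [← Nat.cast_prod]
          exact Nat.cast_le.mpr h2

end PSLSieve
end

section
namespace PSLSieve

open Finset

lemma char_sum_period (r : ℕ) [NeZero r] (χ : DirichletCharacter ℂ r) (hχ : χ ≠ 1) (a : ℕ) :
    ∑ n ∈ Ico a (a + r), χ (n : ZMod r) = 0 := by
  induction a with
  | zero =>
    rw [zero_add, ← range_eq_Ico, ← sum_zmod_range r (fun x => χ x)]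
    exact MulChar.sum_eq_zero_of_ne_one hχ
  | succ a ih =>
    have hr := NeZero.pos r
    have h1 : ∑ n ∈ Ico a (a + r + 1), χ (n : ZMod r) = χ (a : ZMod r) + ∑ n ∈ Ico (a+1) (a + 1 + r), χ (n : ZMod r) := by
      rw [sum_eq_sum_Ico_succ_bot (by omega), show a + r + 1 = a + 1 + r by ring]
    rw [sum_Ico_succ_top (by omega), ih, zero_add] at h1
    push_cast at h1
    rw [ZMod.natCast_self, add_zero] at h1
    simpa using h1

lemma char_partial_bound (r : ℕ) [NeZero r] (χ : DirichletCharacter ℂ r) (hχ : χ ≠ 1) (a b : ℕ) :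
    ‖∑ n ∈ Ico a b, χ (n : ZMod r)‖ ≤ r := by
  induction' hk : b - a using Nat.strong_induction_on with k ih generalizing a
  have hr := NeZero.pos r
  by_cases hlt : k < r
  · calc _ ≤ ∑ n ∈ Ico a b, ‖χ (n : ZMod r)‖ := norm_sum_le _ _
      _ ≤ ∑ n ∈ Ico a b, (1:ℝ) := sum_le_sum fun n _ => DirichletCharacter.norm_le_one _ _
      _ = k := by rw [sum_const, Nat.card_Ico, hk]; simp
      _ ≤ r := by exact_mod_cast hlt.le
  · have := sum_Ico_consecutive (fun n : ℕ => χ (n : ZMod r)) (show a ≤ a + r by omega) (show a + r ≤ b by omega)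
    rw [← this, char_sum_period r χ hχ a, zero_add]
    exact ih (b - (a + r)) (by omega) (a + r) rfl

/-- Abel summation bound for character sums. -/
lemma char_tail_fin (r : ℕ) [NeZero r] (χ : DirichletCharacter ℂ r) (hχ : χ ≠ 1) (v : ℕ → ℂ)
    (a N : ℕ) (haN : a ≤ N) :
    ‖∑ n ∈ Ico a N, χ (n : ZMod r) * v n‖ ≤ r * ‖v N‖ + r * ∑ n ∈ Ico a N, ‖v n - v (n+1)‖ := by
  have key : ∑ n ∈ Ico a N, χ (n : ZMod r) * v n = (∑ n ∈ Ico a N, χ (n : ZMod r)) * v N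
      + ∑ n ∈ Ico a N, (∑ m ∈ Ico a (n+1), χ (m : ZMod r)) * (v n - v (n+1)) := by
    induction N, haN using Nat.le_induction with
    | base => simp
    | succ N hN ih =>
      rw [sum_Ico_succ_top hN, ih, sum_Ico_succ_top hN, sum_Ico_succ_top hN, sum_Ico_succ_top hN]
      ring
  rw [key]
  refine (norm_add_le _ _).trans ?_
  gcongr
  · rw [norm_mul]; gcongr; exact char_partial_bound r χ hχ a N
  · refine (norm_sum_le _ _).trans ?_
    rw [mul_sum]
    refine sum_le_sum fun n _ => ?_
    rw [norm_mul]; gcongr; exact char_partial_bound r χ hχ a _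

lemma sum_tail_rpow {s : ℝ} (hs : 0 < s) (a N : ℕ) (ha : 1 ≤ a) :
    ∑ n ∈ Ico a N, (n:ℝ) ^ (-1 - s) ≤ (1 + 1 / s) * (a:ℝ) ^ (-s) := by
  have ha0 : (1:ℝ) ≤ a := by exact_mod_cast ha
  have key : ∀ N, a + 1 ≤ N → ∑ n ∈ Ico a N, (n:ℝ) ^ (-1 - s) ≤
      (a:ℝ) ^ (-s) + ((a:ℝ) ^ (-s) - ((N - 1 : ℕ):ℝ) ^ (-s)) / s := by
    intro N hN
    induction N, hN using Nat.le_induction with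
    | base =>
      simp only [Nat.Ico_succ_singleton, sum_singleton, add_tsub_cancel_right, sub_self, zero_div, add_zero]
      exact Real.rpow_le_rpow_of_exponent_le ha0 (by linarith)
    | succ n hn ih =>
      rw [sum_Ico_succ_top (by omega)]
      have := rpow_telescope hs (n - 1) (by omega)
      rw [show n - 1 + 1 = n by omega] at this
      have e : (a:ℝ) ^ (-s) + ((a:ℝ) ^ (-s) - ((n + 1 - 1 : ℕ):ℝ) ^ (-s)) / s =
        (a:ℝ) ^ (-s) + ((a:ℝ) ^ (-s) - ((n - 1 : ℕ):ℝ) ^ (-s)) / s + (((n-1 : ℕ):ℝ) ^ (-s) - (n:ℝ) ^ (-s)) / s := by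
        rw [show n + 1 - 1 = n by omega]; ring
      linarith
  by_cases h : a + 1 ≤ N
  · refine (key N h).trans ?_
    have : 0 ≤ ((N - 1 : ℕ):ℝ) ^ (-s) := by positivity
    have e : (1 + 1 / s) * (a:ℝ) ^ (-s) = (a:ℝ) ^ (-s) + ((a:ℝ) ^ (-s)) / s := by ring
    rw [e]; gcongr; linarith
  · rw [Ico_eq_empty_of_le (by omega)]; simp; positivity

/-- Abel summation bound, infinite version -/
lemma char_tail (r : ℕ) [NeZero r] (χ : DirichletCharacter ℂ r) (hχ : χ ≠ 1) (v : ℕ → ℂ)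
    (hv : Summable v) (a : ℕ) (ha : 1 ≤ a) {s K : ℝ} (hs : 0 < s) (hK : 0 ≤ K)
    (hd : ∀ n, a ≤ n → ‖v n - v (n+1)‖ ≤ K * (n:ℝ) ^ (-1 - s)) :
    ‖∑' n : ℕ, (if a ≤ n then χ (n : ZMod r) * v n else 0)‖ ≤ r * (K * ((1 + 1 / s) * (a:ℝ) ^ (-s))) := by
  have hsum : Summable fun n : ℕ => (if a ≤ n then χ (n : ZMod r) * v n else 0) := by
    refine Summable.of_norm_bounded hv.norm fun n => ?_
    split_ifs
    · rw [norm_mul]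
      exact mul_le_of_le_one_left (norm_nonneg _) (DirichletCharacter.norm_le_one _ _)
    · simp
  have hlim := hsum.hasSum.tendsto_sum_nat.norm
  have hv0 : Filter.Tendsto (fun N => (r:ℝ) * ‖v N‖ + r * (K * ((1 + 1 / s) * (a:ℝ) ^ (-s)))) Filter.atTop
      (nhds (r * (K * ((1 + 1 / s) * (a:ℝ) ^ (-s))))) := by
    have h := (hv.tendsto_atTop_zero.norm.const_mul (r:ℝ)).add_const (r * (K * ((1 + 1 / s) * (a:ℝ) ^ (-s))))
    simpa using h
  refine le_of_tendsto_of_tendsto hlim hv0 ?_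
  filter_upwards [Filter.eventually_ge_atTop a] with N hN
  have e : ∑ n ∈ range N, (if a ≤ n then χ (n : ZMod r) * v n else 0) = ∑ n ∈ Ico a N, χ (n : ZMod r) * v n := by
    rw [← sum_filter]
    apply sum_congr _ (fun _ _ => rfl)
    ext n; simp; tauto
  rw [e]
  refine (char_tail_fin r χ hχ v a N hN).trans ?_
  gcongr
  calc ∑ n ∈ Ico a N, ‖v n - v (n+1)‖ ≤ ∑ n ∈ Ico a N, K * (n:ℝ) ^ (-1 - s) :=
        sum_le_sum fun n hn => hd n (mem_Ico.mp hn).1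
    _ = K * ∑ n ∈ Ico a N, (n:ℝ) ^ (-1 - s) := by rw [mul_sum]
    _ ≤ _ := by gcongr; exact sum_tail_rpow hs a N ha

lemma log_pow_le {η t : ℝ} (hη : 0 < η) (ht : 1 ≤ t) (j : ℕ) :
    (Real.log t) ^ j ≤ η⁻¹ ^ j * j.factorial * t ^ η := by
  have hl : 0 ≤ Real.log t := Real.log_nonneg ht
  have := Real.pow_div_factorial_le_exp (η * Real.log t) (by positivity) j
  have e : Real.exp (η * Real.log t) = t ^ η := by
    rw [Real.rpow_def_of_pos (by linarith), mul_comm]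
  rw [e, div_le_iff₀ (by positivity), mul_pow] at this
  have h2 : (Real.log t) ^ j = η⁻¹ ^ j * (η ^ j * (Real.log t) ^ j) := by
    rw [← mul_assoc, ← mul_pow, inv_mul_cancel₀ hη.ne', one_pow, one_mul]
  rw [h2]
  calc _ ≤ η⁻¹ ^ j * (t ^ η * j.factorial) := by gcongr
    _ = _ := by ring

lemma vdiff_bound (j : ℕ) (s : ℂ) (hs : 1 ≤ s.re) {η : ℝ} (hη : 0 < η) (hη1 : η ≤ 1/2) (n : ℕ) (hn : 1 ≤ n) :
    ‖((Real.log n : ℝ) : ℂ) ^ j * (n : ℂ) ^ (-s) - ((Real.log (n+1 : ℕ) : ℝ) : ℂ) ^ j * ((n+1 : ℕ) : ℂ) ^ (-s)‖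
      ≤ (1 + ‖s‖) * (η⁻¹ ^ j * j.factorial) * (n:ℝ) ^ (-1 - (1 - η)) := by
  have hn1 : (1:ℝ) ≤ n := by exact_mod_cast hn
  let f : ℝ → ℂ := fun t => ((Real.log t : ℝ) : ℂ) ^ j * (t : ℂ) ^ (-s)
  let f' : ℝ → ℂ := fun t => ((j : ℂ) * ((Real.log t : ℝ) : ℂ) ^ (j - 1) * ((t⁻¹ : ℝ) : ℂ)) * (t : ℂ) ^ (-s)
    + ((Real.log t : ℝ) : ℂ) ^ j * ((-s) * (t : ℂ) ^ (-s - 1))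
  have hs0 : -s ≠ 0 := by
    intro h
    have : s.re = 0 := by rw [neg_eq_zero.mp h]; rfl
    linarith
  have hder : ∀ t ∈ Set.Icc (n:ℝ) (n+1), HasDerivWithinAt f (f' t) (Set.Icc (n:ℝ) (n+1)) t := by
    intro t ht
    have ht0 : t ≠ 0 := by have := ht.1; linarith
    apply HasDerivAt.hasDerivWithinAt
    have h1 : HasDerivAt (fun t : ℝ => ((Real.log t : ℝ) : ℂ)) ((t⁻¹ : ℝ) : ℂ) t :=
      (Real.hasDerivAt_log ht0).ofReal_comp
    have h2 := h1.pow j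
    have h4 := hasDerivAt_ofReal_cpow_const ht0 hs0
    exact h2.mul h4
  have hbd : ∀ t ∈ Set.Icc (n:ℝ) (n+1), ‖f' t‖ ≤ (1 + ‖s‖) * (η⁻¹ ^ j * j.factorial) * (n:ℝ) ^ (-1 - (1 - η)) := by
    intro t ht
    have ht1 : 1 ≤ t := by have := ht.1; linarith
    have htp : 0 < t := by linarith
    have hl : 0 ≤ Real.log t := Real.log_nonneg ht1
    have hη' : 1 ≤ η⁻¹ := by rw [one_le_inv₀ hη]; linarith
    have ht2 : t ^ (-s.re) ≤ t ^ (-1 : ℝ) := Real.rpow_le_rpow_of_exponent_le ht1 (by linarith)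
    have e1 : ‖f' t‖ ≤ (j * Real.log t ^ (j-1) + ‖s‖ * Real.log t ^ j) * t ^ (-2 : ℝ) := by
      refine (norm_add_le _ _).trans ?_
      simp only [norm_mul, norm_pow, Complex.norm_real, norm_neg, Complex.norm_natCast]
      rw [Complex.norm_cpow_eq_rpow_re_of_pos htp, Complex.norm_cpow_eq_rpow_re_of_pos htp]
      simp only [Complex.neg_re, Complex.sub_re, Complex.one_re]
      rw [Real.norm_of_nonneg hl, Real.norm_of_nonneg (by positivity : 0 ≤ t⁻¹)]
      have q1 : t ^ (-s.re - 1) = t ^ (-s.re) * t⁻¹ := by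
        rw [Real.rpow_sub_one htp.ne', div_eq_mul_inv]
      have q2 : t ^ (-2:ℝ) = t ^ (-1:ℝ) * t⁻¹ := by
        rw [show (-2:ℝ) = -1 - 1 by norm_num, Real.rpow_sub_one htp.ne', div_eq_mul_inv]
      rw [q1, q2]
      have : (j * Real.log t ^ (j-1) + ‖s‖ * Real.log t ^ j) * (t ^ (-s.re) * t⁻¹) ≤
        (j * Real.log t ^ (j-1) + ‖s‖ * Real.log t ^ j) * (t ^ (-1:ℝ) * t⁻¹) := by gcongr
      refine le_trans (le_of_eq ?_) this
      ring
    have e2 : (j:ℝ) * Real.log t ^ (j-1) ≤ (η⁻¹ ^ j * j.factorial) * t ^ η := by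
      rcases j with _ | j
      · simp; positivity
      · have := log_pow_le hη ht1 j
        simp only [Nat.add_sub_cancel]
        rw [Nat.factorial_succ, pow_succ]
        push_cast
        calc ((j:ℝ)+1) * Real.log t ^ j ≤ ((j:ℝ)+1) * (η⁻¹ ^ j * j.factorial * t ^ η) := by gcongr
          _ = 1 * (η⁻¹ ^ j * (((j:ℝ)+1) * j.factorial) * t ^ η) := by ring
          _ ≤ η⁻¹ * (η⁻¹ ^ j * (((j:ℝ)+1) * j.factorial) * t ^ η) := by gcongr
          _ = _ := by ring
    have e3 := log_pow_le hη ht1 j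
    have e4 : t ^ η * t ^ (-2:ℝ) ≤ (n:ℝ) ^ (-1 - (1 - η)) := by
      rw [← Real.rpow_add htp, show η + -2 = -1 - (1 - η) by ring]
      exact Real.rpow_le_rpow_of_nonpos (by linarith) ht.1 (by linarith)
    calc ‖f' t‖ ≤ _ := e1
      _ ≤ ((η⁻¹ ^ j * j.factorial) * t ^ η + ‖s‖ * (η⁻¹ ^ j * j.factorial * t ^ η)) * t ^ (-2 : ℝ) := by gcongr
      _ = (1 + ‖s‖) * (η⁻¹ ^ j * j.factorial) * (t ^ η * t ^ (-2:ℝ)) := by ring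
      _ ≤ _ := by gcongr
  have := (convex_Icc (n:ℝ) (n+1)).norm_image_sub_le_of_norm_hasDerivWithin_le hder hbd
    (x := (n:ℝ)+1) (y := n) (by simp) (by simp)
  simpa [f] using this

end PSLSieve
end

section
open Finset
namespace PSLSieve

lemma LSeries_logpow (f : ℕ → ℂ) (j : ℕ) {s : ℂ} (hs : s ≠ 0) (n : ℕ) :
    LSeries.term (LSeries.logMul^[j] f) s n = f n * (((Real.log n : ℝ) : ℂ) ^ j * (n : ℂ) ^ (-s)) := by
  have h : ∀ j, (LSeries.logMul^[j] f) n = ((Real.log n : ℝ) : ℂ) ^ j * f n := by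
    intro j
    induction j with
    | zero => simp
    | succ j ih =>
      rw [Function.iterate_succ_apply', LSeries.logMul, ih, ← Complex.natCast_log]
      ring
  rcases Nat.eq_zero_or_pos n with rfl | hn
  · simp [Complex.zero_cpow (neg_ne_zero.mpr hs)]
  · rw [LSeries.term_of_ne_zero hn.ne', h, Complex.cpow_neg]
    ring

lemma iter_LFunction (r : ℕ) [NeZero r] (χ : DirichletCharacter ℂ r) (j : ℕ) {s : ℂ} (hs : 1 < s.re) :
    iteratedDeriv j (DirichletCharacter.LFunction χ) s =
      (-1)^j * ∑' n : ℕ, χ (n : ZMod r) * (((Real.log n : ℝ) : ℂ) ^ j * (n : ℂ) ^ (-s)) := by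
  have hne : s ≠ 0 := by rintro rfl; simp at hs; linarith
  have habs : LSeries.abscissaOfAbsConv (fun n : ℕ => χ (n : ZMod r)) < s.re := by
    refine lt_of_le_of_lt (LSeries.abscissaOfAbsConv_le_of_le_const (f := fun n : ℕ => χ (n : ZMod r)) ⟨1, fun n _ => DirichletCharacter.norm_le_one _ _⟩) ?_
    exact_mod_cast hs
  have h1 : iteratedDeriv j (DirichletCharacter.LFunction χ) s = iteratedDeriv j (LSeries (fun n : ℕ => χ (n : ZMod r))) s := by
    apply Filter.EventuallyEq.iteratedDeriv_eq
    have : {z : ℂ | 1 < z.re} ∈ nhds s := (isOpen_lt continuous_const Complex.continuous_re).mem_nhds hs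
    filter_upwards [this] with z hz
    exact DirichletCharacter.LFunction_eq_LSeries χ hz
  rw [h1, LSeries_iteratedDeriv j habs]
  congr 1
  exact tsum_congr fun n => LSeries_logpow _ j hne n

lemma summable_logpow (j : ℕ) {s : ℂ} (hs : 1 < s.re) :
    Summable fun n : ℕ => (((Real.log n : ℝ) : ℂ) ^ j * (n : ℂ) ^ (-s)) := by
  have hne : s ≠ 0 := by rintro rfl; simp at hs; linarith
  have habs : LSeries.abscissaOfAbsConv (LSeries.logMul^[j] (fun _ : ℕ => (1:ℂ))) < s.re := by
    rw [LSeries.absicssaOfAbsConv_logPowMul]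
    refine lt_of_le_of_lt (LSeries.abscissaOfAbsConv_le_of_le_const (f := fun _ : ℕ => (1:ℂ)) ⟨1, fun n _ => by simp⟩) ?_
    exact_mod_cast hs
  have := LSeriesSummable_of_abscissaOfAbsConv_lt_re habs
  unfold LSeriesSummable at this
  refine this.congr fun n => ?_
  rw [LSeries_logpow _ j hne, one_mul]

lemma LFunction_iter_bound (r : ℕ) [NeZero r] (χ : DirichletCharacter ℂ r) (hχ : χ ≠ 1) (j : ℕ)
    {s : ℝ} (hs : 1 < s) (hs2 : s ≤ 2) :
    ‖iteratedDeriv j (DirichletCharacter.LFunction χ) s‖ ≤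
      11 * (Real.log r + 1) * (2 * (Real.log r + 1)) ^ j * j.factorial := by
  have hr1 : (1:ℝ) ≤ r := by exact_mod_cast NeZero.pos r
  have hlr : 0 ≤ Real.log r := Real.log_nonneg hr1
  set ℓ := Real.log r + 1 with hℓ
  have hs' : 1 < ((s:ℂ)).re := by simpa using hs
  rw [iter_LFunction r χ j hs', norm_mul, norm_pow, norm_neg, norm_one, one_pow, one_mul]
  set v : ℕ → ℂ := fun n => (((Real.log n : ℝ) : ℂ) ^ j * (n : ℂ) ^ (-(s:ℂ))) with hv
  have hvs : Summable v := summable_logpow j hs'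
  have hsum : Summable fun n : ℕ => χ (n : ZMod r) * v n := by
    refine Summable.of_norm_bounded hvs.norm fun n => ?_
    rw [norm_mul]
    exact mul_le_of_le_one_left (norm_nonneg _) (DirichletCharacter.norm_le_one _ _)
  have ha : 1 ≤ r^2 := Nat.one_le_pow _ _ (NeZero.pos r)
  have hsplit : ∑' n : ℕ, χ (n : ZMod r) * v n = ∑ n ∈ range (r^2), χ (n : ZMod r) * v n +
      ∑' n : ℕ, (if r^2 ≤ n then χ (n : ZMod r) * v n else 0) := by
    have e1 : ∑ n ∈ range (r^2), χ (n : ZMod r) * v n = ∑' n : ℕ, (if r^2 ≤ n then 0 else χ (n : ZMod r) * v n) := by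
      rw [tsum_eq_sum (s := range (r^2))]
      · refine sum_congr rfl fun n hn => ?_
        rw [if_neg (by simpa using hn)]
      · intro n hn; rw [if_pos (by simpa using hn)]
    rw [e1, ← Summable.tsum_add]
    · refine tsum_congr fun n => ?_
      split_ifs <;> simp
    · refine summable_of_ne_finset_zero (s := range (r^2)) ?_
      intro n hn; rw [if_pos (by simpa using hn)]
    · refine Summable.of_norm_bounded hsum.norm fun n => ?_
      split_ifs
      · exact le_rfl
      · rw [norm_zero]; exact norm_nonneg _
  have htail := char_tail r χ hχ v hvs (r^2) ha (s := 1/2) (K := 3 * (2^j * j.factorial)) (by norm_num) (by positivity) (by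
    intro n hn
    have := vdiff_bound j (s:ℂ) hs'.le (η := 1/2) (by norm_num) (by norm_num) n (by omega)
    refine this.trans ?_
    rw [show (1/2:ℝ)⁻¹ = 2 by norm_num, show (-1 - (1 - 1/2) : ℝ) = -1 - 1/2 by norm_num]
    gcongr
    rw [Complex.norm_real, Real.norm_of_nonneg (by linarith)]; linarith)
  have hrr : ((r^2 : ℕ) : ℝ) ^ (-(1/2:ℝ)) = (r:ℝ)⁻¹ := by
    push_cast
    rw [← Real.rpow_natCast, ← Real.rpow_mul (by linarith)]
    norm_num [Real.rpow_neg_one]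
  rw [hrr] at htail
  have htail2 : (r:ℝ) * (3 * (2^j * j.factorial) * ((1 + 1/(1/2)) * (r:ℝ)⁻¹)) = 9 * (2^j * j.factorial) := by
    field_simp; norm_num
  rw [htail2] at htail
  have hhead : ‖∑ n ∈ range (r^2), χ (n : ZMod r) * v n‖ ≤ (2 * ℓ)^j * (2 * ℓ) := by
    have h1 : ∀ n ∈ range (r^2), ‖χ (n : ZMod r) * v n‖ ≤ (2*ℓ)^j * (n:ℝ)⁻¹ := by
      intro n hn
      rw [mem_range] at hn
      rw [norm_mul]
      refine (mul_le_of_le_one_left (norm_nonneg _) (DirichletCharacter.norm_le_one _ _)).trans ?_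
      rcases Nat.eq_zero_or_pos n with rfl | hn0
      · have : (-(s:ℂ)) ≠ 0 := by
          rw [neg_ne_zero]; exact_mod_cast (by linarith : s ≠ 0)
        simp [hv, Complex.zero_cpow this]
      · have hn1 : (1:ℝ) ≤ n := by exact_mod_cast hn0
        simp only [hv]
        rw [norm_mul, norm_pow, Complex.norm_real, Real.norm_of_nonneg (Real.log_nonneg hn1),
          Complex.norm_natCast_cpow_of_pos hn0]
        have hlog : Real.log n ≤ 2 * ℓ := by
          have : Real.log n ≤ Real.log ((r:ℝ)^2) := Real.log_le_log (by linarith) (by exact_mod_cast hn.le)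
          rw [Real.log_pow] at this
          push_cast at this; linarith
        have hl0 := Real.log_nonneg hn1
        gcongr
        rw [← Real.rpow_neg_one]
        apply Real.rpow_le_rpow_of_exponent_le hn1
        simp; linarith
    refine (norm_sum_le _ _).trans ((sum_le_sum h1).trans ?_)
    rw [← mul_sum]
    have h2 : ∑ n ∈ range (r^2), (n:ℝ)⁻¹ ≤ 2 * ℓ := by
      have h3 := tau_moment_inv 0 (r^2)
      simp only [pow_zero, pow_one] at h3
      push_cast at h3
      rw [Real.log_pow] at h3
      push_cast at h3
      have h4 : ∑ n ∈ range (r^2), (n:ℝ)⁻¹ ≤ ∑ n ∈ Icc 1 (r^2), 1 / (n:ℝ) := by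
        have : ∑ n ∈ range (r^2), (n:ℝ)⁻¹ ≤ ∑ n ∈ range (r^2+1), (n:ℝ)⁻¹ :=
          sum_le_sum_of_subset_of_nonneg (by intro x; simp; omega) (fun _ _ _ => by positivity)
        refine this.trans (le_of_eq ?_)
        rw [range_eq_Ico, sum_eq_sum_Ico_succ_bot (by omega)]
        simp only [Nat.cast_zero, inv_zero, zero_add, one_div]
        rfl
      linarith
    gcongr
  rw [hsplit]
  refine (norm_add_le _ _).trans ((add_le_add hhead htail).trans ?_)
  have hℓ1 : 1 ≤ ℓ := by linarith
  have hf : (1:ℝ) ≤ j.factorial := by exact_mod_cast Nat.factorial_pos j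
  have hA : (2:ℝ)^j ≤ (2*ℓ)^j := pow_le_pow_left₀ (by norm_num) (by linarith) j
  have hA0 : (0:ℝ) ≤ (2*ℓ)^j := by positivity
  calc (2 * ℓ)^j * (2 * ℓ) + 9 * (2^j * j.factorial) ≤ (2 * ℓ)^j * (2 * ℓ) * j.factorial + 9 * ((2*ℓ)^j * j.factorial) * ℓ := by
        have e1 : (2 * ℓ)^j * (2 * ℓ) ≤ (2 * ℓ)^j * (2 * ℓ) * j.factorial := le_mul_of_one_le_right (by positivity) hf
        have e2 : 9 * (2^j * (j.factorial:ℝ)) ≤ 9 * ((2*ℓ)^j * j.factorial) := by gcongr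
        have e3 : 9 * ((2*ℓ)^j * (j.factorial:ℝ)) ≤ 9 * ((2*ℓ)^j * j.factorial) * ℓ := le_mul_of_one_le_right (by positivity) hℓ1
        linarith
    _ = _ := by ring

/-- Taylor bound on a disc. -/
lemma LFunction_disc_bound (r : ℕ) [NeZero r] (χ : DirichletCharacter ℂ r) (hχ : χ ≠ 1)
    {s : ℝ} (hs : 1 < s) (hs2 : s ≤ 2) (z : ℂ) (hz : ‖z - s‖ ≤ 1 / (4 * (Real.log r + 1))) :
    ‖DirichletCharacter.LFunction χ z‖ ≤ 22 * (Real.log r + 1) := by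
  have hr1 : (1:ℝ) ≤ r := by exact_mod_cast NeZero.pos r
  have hlr : 0 ≤ Real.log r := Real.log_nonneg hr1
  set ℓ := Real.log r + 1 with hℓ
  have hℓ0 : ℓ ≠ 0 := by positivity
  have hT := Complex.hasSum_taylorSeries_of_entire (DirichletCharacter.differentiable_LFunction hχ) (s:ℂ) z
  have hg : HasSum (fun n : ℕ => 11 * ℓ * (1/2:ℝ)^n) (11 * ℓ * 2) := hasSum_geometric_two.mul_left _
  have := tsum_of_norm_bounded hg (f := fun n : ℕ => ((n.factorial : ℂ)⁻¹) • (z - s)^n • iteratedDeriv n (DirichletCharacter.LFunction χ) s) (by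
    intro n
    rw [norm_smul, norm_smul, norm_inv, norm_pow, Complex.norm_natCast]
    have h1 := LFunction_iter_bound r χ hχ n hs hs2
    rw [← hℓ] at h1
    have hf : (0:ℝ) < n.factorial := by exact_mod_cast Nat.factorial_pos n
    calc (n.factorial:ℝ)⁻¹ * (‖z - s‖^n * ‖iteratedDeriv n (DirichletCharacter.LFunction χ) s‖)
        ≤ (n.factorial:ℝ)⁻¹ * ((1/(4*ℓ))^n * (11 * ℓ * (2 * ℓ)^n * n.factorial)) := by gcongr
      _ = 11 * ℓ * ((1/(4*ℓ)) * (2*ℓ))^n := by rw [mul_pow (1/(4*ℓ))]; field_simp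
      _ = 11 * ℓ * (1/2)^n := by
          congr 2; field_simp; norm_num)
  rw [hT.tsum_eq] at this
  linarith

lemma LFunction_deriv_disc_bound (r : ℕ) [NeZero r] (χ : DirichletCharacter ℂ r) (hχ : χ ≠ 1)
    {s : ℝ} (hs : 1 < s) (hs2 : s ≤ 2) (z : ℂ) (hz : ‖z - s‖ ≤ 1 / (8 * (Real.log r + 1))) :
    ‖deriv (DirichletCharacter.LFunction χ) z‖ ≤ 176 * (Real.log r + 1)^2 := by
  have hr1 : (1:ℝ) ≤ r := by exact_mod_cast NeZero.pos r
  have hlr : 0 ≤ Real.log r := Real.log_nonneg hr1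
  set ℓ := Real.log r + 1 with hℓ
  have h := Complex.norm_deriv_le_of_forall_mem_sphere_norm_le (f := DirichletCharacter.LFunction χ) (c := z)
    (R := 1/(8*ℓ)) (C := 22 * ℓ) (by positivity)
    (DirichletCharacter.differentiable_LFunction hχ).diffContOnCl (by
      intro w hw
      refine LFunction_disc_bound r χ hχ hs hs2 w ?_
      rw [mem_sphere_iff_norm] at hw
      have : w - s = (w - z) + (z - s) := by ring
      rw [this]
      refine (norm_add_le _ _).trans ?_
      rw [hw, ← hℓ]
      have : 1/(8*ℓ) + 1/(8*ℓ) = 1/(4*ℓ) := by field_simp; norm_num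
      linarith)
  refine h.trans (le_of_eq ?_)
  field_simp; ring

end PSLSieve
end

section
open Finset
namespace PSLSieve

lemma changeLevel_nat {r D : ℕ} (h : r ∣ D) (χ : DirichletCharacter ℂ r) (n : ℕ) :
    (DirichletCharacter.changeLevel h χ) (n : ZMod D) = if n.Coprime D then χ (n : ZMod r) else 0 := by
  split_ifs with hc
  · have := DirichletCharacter.changeLevel_eq_cast_of_dvd' χ h (a := (n:ℤ)) (Nat.isCoprime_iff_coprime.mpr hc)
    simpa using this
  · exact MulChar.map_nonunit _ (by rwa [ZMod.isUnit_iff_coprime])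

lemma char_nat_zero {r : ℕ} (χ : DirichletCharacter ℂ r) (n : ℕ) (hc : ¬ n.Coprime r) : χ (n : ZMod r) = 0 :=
  MulChar.map_nonunit _ (by rwa [ZMod.isUnit_iff_coprime])

lemma changeLevel_prim_inj {r1 r2 D : ℕ} [NeZero D] (h1 : r1 ∣ D) (h2 : r2 ∣ D)
    (χ1 : DirichletCharacter ℂ r1) (χ2 : DirichletCharacter ℂ r2) (p1 : χ1.IsPrimitive) (p2 : χ2.IsPrimitive)
    (h : DirichletCharacter.changeLevel h1 χ1 = DirichletCharacter.changeLevel h2 χ2) :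
    (⟨r1, χ1⟩ : Σ r : ℕ, DirichletCharacter ℂ r) = ⟨r2, χ2⟩ := by
  have e : r1 = r2 := by
    have a1 := DirichletCharacter.conductor_changeLevel χ1 h1
    have a2 := DirichletCharacter.conductor_changeLevel χ2 h2
    rw [DirichletCharacter.isPrimitive_def] at p1 p2
    rw [← p1, ← a1, h, a2, p2]
  subst e
  have := DirichletCharacter.changeLevel_injective h1 h
  rw [this]

lemma LSeries_triv_bound {r : ℕ} (χ : DirichletCharacter ℂ r) {σ : ℝ} (hσ : 0 < σ) :
    ‖LSeries (fun n : ℕ => χ (n : ZMod r)) ((1 + σ : ℝ) : ℂ)‖ ≤ 1 + 1/σ := by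
  obtain ⟨h1, h2⟩ := tau_tsum hσ 0
  simp only [pow_zero, one_mul, pow_one] at h1 h2
  refine (tsum_of_norm_bounded h1.hasSum fun n => ?_).trans h2
  rcases Nat.eq_zero_or_pos n with rfl | hn
  · simp
    exact Real.rpow_nonneg le_rfl _
  · rw [LSeries.term_of_ne_zero hn.ne', norm_div, Complex.norm_natCast_cpow_of_pos hn]
    simp only [Complex.ofReal_re]
    rw [show -1 - σ = -(1+σ) by ring, Real.rpow_neg (by positivity), ← one_div]
    gcongr
    exact DirichletCharacter.norm_le_one _ _

/-- lower bound for complex characters -/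
lemma complex_lower {r : ℕ} [NeZero r] (χ : DirichletCharacter ℂ r) (hχ : χ ^ 2 ≠ 1) {σ : ℝ} (hσ : 0 < σ) (hσ1 : σ ≤ 1) :
    1 ≤ (1 + 1/σ)^3 * ‖DirichletCharacter.LFunction χ ((1 + σ : ℝ) : ℂ)‖^4 * (22 * (Real.log r + 1)) := by
  have h := DirichletCharacter.norm_LSeries_product_ge_one χ hσ 0
  have e1 : (1 + (σ:ℂ) + Complex.I * ((0:ℝ):ℂ)) = ((1 + σ : ℝ) : ℂ) := by push_cast; ring
  have e2 : (1 + (σ:ℂ) + 2 * Complex.I * ((0:ℝ):ℂ)) = ((1 + σ : ℝ) : ℂ) := by push_cast; ring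
  have e3 : (1 + (σ:ℂ)) = ((1 + σ : ℝ) : ℂ) := by push_cast; ring
  rw [e1, e2, e3, norm_mul, norm_mul, norm_pow, norm_pow] at h
  have hs : 1 < (((1 + σ : ℝ) : ℂ)).re := by simp [hσ]
  have f1 := LSeries_triv_bound (1 : DirichletCharacter ℂ r) hσ
  have f2 := LFunction_disc_bound r (χ^2) hχ (s := 1 + σ) (by linarith) (by linarith) ((1 + σ : ℝ) : ℂ) (by
    rw [sub_self, norm_zero]
    have : 0 ≤ Real.log r := Real.log_natCast_nonneg r
    positivity)
  rw [DirichletCharacter.LFunction_eq_LSeries _ hs] at f2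
  rw [DirichletCharacter.LFunction_eq_LSeries _ hs]
  refine (ge_iff_le.mp h).trans ?_
  gcongr

lemma local_factor {x : ℝ} (h0 : 0 ≤ x) (h1 : x < 1) {a b : ℝ} (ha : a = 0 ∨ a = 1 ∨ a = -1) (hb : b = 0 ∨ b = 1 ∨ b = -1) :
    0 < (1 - x) * (1 - a * x) * (1 - b * x) * (1 - a * b * x) ∧
    (1 - x) * (1 - a * x) * (1 - b * x) * (1 - a * b * x) ≤ 1 := by
  have g1 : 0 < 1 - x := by linarith
  have g2 : 0 < 1 + x := by linarith
  have g3 : (1-x)*(1+x) ≤ 1 := by nlinarith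
  have g3' : 0 ≤ (1-x)*(1+x) := by positivity
  have g4 : (1-x)*(1-x) ≤ 1 := by nlinarith
  have g5 : ((1-x)*(1+x)) * ((1-x)*(1+x)) ≤ 1 := mul_le_one₀ g3 g3' g3
  have g6 : ((1-x)*(1-x)) * ((1-x)*(1-x)) ≤ 1 := mul_le_one₀ g4 (by positivity) g4
  rcases ha with rfl | rfl | rfl <;> rcases hb with rfl | rfl | rfl <;> norm_num
  all_goals
    first
    | exact ⟨by linarith, by linarith⟩
    | (constructor
       · have : 0 < (1 - x) * (1 + x) := by positivity
         positivity
       · nlinarith)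

lemma quad_vals {r : ℕ} (χ : DirichletCharacter ℂ r) (h : χ ^ 2 = 1) (n : ℕ) :
    ∃ a : ℝ, (a = 0 ∨ a = 1 ∨ a = -1) ∧ χ (n : ZMod r) = (a : ℂ) := by
  by_cases hc : IsUnit (n : ZMod r)
  · have h1 : (χ (n : ZMod r))^2 = 1 := by
      rw [← MulChar.pow_apply' _ two_ne_zero, h]; exact MulChar.one_apply hc
    rcases (mul_self_eq_one_iff.mp ((pow_two _).symm.trans h1)) with h2 | h2
    · exact ⟨1, by simp, by simp [h2]⟩
    · exact ⟨-1, by simp, by simp [h2]⟩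
  · exact ⟨0, by simp, by rw [MulChar.map_nonunit _ hc]; simp⟩

lemma real_pair {r1 r2 : ℕ} [NeZero r1] [NeZero r2] (χ1 : DirichletCharacter ℂ r1) (χ2 : DirichletCharacter ℂ r2)
    (h1 : χ1 ^ 2 = 1) (h2 : χ2 ^ 2 = 1) {σ : ℝ} (hσ : 0 < σ) :
    1 ≤ ‖LSeries (fun n : ℕ => (1 : DirichletCharacter ℂ 1) (n : ZMod 1)) ((1 + σ : ℝ) : ℂ) *
      LSeries (fun n : ℕ => χ1 (n : ZMod r1)) ((1 + σ : ℝ) : ℂ) *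
      LSeries (fun n : ℕ => χ2 (n : ZMod r2)) ((1 + σ : ℝ) : ℂ) *
      LSeries (fun n : ℕ => (DirichletCharacter.changeLevel (Dvd.intro _ rfl) χ1 *
        DirichletCharacter.changeLevel (Dvd.intro_left _ rfl) χ2 : DirichletCharacter ℂ (r1 * r2)) (n : ZMod (r1 * r2))) ((1 + σ : ℝ) : ℂ)‖ := by
  have hs : 1 < (((1 + σ : ℝ) : ℂ)).re := by simp [hσ]
  have H := (((DirichletCharacter.LSeries_eulerProduct_hasProd (1 : DirichletCharacter ℂ 1) hs).mul
    (DirichletCharacter.LSeries_eulerProduct_hasProd χ1 hs)).mul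
    (DirichletCharacter.LSeries_eulerProduct_hasProd χ2 hs)).mul
    (DirichletCharacter.LSeries_eulerProduct_hasProd (DirichletCharacter.changeLevel (Dvd.intro _ rfl) χ1 *
        DirichletCharacter.changeLevel (Dvd.intro_left _ rfl) χ2 : DirichletCharacter ℂ (r1 * r2)) hs)
  have H2 : Filter.Tendsto _ _ _ := H.norm
  refine ge_of_tendsto H2 (Filter.Eventually.of_forall fun S => ?_)
  have hone : ∏ _p ∈ S, (1:ℝ) = 1 := by simp
  refine hone.symm.le.trans ?_
  refine Finset.prod_le_prod (fun _ _ => zero_le_one) fun p _ => ?_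
  obtain ⟨a, ha, ea⟩ := quad_vals χ1 h1 p
  obtain ⟨b, hb, eb⟩ := quad_vals χ2 h2 p
  have e0 : (1 : DirichletCharacter ℂ 1) ((p:ℕ) : ZMod 1) = 1 :=
    MulChar.one_apply (by rw [ZMod.isUnit_iff_coprime]; simp)
  have e12 : (DirichletCharacter.changeLevel (Dvd.intro _ rfl) χ1 *
        DirichletCharacter.changeLevel (Dvd.intro_left _ rfl) χ2 : DirichletCharacter ℂ (r1 * r2)) ((p:ℕ) : ZMod (r1 * r2)) = ((a * b : ℝ) : ℂ) := by
    rw [MulChar.mul_apply, changeLevel_nat, changeLevel_nat, Complex.ofReal_mul, ← ea, ← eb]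
    split_ifs with hc
    · rfl
    · rw [Nat.coprime_mul_iff_right, not_and_or] at hc
      rcases hc with hc | hc
      · rw [char_nat_zero χ1 _ hc]; simp
      · rw [char_nat_zero χ2 _ hc]; simp
  have hp2 : (2:ℝ) ≤ (p:ℕ) := by exact_mod_cast p.2.two_le
  have hp0 : (0:ℝ) ≤ (p:ℕ) := by linarith
  have ex : (((p:ℕ):ℂ)) ^ (-((1 + σ : ℝ) : ℂ)) = ((((p:ℕ):ℝ) ^ (-(1+σ)) : ℝ) : ℂ) := by
    rw [Complex.ofReal_cpow hp0]; push_cast; rfl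
  have hx0 : (0:ℝ) ≤ ((p:ℕ):ℝ) ^ (-(1+σ)) := by positivity
  have hx1 : ((p:ℕ):ℝ) ^ (-(1+σ)) < 1 := Real.rpow_lt_one_of_one_lt_of_neg (by linarith) (by linarith)
  obtain ⟨l1, l2⟩ := local_factor hx0 hx1 ha hb
  rw [e0, e12, ea, eb, ex]
  set x := ((p:ℕ):ℝ) ^ (-(1+σ))
  have : (1 - 1 * (x:ℂ))⁻¹ * (1 - (a:ℂ) * x)⁻¹ * (1 - (b:ℂ) * x)⁻¹ * (1 - ((a * b : ℝ) : ℂ) * x)⁻¹ =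
      ((((1 - x) * (1 - a * x) * (1 - b * x) * (1 - a * b * x))⁻¹ : ℝ) : ℂ) := by
    push_cast
    rw [mul_inv, mul_inv, mul_inv, one_mul]
  rw [this, Complex.norm_real, Real.norm_of_nonneg (by positivity)]
  exact (one_le_inv₀ l1).mpr l2

lemma real_pair_bound {r1 r2 : ℕ} [NeZero r1] [NeZero r2] (χ1 : DirichletCharacter ℂ r1) (χ2 : DirichletCharacter ℂ r2)
    (p1 : χ1.IsPrimitive) (p2 : χ2.IsPrimitive)
    (h1 : χ1 ^ 2 = 1) (h2 : χ2 ^ 2 = 1) (hne : (⟨r1, χ1⟩ : Σ r : ℕ, DirichletCharacter ℂ r) ≠ ⟨r2, χ2⟩)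
    {σ : ℝ} (hσ : 0 < σ) (hσ1 : σ ≤ 1) :
    1 ≤ (1 + 1/σ) * ‖DirichletCharacter.LFunction χ1 ((1 + σ : ℝ) : ℂ)‖ * ‖DirichletCharacter.LFunction χ2 ((1 + σ : ℝ) : ℂ)‖
      * (22 * (Real.log r1 + Real.log r2 + 1)) := by
  have hs : 1 < (((1 + σ : ℝ) : ℂ)).re := by simp [hσ]
  have h := real_pair χ1 χ2 h1 h2 hσ
  rw [norm_mul, norm_mul, norm_mul] at h
  set ψ : DirichletCharacter ℂ (r1 * r2) := (DirichletCharacter.changeLevel (Dvd.intro _ rfl) χ1 *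
        DirichletCharacter.changeLevel (Dvd.intro_left _ rfl) χ2 : DirichletCharacter ℂ (r1 * r2)) with hψ
  have hψ1 : ψ ≠ 1 := by
    intro h0
    apply hne
    apply changeLevel_prim_inj (D := r1 * r2) (Dvd.intro _ rfl) (Dvd.intro_left _ rfl) χ1 χ2 p1 p2
    have e2 : DirichletCharacter.changeLevel (Dvd.intro_left r1 rfl : r2 ∣ r1 * r2) χ2 *
        DirichletCharacter.changeLevel (Dvd.intro_left r1 rfl : r2 ∣ r1 * r2) χ2 = 1 := by
      rw [← pow_two, ← map_pow, h2, map_one]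
    have e3 := mul_eq_one_iff_eq_inv.mp (hψ ▸ h0)
    have e4 := mul_eq_one_iff_eq_inv.mp e2
    rw [e3, ← e4]
  have f1 := LSeries_triv_bound (1 : DirichletCharacter ℂ 1) hσ
  have f2 := LFunction_disc_bound (r1 * r2) ψ hψ1 (s := 1 + σ) (by linarith) (by linarith) ((1 + σ : ℝ) : ℂ) (by
    rw [sub_self, norm_zero]
    have : 0 ≤ Real.log ((r1 * r2 : ℕ):ℝ) := Real.log_natCast_nonneg _
    positivity)
  have hr1 : (r1:ℝ) ≠ 0 := by exact_mod_cast NeZero.ne r1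
  have hr2 : (r2:ℝ) ≠ 0 := by exact_mod_cast NeZero.ne r2
  rw [DirichletCharacter.LFunction_eq_LSeries _ hs, Nat.cast_mul, Real.log_mul hr1 hr2] at f2
  rw [DirichletCharacter.LFunction_eq_LSeries _ hs, DirichletCharacter.LFunction_eq_LSeries _ hs]
  refine h.trans ?_
  gcongr

end PSLSieve
end

section
open Finset
namespace PSLSieve

/-- From a lower bound of `L(1+σ,χ)` to a bound for the von Mangoldt sum. -/
lemma small_char (r : ℕ) [NeZero r] (χ : DirichletCharacter ℂ r) (hχ : χ ≠ 1) (M : ℕ) (hM : 1408 ≤ M)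
    (hr : Real.log r ≤ M) {σ : ℝ} (hσ : 0 < σ) (hσ1 : σ ≤ 1) (k : ℕ)
    (hL : 1 / (M:ℝ)^14 ≤ ‖DirichletCharacter.LFunction χ ((1 + σ : ℝ) : ℂ)‖) :
    ‖∑' n : ℕ, (χ (n : ZMod r) * (ArithmeticFunction.vonMangoldt n : ℂ)) *
      (((Real.log n : ℝ) : ℂ) ^ k * (n : ℂ) ^ (-((1 + σ : ℝ) : ℂ)))‖ ≤ k.factorial * (M:ℝ)^(17 * k + 17) := by
  set s : ℂ := ((1 + σ : ℝ) : ℂ) with hs_def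
  have hM0 : (1408:ℝ) ≤ M := by exact_mod_cast hM
  have hMp : (0:ℝ) < M := by linarith
  have hM1 : (1:ℝ) ≤ M := by linarith
  have hs : 1 < s.re := by simp [hs_def, hσ]
  have hs0 : s ≠ 0 := by intro h; rw [h] at hs; simp at hs; linarith
  set F := DirichletCharacter.LFunction χ with hF
  have hFd : Differentiable ℂ F := DirichletCharacter.differentiable_LFunction hχ
  have hlr : 0 ≤ Real.log r := Real.log_natCast_nonneg r
  set ℓ := Real.log r + 1
  have hℓM : ℓ ≤ 2 * M := by simp only [ℓ]; linarith
  have hℓ0 : 0 < ℓ := by positivity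
  set ρ : ℝ := 1 / (M:ℝ)^17 with hρ
  have hρ0 : 0 < ρ := by positivity
  have hρℓ : ρ ≤ 1 / (8 * ℓ) := by
    apply one_div_le_one_div_of_le (by positivity)
    calc 8 * ℓ ≤ 16 * M := by linarith
      _ ≤ M * M := by gcongr; linarith
      _ = (M:ℝ)^2 := by ring
      _ ≤ (M:ℝ)^17 := pow_le_pow_right₀ hM1 (by norm_num)
  have hder : ∀ z ∈ Metric.closedBall s ρ, ‖deriv F z‖ ≤ 704 * (M:ℝ)^2 := by
    intro z hz
    rw [mem_closedBall_iff_norm] at hz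
    have := LFunction_deriv_disc_bound r χ hχ (s := 1 + σ) (by linarith) (by linarith) z (hz.trans hρℓ)
    refine this.trans ?_
    calc 176 * ℓ^2 ≤ 176 * (2 * M)^2 := by gcongr
      _ = _ := by ring
  have hlow : ∀ z ∈ Metric.closedBall s ρ, 1 / (M:ℝ)^14 / 2 ≤ ‖F z‖ := by
    intro z hz
    have h1 := (convex_closedBall s ρ).norm_image_sub_le_of_norm_deriv_le (fun x _ => hFd x) hder
      (Metric.mem_closedBall_self hρ0.le) hz
    rw [mem_closedBall_iff_norm] at hz
    have h2 : ‖F s‖ ≤ ‖F z‖ + ‖F z - F s‖ := by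
      have := norm_sub_le (F z) (F z - F s)
      simpa using this
    have h3 : 704 * (M:ℝ)^2 * ‖z - s‖ ≤ 1 / (M:ℝ)^14 / 2 := by
      calc 704 * (M:ℝ)^2 * ‖z - s‖ ≤ 704 * (M:ℝ)^2 * (1 / (M:ℝ)^17) := by gcongr
        _ = 704 / M / (M:ℝ)^14 := by field_simp
        _ ≤ (1/2) / (M:ℝ)^14 := by
          apply div_le_div_of_nonneg_right _ (by positivity)
          rw [div_le_iff₀ hMp]; linarith
        _ = _ := by ring
    linarith
  have hne : ∀ z ∈ Metric.closedBall s ρ, F z ≠ 0 := by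
    intro z hz h0
    have := hlow z hz
    rw [h0, norm_zero] at this
    have : 0 < 1 / (M:ℝ)^14 / 2 := by positivity
    linarith
  set G : ℂ → ℂ := fun z => - deriv F z / F z with hG
  have hGd : DiffContOnCl ℂ G (Metric.ball s ρ) := by
    apply DifferentiableOn.diffContOnCl
    rw [closure_ball _ hρ0.ne']
    have hdd : Differentiable ℂ (deriv F) := fun z => (hFd.analyticAt z).deriv.differentiableAt
    intro z hz
    exact ((hdd z).neg.div (hFd z) (hne z hz)).differentiableWithinAt
  have hGb : ∀ z ∈ Metric.sphere s ρ, ‖G z‖ ≤ (M:ℝ)^17 := by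
    intro z hz
    have hz' := Metric.sphere_subset_closedBall hz
    simp only [hG]
    rw [norm_div, norm_neg]
    have h1 := hder z hz'
    have h2 := hlow z hz'
    calc ‖deriv F z‖ / ‖F z‖ ≤ (704 * (M:ℝ)^2) / (1 / (M:ℝ)^14 / 2) := by gcongr
      _ = 1408 * (M:ℝ)^16 := by field_simp; norm_num
      _ ≤ M * (M:ℝ)^16 := by gcongr
      _ = _ := by ring
  have hC := Complex.norm_iteratedDeriv_le_of_forall_mem_sphere_norm_le k hρ0 hGd hGb
  have habs : LSeries.abscissaOfAbsConv ((fun n : ℕ => χ (n : ZMod r)) * (fun n : ℕ => (ArithmeticFunction.vonMangoldt n : ℂ))) < s.re := by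
    have : 1 < (((1 + σ/2 : ℝ) : ℂ)).re := by simp [hσ]
    have h2 := (DirichletCharacter.LSeriesSummable_twist_vonMangoldt χ this)
    refine lt_of_le_of_lt h2.abscissaOfAbsConv_le ?_
    simp only [Complex.ofReal_re, hs_def]
    exact_mod_cast (by linarith : 1 + σ/2 < 1 + σ)
  have heq : iteratedDeriv k G s = iteratedDeriv k (LSeries ((fun n : ℕ => χ (n : ZMod r)) * (fun n : ℕ => (ArithmeticFunction.vonMangoldt n : ℂ)))) s := by
    apply Filter.EventuallyEq.iteratedDeriv_eq
    have : {z : ℂ | 1 < z.re} ∈ nhds s := (isOpen_lt continuous_const Complex.continuous_re).mem_nhds hs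
    filter_upwards [this] with z hz
    rw [DirichletCharacter.LSeries_twist_vonMangoldt_eq χ hz]
    simp only [hG, hF]
    rw [DirichletCharacter.LFunction_eq_LSeries χ hz, DirichletCharacter.deriv_LFunction_eq_deriv_LSeries χ hz]
  rw [heq, LSeries_iteratedDeriv k habs, norm_mul, norm_pow, norm_neg, norm_one, one_pow, one_mul] at hC
  have e1 : LSeries (LSeries.logMul^[k] ((fun n : ℕ => χ (n : ZMod r)) * (fun n : ℕ => (ArithmeticFunction.vonMangoldt n : ℂ)))) s =
    ∑' n : ℕ, (χ (n : ZMod r) * (ArithmeticFunction.vonMangoldt n : ℂ)) *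
      (((Real.log n : ℝ) : ℂ) ^ k * (n : ℂ) ^ (-s)) := tsum_congr fun n => LSeries_logpow _ k hs0 n
  rw [e1] at hC
  refine hC.trans (le_of_eq ?_)
  rw [hρ, pow_add, pow_mul, one_div, inv_pow, div_inv_eq_mul]
  ring

/-- the small-conductor bound -/
theorem small_cond : ∃ M0 : ℕ, ∀ M : ℕ, M0 ≤ M → ∃ l1 : ℕ, l1.Prime ∧ ∀ (r : ℕ) (_ : NeZero r) (χ : DirichletCharacter ℂ r),
    χ.IsPrimitive → χ ≠ 1 → (r:ℝ) ≤ Real.exp M → ¬ l1 ∣ r →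
    ‖∑' n : ℕ, (χ (n : ZMod r) * (ArithmeticFunction.vonMangoldt n : ℂ)) *
      (((Real.log n : ℝ) : ℂ) ^ (M^2) * (n : ℂ) ^ (-((1 + 1/(M:ℝ)^18 : ℝ) : ℂ)))‖ ≤
      ((M:ℝ)^20) ^ (M^2) * Real.exp (-(2 * (M:ℝ)^2)) := by
  refine ⟨1408, fun M hM => ?_⟩
  have hM0 : (1408:ℝ) ≤ M := by exact_mod_cast hM
  have hMp : (0:ℝ) < M := by linarith
  have hM1 : (1:ℝ) ≤ M := by linarith
  set σ : ℝ := 1 / (M:ℝ)^18 with hσ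
  have hσ0 : 0 < σ := by positivity
  have hσ1 : σ ≤ 1 := by
    rw [hσ, div_le_one (by positivity)]; exact one_le_pow₀ hM1
  have hσi : 1 + 1/σ ≤ 2 * (M:ℝ)^18 := by
    rw [hσ, one_div_one_div]
    have := one_le_pow₀ hM1 (n := 18)
    linarith
  have hlogr : ∀ r : ℕ, NeZero r → (r:ℝ) ≤ Real.exp M → Real.log r ≤ M := by
    intro r _ hr
    rw [Real.log_le_iff_le_exp (by exact_mod_cast NeZero.pos r)]; exact hr
  -- the exceptional set
  let Bad : (Σ r : ℕ, DirichletCharacter ℂ r) → Prop := fun x =>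
    ∃ h : NeZero x.1, x.2.IsPrimitive ∧ x.2 ≠ 1 ∧ (x.1:ℝ) ≤ Real.exp M ∧ x.2 ^ 2 = 1 ∧
      ‖@DirichletCharacter.LFunction x.1 h x.2 ((1 + σ : ℝ) : ℂ)‖ < 1 / (M:ℝ)^14
  have huniq : ∀ x y, Bad x → Bad y → x = y := by
    rintro ⟨r1, χ1⟩ ⟨r2, χ2⟩ ⟨i1, p1, n1, b1, q1, l1⟩ ⟨i2, p2, n2, b2, q2, l2⟩
    by_contra hne
    simp only at i1 i2 p1 p2 n1 n2 b1 b2 q1 q2 l1 l2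
    have := real_pair_bound χ1 χ2 p1 p2 q1 q2 hne hσ0 hσ1
    have g1 := hlogr r1 i1 b1
    have g2 := hlogr r2 i2 b2
    have : (1:ℝ) ≤ (2 * (M:ℝ)^18) * (1 / (M:ℝ)^14) * (1 / (M:ℝ)^14) * (22 * (M + M + 1)) := by
      refine this.trans ?_
      gcongr
    have h3 : (2 * (M:ℝ)^18) * (1 / (M:ℝ)^14) * (1 / (M:ℝ)^14) * (22 * (M + M + 1)) ≤ 132 * M / (M:ℝ)^10 := by
      rw [show (2 * (M:ℝ)^18) * (1 / (M:ℝ)^14) * (1 / (M:ℝ)^14) * (22 * (M + M + 1)) = (44 * (M + M + 1)) / (M:ℝ)^10 by field_simp; norm_num]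
      apply div_le_div_of_nonneg_right _ (by positivity)
      linarith
    have h4 : 132 * (M:ℝ) / (M:ℝ)^10 < 1 := by
      rw [div_lt_one (by positivity)]
      calc 132 * (M:ℝ) < M * M := by gcongr; linarith
        _ = (M:ℝ)^2 := by ring
        _ ≤ (M:ℝ)^10 := pow_le_pow_right₀ hM1 (by norm_num)
    linarith
  obtain ⟨l1, hl1, hbad⟩ : ∃ l1 : ℕ, l1.Prime ∧ ∀ x, Bad x → l1 ∣ x.1 := by
    by_cases hex : ∃ x, Bad x
    · obtain ⟨x, hx⟩ := hex
      have hx1 : x.1 ≠ 1 := by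
        obtain ⟨r, χ⟩ := x
        obtain ⟨i, p, n, -⟩ := hx
        intro h
        simp only at h
        exact n (DirichletCharacter.level_one' χ h)
      refine ⟨x.1.minFac, Nat.minFac_prime hx1, fun y hy => ?_⟩
      rw [huniq y x hy hx]
      exact Nat.minFac_dvd _
    · exact ⟨2, Nat.prime_two, fun x hx => (hex ⟨x, hx⟩).elim⟩
  refine ⟨l1, hl1, fun r ir χ hp hχ hr hlr => ?_⟩
  have hlog := hlogr r ir hr
  have hlow : 1 / (M:ℝ)^14 ≤ ‖DirichletCharacter.LFunction χ ((1 + σ : ℝ) : ℂ)‖ := by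
    by_contra hcon
    push Not at hcon
    by_cases hq : χ ^ 2 = 1
    · exact hlr (hbad ⟨r, χ⟩ ⟨ir, hp, hχ, hr, hq, hcon⟩)
    · have h1 := complex_lower χ hq hσ0 hσ1
      have h2 : (1:ℝ) ≤ (2 * (M:ℝ)^18)^3 * (1 / (M:ℝ)^14)^4 * (22 * (M + 1)) := by
        refine h1.trans ?_
        have : 0 ≤ Real.log r := Real.log_natCast_nonneg r
        gcongr
      have h3 : (2 * (M:ℝ)^18)^3 * (1 / (M:ℝ)^14)^4 * (22 * (M + 1)) ≤ 352 * M / (M:ℝ)^2 := by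
        rw [show (2 * (M:ℝ)^18)^3 * (1 / (M:ℝ)^14)^4 * (22 * (M + 1)) = (176 * (M + 1)) / (M:ℝ)^2 by field_simp; norm_num]
        apply div_le_div_of_nonneg_right _ (by positivity)
        linarith
      have h4 : 352 * (M:ℝ) / (M:ℝ)^2 < 1 := by
        rw [div_lt_one (by positivity), pow_two]
        gcongr; linarith
      linarith
  have hmain := small_char r χ hχ M hM hlog hσ0 hσ1 (M^2) hlow
  refine hmain.trans ?_
  set k := M^2 with hk
  have hkM : ((k:ℕ):ℝ) = (M:ℝ)^2 := by rw [hk]; push_cast; rfl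
  have hk17 : 34 ≤ k := by
    have : M * M ≥ 1408 * 1408 := Nat.mul_le_mul hM hM
    rw [hk, pow_two]; omega
  have hfac : (k.factorial : ℝ) ≤ (M:ℝ)^(2*k) := by
    have := Nat.factorial_le_pow k
    calc (k.factorial : ℝ) ≤ ((k:ℕ):ℝ)^k := by exact_mod_cast this
      _ = _ := by rw [hkM, ← pow_mul]
  have hexp : Real.exp (2 * (M:ℝ)^2) ≤ (M:ℝ)^(k - 17) := by
    have e4 : Real.exp 4 ≤ M := by
      have := Real.exp_one_lt_d9
      have h4 : Real.exp 4 = (Real.exp 1)^4 := by rw [← Real.exp_nat_mul]; norm_num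
      rw [h4]
      calc (Real.exp 1)^4 ≤ (3:ℝ)^4 := by gcongr; linarith
        _ ≤ (M:ℝ) := by norm_num; linarith
    have h2 : 2 * (M:ℝ)^2 ≤ ((k - 17 : ℕ):ℝ) * 4 := by
      rw [← hkM, Nat.cast_sub (by omega)]
      have : (34:ℝ) ≤ k := by exact_mod_cast hk17
      push_cast; linarith
    calc Real.exp (2 * (M:ℝ)^2) ≤ Real.exp (((k - 17 : ℕ):ℝ) * 4) := Real.exp_le_exp.mpr h2
      _ = (Real.exp 4)^(k-17) := Real.exp_nat_mul _ _
      _ ≤ _ := by gcongr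
  rw [Real.exp_neg, ← div_eq_mul_inv, le_div_iff₀ (Real.exp_pos _)]
  calc (k.factorial:ℝ) * (M:ℝ)^(17*k+17) * Real.exp (2 * (M:ℝ)^2) ≤ (M:ℝ)^(2*k) * (M:ℝ)^(17*k+17) * (M:ℝ)^(k-17) := by gcongr
    _ = ((M:ℝ)^20)^k := by
      rw [← pow_mul, ← pow_add, ← pow_add]; congr 1; omega

end PSLSieve
end

section
open Finset
namespace PSLSieve

/-- the weight -/
noncomputable def Wt (M n : ℕ) : ℝ := (Real.log n) ^ (M^2) * (n:ℝ) ^ (-(1 + 1/(M:ℝ)^18))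
/-- the normalisation -/
noncomputable def Nk (M : ℕ) : ℝ := ((M:ℝ)^20) ^ (M^2) * Real.exp (-(M:ℝ)^2)
/-- the main range -/
def InI (M n : ℕ) : Prop := 0.99 * (M:ℝ)^20 < Real.log n ∧ Real.log n ≤ 1.005 * (M:ℝ)^20

lemma Wt_nonneg (M n : ℕ) : 0 ≤ Wt M n := by
  unfold Wt
  have := Real.log_natCast_nonneg n
  positivity

lemma Wt_zero (M : ℕ) (hM : 0 < M) : Wt M 0 = 0 := by
  simp [Wt, hM.ne']

lemma Wt_one (M : ℕ) (hM : 0 < M) : Wt M 1 = 0 := by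
  simp [Wt, hM.ne']

lemma Nk_pos (M : ℕ) (hM : 0 < M) : 0 < Nk M := by
  unfold Nk; have : (0:ℝ) < M := by exact_mod_cast hM
  positivity

lemma nW_eq (M n : ℕ) (hM : 0 < M) (hn : 0 < n) :
    n * Wt M n = Nk M * ((Real.log n / (M:ℝ)^20) * Real.exp (1 - Real.log n / (M:ℝ)^20)) ^ (M^2) := by
  have hM0 : (0:ℝ) < M := by exact_mod_cast hM
  have hn0 : (0:ℝ) < n := by exact_mod_cast hn
  unfold Wt Nk
  rw [Real.rpow_neg hn0.le, Real.rpow_add hn0, Real.rpow_one, Real.rpow_def_of_pos hn0, mul_pow, ← Real.exp_nat_mul, div_pow]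
  have e : Real.exp (((M^2 : ℕ):ℝ) * (1 - Real.log n / (M:ℝ)^20)) = Real.exp ((M:ℝ)^2) * (Real.exp (Real.log n * (1/(M:ℝ)^18)))⁻¹ := by
    rw [← Real.exp_neg, ← Real.exp_add]
    congr 1
    push_cast
    field_simp
    ring
  rw [e, Real.exp_neg]
  have h1 := Real.exp_pos ((M:ℝ)^2)
  have h2 := Real.exp_pos (Real.log n * (1/(M:ℝ)^18))
  field_simp

lemma nW_le (M n : ℕ) (hM : 0 < M) : n * Wt M n ≤ Nk M := by
  rcases Nat.eq_zero_or_pos n with rfl | hn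
  · simp; exact (Nk_pos M hM).le
  rw [nW_eq M n hM hn]
  have hv : 0 ≤ Real.log n / (M:ℝ)^20 := by
    have := Real.log_natCast_nonneg n
    positivity
  apply mul_le_of_le_one_right (Nk_pos M hM).le
  apply pow_le_one₀ (by positivity)
  set v := Real.log n / (M:ℝ)^20
  have := Real.add_one_le_exp (v - 1)
  calc v * Real.exp (1 - v) ≤ Real.exp (v - 1) * Real.exp (1 - v) := by
        gcongr; linarith
    _ = 1 := by rw [← Real.exp_add]; simp

lemma conc_aux {v : ℝ} (hv : 0 ≤ v) (h : v ≤ 0.99 ∨ 1.005 < v) :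
    v * Real.exp (1 - v) ≤ Real.exp (-(0.000001 * (1 + v))) := by
  have key : v ≤ Real.exp (v - 1 - 0.000001 * (1 + v)) := by
    rcases h with h | h
    · -- tangent line at 0.99
      have h1 : Real.log 0.99 ≤ -0.01005 := by
        have := Real.le_log_one_add_of_nonneg (x := 1/99) (by norm_num)
        have e : Real.log 0.99 = - Real.log (1 + 1/99) := by
          rw [← Real.log_inv]; norm_num
        rw [e]; norm_num at this ⊢; linarith
      have h2 : (0.99:ℝ) ≤ Real.exp (-0.01005) := by
        rw [← Real.log_le_iff_le_exp (by norm_num)]; exact h1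
      have h3 := Real.add_one_le_exp (v - 1 - 0.000001 * (1 + v) + 0.01005)
      have e : Real.exp (v - 1 - 0.000001 * (1 + v)) = Real.exp (-0.01005) * Real.exp (v - 1 - 0.000001 * (1 + v) + 0.01005) := by
        rw [← Real.exp_add]; congr 1; ring
      rw [e]
      have h5 := Real.exp_pos (v - 1 - 0.000001 * (1 + v) + 0.01005)
      calc v ≤ 0.99 * (v - 1 - 0.000001 * (1 + v) + 0.01005 + 1) := by linarith
        _ ≤ 0.99 * Real.exp (v - 1 - 0.000001 * (1 + v) + 0.01005) := by gcongr
        _ ≤ _ := by gcongr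
    · have h2 : (1.005:ℝ) ≤ Real.exp 0.004988 := by
        have := Real.quadratic_le_exp_of_nonneg (x := 0.004988) (by norm_num)
        norm_num at this ⊢; linarith
      have h3 := Real.add_one_le_exp (v - 1 - 0.000001 * (1 + v) - 0.004988)
      have e : Real.exp (v - 1 - 0.000001 * (1 + v)) = Real.exp 0.004988 * Real.exp (v - 1 - 0.000001 * (1 + v) - 0.004988) := by
        rw [← Real.exp_add]; congr 1; ring
      rw [e]
      calc v ≤ 1.005 * (v - 1 - 0.000001 * (1 + v) - 0.004988 + 1) := by linarith
        _ ≤ 1.005 * Real.exp (v - 1 - 0.000001 * (1 + v) - 0.004988) := by gcongr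
        _ ≤ _ := by gcongr
  calc v * Real.exp (1 - v) ≤ Real.exp (v - 1 - 0.000001 * (1 + v)) * Real.exp (1 - v) := by gcongr
    _ = _ := by rw [← Real.exp_add]; congr 1; ring

lemma nW_off (M n : ℕ) (hM : 0 < M) (hn : 0 < n) (h : ¬ InI M n) :
    n * Wt M n ≤ Nk M * Real.exp (-(0.000001 * (M:ℝ)^2)) * (n:ℝ) ^ (-(0.000001 * (1 / (M:ℝ)^18))) := by
  have hM0 : (0:ℝ) < M := by exact_mod_cast hM
  have hn0 : (0:ℝ) < n := by exact_mod_cast hn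
  rw [nW_eq M n hM hn, mul_assoc]
  have hl := Real.log_natCast_nonneg n
  have hv : 0 ≤ Real.log n / (M:ℝ)^20 := by positivity
  have hP : (0:ℝ) < (M:ℝ)^20 := by positivity
  have h' : Real.log n / (M:ℝ)^20 ≤ 0.99 ∨ 1.005 < Real.log n / (M:ℝ)^20 := by
    unfold InI at h
    rw [not_and_or, not_lt, not_le] at h
    rcases h with h | h
    · left; rwa [div_le_iff₀ hP]
    · right; rwa [lt_div_iff₀ hP]
  gcongr ?_ * ?_
  · exact (Nk_pos M hM).le
  refine (pow_le_pow_left₀ (by positivity) (conc_aux hv h') _).trans (le_of_eq ?_)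
  rw [← Real.exp_nat_mul, Real.rpow_def_of_pos hn0, ← Real.exp_add]
  congr 1
  push_cast
  field_simp
  ring

lemma fac_le (n : ℕ) (hn : 1 ≤ n) : (n.factorial : ℝ) ≤ Real.exp 1 * (n:ℝ)^(n+1) * Real.exp (-n) := by
  induction n, hn using Nat.le_induction with
  | base => simp [← Real.exp_add]
  | succ n hn ih =>
    have hn0 : (0:ℝ) < n := by exact_mod_cast hn
    have h1 : Real.exp 1 ≤ ((n+1:ℝ)/n)^(n+1) := by
      have : 1 / ((n:ℝ)+1) ≤ Real.log ((n+1:ℝ)/n) := by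
        have := Real.one_sub_inv_le_log_of_pos (x := (n+1:ℝ)/n) (by positivity)
        refine le_trans (le_of_eq ?_) this
        field_simp; ring
      calc Real.exp 1 = Real.exp (1/((n:ℝ)+1))^(n+1) := by
            rw [← Real.exp_nat_mul]; congr 1; push_cast; field_simp
        _ ≤ _ := by
            gcongr
            rw [← Real.le_log_iff_exp_le (by positivity)]; exact this
    rw [div_pow, le_div_iff₀ (by positivity)] at h1
    rw [Nat.factorial_succ]
    push_cast
    have e : Real.exp (-((n:ℝ)+1)) = Real.exp (-n) * (Real.exp 1)⁻¹ := by
      rw [← Real.exp_neg, ← Real.exp_add]; congr 1; ring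
    calc ((n:ℝ)+1) * n.factorial ≤ ((n:ℝ)+1) * (Real.exp 1 * (n:ℝ)^(n+1) * Real.exp (-n)) := by gcongr
      _ = ((n:ℝ)+1) * (Real.exp (-n) * (Real.exp 1 * (n:ℝ)^(n+1))) := by ring
      _ ≤ ((n:ℝ)+1) * (Real.exp (-n) * ((n:ℝ)+1)^(n+1)) := by gcongr
      _ = _ := by rw [e]; field_simp; ring

lemma kfac_bound (M : ℕ) (hM : 2 ≤ M) :
    ((M^2).factorial : ℝ) / ((1 / (M:ℝ)^18) * (1 - 1/(M:ℝ)^2)) ^ (M^2) ≤ 12 * (M:ℝ)^2 * Nk M := by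
  have hM0 : (2:ℝ) ≤ M := by exact_mod_cast hM
  have hMp : (0:ℝ) < M := by linarith
  have hk4 : (4:ℝ) ≤ (M:ℝ)^2 := by nlinarith
  set k := M^2 with hk
  have hkc : ((k:ℕ):ℝ) = (M:ℝ)^2 := by rw [hk]; push_cast; rfl
  have hk1 : 1 ≤ k := Nat.one_le_pow _ _ (by omega)
  -- (1 - 1/k)^k ≥ 1/4
  have hq : (1/4:ℝ) ≤ (1 - 1/(M:ℝ)^2)^k := by
    have hk2 : k = 2 * (k/2) + k % 2 := by omega
    have hx : 0 ≤ 1/(M:ℝ)^2 := by positivity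
    have hx4 : 1/(M:ℝ)^2 ≤ 1/4 := one_div_le_one_div_of_le (by norm_num) hk4
    set x := 1/(M:ℝ)^2
    have hkx : (k:ℝ) * x = 1 := by rw [hkc]; simp only [x]; field_simp
    have h1 : Real.exp (-(4/3 * x)) ≤ 1 - x := by
      have := Real.one_sub_inv_le_log_of_pos (x := 1 - x) (by linarith)
      have h2 : 1 - (1-x)⁻¹ ≥ -(4/3*x) := by
        have h1x : 0 < 1 - x := by linarith
        rw [ge_iff_le, ← sub_nonneg]
        have : 1 - (1-x)⁻¹ - -(4/3*x) = x * (1 - 4 * x) / (3 * (1-x)) := by field_simp; ring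
        rw [this]
        apply div_nonneg
        · apply mul_nonneg hx; linarith
        · linarith
      rw [← Real.le_log_iff_exp_le (by linarith)]; linarith
    calc (1/4:ℝ) ≤ Real.exp (-(4/3)) := by
          rw [Real.exp_neg, one_div]
          apply inv_anti₀ (Real.exp_pos _)
          have h3 : Real.exp (4/3) ^ 3 ≤ 4^3 := by
            rw [← Real.exp_nat_mul, show ((3:ℕ):ℝ) * (4/3) = ((4:ℕ):ℝ) * 1 by norm_num, Real.exp_nat_mul]
            have := Real.exp_one_lt_d9
            calc Real.exp 1 ^ 4 ≤ 2.72^4 := by gcongr; linarith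
              _ ≤ 4^3 := by norm_num
          exact le_of_pow_le_pow_left₀ (by norm_num) (by norm_num) h3
      _ = Real.exp (-(4/3 * x))^k := by
          rw [← Real.exp_nat_mul]; congr 1; linear_combination (4/3) * hkx
      _ ≤ _ := by gcongr
  have hf := fac_le k hk1
  rw [hkc] at hf
  rw [mul_pow, div_le_iff₀ (by positivity)]
  have e3 : Real.exp 1 ≤ 3 := by have := Real.exp_one_lt_d9; linarith
  have hN : Nk M = ((M:ℝ)^20)^k * Real.exp (-(M:ℝ)^2) := rfl
  have hp : ((M:ℝ)^20)^k * (1/(M:ℝ)^18)^k = ((M:ℝ)^2)^k := by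
    rw [← mul_pow]; congr 1; field_simp
  calc (k.factorial:ℝ) ≤ Real.exp 1 * ((M:ℝ)^2)^(k+1) * Real.exp (-(M:ℝ)^2) := hf
    _ ≤ 3 * ((M:ℝ)^2)^(k+1) * Real.exp (-(M:ℝ)^2) := by gcongr
    _ = 12 * (M:ℝ)^2 * (((M:ℝ)^2)^k * Real.exp (-(M:ℝ)^2)) * (1/4) := by ring
    _ ≤ 12 * (M:ℝ)^2 * (((M:ℝ)^2)^k * Real.exp (-(M:ℝ)^2)) * (1 - 1/(M:ℝ)^2)^k := by gcongr
    _ = _ := by rw [hN, ← hp]; ring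

end PSLSieve
end

section
open Finset
namespace PSLSieve

open Classical in
/-- primes in the main range -/
noncomputable def PI (M : ℕ) : Finset ℕ :=
  (Finset.range (⌊Real.exp (1.005 * (M:ℝ)^20)⌋₊ + 1)).filter (fun n => n.Prime ∧ InI M n)

lemma mem_PI (M n : ℕ) : n ∈ PI M ↔ n.Prime ∧ InI M n := by
  simp only [PI, Finset.mem_filter, Finset.mem_range]
  rw [and_iff_right_iff_imp]
  rintro ⟨hp, h1, h2⟩
  rw [Nat.lt_succ_iff]
  apply Nat.le_floor
  rwa [← Real.log_le_iff_le_exp (by exact_mod_cast hp.pos)]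

/-- the weight of a prime -/
noncomputable def wt (M n : ℕ) : ℝ := Real.log n * Wt M n

lemma wt_nonneg (M n : ℕ) : 0 ≤ wt M n :=
  mul_nonneg (Real.log_natCast_nonneg n) (Wt_nonneg M n)

/-- total mass -/
noncomputable def mass (M : ℕ) : ℝ := ∑ p ∈ PI M, wt M p

lemma theta_aux (x : ℝ) (hx : 30^4 ≤ x) : x / 8 ≤ Chebyshev.theta x - Chebyshev.theta (x/8) := by
  have hx1 : 1 ≤ x := by linarith
  have h1 := Chebyshev.theta_ge' hx1
  have h2 := Chebyshev.theta_le_log4_mul_x (x := x/8) (by linarith)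
  set u := x ^ (1/4:ℝ) with hu
  have hu0 : 0 < u := by positivity
  have hu4 : x = u^4 := by
    rw [hu, ← Real.rpow_natCast, ← Real.rpow_mul (by linarith)]; norm_num
  have hu30 : 30 ≤ u := by
    rw [hu4] at hx
    exact le_of_pow_le_pow_left₀ (by norm_num) hu0.le hx
  have hlog : Real.log x ≤ 4 * u := by
    have := Real.log_le_rpow_div (x := x) (by linarith) (ε := 1/4) (by norm_num)
    rw [← hu] at this; linarith
  have hlog2 : Real.log (x+2) ≤ 8 * u := by
    calc Real.log (x+2) ≤ Real.log (x^2) := by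
          apply Real.log_le_log (by linarith); nlinarith
      _ = 2 * Real.log x := by rw [Real.log_pow]; norm_num
      _ ≤ _ := by linarith
  have hs : √x = u^2 := by
    rw [hu4, show u^4 = (u^2)^2 by ring, Real.sqrt_sq (by positivity)]
  have hl2 := Real.log_two_gt_d9
  have hl2' := Real.log_two_lt_d9
  have hl4 : Real.log 4 = 2 * Real.log 2 := by
    rw [show (4:ℝ) = 2^2 by norm_num, Real.log_pow]; norm_num
  rw [hs] at h1
  rw [hl4] at h2
  have h3 : 2 * u^2 * Real.log x ≤ 8 * u^3 := by
    calc 2 * u^2 * Real.log x ≤ 2 * u^2 * (4*u) := by gcongr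
      _ = _ := by ring
  have h4 : (x-1) * 0.69 ≤ (x-1) * Real.log 2 := by gcongr; linarith
  have h5 : 2 * Real.log 2 * (x/8) ≤ 2 * 0.6932 * (x/8) := by gcongr; linarith
  have h6 : 30 * u^3 ≤ u^4 := by
    rw [show u^4 = u * u^3 by ring]; gcongr
  have h7 : 900 * u ≤ u^3 := by nlinarith
  have h8 : x = u^4 := hu4
  nlinarith

lemma mass_lower (M : ℕ) (hM : 10 ≤ M) : Nk M / 16 ≤ mass M := by
  have hM0 : (10:ℝ) ≤ M := by exact_mod_cast hM
  have hMp : (0:ℝ) < M := by linarith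
  have hMpos : 0 < M := by omega
  set L := (M:ℝ)^20 with hL
  have hL1 : (10:ℝ)^20 ≤ L := by rw [hL]; gcongr
  set X := Real.exp L with hX
  have hXp : 0 < X := Real.exp_pos _
  have hXL : L + 1 ≤ X := Real.add_one_le_exp L
  have hth := theta_aux (8*X) (by linarith)
  rw [show 8 * X / 8 = X by ring] at hth
  have hl8 : Real.log 8 ≤ 3 := by
    rw [show (8:ℝ) = 2^3 by norm_num, Real.log_pow]
    have := Real.log_two_lt_d9; push_cast; linarith
  set S := (Finset.Ioc ⌊X⌋₊ ⌊8*X⌋₊).filter Nat.Prime with hS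
  have hdiff : Chebyshev.theta (8*X) - Chebyshev.theta X = ∑ p ∈ S, Real.log p := by
    unfold Chebyshev.theta
    rw [sub_eq_iff_eq_add, hS, add_comm, ← Finset.sum_union]
    · congr 1
      rw [← Finset.filter_union, Finset.Ioc_union_Ioc_eq_Ioc (Nat.zero_le _)]
      exact Nat.floor_le_floor (by linarith)
    · apply Finset.disjoint_filter_filter
      rw [Finset.disjoint_left]; intro a ha hb
      simp at ha hb; omega
  have hbd : ∀ p ∈ S, L < Real.log p ∧ Real.log p ≤ L + 3 ∧ (p:ℝ) ≤ 8*X ∧ p.Prime := by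
    intro p hp
    simp only [hS, Finset.mem_filter, Finset.mem_Ioc] at hp
    obtain ⟨⟨h1, h2⟩, h3⟩ := hp
    have h1' : X < p := (Nat.floor_lt hXp.le).1 h1
    have h2' : (p:ℝ) ≤ 8 * X := (Nat.le_floor_iff (by positivity)).1 h2
    have hp0 : (0:ℝ) < p := by linarith
    refine ⟨?_, ?_, h2', h3⟩
    · rwa [Real.lt_log_iff_exp_lt hp0]
    · calc Real.log p ≤ Real.log (8*X) := Real.log_le_log hp0 h2'
        _ = Real.log 8 + L := by rw [Real.log_mul (by norm_num) hXp.ne', hX, Real.log_exp]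
        _ ≤ _ := by linarith
  have hsub : S ⊆ PI M := by
    intro p hp
    obtain ⟨h1, h2, h3, h4⟩ := hbd p hp
    rw [mem_PI]
    refine ⟨h4, ?_, ?_⟩ <;> rw [← hL] <;> linarith
  have hterm : ∀ p ∈ S, Nk M / (16 * X) * Real.log p ≤ wt M p := by
    intro p hp
    obtain ⟨h1, h2, h3, h4⟩ := hbd p hp
    have hp0 : (0:ℝ) < p := by exact_mod_cast h4.pos
    have hlp : 0 ≤ Real.log p := by linarith
    have hnW := nW_eq M p hMpos h4.pos
    rw [← hL] at hnW
    have hLp : 0 < L := by linarith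
    set d := Real.log p / L - 1 with hd
    have hd0 : 0 ≤ d := by
      rw [hd, sub_nonneg, le_div_iff₀ hLp]; linarith
    have hd3 : d ≤ 3 / L := by
      rw [hd, le_div_iff₀ hLp, sub_mul, div_mul_cancel₀ _ hLp.ne']; linarith
    have hd3' : d ≤ 1 / M^2 := by
      refine hd3.trans ?_
      rw [div_le_div_iff₀ hLp (by positivity), hL]
      have : (10:ℝ)^18 ≤ (M:ℝ)^18 := by gcongr
      calc 3 * (M:ℝ)^2 ≤ (M:ℝ)^18 * M^2 := by gcongr; linarith
        _ = 1 * (M:ℝ)^20 := by ring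
    have hd1 : d ≤ 1/100 := by
      refine hd3'.trans ?_
      apply one_div_le_one_div_of_le (by norm_num); nlinarith
    have hv : Real.log p / L = 1 + d := by rw [hd]; ring
    have hb : 1 - d^2 ≤ (1 + d) * Real.exp (1 - (1+d)) := by
      have := Real.add_one_le_exp (1 - (1+d))
      nlinarith
    have hb2 : 1/2 ≤ ((1 + d) * Real.exp (1 - (1+d)))^(M^2) := by
      have h0 : 0 ≤ 1 - d^2 := by nlinarith
      refine le_trans ?_ (pow_le_pow_left₀ h0 hb _)
      have := one_add_mul_le_pow (a := -d^2) (by nlinarith) (M^2)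
      rw [show 1 - d^2 = 1 + -d^2 by ring]
      refine le_trans ?_ this
      push_cast
      have : (M:ℝ)^2 * d^2 ≤ 1/2 := by
        have h9 : (M:ℝ)^2 * d ≤ 1 := by
          calc (M:ℝ)^2 * d ≤ M^2 * (1/M^2) := by gcongr
            _ = 1 := by field_simp
        nlinarith
      linarith
    rw [hv] at hnW
    have hNp := Nk_pos M hMpos
    have h5 : Nk M / 2 ≤ 8 * X * Wt M p := by
      calc Nk M / 2 = Nk M * (1/2) := by ring
        _ ≤ p * Wt M p := by rw [hnW]; gcongr
        _ ≤ _ := by have := Wt_nonneg M p; gcongr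
    unfold wt
    rw [mul_comm]
    gcongr
    rw [div_le_iff₀ (by positivity)]; linarith
  calc Nk M / 16 = Nk M / (16 * X) * X := by field_simp
    _ ≤ Nk M / (16*X) * ∑ p ∈ S, Real.log p := by
        have := Nk_pos M hMpos
        gcongr; rw [← hdiff]; linarith
    _ = ∑ p ∈ S, Nk M / (16*X) * Real.log p := by rw [Finset.mul_sum]
    _ ≤ ∑ p ∈ S, wt M p := Finset.sum_le_sum hterm
    _ ≤ mass M := Finset.sum_le_sum_of_subset_of_nonneg hsub (fun p _ _ => wt_nonneg M p)

end PSLSieve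
end

section
open Finset
namespace PSLSieve

lemma ev_poly (C c B : ℝ) (hc : 0 < c) (K : ℕ) :
    ∃ M0 : ℕ, ∀ M : ℕ, M0 ≤ M → C * (M:ℝ)^K * Real.exp (B * M) ≤ Real.exp (c * (M:ℝ)^2) := by
  have h1 : ∀ᶠ x : ℝ in Filter.atTop, C * x^K ≤ Real.exp x := by
    have h := (Real.isLittleO_pow_exp_atTop (n := K)).const_mul_left C
    filter_upwards [h.bound (c := 1) one_pos] with x hx
    rw [one_mul, Real.norm_eq_abs, Real.norm_eq_abs, abs_of_pos (Real.exp_pos x)] at hx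
    exact (le_abs_self _).trans hx
  have h2 : ∀ᶠ x : ℝ in Filter.atTop, (1 + B) / c ≤ x := Filter.eventually_ge_atTop _
  have h3 := tendsto_natCast_atTop_atTop (R := ℝ) |>.eventually (h1.and h2)
  obtain ⟨M0, h⟩ := Filter.eventually_atTop.mp h3
  refine ⟨M0, fun M hM => ?_⟩
  obtain ⟨ha, hb⟩ := h M hM
  rw [div_le_iff₀ hc] at hb
  calc C * (M:ℝ)^K * Real.exp (B * M) ≤ Real.exp M * Real.exp (B * M) := by gcongr
    _ = Real.exp ((1 + B) * M) := by rw [← Real.exp_add]; congr 1; ring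
    _ ≤ _ := by
        apply Real.exp_le_exp.mpr
        have : (0:ℝ) ≤ M := Nat.cast_nonneg M
        nlinarith

lemma sum_sqfree_div {m : ℕ} (hm : m ≠ 0) (a : ℝ) :
    ∑ D ∈ m.divisors.filter Squarefree, a ^ D.primeFactors.card = (a + 1) ^ m.primeFactors.card := by
  rw [← Finset.sum_pow_mul_eq_add_pow]
  refine Finset.sum_nbij' (fun D => D.primeFactors) (fun s => ∏ p ∈ s, p) ?_ ?_ ?_ ?_ ?_
  · intro D hD
    simp only [mem_filter, Nat.mem_divisors] at hD
    rw [Finset.mem_powerset]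
    exact Nat.primeFactors_mono hD.1.1 hm
  · intro s hs
    rw [Finset.mem_powerset] at hs
    have hp : ∀ p ∈ s, p.Prime := fun p hp => Nat.prime_of_mem_primeFactors (hs hp)
    simp only [mem_filter, Nat.mem_divisors]
    refine ⟨⟨?_, hm⟩, ?_⟩
    · exact (Finset.prod_dvd_prod_of_subset _ _ _ hs).trans (Nat.prod_primeFactors_dvd m)
    · apply Finset.squarefree_prod_of_pairwise_isCoprime
      · intro p hpp q hq hpq
        exact Nat.coprime_iff_isRelPrime.mp ((Nat.coprime_primes (hp p hpp) (hp q hq)).mpr hpq)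
      · intro p hpp; exact (hp p hpp).squarefree
  · intro D hD
    simp only [mem_filter, Nat.mem_divisors] at hD
    exact Nat.prod_primeFactors_of_squarefree hD.2
  · intro s hs
    rw [Finset.mem_powerset] at hs
    exact Nat.primeFactors_prod fun p hp => Nat.prime_of_mem_primeFactors (hs hp)
  · intro D hD; simp

lemma two_pow_omega_le_tau {m : ℕ} (hm : m ≠ 0) : (2:ℝ) ^ m.primeFactors.card ≤ tau m := by
  have := sum_sqfree_div hm 1
  norm_num at this
  rw [← this]
  unfold tau
  exact_mod_cast Finset.card_le_card (Finset.filter_subset _ _)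

lemma omega64_le {n : ℕ} (hn : 2 ≤ n) :
    (64:ℝ) ^ (n^2-1).primeFactors.card ≤ tau (n-1)^6 * tau (n+1)^6 := by
  have e : n^2 - 1 = (n-1)*(n+1) := by
    obtain ⟨k, rfl⟩ : ∃ k, n = k + 1 := ⟨n-1, by omega⟩
    have : (k+1)^2 = (k+1-1)*(k+1+1) + 1 := by simp; ring
    omega
  have h0 : n^2 - 1 ≠ 0 := by
    rw [e]; apply Nat.mul_ne_zero <;> omega
  calc (64:ℝ) ^ (n^2-1).primeFactors.card = ((2:ℝ) ^ (n^2-1).primeFactors.card)^6 := by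
        rw [← pow_mul, mul_comm, pow_mul]; norm_num
    _ ≤ (tau (n^2-1))^6 := by gcongr; exact two_pow_omega_le_tau h0
    _ ≤ (tau (n-1) * tau (n+1))^6 := by
        have := tau_nonneg (n^2-1)
        gcongr
        rw [e]; exact tau_mul_le _ _
    _ = _ := by ring

lemma prod13 {a b c : ℝ} (ha : 0 ≤ a) (hb : 0 ≤ b) (hc : 0 ≤ c) :
    a * (b^6 * c^6) ≤ a^13 + b^13 + c^13 := by
  have h : ∀ m, a ≤ m → b ≤ m → c ≤ m → a * (b^6*c^6) ≤ m^13 := by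
    intro m h1 h2 h3
    have hm : 0 ≤ m := ha.trans h1
    calc a * (b^6*c^6) ≤ m * (m^6 * m^6) := by gcongr
      _ = m^13 := by ring
  have h1 := pow_nonneg ha 13
  have h2 := pow_nonneg hb 13
  have h3 := pow_nonneg hc 13
  rcases le_total a b with h4 | h4
  · rcases le_total b c with h5 | h5
    · linarith [h c (h4.trans h5) h5 le_rfl]
    · linarith [h b h4 le_rfl h5]
  · rcases le_total a c with h5 | h5
    · linarith [h c h5 (h4.trans h5) le_rfl]
    · linarith [h a le_rfl h4 h5]

lemma tail_sum13 {s : ℝ} (hs : 0 < s) (hs1 : s ≤ 1) (N J : ℕ) (hJ : J = 2^13) :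
    ∑ n ∈ Icc 2 N, tau n * (tau (n-1)^6 * tau (n+1)^6) * (n:ℝ)^(-1-s) ≤ 6 * (1+1/s)^J := by
  have hmom : ∀ N, ∑ n ∈ Icc 1 N, tau n^13 * (n:ℝ)^(-1-s) ≤ (1+1/s)^J := fun N => hJ ▸ tau_moment_rpow hs 13 N
  clear hJ
  set B := (1+1/s)^J with hB
  have h1 : ∑ n ∈ Icc 2 N, tau n^13 * (n:ℝ)^(-1-s) ≤ B := by
    refine le_trans ?_ (hmom N)
    apply Finset.sum_le_sum_of_subset_of_nonneg
    · apply Finset.Icc_subset_Icc_left; omega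
    · intro i _ _; have := tau_nonneg i; positivity
  have h2 : ∑ n ∈ Icc 2 N, tau (n-1)^13 * (n:ℝ)^(-1-s) ≤ B := by
    refine le_trans ?_ (hmom N)
    calc ∑ n ∈ Icc 2 N, tau (n-1)^13 * (n:ℝ)^(-1-s)
        ≤ ∑ n ∈ Icc 2 N, tau (n-1)^13 * ((n-1:ℕ):ℝ)^(-1-s) := by
          apply Finset.sum_le_sum; intro n hn
          simp only [mem_Icc] at hn
          have := tau_nonneg (n-1)
          have hn1 : (0:ℝ) < ((n-1:ℕ):ℝ) := by exact_mod_cast (by omega : 0 < n-1)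
          apply mul_le_mul_of_nonneg_left _ (by positivity)
          apply Real.rpow_le_rpow_of_nonpos hn1 _ (by linarith)
          exact_mod_cast (by omega : n - 1 ≤ n)
      _ = ∑ n ∈ (Icc 2 N).image (fun n => n-1), tau n^13 * (n:ℝ)^(-1-s) := by
          rw [Finset.sum_image]
          intro a ha b hb h; simp at ha hb h; omega
      _ ≤ _ := by
          apply Finset.sum_le_sum_of_subset_of_nonneg
          · intro a ha; simp only [mem_image, mem_Icc] at ha ⊢; omega
          · intro i _ _; have := tau_nonneg i; positivity
  have h3 : ∑ n ∈ Icc 2 N, tau (n+1)^13 * (n:ℝ)^(-1-s) ≤ 4 * B := by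
    calc ∑ n ∈ Icc 2 N, tau (n+1)^13 * (n:ℝ)^(-1-s)
        ≤ ∑ n ∈ Icc 2 N, 4 * (tau (n+1)^13 * ((n+1:ℕ):ℝ)^(-1-s)) := by
          apply Finset.sum_le_sum; intro n hn
          simp only [mem_Icc] at hn
          have hn0 : (0:ℝ) < n := by exact_mod_cast (by omega : 0 < n)
          have hn1 : (1:ℝ) ≤ n := by exact_mod_cast (by omega : 1 ≤ n)
          have := tau_nonneg (n+1)
          have key : (n:ℝ)^(-1-s) ≤ 4 * ((n+1:ℕ):ℝ)^(-1-s) := by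
            have h4 : ((2*n:ℝ))^(-1-s) ≤ ((n+1:ℕ):ℝ)^(-1-s) := by
              apply Real.rpow_le_rpow_of_nonpos (by positivity) _ (by linarith)
              push_cast; linarith
            rw [Real.mul_rpow (by norm_num) hn0.le] at h4
            have h5 : (1/4:ℝ) ≤ 2^(-1-s) := by
              calc (1/4:ℝ) = 2^(-2:ℝ) := by rw [Real.rpow_neg (by norm_num)]; norm_num
                _ ≤ _ := Real.rpow_le_rpow_of_exponent_le (by norm_num) (by linarith)
            have h6 : 0 ≤ (n:ℝ)^(-1-s) := by positivity
            nlinarith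
          calc _ ≤ tau (n+1)^13 * (4 * ((n+1:ℕ):ℝ)^(-1-s)) := by gcongr
            _ = _ := by ring
      _ = 4 * ∑ n ∈ (Icc 2 N).image (fun n => n+1), tau n^13 * (n:ℝ)^(-1-s) := by
          rw [Finset.sum_image, Finset.mul_sum]
          intro a ha b hb h; simp at ha hb h; omega
      _ ≤ 4 * ∑ n ∈ Icc 1 (N+1), tau n^13 * (n:ℝ)^(-1-s) := by
          apply mul_le_mul_of_nonneg_left _ (by norm_num)
          apply Finset.sum_le_sum_of_subset_of_nonneg
          · intro a ha; simp only [mem_image, mem_Icc] at ha ⊢; omega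
          · intro i _ _; have := tau_nonneg i; positivity
      _ ≤ _ := by
          apply mul_le_mul_of_nonneg_left (hmom (N+1)) (by norm_num)
  calc _ ≤ ∑ n ∈ Icc 2 N, (tau n^13 + tau (n-1)^13 + tau (n+1)^13) * (n:ℝ)^(-1-s) := by
        apply Finset.sum_le_sum; intro n _
        gcongr
        exact prod13 (tau_nonneg _) (tau_nonneg _) (tau_nonneg _)
    _ = ∑ n ∈ Icc 2 N, tau n^13 * (n:ℝ)^(-1-s) + ∑ n ∈ Icc 2 N, tau (n-1)^13 * (n:ℝ)^(-1-s) + ∑ n ∈ Icc 2 N, tau (n+1)^13 * (n:ℝ)^(-1-s) := by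
        simp_rw [add_mul, Finset.sum_add_distrib]
    _ ≤ _ := by linarith

open Classical in
lemma tail_bound : ∃ M0 : ℕ, ∀ M : ℕ, M0 ≤ M → ∀ t : ℕ → ℝ,
    (∀ n, ¬ InI M n → |t n| ≤ 4 * Real.log n * tau n) →
    (∀ n, InI M n → |t n| ≤ if n.Prime then 0 else ArithmeticFunction.vonMangoldt n) →
    Summable (fun n => |t n| * Wt M n * 64 ^ (n^2-1).primeFactors.card) ∧
    ∑' n, |t n| * Wt M n * 64 ^ (n^2-1).primeFactors.card ≤ Nk M * Real.exp (-(10 * (M:ℝ))) := by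
  obtain ⟨J, hJ⟩ : ∃ J : ℕ, J = 2^13 := ⟨_, rfl⟩
  obtain ⟨C, hC, hCb⟩ := pow_omega_le 64 (by norm_num) (1/10) (by norm_num)
  obtain ⟨M1, h1⟩ := ev_poly (2 * 24) 0.000001 10 (by norm_num) (20 + 20 * J)
  obtain ⟨M2, h2⟩ := ev_poly (2 * (C * 2 * 1.005)) 0.1 10 (by norm_num) 20
  refine ⟨max (max M1 M2) 10000000, fun M hM t ht1 ht2 => ?_⟩
  have hM1 : M1 ≤ M := by omega
  have hM2 : M2 ≤ M := by omega
  have hM3 : 10000000 ≤ M := by omega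
  specialize h1 M hM1
  specialize h2 M hM2
  have hMr : (10000000:ℝ) ≤ M := by exact_mod_cast hM3
  have hMp : (0:ℝ) < M := by linarith
  have hMpos : 0 < M := by omega
  have hN := Nk_pos M hMpos
  set L := (M:ℝ)^20 with hL
  have hLp : 0 < L := by positivity
  -- parameters
  set s : ℝ := 0.0000005 * (1/(M:ℝ)^18) with hs
  have hs0 : 0 < s := by positivity
  have hsinv : 1 / s = 2000000 * (M:ℝ)^18 := by rw [hs]; field_simp; norm_num
  have hM18 : (1:ℝ) ≤ (M:ℝ)^18 := one_le_pow₀ (by linarith)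
  have hs1 : s ≤ 1 := by
    rw [← one_div_one_div s, hsinv, div_le_one (by positivity)]; linarith
  have hs2 : 1 + 1/s ≤ L := by
    rw [hsinv, hL]
    calc 1 + 2000000 * (M:ℝ)^18 ≤ 10000000^2 * (M:ℝ)^18 := by linarith
      _ ≤ (M:ℝ)^2 * (M:ℝ)^18 := by gcongr
      _ = _ := by ring
  have hs2' : 1/s ≤ L := by linarith
  set f : ℕ → ℝ := fun n => |t n| * Wt M n * 64 ^ (n^2-1).primeFactors.card with hf
  have hf0 : ∀ n, 0 ≤ f n := fun n => by have := Wt_nonneg M n; simp only [hf]; positivity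
  have hfz : f 0 = 0 := by simp [hf, Wt_zero M hMpos]
  have hf1 : f 1 = 0 := by simp [hf, Wt_one M hMpos]
  set E := Real.exp (-(0.000001 * (M:ℝ)^2)) with hE
  have hoff : ∀ n, 2 ≤ n → ¬ InI M n → f n ≤ 4 * L * Nk M * E * (tau n * (tau (n-1)^6 * tau (n+1)^6) * (n:ℝ)^(-1-s)) := by
    intro n hn hI
    have hn0 : (0:ℝ) < n := by exact_mod_cast (by omega : 0 < n)
    have hW := nW_off M n hMpos (by omega) hI
    rw [← hE] at hW
    have hW' : Wt M n ≤ Nk M * E * (n:ℝ)^(-(2*s)) * (n:ℝ)^(-1:ℝ) := by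
      rw [Real.rpow_neg_one, ← div_eq_mul_inv, le_div_iff₀ hn0, mul_comm]
      refine hW.trans (le_of_eq ?_)
      congr 2; rw [hs]; ring
    have hlog : Real.log n ≤ L * (n:ℝ)^s := by
      calc Real.log n ≤ (n:ℝ)^s / s := Real.log_le_rpow_div hn0.le hs0
        _ = 1/s * (n:ℝ)^s := by ring
        _ ≤ _ := by gcongr
    have hlog0 := Real.log_natCast_nonneg n
    have ht := tau_nonneg n
    have ht' := tau_nonneg (n-1)
    have ht'' := tau_nonneg (n+1)
    have hWn := Wt_nonneg M n
    calc f n ≤ (4 * Real.log n * tau n) * (Nk M * E * (n:ℝ)^(-(2*s)) * (n:ℝ)^(-1:ℝ)) * (tau (n-1)^6 * tau (n+1)^6) := by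
          simp only [hf]
          gcongr
          · exact ht1 n hI
          · exact omega64_le hn
      _ ≤ (4 * (L * (n:ℝ)^s) * tau n) * (Nk M * E * (n:ℝ)^(-(2*s)) * (n:ℝ)^(-1:ℝ)) * (tau (n-1)^6 * tau (n+1)^6) := by
          gcongr
      _ = 4 * L * Nk M * E * (tau n * (tau (n-1)^6 * tau (n+1)^6) * ((n:ℝ)^s * (n:ℝ)^(-(2*s)) * (n:ℝ)^(-1:ℝ))) := by ring
      _ = _ := by
          rw [← Real.rpow_add hn0, ← Real.rpow_add hn0]; congr 3; ring
  set x := Real.exp (1.005 * L) with hx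
  have hx1 : 1 ≤ x := Real.one_le_exp (by positivity)
  have hin : ∀ n, 2 ≤ n → InI M n → f n ≤ Nk M * C * Real.exp (-(0.792 * L)) * (if n ∈ (Ioc 0 ⌊x⌋₊).filter (fun n => ¬ n.Prime) then ArithmeticFunction.vonMangoldt n else 0) := by
    intro n hn hI
    have hn0 : (0:ℝ) < n := by exact_mod_cast (by omega : 0 < n)
    have hmem : n ∈ Ioc 0 ⌊x⌋₊ := by
      rw [mem_Ioc]; refine ⟨by omega, Nat.le_floor ?_⟩
      rw [hx, ← Real.log_le_iff_le_exp hn0]; exact hI.2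
    have h := ht2 n hI
    by_cases hp : n.Prime
    · rw [if_pos hp] at h
      have : t n = 0 := by rwa [abs_nonpos_iff] at h
      have : f n = 0 := by simp [hf, this]
      rw [this, if_neg (by simp [hp])]; simp
    · rw [if_neg hp] at h
      rw [if_pos (by simp only [mem_filter]; exact ⟨hmem, hp⟩)]
      have hW : Wt M n ≤ Nk M * (n:ℝ)^(-1:ℝ) := by
        rw [Real.rpow_neg_one, ← div_eq_mul_inv, le_div_iff₀ hn0, mul_comm]
        exact nW_le M n hMpos
      have ho : (64:ℝ) ^ (n^2-1).primeFactors.card ≤ C * (n:ℝ)^(0.2:ℝ) := by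
        have h0 : n^2 - 1 ≠ 0 := by
          have : 2^2 ≤ n^2 := Nat.pow_le_pow_left hn 2
          omega
        refine (hCb _ h0).trans ?_
        gcongr
        calc ((n^2-1:ℕ):ℝ)^(1/10:ℝ) ≤ ((n:ℝ)^2)^(1/10:ℝ) := by
              gcongr; exact_mod_cast Nat.sub_le _ _
          _ = _ := by rw [← Real.rpow_natCast, ← Real.rpow_mul hn0.le]; norm_num
      have hv : 0 ≤ ArithmeticFunction.vonMangoldt n := ArithmeticFunction.vonMangoldt_nonneg
      have hn8 : (n:ℝ)^(-1:ℝ) * (n:ℝ)^(0.2:ℝ) ≤ Real.exp (-(0.792 * L)) := by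
        rw [← Real.rpow_add hn0, Real.rpow_def_of_pos hn0]
        apply Real.exp_le_exp.mpr
        have := hI.1
        rw [← hL] at this
        linarith
      have hWn := Wt_nonneg M n
      calc f n ≤ ArithmeticFunction.vonMangoldt n * (Nk M * (n:ℝ)^(-1:ℝ)) * (C * (n:ℝ)^(0.2:ℝ)) := by
            simp only [hf]; gcongr
        _ = Nk M * C * ((n:ℝ)^(-1:ℝ) * (n:ℝ)^(0.2:ℝ)) * ArithmeticFunction.vonMangoldt n := by ring
        _ ≤ _ := by gcongr
  have e1 : 4 * L * Nk M * E * (6 * (1+1/s)^(J)) ≤ Nk M * Real.exp (-(10 * (M:ℝ))) / 2 := by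
    have : (1+1/s)^(J) ≤ (M:ℝ)^(20*J) := by
      rw [pow_mul]; exact pow_le_pow_left₀ (by positivity) hs2 _
    calc _ ≤ 4 * L * Nk M * E * (6 * (M:ℝ)^(20*J)) := by gcongr
      _ = Nk M * (Real.exp (-(10 * (M:ℝ))) * E) * ((2 * 24) * (M:ℝ)^(20 + 20*J) * Real.exp (10 * M)) / 2 := by
          rw [Real.exp_neg, hL]
          have := Real.exp_pos (10 * (M:ℝ))
          field_simp
          rw [pow_add]; ring
      _ ≤ Nk M * (Real.exp (-(10 * (M:ℝ))) * E) * (Real.exp (0.000001 * (M:ℝ)^2)) / 2 := by gcongr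
      _ = _ := by
          rw [hE, Real.exp_neg (0.000001 * (M:ℝ)^2)]; have := Real.exp_pos (0.000001 * (M:ℝ)^2)
          field_simp
  have e2 : Nk M * C * Real.exp (-(0.792 * L)) * (2 * √x * Real.log x) ≤ Nk M * Real.exp (-(10 * (M:ℝ))) / 2 := by
    have hsx : √x = Real.exp (0.5025 * L) := by
      rw [hx, show 1.005 * L = 0.5025 * L + 0.5025 * L by ring, Real.exp_add, Real.sqrt_mul_self (Real.exp_pos _).le]
    have hlx : Real.log x = 1.005 * L := by rw [hx, Real.log_exp]
    have hLM : (M:ℝ)^2 ≤ L := by rw [hL]; exact pow_le_pow_right₀ (by linarith) (by norm_num)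
    rw [hsx, hlx]
    calc _ = Nk M * (Real.exp (-(10*(M:ℝ))) * (Real.exp (-(0.792 * L)) * Real.exp (0.5025 * L))) * ((2 * (C * 2 * 1.005)) * (M:ℝ)^20 * Real.exp (10 * M)) / 2 := by
          rw [Real.exp_neg (10*(M:ℝ)), ← hL]
          have := Real.exp_pos (10 * (M:ℝ))
          field_simp
      _ ≤ Nk M * (Real.exp (-(10*(M:ℝ))) * (Real.exp (-(0.792 * L)) * Real.exp (0.5025 * L))) * (Real.exp (0.1 * (M:ℝ)^2)) / 2 := by gcongr
      _ = Nk M * Real.exp (-(10*(M:ℝ))) * Real.exp (-(0.792 * L) + 0.5025 * L + 0.1 * (M:ℝ)^2) / 2 := by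
          rw [Real.exp_add, Real.exp_add]; ring
      _ ≤ Nk M * Real.exp (-(10*(M:ℝ))) * 1 / 2 := by
          gcongr
          rw [Real.exp_le_one_iff]; linarith
      _ = _ := by ring
  apply summable_of_Icc hf0 hfz
  intro N
  have hsplit : ∑ n ∈ Icc 1 N, f n ≤ ∑ n ∈ Icc 2 N, f n := by
    have : Icc 1 N ⊆ insert 1 (Icc 2 N) := by
      intro a ha; simp only [mem_insert, mem_Icc] at *; omega
    calc _ ≤ ∑ n ∈ insert 1 (Icc 2 N), f n := Finset.sum_le_sum_of_subset_of_nonneg this (fun i _ _ => hf0 i)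
      _ = f 1 + ∑ n ∈ Icc 2 N, f n := Finset.sum_insert (by simp)
      _ = _ := by rw [hf1, zero_add]
  have hA : 0 ≤ 4 * L * Nk M * E := by positivity
  have hB : 0 ≤ Nk M * C * Real.exp (-(0.792 * L)) := by positivity
  calc ∑ n ∈ Icc 1 N, f n ≤ ∑ n ∈ Icc 2 N, f n := hsplit
    _ ≤ ∑ n ∈ Icc 2 N, (4 * L * Nk M * E * (tau n * (tau (n-1)^6 * tau (n+1)^6) * (n:ℝ)^(-1-s)) + Nk M * C * Real.exp (-(0.792 * L)) * (if n ∈ (Ioc 0 ⌊x⌋₊).filter (fun n => ¬ n.Prime) then ArithmeticFunction.vonMangoldt n else 0)) := by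
        apply Finset.sum_le_sum
        intro n hn
        simp only [mem_Icc] at hn
        by_cases hI : InI M n
        · refine (hin n hn.1 hI).trans (le_add_of_nonneg_left ?_)
          have ht := tau_nonneg n
          have ht' := tau_nonneg (n-1)
          have ht'' := tau_nonneg (n+1)
          positivity
        · refine (hoff n hn.1 hI).trans (le_add_of_nonneg_right ?_)
          apply mul_nonneg hB
          split_ifs
          · exact ArithmeticFunction.vonMangoldt_nonneg
          · exact le_rfl
    _ = 4 * L * Nk M * E * ∑ n ∈ Icc 2 N, (tau n * (tau (n-1)^6 * tau (n+1)^6) * (n:ℝ)^(-1-s)) + Nk M * C * Real.exp (-(0.792 * L)) * ∑ n ∈ Icc 2 N, (if n ∈ (Ioc 0 ⌊x⌋₊).filter (fun n => ¬ n.Prime) then ArithmeticFunction.vonMangoldt n else 0) := by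
        rw [Finset.sum_add_distrib, Finset.mul_sum, Finset.mul_sum]
    _ ≤ 4 * L * Nk M * E * (6 * (1+1/s)^(J)) + Nk M * C * Real.exp (-(0.792 * L)) * (2 * √x * Real.log x) := by
        apply add_le_add
        · exact mul_le_mul_of_nonneg_left (tail_sum13 hs0 hs1 N J hJ) hA
        · apply mul_le_mul_of_nonneg_left _ hB
          refine le_trans ?_ (Chebyshev.psi_sub_theta_le hx1)
          rw [Chebyshev.psi_sub_theta_eq_sum_not_prime, ← Finset.sum_filter]
          apply Finset.sum_le_sum_of_subset_of_nonneg
          · intro a ha; exact (Finset.mem_filter.mp ha).2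
          · intro i _ _; exact ArithmeticFunction.vonMangoldt_nonneg
    _ ≤ _ := by linarith

end PSLSieve
end

section
open Finset
namespace PSLSieve

lemma Wt_cast (M n : ℕ) : ((Wt M n : ℝ) : ℂ) = ((Real.log n : ℝ) : ℂ) ^ (M^2) * (n:ℂ) ^ (-((1+1/(M:ℝ)^18:ℝ):ℂ)) := by
  unfold Wt
  push_cast
  rw [Complex.ofReal_cpow (Nat.cast_nonneg n)]
  push_cast
  rfl

lemma kderiv {ι : Type*} (S : Finset ι) (w : ι → ℝ) (hw : ∀ i ∈ S, 0 ≤ w i) (f : ι → ℕ → ℂ)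
    (k : ℕ) (s0 ρ E : ℝ) (hρ : 0 < ρ) (hs0 : 1 < s0 - ρ)
    (hsum : ∀ i ∈ S, ∀ z : ℂ, 1 < z.re → LSeriesSummable (f i) z)
    (hE : ∀ z : ℂ, z ∈ Metric.sphere (s0:ℂ) ρ → ∑ i ∈ S, w i * ‖LSeries (f i) z‖ ≤ E) :
    ∑ i ∈ S, w i * ‖∑' n : ℕ, f i n * (((Real.log n : ℝ) : ℂ) ^ k * (n:ℂ) ^ (-(s0:ℂ)))‖ ≤ k.factorial * E / ρ ^ k := by
  have hs1 : 1 < s0 := by linarith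
  set A : ι → ℂ := fun i => ∑' n : ℕ, f i n * (((Real.log n : ℝ) : ℂ) ^ k * (n:ℂ) ^ (-(s0:ℂ))) with hA
  have habs : ∀ i ∈ S, ∀ z : ℂ, 1 < z.re → LSeries.abscissaOfAbsConv (f i) < z.re := by
    intro i hi z hz
    have h1 : 1 < ((((1 + z.re)/2 : ℝ)) : ℂ).re := by simp only [Complex.ofReal_re]; linarith
    refine lt_of_le_of_lt (hsum i hi _ h1).abscissaOfAbsConv_le ?_
    simp only [Complex.ofReal_re]
    exact_mod_cast (by linarith : (1 + z.re)/2 < z.re)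
  have hopen : IsOpen {z : ℂ | 1 < z.re} := isOpen_lt continuous_const Complex.continuous_re
  have hdiff : ∀ i ∈ S, DifferentiableOn ℂ (LSeries (f i)) {z : ℂ | 1 < z.re} := by
    intro i hi z hz
    exact ((LSeries_hasDerivAt (habs i hi z hz)).differentiableAt).differentiableWithinAt
  set ε : ι → ℂ := fun i => (starRingEnd ℂ (A i)) / ‖A i‖ * (-1)^k with hε
  have hεn : ∀ i, ‖ε i‖ ≤ 1 := by
    intro i
    simp only [hε, norm_mul, norm_div, norm_pow, norm_neg, norm_one, one_pow, mul_one, RCLike.norm_conj, Complex.norm_real, norm_norm]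
    exact div_self_le_one _
  set G : ℂ → ℂ := fun z => ∑ i ∈ S, (w i : ℂ) * ε i * LSeries (f i) z with hG
  have hGd : DifferentiableOn ℂ G {z : ℂ | 1 < z.re} := by
    apply DifferentiableOn.fun_sum
    intro i hi
    exact (hdiff i hi).const_mul _
  have hsubset : Metric.closedBall (s0:ℂ) ρ ⊆ {z : ℂ | 1 < z.re} := by
    intro z hz
    rw [Metric.mem_closedBall, dist_eq_norm] at hz
    have := (Complex.abs_re_le_norm (z - s0)).trans hz
    rw [Complex.sub_re, Complex.ofReal_re, abs_le] at this
    simp only [Set.mem_setOf_eq]; linarith [this.1]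
  have hGc : DiffContOnCl ℂ G (Metric.ball (s0:ℂ) ρ) := by
    apply DifferentiableOn.diffContOnCl
    apply hGd.mono
    exact Metric.closure_ball_subset_closedBall.trans hsubset
  have hGb : ∀ z ∈ Metric.sphere (s0:ℂ) ρ, ‖G z‖ ≤ E := by
    intro z hz
    refine le_trans ?_ (hE z hz)
    refine (norm_sum_le _ _).trans (Finset.sum_le_sum fun i hi => ?_)
    rw [norm_mul, norm_mul, Complex.norm_real, Real.norm_of_nonneg (hw i hi)]
    have := hεn i
    have h0 := hw i hi
    calc w i * ‖ε i‖ * ‖LSeries (f i) z‖ ≤ w i * 1 * ‖LSeries (f i) z‖ := by gcongr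
      _ = _ := by ring
  have hC := Complex.norm_iteratedDeriv_le_of_forall_mem_sphere_norm_le k hρ hGc hGb
  refine le_trans ?_ hC
  have hs0m : (s0:ℂ) ∈ {z : ℂ | 1 < z.re} := by simpa using hs1
  have hcd : ∀ i ∈ S, ContDiffAt ℂ k (LSeries (f i)) s0 := fun i hi =>
    ((hdiff i hi).analyticAt (hopen.mem_nhds hs0m)).contDiffAt
  have hne : (s0:ℂ) ≠ 0 := by
    norm_cast; linarith
  have hit : iteratedDeriv k G s0 = ∑ i ∈ S, (w i : ℂ) * ε i * ((-1)^k * A i) := by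
    simp only [hG]
    rw [iteratedDeriv_fun_sum (fun i hi => ContDiffAt.mul contDiffAt_const (hcd i hi))]
    apply Finset.sum_congr rfl
    intro i hi
    rw [iteratedDeriv_const_mul_field, LSeries_iteratedDeriv k (habs i hi _ hs0m)]
    congr 2
    exact tsum_congr fun n => LSeries_logpow _ k hne n
  rw [hit]
  have hterm : ∀ i ∈ S, (w i : ℂ) * ε i * ((-1)^k * A i) = ((w i * ‖A i‖ : ℝ) : ℂ) := by
    intro i hi
    simp only [hε]
    have h1 : ((-1:ℂ)^k) * (-1)^k = 1 := by rw [← mul_pow]; simp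
    by_cases h : A i = 0
    · simp [h]
    have hn : (‖A i‖ : ℂ) ≠ 0 := by simpa using h
    have h2 : starRingEnd ℂ (A i) * A i = (‖A i‖ : ℂ)^2 := Complex.conj_mul' _
    push_cast
    calc (w i:ℂ) * ((starRingEnd ℂ) (A i) / ‖A i‖ * (-1)^k) * ((-1)^k * A i) = w i * ((starRingEnd ℂ (A i) * A i) / ‖A i‖) * ((-1)^k * (-1)^k) := by ring
      _ = _ := by rw [h1, h2]; field_simp
  rw [Finset.sum_congr rfl hterm, ← Complex.ofReal_sum, Complex.norm_real]
  exact le_abs_self _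

/-- twist of a real arithmetic function -/
noncomputable def tw (g : ℕ → ℂ) (f : ArithmeticFunction ℝ) : ArithmeticFunction ℂ :=
  ⟨fun n => g n * (f n : ℂ), by simp⟩

lemma tw_apply (g : ℕ → ℂ) (f : ArithmeticFunction ℝ) (n : ℕ) : tw g f n = g n * (f n : ℂ) := rfl

lemma tw_mul (g : ℕ → ℂ) (hg : ∀ a b, g (a*b) = g a * g b) (f1 f2 : ArithmeticFunction ℝ) :
    tw g (f1 * f2) = tw g f1 * tw g f2 := by
  ext n
  rw [tw_apply, ArithmeticFunction.mul_apply, ArithmeticFunction.mul_apply]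
  push_cast
  rw [Finset.mul_sum]
  apply Finset.sum_congr rfl
  intro p hp
  rw [Nat.mem_divisorsAntidiagonal] at hp
  rw [tw_apply, tw_apply, ← hp.1, hg]; ring

lemma tw_add (g : ℕ → ℂ) (f1 f2 : ArithmeticFunction ℝ) : tw g (f1 + f2) = tw g f1 + tw g f2 := by
  ext n; simp [tw_apply, mul_add]

lemma tw_sub (g : ℕ → ℂ) (f1 f2 : ArithmeticFunction ℝ) : tw g (f1 - f2) = tw g f1 - tw g f2 := by
  apply eq_sub_of_add_eq
  rw [← tw_add, sub_add_cancel]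

lemma af_sub_apply {R : Type*} [AddGroup R] (f1 f2 : ArithmeticFunction R) (n : ℕ) :
    (f1 - f2) n = f1 n - f2 n := by
  have : ((f1 - f2) + f2) n = f1 n := by rw [sub_add_cancel]
  rw [ArithmeticFunction.add_apply] at this
  exact eq_sub_of_add_eq this

lemma log_tau_sum {s : ℝ} (hs : 0 < s) :
    Summable (fun n : ℕ => (1 + Real.log n) * tau n * (n:ℝ)^(-1-s)) ∧
    ∑' n : ℕ, (1 + Real.log n) * tau n * (n:ℝ)^(-1-s) ≤ (1+2/s)^3 := by
  have hs2 : 0 < s/2 := by positivity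
  obtain ⟨h1, h2⟩ := tau_tsum hs2 1
  have hle : ∀ n : ℕ, (1 + Real.log n) * tau n * (n:ℝ)^(-1-s) ≤ (1+2/s) * (tau n^1 * (n:ℝ)^(-1-s/2)) := by
    intro n
    rcases Nat.eq_zero_or_pos n with rfl | hn
    · simp [tau_zero]
    have hn0 : (0:ℝ) < n := by exact_mod_cast hn
    have hn1 : (1:ℝ) ≤ n := by exact_mod_cast hn
    have hl : Real.log n ≤ (2/s) * (n:ℝ)^(s/2) := by
      have := Real.log_le_rpow_div hn0.le hs2
      refine this.trans (le_of_eq ?_); field_simp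
    have h1 : (1:ℝ) ≤ (n:ℝ)^(s/2) := Real.one_le_rpow hn1 hs2.le
    have ht := tau_nonneg n
    calc (1 + Real.log n) * tau n * (n:ℝ)^(-1-s) ≤ ((1+2/s) * (n:ℝ)^(s/2)) * tau n * (n:ℝ)^(-1-s) := by
          gcongr; linarith
      _ = (1+2/s) * (tau n^1 * ((n:ℝ)^(s/2) * (n:ℝ)^(-1-s))) := by ring
      _ = _ := by rw [← Real.rpow_add hn0]; congr 3; ring
  have h0 : ∀ n : ℕ, 0 ≤ (1 + Real.log n) * tau n * (n:ℝ)^(-1-s) := by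
    intro n; have := tau_nonneg n; have := Real.log_natCast_nonneg n; positivity
  have hS := Summable.of_nonneg_of_le h0 hle (h1.mul_left _)
  refine ⟨hS, ?_⟩
  calc _ ≤ ∑' n : ℕ, (1+2/s) * (tau n^1 * (n:ℝ)^(-1-s/2)) := hS.tsum_le_tsum hle (h1.mul_left _)
    _ = (1+2/s) * ∑' n : ℕ, (tau n^1 * (n:ℝ)^(-1-s/2)) := tsum_mul_left
    _ ≤ (1+2/s) * (1+1/(s/2))^(2^1) := by gcongr
    _ = _ := by rw [show 1/(s/2) = 2/s by field_simp]; ring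

lemma LSeries_crude {s : ℝ} (hs : 0 < s) (f : ℕ → ℂ)
    (hf : ∀ n, ‖f n‖ ≤ (1 + Real.log n) * tau n) (z : ℂ) (hz : 1 + s ≤ z.re) :
    LSeriesSummable f z ∧ ‖LSeries f z‖ ≤ (1+2/s)^3 := by
  obtain ⟨h1, h2⟩ := log_tau_sum hs
  have hle : ∀ n, ‖LSeries.term f z n‖ ≤ (1 + Real.log n) * tau n * (n:ℝ)^(-1-s) := by
    intro n
    rcases Nat.eq_zero_or_pos n with rfl | hn
    · simp [tau_zero]
    have hn1 : (1:ℝ) ≤ n := by exact_mod_cast hn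
    rw [LSeries.norm_term_eq, if_neg hn.ne', div_eq_mul_inv, ← Real.rpow_neg (by positivity)]
    have ht := tau_nonneg n
    have hl := Real.log_natCast_nonneg n
    apply mul_le_mul (hf n) _ (by positivity) (by positivity)
    exact Real.rpow_le_rpow_of_exponent_le hn1 (by linarith)
  have hS : Summable (fun n => ‖LSeries.term f z n‖) := Summable.of_nonneg_of_le (fun _ => norm_nonneg _) hle h1
  refine ⟨hS.of_norm, ?_⟩
  exact (norm_tsum_le_tsum_norm hS).trans ((hS.tsum_le_tsum hle h1).trans h2)

lemma LSeries_crude_summable (f : ℕ → ℂ)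
    (hf : ∀ n, ‖f n‖ ≤ (1 + Real.log n) * tau n) (z : ℂ) (hz : 1 < z.re) : LSeriesSummable f z :=
  (LSeries_crude (s := z.re - 1) (by linarith) f hf z (by linarith)).1

end PSLSieve
end

section
open Finset
namespace PSLSieve

/-- truncation to `n ≤ N` -/
noncomputable def trle (N : ℕ) (f : ArithmeticFunction ℝ) : ArithmeticFunction ℝ :=
  ⟨fun n => if n ≤ N then f n else 0, by simp⟩
/-- truncation to `n > N` -/
noncomputable def trgt (N : ℕ) (f : ArithmeticFunction ℝ) : ArithmeticFunction ℝ :=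
  ⟨fun n => if n ≤ N then 0 else f n, by simp⟩

lemma trle_apply (N : ℕ) (f : ArithmeticFunction ℝ) (n : ℕ) : trle N f n = if n ≤ N then f n else 0 := rfl
lemma trgt_apply (N : ℕ) (f : ArithmeticFunction ℝ) (n : ℕ) : trgt N f n = if n ≤ N then 0 else f n := rfl

lemma tr_add (N : ℕ) (f : ArithmeticFunction ℝ) : trle N f + trgt N f = f := by
  ext n; rw [ArithmeticFunction.add_apply, trle_apply, trgt_apply]; split_ifs <;> simp

/-- von Mangoldt -/
noncomputable def afL : ArithmeticFunction ℝ := ArithmeticFunction.vonMangoldt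
/-- zeta -/
noncomputable def afZ : ArithmeticFunction ℝ := ((ArithmeticFunction.zeta : ArithmeticFunction ℕ) : ArithmeticFunction ℝ)
/-- moebius -/
noncomputable def afM : ArithmeticFunction ℝ := ((ArithmeticFunction.moebius : ArithmeticFunction ℤ) : ArithmeticFunction ℝ)
/-- log -/
noncomputable def afG : ArithmeticFunction ℝ := ArithmeticFunction.log

lemma afL_mul_afZ : afL * afZ = afG := ArithmeticFunction.vonMangoldt_mul_zeta
lemma afZ_mul_afM : afZ * afM = 1 := ArithmeticFunction.coe_zeta_mul_coe_moebius

lemma afZ_apply (n : ℕ) : afZ n = if n = 0 then 0 else 1 := by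
  unfold afZ; rw [ArithmeticFunction.natCoe_apply, ArithmeticFunction.zeta_apply]; split_ifs <;> simp
lemma afG_apply (n : ℕ) : afG n = Real.log n := rfl
lemma afL_nonneg (n : ℕ) : 0 ≤ afL n := ArithmeticFunction.vonMangoldt_nonneg
lemma afL_le (n : ℕ) : afL n ≤ Real.log n := ArithmeticFunction.vonMangoldt_le_log
lemma afM_le (n : ℕ) : |afM n| ≤ if n = 0 then 0 else 1 := by
  unfold afM
  rw [ArithmeticFunction.intCoe_apply]
  split_ifs with h
  · simp [h]
  · have := ArithmeticFunction.abs_moebius_le_one (n := n)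
    exact_mod_cast this

/-- type I, short -/
noncomputable def aA (U V Y : ℕ) : ArithmeticFunction ℝ :=
  trle U afL + trle Y afG * trle V afM - trle U afL * trle Y afZ * trle V afM
/-- type II -/
noncomputable def aB (U V : ℕ) : ArithmeticFunction ℝ := trgt U afL * (afZ * trgt V afM)
/-- type I, long -/
noncomputable def aC (U V Y : ℕ) : ArithmeticFunction ℝ :=
  (trgt Y afG - trle U afL * trgt Y afZ) * trle V afM

lemma vaughan (U V Y : ℕ) : afL = aA U V Y + aB U V + aC U V Y := by
  unfold aA aB aC
  have h1 := tr_add U afL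
  have h2 := tr_add V afM
  have h3 := tr_add Y afG
  have h4 := tr_add Y afZ
  have h5 := afL_mul_afZ
  have h6 := afZ_mul_afM
  set L1 := trle U afL
  set L2 := trgt U afL
  set m1 := trle V afM
  set m2 := trgt V afM
  set g1 := trle Y afG
  set g2 := trgt Y afG
  set z1 := trle Y afZ
  set z2 := trgt Y afZ
  have hG : g1 + g2 = (L1 + L2) * (z1 + z2) := by rw [h3, h1, h4, h5]
  have hM : (z1 + z2) * (m1 + m2) = 1 := by rw [h4, h2, h6]
  rw [← h1, ← h4]
  linear_combination -m1 * hG - L2 * hM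

lemma conv_abs_le (f g : ArithmeticFunction ℝ) (F : ℝ) (n : ℕ)
    (h : ∀ a b, a * b = n → n ≠ 0 → |f a| * |g b| ≤ F) : |(f * g) n| ≤ F * tau n := by
  rw [ArithmeticFunction.mul_apply]
  refine (Finset.abs_sum_le_sum_abs _ _).trans ?_
  calc ∑ x ∈ n.divisorsAntidiagonal, |f x.1 * g x.2| ≤ ∑ x ∈ n.divisorsAntidiagonal, F := by
        apply Finset.sum_le_sum
        intro x hx
        rw [Nat.mem_divisorsAntidiagonal] at hx
        rw [abs_mul]; exact h _ _ hx.1 hx.2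
    _ = F * tau n := by
        rw [Finset.sum_const, nsmul_eq_mul, mul_comm]
        congr 2
        rw [← Nat.map_div_right_divisors, Finset.card_map]

lemma conv_zero (f g : ArithmeticFunction ℝ) (A B n : ℕ) (hf : ∀ a, A < a → f a = 0) (hg : ∀ b, B < b → g b = 0)
    (hn : A * B < n) : (f * g) n = 0 := by
  rw [ArithmeticFunction.mul_apply]
  apply Finset.sum_eq_zero
  intro x hx
  rw [Nat.mem_divisorsAntidiagonal] at hx
  by_cases h : A < x.1
  · rw [hf _ h, zero_mul]
  by_cases h' : B < x.2
  · rw [hg _ h', mul_zero]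
  · exfalso
    have := Nat.mul_le_mul (not_lt.mp h) (not_lt.mp h')
    omega

lemma trle_zero (N : ℕ) (f : ArithmeticFunction ℝ) (a : ℕ) (h : N < a) : trle N f a = 0 := by
  rw [trle_apply, if_neg (by omega)]

lemma trle_abs (N : ℕ) (f : ArithmeticFunction ℝ) (a : ℕ) : |trle N f a| ≤ |f a| := by
  rw [trle_apply]; split_ifs <;> simp

lemma trgt_abs (N : ℕ) (f : ArithmeticFunction ℝ) (a : ℕ) : |trgt N f a| ≤ |f a| := by
  rw [trgt_apply]; split_ifs <;> simp

lemma aA_zero (U V Y n : ℕ) (hU : 1 ≤ U) (hV : 1 ≤ V) (hY : 1 ≤ Y) (h : U * V * Y < n) : aA U V Y n = 0 := by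
  unfold aA
  rw [af_sub_apply, ArithmeticFunction.add_apply, trle_zero, conv_zero _ _ Y V n (trle_zero Y _) (trle_zero V _),
    conv_zero _ _ (U*Y) V n _ (trle_zero V _)]
  · simp
  · calc U*Y*V = U*V*Y := by ring
      _ < n := h
  · intro a ha
    exact conv_zero _ _ U Y a (trle_zero U _) (trle_zero Y _) ha
  · calc Y*V ≤ U*(Y*V) := Nat.le_mul_of_pos_left _ hU
      _ = U*V*Y := by ring
      _ < n := h
  · calc U ≤ U*(V*Y) := Nat.le_mul_of_pos_right _ (Nat.mul_pos hV hY)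
      _ = U*V*Y := by ring
      _ < n := h

lemma log_mono_nat {a n : ℕ} (h : a ∣ n) (hn : n ≠ 0) : Real.log a ≤ Real.log n := by
  have ha : 0 < a := Nat.pos_of_dvd_of_pos h (Nat.pos_of_ne_zero hn)
  apply Real.log_le_log (by exact_mod_cast ha)
  exact_mod_cast Nat.le_of_dvd (Nat.pos_of_ne_zero hn) h

lemma trle_afM (V b : ℕ) : |trle V afM b| ≤ 1 :=
  (trle_abs _ _ _).trans ((afM_le b).trans (by split_ifs <;> norm_num))

lemma LZ_le (U Y a : ℕ) : |(trle U afL * trle Y afZ) a| ≤ Real.log a := by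
  rw [ArithmeticFunction.mul_apply]
  refine (Finset.abs_sum_le_sum_abs _ _).trans ?_
  have : Real.log a = (afL * afZ) a := by rw [afL_mul_afZ]; rfl
  rw [this, ArithmeticFunction.mul_apply]
  apply Finset.sum_le_sum
  intro x _
  rw [abs_mul]
  have h1 := afL_nonneg x.1
  have h2 : 0 ≤ afZ x.2 := by rw [afZ_apply]; split_ifs <;> norm_num
  calc _ ≤ |afL x.1| * |afZ x.2| := mul_le_mul (trle_abs _ _ _) (trle_abs _ _ _) (abs_nonneg _) (abs_nonneg _)
    _ = _ := by rw [abs_of_nonneg h1, abs_of_nonneg h2]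

lemma aA_abs (U V Y n : ℕ) : |aA U V Y n| ≤ Real.log n + 2 * (Real.log n * tau n) := by
  unfold aA
  rw [af_sub_apply, ArithmeticFunction.add_apply]
  have h1 : |trle U afL n| ≤ Real.log n := by
    refine (trle_abs _ _ _).trans ?_
    rw [abs_of_nonneg (afL_nonneg n)]; exact afL_le n
  have h2 : |(trle Y afG * trle V afM) n| ≤ Real.log n * tau n := by
    apply conv_abs_le
    intro a b hab hn
    calc _ ≤ |afG a| * 1 := mul_le_mul (trle_abs _ _ _) (trle_afM V b) (abs_nonneg _) (abs_nonneg _)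
      _ = Real.log a := by rw [mul_one, afG_apply, abs_of_nonneg (Real.log_natCast_nonneg a)]
      _ ≤ _ := log_mono_nat ⟨b, hab.symm⟩ hn
  have h3 : |(trle U afL * trle Y afZ * trle V afM) n| ≤ Real.log n * tau n := by
    apply conv_abs_le
    intro a b hab hn
    calc _ ≤ Real.log a * 1 := mul_le_mul (LZ_le U Y a) (trle_afM V b) (abs_nonneg _) (Real.log_natCast_nonneg a)
      _ = Real.log a := by rw [mul_one]
      _ ≤ _ := log_mono_nat ⟨b, hab.symm⟩ hn
  calc _ ≤ |trle U afL n + (trle Y afG * trle V afM) n| + |(trle U afL * trle Y afZ * trle V afM) n| := abs_sub _ _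
    _ ≤ |trle U afL n| + |(trle Y afG * trle V afM) n| + |(trle U afL * trle Y afZ * trle V afM) n| := by
        gcongr; exact abs_add_le _ _
    _ ≤ _ := by linarith

/-- the coefficient `b` -/
lemma bco_abs (V n : ℕ) : |(afZ * trgt V afM) n| ≤ tau n := by
  have := conv_abs_le afZ (trgt V afM) 1 n (by
    intro a b _ _
    have h1 : |afZ a| ≤ 1 := by rw [afZ_apply]; split_ifs <;> norm_num
    have h2 : |trgt V afM b| ≤ 1 := (trgt_abs _ _ _).trans ((afM_le b).trans (by split_ifs <;> norm_num))
    calc _ ≤ (1:ℝ) * 1 := mul_le_mul h1 h2 (abs_nonneg _) (by norm_num)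
      _ = 1 := one_mul 1)
  simpa using this

lemma bco_zero (V n : ℕ) (hn : n ≤ V) : (afZ * trgt V afM) n = 0 := by
  rw [ArithmeticFunction.mul_apply]
  apply Finset.sum_eq_zero
  intro x hx
  rw [Nat.mem_divisorsAntidiagonal] at hx
  have : x.2 ≤ n := Nat.le_of_dvd (Nat.pos_of_ne_zero hx.2) ⟨x.1, by rw [← hx.1]; ring⟩
  rw [trgt_apply, if_pos (by omega), mul_zero]

end PSLSieve
end

section
open Finset
namespace PSLSieve

/-- the arithmetic function of a character -/
noncomputable def chn {D : ℕ} (χ : DirichletCharacter ℂ D) : ℕ → ℂ := fun n => χ (n : ZMod D)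

lemma chn_mul {D : ℕ} (χ : DirichletCharacter ℂ D) (a b : ℕ) : chn χ (a*b) = chn χ a * chn χ b := by
  simp [chn]

lemma chn_le {D : ℕ} (χ : DirichletCharacter ℂ D) (a : ℕ) : ‖chn χ a‖ ≤ 1 := DirichletCharacter.norm_le_one _ _

lemma tw_crude (g : ℕ → ℂ) (hg : ∀ n, ‖g n‖ ≤ 1) (f : ArithmeticFunction ℝ) (hf : ∀ n, |f n| ≤ 1 + Real.log n) (n : ℕ) :
    ‖tw g f n‖ ≤ (1 + Real.log n) * tau n := by
  rcases Nat.eq_zero_or_pos n with rfl | hn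
  · simp [tau_zero]
  rw [tw_apply, norm_mul, Complex.norm_real, Real.norm_eq_abs]
  have h1 := one_le_tau hn.ne'
  have hl := Real.log_natCast_nonneg n
  calc ‖g n‖ * |f n| ≤ 1 * (1 + Real.log n) := mul_le_mul (hg n) (hf n) (abs_nonneg _) (by norm_num)
    _ = (1 + Real.log n) * 1 := by ring
    _ ≤ _ := by gcongr

lemma tw_crude2 (g : ℕ → ℂ) (hg : ∀ n, ‖g n‖ ≤ 1) (f : ArithmeticFunction ℝ) (hf : ∀ n, |f n| ≤ tau n) (n : ℕ) :
    ‖tw g f n‖ ≤ (1 + Real.log n) * tau n := by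
  rw [tw_apply, norm_mul, Complex.norm_real, Real.norm_eq_abs]
  have ht := tau_nonneg n
  have hl := Real.log_natCast_nonneg n
  calc ‖g n‖ * |f n| ≤ 1 * tau n := mul_le_mul (hg n) (hf n) (abs_nonneg _) (by norm_num)
    _ ≤ (1 + Real.log n) * tau n := by gcongr; linarith

lemma afL_b1 (n : ℕ) : |afL n| ≤ 1 + Real.log n := by
  rw [abs_of_nonneg (afL_nonneg n)]; linarith [afL_le n]
lemma afG_b1 (n : ℕ) : |afG n| ≤ 1 + Real.log n := by
  rw [afG_apply, abs_of_nonneg (Real.log_natCast_nonneg n)]; linarith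
lemma afZ_b1 (n : ℕ) : |afZ n| ≤ 1 + Real.log n := by
  have := Real.log_natCast_nonneg n
  rw [afZ_apply]; split_ifs <;> simp <;> linarith
lemma afM_b1 (n : ℕ) : |afM n| ≤ 1 + Real.log n := by
  have := Real.log_natCast_nonneg n
  refine (afM_le n).trans ?_
  split_ifs <;> linarith

lemma tail_L (D : ℕ) [NeZero D] (χ : DirichletCharacter ℂ D) (hχ : χ ≠ 1) (Y : ℕ) (hY : 1 ≤ Y) (z : ℂ) (hz : 1 < z.re) (hz3 : ‖z‖ ≤ 3)
    (j : ℕ) (hj : j ≤ 1) (f : ArithmeticFunction ℝ) (hf : ∀ n, n ≠ 0 → f n = Real.log n ^ j) :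
    ‖LSeries (tw (chn χ) (trgt Y f)) z‖ ≤ 10000 * (D * (Y:ℝ)^(-(0.999:ℝ))) := by
  have hterm : ∀ n, LSeries.term (tw (chn χ) (trgt Y f)) z n = if Y + 1 ≤ n then χ (n : ZMod D) * (((Real.log n : ℝ) : ℂ)^j * (n:ℂ)^(-z)) else 0 := by
    intro n
    rcases Nat.eq_zero_or_pos n with rfl | hn
    · simp
    rw [LSeries.term_of_ne_zero hn.ne', tw_apply, trgt_apply]
    by_cases h : n ≤ Y
    · rw [if_pos h, if_neg (by omega)]; simp
    · rw [if_neg h, if_pos (by omega), hf n hn.ne', Complex.cpow_neg]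
      simp only [chn]; push_cast; ring
  unfold LSeries
  rw [tsum_congr hterm]
  have h := char_tail D χ hχ (fun n => ((Real.log n : ℝ) : ℂ)^j * (n:ℂ)^(-z)) (summable_logpow j hz) (Y+1) (by omega)
    (s := 1 - 0.001) (K := (1 + ‖z‖) * ((0.001:ℝ)⁻¹ ^ j * j.factorial)) (by norm_num) (by positivity)
    (fun n hn => vdiff_bound j z hz.le (by norm_num) (by norm_num) n (by omega))
  refine h.trans ?_
  have hY0 : (0:ℝ) < Y := by exact_mod_cast hY
  have h1 : (((Y+1:ℕ)):ℝ)^(-(1-0.001:ℝ)) ≤ (Y:ℝ)^(-(0.999:ℝ)) := by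
    rw [show (1-0.001:ℝ) = 0.999 by norm_num]
    apply Real.rpow_le_rpow_of_nonpos hY0 _ (by norm_num)
    push_cast; linarith
  have h2 : (0.001:ℝ)⁻¹ ^ j * j.factorial ≤ 1000 := by
    interval_cases j <;> norm_num
  calc _ ≤ (D:ℝ) * ((1+3) * 1000 * ((1 + 1/(1-0.001)) * (Y:ℝ)^(-(0.999:ℝ)))) := by gcongr
    _ = 4000 * (1 + 1/(1-0.001)) * (D * (Y:ℝ)^(-(0.999:ℝ))) := by ring
    _ ≤ _ := by gcongr; norm_num

lemma aC_bound (D : ℕ) [NeZero D] (χ : DirichletCharacter ℂ D) (hχ : χ ≠ 1) (U V Y : ℕ) (hY : 1 ≤ Y) {s : ℝ} (hs : 0 < s)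
    (z : ℂ) (hz : 1 + s ≤ z.re) (hz3 : ‖z‖ ≤ 3) :
    ‖LSeries (tw (chn χ) (aC U V Y)) z‖ ≤ 20000 * (D * (Y:ℝ)^(-(0.999:ℝ))) * (1+2/s)^6 := by
  have hz1 : 1 < z.re := by linarith
  have hg := chn_le χ
  have hm := chn_mul χ
  have c1 := LSeries_crude hs _ (tw_crude _ hg (trle U afL) (fun n => (trle_abs _ _ n).trans (afL_b1 n))) z hz
  have c2 := LSeries_crude hs _ (tw_crude _ hg (trle V afM) (fun n => (trle_abs _ _ n).trans (afM_b1 n))) z hz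
  have c3 := LSeries_crude hs _ (tw_crude _ hg (trgt Y afZ) (fun n => (trgt_abs _ _ n).trans (afZ_b1 n))) z hz
  have c4 := LSeries_crude hs _ (tw_crude _ hg (trgt Y afG) (fun n => (trgt_abs _ _ n).trans (afG_b1 n))) z hz
  have b3 := tail_L D χ hχ Y hY z hz1 hz3 0 (by norm_num) afZ (fun n hn => by simp [afZ_apply, hn])
  have b4 := tail_L D χ hχ Y hY z hz1 hz3 1 (by norm_num) afG (fun n hn => by simp [afG_apply])
  have hprod := ArithmeticFunction.LSeriesSummable_mul c1.1 c3.1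
  have hsub := c4.1.sub hprod
  have e : LSeries (tw (chn χ) (aC U V Y)) z = (LSeries (tw (chn χ) (trgt Y afG)) z - LSeries (tw (chn χ) (trle U afL)) z * LSeries (tw (chn χ) (trgt Y afZ)) z) * LSeries (tw (chn χ) (trle V afM)) z := by
    unfold aC
    rw [tw_mul _ hm, tw_sub, tw_mul _ hm]
    have hfun : (fun n => (tw (chn χ) (trgt Y afG) - tw (chn χ) (trle U afL) * tw (chn χ) (trgt Y afZ)) n) =
        (fun n => tw (chn χ) (trgt Y afG) n) - fun n => (tw (chn χ) (trle U afL) * tw (chn χ) (trgt Y afZ)) n := by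
      funext n; rw [af_sub_apply]; rfl
    rw [ArithmeticFunction.LSeries_mul' _ c2.1]
    · congr 1
      rw [hfun, LSeries_sub c4.1 hprod, ArithmeticFunction.LSeries_mul' c1.1 c3.1]
    · rw [hfun]; exact hsub
  rw [e, norm_mul]
  set T := (D * (Y:ℝ)^(-(0.999:ℝ))) with hT
  set B := (1+2/s)^3 with hB
  have hT0 : 0 ≤ T := by positivity
  have hB1 : 1 ≤ B := one_le_pow₀ (by have : 0 < 2/s := by positivity
                                      linarith)
  calc _ ≤ (10000 * T + B * (10000 * T)) * B := by
        apply mul_le_mul _ c2.2 (norm_nonneg _) (by positivity)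
        refine (norm_sub_le _ _).trans (add_le_add b4 ?_)
        rw [norm_mul]
        exact mul_le_mul c1.2 b3 (norm_nonneg _) (by positivity)
    _ ≤ (B * (10000 * T) + B * (10000 * T)) * B := by
        have hh : 10000*T ≤ B*(10000*T) := le_mul_of_one_le_left (by positivity) hB1
        apply mul_le_mul_of_nonneg_right _ (by positivity)
        linarith
    _ = 20000 * T * (B * B) := by ring
    _ = _ := by rw [hB, ← pow_add]

end PSLSieve
end

section
open Finset
namespace PSLSieve

/-- number of square roots of one -/
noncomputable def sqc (D : ℕ) : ℕ := Nat.card {u : ZMod D // u ^ 2 = 1}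

lemma sqc_mul (a b : ℕ) (h : a.Coprime b) : sqc (a * b) = sqc a * sqc b := by
  unfold sqc
  rw [← Nat.card_prod]
  let e := ZMod.chineseRemainder h
  refine Nat.card_congr ⟨fun u => (⟨(e u.1).1, ?_⟩, ⟨(e u.1).2, ?_⟩), fun v => ⟨e.symm (v.1.1, v.2.1), ?_⟩, ?_, ?_⟩
  · have := congrArg (fun x => (e x).1) u.2
    simpa using this
  · have := congrArg (fun x => (e x).2) u.2
    simpa using this
  · rw [← map_pow]
    have : ((v.1.1, v.2.1) : ZMod a × ZMod b) ^ 2 = 1 := by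
      ext
      · simpa using v.1.2
      · simpa using v.2.2
    rw [this, map_one]
  · intro u; simp
  · intro v; simp

lemma sqc_prime (p : ℕ) (hp : p.Prime) (h2 : p ≠ 2) : sqc p = 2 := by
  have : Fact p.Prime := ⟨hp⟩
  have : Fact (2 < p) := ⟨lt_of_le_of_ne hp.two_le (Ne.symm h2)⟩
  unfold sqc
  have : {u : ZMod p | u ^ 2 = 1} = {1, -1} := by
    ext u
    simp [pow_two, mul_self_eq_one_iff]
  have h3 : Nat.card {u : ZMod p // u ^ 2 = 1} = Set.ncard {u : ZMod p | u ^ 2 = 1} := rfl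
  rw [h3, this, Set.ncard_pair]
  intro h
  exact ZMod.neg_one_ne_one h.symm

lemma sqc_eq (D : ℕ) (hD : Squarefree D) (h2 : ¬ 2 ∣ D) : sqc D = 2 ^ D.primeFactors.card := by
  induction D using Nat.recOnPosPrimePosCoprime with
  | prime_pow p n hp hn =>
    have hn1 : n = 1 := by
      by_contra hne
      have := hD p (by rw [← pow_two]; exact pow_dvd_pow p (by omega))
      exact hp.one_lt.ne' (Nat.isUnit_iff.mp this)
    subst hn1
    rw [pow_one, sqc_prime p hp (by rintro rfl; exact h2 (by simp)), hp.primeFactors]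
    simp
  | zero => simp at h2
  | one =>
    have : Subsingleton (ZMod 1) := inferInstance
    have hu : Unique {u : ZMod 1 // u ^ 2 = 1} := ⟨⟨⟨1, by simp⟩⟩, fun x => Subsingleton.elim _ _⟩
    simp [sqc]
  | coprime a b ha hb hab iha ihb =>
    rw [sqc_mul a b hab, iha (hD.squarefree_of_dvd (dvd_mul_right a b)) (fun h => h2 (h.mul_right b)),
      ihb (hD.squarefree_of_dvd (dvd_mul_left b a)) (fun h => h2 (h.mul_left a)), ← pow_add, hab.primeFactors_mul,
      card_union_of_disjoint hab.disjoint_primeFactors]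

/-- coefficient -/
noncomputable def cco {D : ℕ} [NeZero D] (χ : DirichletCharacter ℂ D) : ℂ :=
  ∑ u ∈ (univ : Finset (ZMod D)).filter (fun u => u ^ 2 = 1), χ u⁻¹

lemma card_sq (D : ℕ) [NeZero D] : ((univ : Finset (ZMod D)).filter (fun u => u ^ 2 = 1)).card = sqc D := by
  unfold sqc
  rw [Nat.card_eq_fintype_card, Fintype.card_subtype]

lemma cco_le {D : ℕ} [NeZero D] (χ : DirichletCharacter ℂ D) : ‖cco χ‖ ≤ sqc D := by
  unfold cco
  refine (norm_sum_le _ _).trans ?_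
  rw [← card_sq, ← nsmul_one]
  refine (sum_le_card_nsmul _ _ 1 fun u _ => DirichletCharacter.norm_le_one _ _)

lemma cco_one (D : ℕ) [NeZero D] : cco (1 : DirichletCharacter ℂ D) = sqc D := by
  unfold cco
  rw [← card_sq, ← nsmul_one]
  refine sum_eq_card_nsmul fun u hu => ?_
  rw [mem_filter] at hu
  have hu1 : u * u = 1 := by rw [← pow_two]; exact hu.2
  apply MulChar.one_apply
  have : IsUnit u := IsUnit.of_mul_eq_one u hu1
  rw [ZMod.inv_eq_of_mul_eq_one _ u u hu1]
  exact this

lemma detect (D : ℕ) [NeZero D] (b : ZMod D) :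
    ∑ χ : DirichletCharacter ℂ D, cco χ * χ b = if b ^ 2 = 1 then (D.totient : ℂ) else 0 := by
  unfold cco
  simp_rw [sum_mul]
  rw [sum_comm]
  have h : ∀ u ∈ (univ : Finset (ZMod D)).filter (fun u => u ^ 2 = 1), ∑ χ : DirichletCharacter ℂ D, χ u⁻¹ * χ b = if u = b then (D.totient : ℂ) else 0 := by
    intro u hu
    rw [mem_filter] at hu
    exact DirichletCharacter.sum_char_inv_mul_char_eq ℂ (IsUnit.of_mul_eq_one u (by rw [← pow_two]; exact hu.2)) b
  rw [sum_congr rfl h, sum_ite_eq']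
  simp

/-- character sum of a sequence -/
noncomputable def chS {D : ℕ} (f : ℕ → ℝ) (χ : DirichletCharacter ℂ D) : ℂ := ∑' n : ℕ, (f n : ℂ) * χ (n : ZMod D)

lemma chS_summable {D : ℕ} (f : ℕ → ℝ) (hf : Summable f) (χ : DirichletCharacter ℂ D) :
    Summable fun n : ℕ => (f n : ℂ) * χ (n : ZMod D) := by
  refine Summable.of_norm_bounded hf.abs fun n => ?_
  rw [norm_mul, Complex.norm_real, Real.norm_eq_abs]
  exact mul_le_of_le_one_right (abs_nonneg _) (DirichletCharacter.norm_le_one _ _)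

lemma chS_le {D : ℕ} (f : ℕ → ℝ) (hf : Summable f) (χ : DirichletCharacter ℂ D) : ‖chS f χ‖ ≤ ∑' n, |f n| := by
  refine tsum_of_norm_bounded hf.abs.hasSum fun n => ?_
  rw [norm_mul, Complex.norm_real, Real.norm_eq_abs]
  exact mul_le_of_le_one_right (abs_nonneg _) (DirichletCharacter.norm_le_one _ _)

lemma chS_add {D : ℕ} (f g h : ℕ → ℝ) (hf : Summable f) (hg : Summable g) (e : ∀ n, h n = f n + g n) (χ : DirichletCharacter ℂ D) :
    chS h χ = chS f χ + chS g χ := by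
  unfold chS
  rw [← (chS_summable f hf χ).tsum_add (chS_summable g hg χ)]
  refine tsum_congr fun n => ?_
  rw [e]; push_cast; ring

lemma chS_detect {D : ℕ} [NeZero D] (f : ℕ → ℝ) (hf : Summable f) :
    ((∑' n : ℕ, (if (n : ZMod D) ^ 2 = 1 then f n else 0) : ℝ) : ℂ) * D.totient = ∑ χ : DirichletCharacter ℂ D, cco χ * chS f χ := by
  unfold chS
  simp_rw [← tsum_mul_left]
  rw [← Summable.tsum_finsetSum (fun χ _ => (chS_summable f hf χ).mul_left _), Complex.ofReal_tsum, ← tsum_mul_right]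
  refine tsum_congr fun n => ?_
  have h := detect D (n : ZMod D)
  have : ∑ χ : DirichletCharacter ℂ D, cco χ * ((f n : ℂ) * χ (n : ZMod D)) = (f n : ℂ) * ∑ χ : DirichletCharacter ℂ D, cco χ * χ (n : ZMod D) := by
    rw [mul_sum]; exact sum_congr rfl fun χ _ => by ring
  rw [this, h]
  split_ifs <;> simp

lemma ED_bound (D : ℕ) [NeZero D] (g0 t g1 : ℕ → ℝ) (h0 : Summable g0) (ht : Summable t) (h1 : ∀ n, g1 n = g0 n + t n)
    (hc : ∀ n, g0 n ≠ 0 → n.Coprime D) (A B : Finset (DirichletCharacter ℂ D)) (hA : (1 : DirichletCharacter ℂ D) ∉ A)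
    (hB : ∀ χ, χ ∈ B ↔ χ ≠ 1 ∧ χ ∉ A) :
    |(∑' n : ℕ, (if (n : ZMod D) ^ 2 = 1 then g0 n else 0)) - (sqc D : ℝ) / D.totient * ∑' n, g0 n| ≤
      (sqc D : ℝ) / D.totient * ∑ χ ∈ A, ‖chS g0 χ‖ + (sqc D : ℝ) / D.totient * ∑ χ ∈ B, ‖chS g1 χ‖
      + (∑' n : ℕ, (if (n : ZMod D) ^ 2 = 1 then |t n| else 0)) + (sqc D : ℝ) / D.totient * ((A.card + 1) * ∑' n, |t n|) := by
  classical
  have hφ : (0:ℝ) < D.totient := by exact_mod_cast Nat.totient_pos.mpr (NeZero.pos D)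
  have hone : chS g0 (1 : DirichletCharacter ℂ D) = ((∑' n, g0 n : ℝ) : ℂ) := by
    unfold chS
    rw [Complex.ofReal_tsum]
    refine tsum_congr fun n => ?_
    by_cases h : g0 n = 0
    · simp [h]
    · rw [MulChar.one_apply ((ZMod.isUnit_iff_coprime n D).mpr (hc n h)), mul_one]
  have hsplit : ∀ F : DirichletCharacter ℂ D → ℂ, ∑ χ, F χ = F 1 + (∑ χ ∈ A, F χ + ∑ χ ∈ B, F χ) := by
    intro F
    have hd : Disjoint A B := by
      rw [Finset.disjoint_left]; intro χ ha hb; exact ((hB χ).mp hb).2 ha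
    rw [← sum_union hd, ← sum_insert (a := (1 : DirichletCharacter ℂ D)) (s := A ∪ B)]
    · refine sum_congr ?_ fun _ _ => rfl
      ext χ
      simp only [mem_univ, mem_insert, mem_union, true_iff, hB]
      tauto
    · simp [hB, hA]
  have d0 := chS_detect (D := D) g0 h0
  have dt := chS_detect (D := D) t ht
  rw [hsplit] at d0 dt
  have hB1 : ∑ χ ∈ B, cco χ * chS g0 χ = ∑ χ ∈ B, cco χ * chS g1 χ - ∑ χ ∈ B, cco χ * chS t χ := by
    rw [← sum_sub_distrib]
    refine sum_congr rfl fun χ _ => ?_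
    rw [chS_add g0 t g1 h0 ht h1]; ring
  set X0 := ∑' n : ℕ, (if (n : ZMod D) ^ 2 = 1 then g0 n else 0) with hX0
  set Xt := ∑' n : ℕ, (if (n : ZMod D) ^ 2 = 1 then t n else 0) with hXt
  set G := ∑' n, g0 n with hG
  set TT := ∑' n, |t n| with hTT
  have key : ((X0 * D.totient - sqc D * G : ℝ) : ℂ) = ∑ χ ∈ A, cco χ * chS g0 χ + ∑ χ ∈ B, cco χ * chS g1 χ
      - ((Xt * D.totient : ℝ) : ℂ) + (cco (1 : DirichletCharacter ℂ D) * chS t (1 : DirichletCharacter ℂ D) + ∑ χ ∈ A, cco χ * chS t χ) := by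
    push_cast
    rw [d0, dt, hB1, hone, cco_one]
    ring
  have hbd : ∀ (f : ℕ → ℝ) (S : Finset (DirichletCharacter ℂ D)), ‖∑ χ ∈ S, cco χ * chS f χ‖ ≤ sqc D * ∑ χ ∈ S, ‖chS f χ‖ := by
    intro f S
    rw [mul_sum]
    refine (norm_sum_le _ _).trans (sum_le_sum fun χ _ => ?_)
    rw [norm_mul]
    exact mul_le_mul_of_nonneg_right (cco_le χ) (norm_nonneg _)
  have hAt : ‖∑ χ ∈ A, cco χ * chS t χ‖ ≤ sqc D * (A.card * TT) := by
    refine (hbd t A).trans (mul_le_mul_of_nonneg_left ?_ (Nat.cast_nonneg _))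
    rw [← nsmul_eq_mul]
    exact sum_le_card_nsmul _ _ _ fun χ _ => chS_le t ht χ
  have h1t : ‖cco (1 : DirichletCharacter ℂ D) * chS t (1 : DirichletCharacter ℂ D)‖ ≤ sqc D * TT := by
    rw [norm_mul]
    exact mul_le_mul (cco_le _) (chS_le t ht _) (norm_nonneg _) (Nat.cast_nonneg _)
  have hXt' : |Xt| ≤ ∑' n : ℕ, (if (n : ZMod D) ^ 2 = 1 then |t n| else 0) := by
    have hs : Summable fun n : ℕ => (if (n : ZMod D) ^ 2 = 1 then |t n| else 0) := by
      refine Summable.of_nonneg_of_le (fun n => ?_) (fun n => ?_) ht.abs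
      · split_ifs <;> simp
      · split_ifs <;> simp
    rw [← Real.norm_eq_abs]
    refine tsum_of_norm_bounded hs.hasSum fun n => ?_
    split_ifs <;> simp
  set XA := ∑' n : ℕ, (if (n : ZMod D) ^ 2 = 1 then |t n| else 0)
  have hfin : |X0 * D.totient - sqc D * G| ≤ sqc D * ∑ χ ∈ A, ‖chS g0 χ‖ + sqc D * ∑ χ ∈ B, ‖chS g1 χ‖ + XA * D.totient + (sqc D * TT + sqc D * (A.card * TT)) := by
    rw [← Real.norm_eq_abs, ← Complex.norm_real, key]
    refine (norm_add_le _ _).trans (add_le_add ((norm_sub_le _ _).trans (add_le_add ((norm_add_le _ _).trans (add_le_add (hbd _ _) (hbd _ _))) ?_)) ((norm_add_le _ _).trans (add_le_add h1t hAt)))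
    rw [Complex.norm_real, Real.norm_eq_abs, abs_mul, abs_of_pos hφ]
    exact mul_le_mul_of_nonneg_right hXt' hφ.le
  have e1 : X0 - (sqc D : ℝ) / D.totient * G = (X0 * D.totient - sqc D * G) / D.totient := by field_simp
  rw [e1, abs_div, abs_of_pos hφ, div_le_iff₀ hφ]
  refine hfin.trans (le_of_eq ?_)
  field_simp
  ring

end PSLSieve
end

section
open Finset
namespace PSLSieve

open Classical in
/-- prime indicator weight without W -/
noncomputable def a0 (M n : ℕ) : ℝ := if n ∈ PI M then Real.log n else 0

/-- weighted -/
noncomputable def g0 (M n : ℕ) : ℝ := a0 M n * Wt M n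

lemma g0_summable (M : ℕ) : Summable (g0 M) := by
  refine summable_of_ne_finset_zero (s := PI M) fun n hn => ?_
  simp [g0, a0, hn]

lemma g0_tsum (M : ℕ) : ∑' n, g0 M n = mass M := by
  rw [tsum_eq_sum (s := PI M) fun n hn => by simp [g0, a0, hn]]
  unfold mass
  refine sum_congr rfl fun n hn => by simp [g0, a0, hn, wt]

lemma a0_nonneg (M n : ℕ) : 0 ≤ a0 M n := by
  unfold a0; split_ifs; exact Real.log_natCast_nonneg n; exact le_rfl

lemma sum_tW {M : ℕ} (t : ℕ → ℝ) (h1 : Summable (fun n : ℕ => |t n| * Wt M n * 64 ^ (n^2-1).primeFactors.card)) :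
    Summable (fun n => t n * Wt M n) ∧ ∑' n, |t n * Wt M n| ≤ ∑' n : ℕ, |t n| * Wt M n * 64 ^ (n^2-1).primeFactors.card := by
  have h : ∀ n : ℕ, |t n * Wt M n| ≤ |t n| * Wt M n * 64 ^ (n^2-1).primeFactors.card := by
    intro n
    rw [abs_mul, abs_of_nonneg (Wt_nonneg M n)]
    exact le_mul_of_one_le_right (mul_nonneg (abs_nonneg _) (Wt_nonneg M n)) (one_le_pow₀ (by norm_num))
  have hs : Summable (fun n => |t n * Wt M n|) := Summable.of_nonneg_of_le (fun n => abs_nonneg _) h h1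
  exact ⟨hs.of_abs, hs.tsum_le_tsum h h1⟩

lemma t1_hyp (M n : ℕ) : (¬ InI M n → |afL n - a0 M n| ≤ 4 * Real.log n * tau n) ∧
    (InI M n → |afL n - a0 M n| ≤ if n.Prime then 0 else ArithmeticFunction.vonMangoldt n) := by
  have hl := Real.log_natCast_nonneg n
  constructor
  · intro h
    have : n ∉ PI M := fun h2 => h ((mem_PI M n).mp h2).2
    rw [a0, if_neg this, sub_zero, abs_of_nonneg (afL_nonneg n)]
    rcases Nat.eq_zero_or_pos n with rfl | hn
    · simp
    have ht := one_le_tau hn.ne'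
    nlinarith [afL_le n]
  · intro h
    split_ifs with hp
    · rw [a0, if_pos ((mem_PI M n).mpr ⟨hp, h⟩)]
      have : afL n = Real.log n := ArithmeticFunction.vonMangoldt_apply_prime hp
      rw [this, sub_self, abs_zero]
    · have : n ∉ PI M := fun h2 => hp ((mem_PI M n).mp h2).1
      rw [a0, if_neg this, sub_zero, abs_of_nonneg (afL_nonneg n)]
      exact le_rfl

lemma t2_hyp (M U V Y n : ℕ) (hU : 1 ≤ U) (hV : 1 ≤ V) (hY : 1 ≤ Y) (h : ((U*V*Y : ℕ):ℝ) ≤ Real.exp (0.99 * (M:ℝ)^20)) :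
    (¬ InI M n → |afL n - aA U V Y n - a0 M n| ≤ 4 * Real.log n * tau n) ∧
    (InI M n → |afL n - aA U V Y n - a0 M n| ≤ if n.Prime then 0 else ArithmeticFunction.vonMangoldt n) := by
  have hl := Real.log_natCast_nonneg n
  constructor
  · intro h
    have : n ∉ PI M := fun h2 => h ((mem_PI M n).mp h2).2
    rw [a0, if_neg this, sub_zero]
    rcases Nat.eq_zero_or_pos n with rfl | hn
    · simp
    have ht := one_le_tau hn.ne'
    have h1 := aA_abs U V Y n
    have h2 := afL_le n
    have h3 := afL_nonneg n
    have h4 : |afL n - aA U V Y n| ≤ |afL n| + |aA U V Y n| := abs_sub _ _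
    rw [abs_of_nonneg h3] at h4
    nlinarith
  · intro hI
    have hn0 : 0 < n := by
      rcases Nat.eq_zero_or_pos n with rfl | hn
      · have := hI.1
        simp at this
        have h5 : (0:ℝ) ≤ (M:ℝ)^20 := by positivity
        norm_num at this
        linarith
      · exact hn
    have : aA U V Y n = 0 := by
      apply aA_zero U V Y n hU hV hY
      have h6 : ((U*V*Y : ℕ):ℝ) < n := by
        refine h.trans_lt ?_
        rw [← Real.lt_log_iff_exp_lt (by exact_mod_cast hn0)]
        exact hI.1
      exact_mod_cast h6
    rw [this, sub_zero]
    exact (t1_hyp M n).2 hI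

lemma small_part : ∃ M0 : ℕ, ∀ M : ℕ, M0 ≤ M → ∃ l1 : ℕ, l1.Prime ∧ ∀ D : ℕ, NeZero D → ¬ l1 ∣ D →
    (D:ℝ) < Real.exp (0.99 * (M:ℝ)^20) → ∀ χ : DirichletCharacter ℂ D, χ ≠ 1 → (χ.conductor : ℝ) ≤ Real.exp M →
    ‖chS (g0 M) χ‖ ≤ 2 * Nk M * Real.exp (-(10*M)) := by
  obtain ⟨M1, h1⟩ := small_cond
  obtain ⟨M2, h2⟩ := tail_bound
  refine ⟨max (max M1 M2) 10, fun M hM => ?_⟩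
  simp only [max_le_iff] at hM
  obtain ⟨l1, hl1, hsm⟩ := h1 M hM.1.1
  refine ⟨l1, hl1, fun D hD hlD hDe χ hχ hcond => ?_⟩
  obtain ⟨hts, htb⟩ := h2 M hM.1.2 (fun n => afL n - a0 M n) (fun n => (t1_hyp M n).1) (fun n => (t1_hyp M n).2)
  obtain ⟨hs1, hs2⟩ := sum_tW _ hts
  set t : ℕ → ℝ := fun n => (afL n - a0 M n) * Wt M n with ht
  have hdvd := χ.conductor_dvd_level
  have hr : NeZero χ.conductor := ⟨fun h => hD.out (by rw [h] at hdvd; exact Nat.eq_zero_of_zero_dvd hdvd)⟩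
  set ψ := χ.primitiveCharacter with hψ
  have hχψ : DirichletCharacter.changeLevel hdvd ψ = χ := χ.changeLevel_primitiveCharacter
  have e1 : chS (g0 M) χ = chS (g0 M) ψ := by
    unfold chS
    refine tsum_congr fun n => ?_
    by_cases hn : n ∈ PI M
    · obtain ⟨hp, hI⟩ := (mem_PI M n).mp hn
      have hlt : (D:ℝ) < n := by
        refine hDe.trans ?_
        rw [← Real.lt_log_iff_exp_lt (by exact_mod_cast hp.pos)]
        exact hI.1
      have hlt' : D < n := by exact_mod_cast hlt
      have hc : n.Coprime D := (Nat.Prime.coprime_iff_not_dvd hp).mpr fun h => absurd (Nat.le_of_dvd (NeZero.pos D) h) (by omega)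
      congr 1
      have h7 := changeLevel_nat hdvd ψ n
      rw [if_pos hc, hχψ] at h7
      exact h7
    · simp [g0, a0, hn]
  have hψ1 : ψ ≠ 1 := by
    intro h
    rw [h] at hχψ
    exact hχ (by rw [← hχψ, map_one])
  have e2 : chS (fun n => afL n * Wt M n) ψ = chS (g0 M) ψ + chS t ψ :=
    chS_add _ _ _ (g0_summable M) hs1 (fun n => by simp only [g0, ht]; ring) ψ
  have b1 := hsm χ.conductor hr ψ χ.primitiveCharacter_isPrimitive hψ1 hcond (fun h => hlD (h.trans hdvd))
  have e3 : chS (fun n => afL n * Wt M n) ψ = ∑' n : ℕ, (ψ (n : ZMod χ.conductor) * (ArithmeticFunction.vonMangoldt n : ℂ)) * (((Real.log n : ℝ) : ℂ)^(M^2) * (n:ℂ)^(-((1+1/(M:ℝ)^18:ℝ):ℂ))) := by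
    unfold chS
    refine tsum_congr fun n => ?_
    rw [← Wt_cast]
    push_cast
    simp only [afL]
    ring
  rw [← e3] at b1
  have b2 := (chS_le t hs1 ψ).trans (hs2.trans htb)
  have hN := (Nk_pos M (by omega)).le
  have b3 : ((M:ℝ)^20)^(M^2) * Real.exp (-(2*(M:ℝ)^2)) ≤ Nk M * Real.exp (-(10*M)) := by
    unfold Nk
    rw [mul_assoc, ← Real.exp_add]
    have : (10:ℝ) ≤ M := by exact_mod_cast hM.2
    gcongr
    nlinarith
  rw [e1, eq_sub_of_add_eq e2.symm]
  refine (norm_sub_le _ _).trans ?_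
  linarith

lemma card_small (D : ℕ) [NeZero D] (B : ℝ) (hB : 0 ≤ B) (A : Finset (DirichletCharacter ℂ D)) (hA : ∀ χ ∈ A, (χ.conductor : ℝ) ≤ B) :
    (A.card : ℝ) ≤ B ^ 2 := by
  classical
  let T : Finset (Σ r : ℕ, DirichletCharacter ℂ r) := (Icc 1 ⌊B⌋₊).sigma fun r => univ
  have h1 : A.card ≤ T.card := by
    apply card_le_card_of_injOn (fun χ => (⟨χ.conductor, χ.primitiveCharacter⟩ : Σ r : ℕ, DirichletCharacter ℂ r))
    · intro χ hχ
      have hdvd := χ.conductor_dvd_level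
      have hr : 0 < χ.conductor := Nat.pos_of_dvd_of_pos hdvd (NeZero.pos D)
      simp only [T, coe_sigma, Set.mem_sigma_iff, coe_Icc, Set.mem_Icc, coe_univ, Set.mem_univ, and_true]
      exact ⟨hr, Nat.le_floor (hA χ hχ)⟩
    · intro χ1 _ χ2 _ h
      have key : ∀ (x y : Σ r : ℕ, DirichletCharacter ℂ r) (hx : x.1 ∣ D) (hy : y.1 ∣ D), x = y →
          DirichletCharacter.changeLevel hx x.2 = DirichletCharacter.changeLevel hy y.2 := by
        rintro x y hx hy rfl; rfl
      have := key _ _ χ1.conductor_dvd_level χ2.conductor_dvd_level h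
      simpa [DirichletCharacter.changeLevel_primitiveCharacter] using this
  have h2 : T.card ≤ ⌊B⌋₊ * ⌊B⌋₊ := by
    simp only [T, card_sigma]
    refine (sum_le_card_nsmul _ _ ⌊B⌋₊ fun r hr => ?_).trans ?_
    · rw [mem_Icc] at hr
      have : NeZero r := ⟨by omega⟩
      rw [card_univ, ← Nat.card_eq_fintype_card, DirichletCharacter.card_eq_totient_of_hasEnoughRootsOfUnity]
      exact (Nat.totient_le r).trans hr.2
    · simp
  have h3 : (A.card : ℝ) ≤ (⌊B⌋₊ : ℝ) * ⌊B⌋₊ := by exact_mod_cast h1.trans h2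
  have h4 := Nat.floor_le hB
  have h5 : (0:ℝ) ≤ (⌊B⌋₊ : ℝ) := Nat.cast_nonneg _
  nlinarith

end PSLSieve
end

section
open Finset
namespace PSLSieve

/-- twisted character value with extra coprimality -/
noncomputable def gx (m : ℕ) (x : Σ r : ℕ, DirichletCharacter ℂ r) (n : ℕ) : ℂ := if n.Coprime m then x.2 (n : ZMod x.1) else 0

lemma one_add_log_le {s : ℝ} (hs : 0 < s) (hs1 : s ≤ 1) {n : ℕ} (hn : 1 ≤ n) : 1 + Real.log n ≤ (1 + 4/s) * (n:ℝ)^(s/4) := by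
  have h0 : (1:ℝ) ≤ n := by exact_mod_cast hn
  have h1 := Real.log_le_rpow_div (x := (n:ℝ)) (by linarith) (show 0 < s/4 by positivity)
  have h2 : (1:ℝ) ≤ (n:ℝ)^(s/4) := Real.one_le_rpow h0 (by positivity)
  have h3 : (n:ℝ)^(s/4) / (s/4) = 4/s * (n:ℝ)^(s/4) := by field_simp
  rw [h3] at h1
  linarith

lemma ls_block (R U : ℕ) (hR : 1 ≤ R) (hU : 1 ≤ U) (S : Finset (Σ r : ℕ, DirichletCharacter ℂ r))
    (hS : ∀ x ∈ S, 0 < x.1 ∧ x.1 ≤ 2*R ∧ x.2.IsPrimitive) (m : ℕ) (f : ArithmeticFunction ℝ)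
    (hf : ∀ n, |f n| ≤ (1 + Real.log n) * tau n) (hfU : ∀ n < U, f n = 0) {s : ℝ} (hs : 0 < s) (hs1 : s ≤ 1) (z : ℂ) (hz : 1 + s ≤ z.re) :
    ∑ x ∈ S, ‖LSeries (tw (gx m x) f) z‖^2 ≤ (16/s + 32*R^2/U) * (1+4/s)^6 := by
  set a : ℕ → ℂ := fun n => if n.Coprime m then (f n : ℂ) * (n:ℂ)^(-z) else 0 with ha
  have hterm : ∀ x : Σ r : ℕ, DirichletCharacter ℂ r, LSeries (tw (gx m x) f) z = ∑' n : ℕ, a n * x.2 (n : ZMod x.1) := by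
    intro x
    unfold LSeries
    refine tsum_congr fun n => ?_
    rcases Nat.eq_zero_or_pos n with rfl | hn
    · simp [ha]
    rw [LSeries.term_of_ne_zero hn.ne', tw_apply]
    simp only [ha, gx]
    split_ifs
    · rw [Complex.cpow_neg]; ring
    · simp
  have hnorm : ∀ n : ℕ, ‖a n‖ ≤ ‖LSeries.term (fun n => ((f n : ℝ):ℂ)) z n‖ := by
    intro n
    rcases Nat.eq_zero_or_pos n with rfl | hn
    · simp [ha]
    rw [LSeries.term_of_ne_zero hn.ne']
    simp only [ha]
    split_ifs
    · rw [Complex.cpow_neg, ← div_eq_mul_inv]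
    · rw [norm_zero]; exact norm_nonneg _
  have hsum : Summable a := by
    have hc := (LSeries_crude hs (fun n => ((f n : ℝ):ℂ)) (fun n => by rw [Complex.norm_real]; exact hf n) z hz).1
    exact Summable.of_norm_bounded hc.norm hnorm
  obtain ⟨ts, tb⟩ := tau_tsum (show 0 < s/2 by positivity) 2
  have hpt : ∀ n : ℕ, ‖a n‖^2 * (n:ℝ)^(1+s) ≤ (1+4/s)^2 * (tau n^2 * (n:ℝ)^(-1-s/2)) := by
    intro n
    rcases Nat.eq_zero_or_pos n with rfl | hn
    · simp [ha, tau_zero]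
    have hn0 : (0:ℝ) < n := by exact_mod_cast hn
    have hn1 : (1:ℝ) ≤ n := by exact_mod_cast hn
    have h1 : ‖a n‖ ≤ (1+4/s) * (n:ℝ)^(s/4) * tau n * (n:ℝ)^(-(1+s)) := by
      refine (hnorm n).trans ?_
      rw [LSeries.term_of_ne_zero hn.ne', norm_div, Complex.norm_natCast_cpow_of_pos hn, Complex.norm_real, div_eq_mul_inv, ← Real.rpow_neg hn0.le]
      refine mul_le_mul ((hf n).trans ?_) (Real.rpow_le_rpow_of_exponent_le hn1 (by linarith)) (by positivity) ?_
      · exact mul_le_mul_of_nonneg_right (one_add_log_le hs hs1 hn) (tau_nonneg n)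
      · have := tau_nonneg n; positivity
    calc ‖a n‖^2 * (n:ℝ)^(1+s) ≤ ((1+4/s) * (n:ℝ)^(s/4) * tau n * (n:ℝ)^(-(1+s)))^2 * (n:ℝ)^(1+s) := by
          gcongr
      _ = (1+4/s)^2 * (tau n^2 * (((n:ℝ)^(s/4))^2 * ((n:ℝ)^(-(1+s)))^2 * (n:ℝ)^(1+s))) := by ring
      _ = _ := by
          congr 2
          rw [← Real.rpow_natCast, ← Real.rpow_natCast, ← Real.rpow_mul hn0.le, ← Real.rpow_mul hn0.le, ← Real.rpow_add hn0, ← Real.rpow_add hn0]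
          congr 1; push_cast; ring
  have hs2 : Summable fun n : ℕ => ‖a n‖^2 * (n:ℝ)^(1+s) :=
    Summable.of_nonneg_of_le (fun n => by positivity) hpt (ts.mul_left _)
  have hb : ∑' n : ℕ, ‖a n‖^2 * (n:ℝ)^(1+s) ≤ (1+4/s)^6 := by
    refine (hs2.tsum_le_tsum hpt (ts.mul_left _)).trans ?_
    rw [tsum_mul_left]
    have e : 1 + 1/(s/2) ≤ 1 + 4/s := by
      rw [one_div_div]; gcongr; norm_num
    calc (1+4/s)^2 * ∑' n : ℕ, tau n^2 * (n:ℝ)^(-1-s/2) ≤ (1+4/s)^2 * (1+4/s)^4 := by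
          apply mul_le_mul_of_nonneg_left _ (by positivity)
          refine tb.trans ?_
          norm_num only
          exact pow_le_pow_left₀ (by positivity) (by simpa using e) 4
      _ = _ := by ring
  have hl := large_sieve R U hR hU S hS a (fun n hn => by simp [ha, hfU n hn]) hsum hs hs1 hs2
  simp_rw [hterm]
  exact hl.trans (mul_le_mul_of_nonneg_left hb (by positivity))

lemma chn_gx {D : ℕ} [NeZero D] (χ : DirichletCharacter ℂ D) :
    chn χ = gx (D / χ.conductor) ⟨χ.conductor, χ.primitiveCharacter⟩ := by
  funext n
  have h := changeLevel_nat χ.conductor_dvd_level χ.primitiveCharacter n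
  rw [χ.changeLevel_primitiveCharacter] at h
  have hD : D = χ.conductor * (D / χ.conductor) := (Nat.mul_div_cancel' χ.conductor_dvd_level).symm
  have hco : n.Coprime D ↔ n.Coprime χ.conductor ∧ n.Coprime (D / χ.conductor) := by
    conv_lhs => rw [hD]
    exact Nat.coprime_mul_iff_right
  unfold chn gx
  rw [h]
  by_cases h1 : n.Coprime χ.conductor
  · by_cases h2 : n.Coprime (D / χ.conductor)
    · rw [if_pos (hco.mpr ⟨h1, h2⟩), if_pos h2]
    · rw [if_neg (fun h => h2 (hco.mp h).2), if_neg h2]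
  · rw [if_neg (fun h => h1 (hco.mp h).1), char_nat_zero _ _ h1]
    simp

/-- product of the two factors -/
noncomputable def GG (U m : ℕ) (z : ℂ) (x : Σ r : ℕ, DirichletCharacter ℂ r) : ℝ :=
  ‖LSeries (tw (gx m x) (trgt U afL)) z‖ * ‖LSeries (tw (gx m x) (afZ * trgt U afM)) z‖

lemma GG_nonneg (U m : ℕ) (z : ℂ) (x : Σ r : ℕ, DirichletCharacter ℂ r) : 0 ≤ GG U m z x := by
  unfold GG; positivity

lemma f1_b (U n : ℕ) : |trgt U afL n| ≤ (1 + Real.log n) * tau n := by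
  rcases Nat.eq_zero_or_pos n with rfl | hn
  · simp [tau_zero]
  have h1 := (trgt_abs U afL n).trans (afL_b1 n)
  have h2 := one_le_tau hn.ne'
  have h3 := Real.log_natCast_nonneg n
  refine h1.trans (le_mul_of_one_le_right (by linarith) h2)

lemma f2_b (U n : ℕ) : |(afZ * trgt U afM) n| ≤ (1 + Real.log n) * tau n := by
  have h3 := Real.log_natCast_nonneg n
  exact (bco_abs U n).trans (le_mul_of_one_le_left (tau_nonneg n) (by linarith))

lemma GG_block (R U : ℕ) (hR : 1 ≤ R) (hU : 1 ≤ U) (S : Finset (Σ r : ℕ, DirichletCharacter ℂ r))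
    (hS : ∀ x ∈ S, 0 < x.1 ∧ x.1 ≤ 2*R ∧ x.2.IsPrimitive) (m : ℕ) {s : ℝ} (hs : 0 < s) (hs1 : s ≤ 1) (z : ℂ) (hz : 1 + s ≤ z.re) :
    ∑ x ∈ S, GG U m z x ≤ (16/s + 32*R^2/U) * (1+4/s)^6 := by
  have h1 := ls_block R U hR hU S hS m (trgt U afL) (f1_b U) (fun n hn => by rw [trgt_apply, if_pos hn.le]) hs hs1 z hz
  have h2 := ls_block R U hR hU S hS m (afZ * trgt U afM) (f2_b U) (fun n hn => bco_zero U n hn.le) hs hs1 z hz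
  have h3 : ∑ x ∈ S, GG U m z x ≤ ∑ x ∈ S, (‖LSeries (tw (gx m x) (trgt U afL)) z‖^2 + ‖LSeries (tw (gx m x) (afZ * trgt U afM)) z‖^2) / 2 := by
    refine sum_le_sum fun x _ => ?_
    unfold GG
    nlinarith [sq_nonneg (‖LSeries (tw (gx m x) (trgt U afL)) z‖ - ‖LSeries (tw (gx m x) (afZ * trgt U afM)) z‖)]
  rw [← sum_div, sum_add_distrib] at h3
  linarith

lemma aB_GG {D : ℕ} [NeZero D] (χ : DirichletCharacter ℂ D) (U : ℕ) {s : ℝ} (hs : 0 < s) (z : ℂ) (hz : 1 + s ≤ z.re) :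
    ‖LSeries (tw (chn χ) (aB U U)) z‖ = GG U (D / χ.conductor) z ⟨χ.conductor, χ.primitiveCharacter⟩ := by
  have hg := chn_le χ
  have hm := chn_mul χ
  have c1 := LSeries_crude hs _ (tw_crude _ hg (trgt U afL) (fun n => (trgt_abs _ _ n).trans (afL_b1 n))) z hz
  have c2 := LSeries_crude hs _ (tw_crude2 _ hg (afZ * trgt U afM) (bco_abs U)) z hz
  unfold aB
  rw [tw_mul _ hm, ArithmeticFunction.LSeries_mul' c1.1 c2.1, norm_mul, chn_gx χ]
  rfl

lemma aB_total (Q U : ℕ) (hU : 1 ≤ U) (Q0 : ℝ) (hQ0 : 1 ≤ Q0) {s : ℝ} (hs : 0 < s) (hs1 : s ≤ 1) (z : ℂ) (hz : 1 + s ≤ z.re)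
    (δ : ℝ) (hδ0 : 0 ≤ δ)
    (hδ : ∀ r R : ℕ, 1 ≤ R → R ≤ r → r ≤ 2*R → Squarefree r → Q0 < r → r ≤ Q → tau r^7/r * (16/s + 32*R^2/U) ≤ δ)
    (Y : Finset (Σ D : ℕ, DirichletCharacter ℂ D))
    (hY : ∀ y ∈ Y, 0 < y.1 ∧ y.1 ≤ Q ∧ Squarefree y.1 ∧ Q0 < y.2.conductor) :
    ∑ y ∈ Y, tau y.1^7/y.1 * ‖LSeries (tw (chn y.2) (aB U U)) z‖ ≤
      (1 + Real.log Q)^(2^7) * ((Nat.log 2 Q + 1) * (δ * (1+4/s)^6)) := by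
  classical
  let Φ : (Σ D : ℕ, DirichletCharacter ℂ D) → ℕ × (Σ r : ℕ, DirichletCharacter ℂ r) :=
    fun y => (y.1 / y.2.conductor, ⟨y.2.conductor, y.2.primitiveCharacter⟩)
  let X : Finset (Σ r : ℕ, DirichletCharacter ℂ r) :=
    ((Icc 1 Q).sigma fun r => univ).filter fun x => Squarefree x.1 ∧ Q0 < x.1 ∧ x.2.IsPrimitive
  let H : ℕ × (Σ r : ℕ, DirichletCharacter ℂ r) → ℝ := fun q => (tau q.1^7/q.1) * ((tau q.2.1^7/q.2.1) * GG U q.1 z q.2)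
  have hH0 : ∀ q, 0 ≤ H q := by
    intro q
    have := GG_nonneg U q.1 z q.2
    have := tau_nonneg q.1
    have := tau_nonneg q.2.1
    simp only [H]; positivity
  have hbd : ∀ y ∈ Y, 0 < y.2.conductor ∧ y.2.conductor ∣ y.1 ∧ y.1 / y.2.conductor * y.2.conductor = y.1 ∧ 0 < y.1 / y.2.conductor := by
    intro y hy
    have hd := y.2.conductor_dvd_level
    have h0 := (hY y hy).1
    exact ⟨Nat.pos_of_dvd_of_pos hd h0, hd, Nat.div_mul_cancel hd, Nat.div_pos (Nat.le_of_dvd h0 hd) (Nat.pos_of_dvd_of_pos hd h0)⟩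
  have step1 : ∑ y ∈ Y, tau y.1^7/y.1 * ‖LSeries (tw (chn y.2) (aB U U)) z‖ ≤ ∑ y ∈ Y, H (Φ y) := by
    refine sum_le_sum fun y hy => ?_
    obtain ⟨hc0, hd, hmul, hm0⟩ := hbd y hy
    have : NeZero y.1 := ⟨(hY y hy).1.ne'⟩
    rw [aB_GG y.2 U hs z hz]
    simp only [H, Φ]
    rw [← mul_assoc]
    apply mul_le_mul_of_nonneg_right _ (GG_nonneg _ _ _ _)
    rw [div_mul_div_comm, ← mul_pow, ← Nat.cast_mul, hmul]
    apply div_le_div_of_nonneg_right _ (Nat.cast_nonneg _)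
    apply pow_le_pow_left₀ (tau_nonneg _)
    conv_lhs => rw [← hmul]
    exact tau_mul_le _ _
  have hinj : Set.InjOn Φ Y := by
    intro y1 h1 y2 h2 h
    obtain ⟨D1, χ1⟩ := y1
    obtain ⟨D2, χ2⟩ := y2
    simp only [Φ, Prod.mk.injEq] at h
    obtain ⟨ha, hb⟩ := h
    have hb1 : χ1.conductor = χ2.conductor := congrArg Sigma.fst hb
    have m1 := (hbd _ h1).2.2.1
    have m2 := (hbd _ h2).2.2.1
    simp only at m1 m2
    have hD : D1 = D2 := by rw [← m1, ← m2, ha, hb1]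
    subst hD
    have key : ∀ (x y : Σ r : ℕ, DirichletCharacter ℂ r) (hx : x.1 ∣ D1) (hy : y.1 ∣ D1), x = y →
          DirichletCharacter.changeLevel hx x.2 = DirichletCharacter.changeLevel hy y.2 := by
        rintro x y hx hy rfl; rfl
    have := key _ _ χ1.conductor_dvd_level χ2.conductor_dvd_level hb
    simp only [DirichletCharacter.changeLevel_primitiveCharacter] at this
    rw [this]
  have hsub : Y.image Φ ⊆ (Icc 1 Q) ×ˢ X := by
    intro q hq
    rw [mem_image] at hq
    obtain ⟨y, hy, rfl⟩ := hq
    obtain ⟨hc0, hd, hmul, hm0⟩ := hbd y hy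
    obtain ⟨h0, hQ, hsq, hlt⟩ := hY y hy
    simp only [Φ, X, mem_product, mem_Icc, mem_filter, mem_sigma, mem_univ, and_true]
    exact ⟨⟨hm0, (Nat.div_le_self _ _).trans hQ⟩, ⟨hc0, (Nat.le_of_dvd h0 hd).trans hQ⟩, hsq.squarefree_of_dvd hd, hlt, y.2.primitiveCharacter_isPrimitive⟩
  have step2 : ∑ y ∈ Y, H (Φ y) ≤ ∑ q ∈ (Icc 1 Q) ×ˢ X, H q := by
    rw [← sum_image hinj]
    exact sum_le_sum_of_subset_of_nonneg hsub fun q _ _ => hH0 q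
  have hX : ∀ m, ∑ x ∈ X, (tau x.1^7/x.1) * GG U m z x ≤ (Nat.log 2 Q + 1) * (δ * (1+4/s)^6) := by
    intro m
    have hmaps : ∀ x ∈ X, Nat.log 2 x.1 ∈ range (Nat.log 2 Q + 1) := by
      intro x hx
      simp only [X, mem_filter, mem_sigma, mem_Icc] at hx
      rw [mem_range]
      have := Nat.log_mono_right (b := 2) hx.1.1.2
      omega
    rw [← sum_fiberwise_of_maps_to hmaps]
    have hfib : ∀ i ∈ range (Nat.log 2 Q + 1), ∑ x ∈ X.filter (fun x => Nat.log 2 x.1 = i), (tau x.1^7/x.1) * GG U m z x ≤ δ * (1+4/s)^6 := by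
      intro i _
      have hp : 1 ≤ 2^i := Nat.one_le_two_pow
      have hE : (0:ℝ) < 16/s + 32*((2^i : ℕ):ℝ)^2/U := by positivity
      have hmem : ∀ x ∈ X.filter (fun x => Nat.log 2 x.1 = i), 0 < x.1 ∧ 2^i ≤ x.1 ∧ x.1 ≤ 2*2^i ∧ x.2.IsPrimitive ∧ Squarefree x.1 ∧ Q0 < x.1 ∧ x.1 ≤ Q := by
        intro x hx
        simp only [X, mem_filter, mem_sigma, mem_Icc] at hx
        obtain ⟨⟨⟨⟨h1, h2⟩, -⟩, h3, h4, h5⟩, h6⟩ := hx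
        refine ⟨h1, ?_, ?_, h5, h3, h4, h2⟩
        · rw [← h6]; exact Nat.pow_log_le_self 2 (by omega)
        · have := Nat.lt_pow_succ_log_self (b := 2) (by norm_num) x.1
          rw [h6, pow_succ] at this
          omega
      have hb := GG_block (2^i) U hp hU (X.filter (fun x => Nat.log 2 x.1 = i)) (fun x hx => ⟨(hmem x hx).1, (hmem x hx).2.2.1, (hmem x hx).2.2.2.1⟩) m hs hs1 z hz
      calc _ ≤ ∑ x ∈ X.filter (fun x => Nat.log 2 x.1 = i), (δ / (16/s + 32*((2^i : ℕ):ℝ)^2/U)) * GG U m z x := by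
            refine sum_le_sum fun x hx => mul_le_mul_of_nonneg_right ?_ (GG_nonneg _ _ _ _)
            obtain ⟨h1, h2, h3, h4, h5, h6, h7⟩ := hmem x hx
            rw [le_div_iff₀ hE]
            exact hδ x.1 (2^i) hp h2 h3 h5 h6 h7
        _ ≤ (δ / (16/s + 32*((2^i : ℕ):ℝ)^2/U)) * ((16/s + 32*((2^i : ℕ):ℝ)^2/U) * (1+4/s)^6) := by
            rw [← mul_sum]
            exact mul_le_mul_of_nonneg_left hb (by positivity)
        _ = _ := by field_simp
    refine (sum_le_card_nsmul _ _ _ hfib).trans ?_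
    rw [card_range, nsmul_eq_mul]
    push_cast
    exact le_rfl
  refine step1.trans (step2.trans ?_)
  rw [sum_product]
  calc ∑ m ∈ Icc 1 Q, ∑ x ∈ X, H (m, x) = ∑ m ∈ Icc 1 Q, (tau m^7/m) * ∑ x ∈ X, (tau x.1^7/x.1) * GG U m z x := by
        refine sum_congr rfl fun m _ => ?_
        rw [mul_sum]
    _ ≤ ∑ m ∈ Icc 1 Q, (tau m^7/m) * ((Nat.log 2 Q + 1) * (δ * (1+4/s)^6)) := by
        refine sum_le_sum fun m _ => mul_le_mul_of_nonneg_left (hX m) ?_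
        have := tau_nonneg m
        positivity
    _ ≤ _ := by
        rw [← sum_mul]
        exact mul_le_mul_of_nonneg_right (tau_moment_inv 7 Q) (by positivity)

end PSLSieve
end

section
open Finset
namespace PSLSieve

/-- level -/
noncomputable def QQ (M : ℕ) : ℕ := ⌊Real.exp (0.245 * (M:ℝ)^20)⌋₊
/-- Vaughan parameter -/
noncomputable def UU (M : ℕ) : ℕ := ⌊Real.exp (0.24745 * (M:ℝ)^20)⌋₊
/-- Vaughan parameter -/
noncomputable def YY (M : ℕ) : ℕ := ⌊Real.exp (0.49245 * (M:ℝ)^20)⌋₊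

lemma floor_half {x : ℝ} (hx : 1 ≤ x) : x / 2 ≤ ⌊x⌋₊ := by
  have h1 := Nat.lt_floor_add_one x
  have h2 : (1:ℝ) ≤ ⌊x⌋₊ := by exact_mod_cast Nat.le_floor (by simpa using hx)
  linarith

lemma QQ_le (M : ℕ) : (QQ M : ℝ) ≤ Real.exp (0.245 * (M:ℝ)^20) := Nat.floor_le (Real.exp_pos _).le

lemma UU_ge (M : ℕ) : Real.exp (0.24745 * (M:ℝ)^20) / 2 ≤ UU M := floor_half (Real.one_le_exp (by positivity))
lemma YY_ge (M : ℕ) : Real.exp (0.49245 * (M:ℝ)^20) / 2 ≤ YY M := floor_half (Real.one_le_exp (by positivity))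
lemma UU_one (M : ℕ) : 1 ≤ UU M := Nat.le_floor (by simpa using Real.one_le_exp (x := 0.24745 * (M:ℝ)^20) (by positivity))
lemma YY_one (M : ℕ) : 1 ≤ YY M := Nat.le_floor (by simpa using Real.one_le_exp (x := 0.49245 * (M:ℝ)^20) (by positivity))

lemma UVY_le (M : ℕ) : ((UU M * UU M * YY M : ℕ):ℝ) ≤ Real.exp (0.99 * (M:ℝ)^20) := by
  have h1 : (UU M : ℝ) ≤ Real.exp (0.24745 * (M:ℝ)^20) := Nat.floor_le (Real.exp_pos _).le
  have h2 : (YY M : ℝ) ≤ Real.exp (0.49245 * (M:ℝ)^20) := Nat.floor_le (Real.exp_pos _).le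
  push_cast
  calc (UU M:ℝ) * UU M * YY M ≤ Real.exp (0.24745 * (M:ℝ)^20) * Real.exp (0.24745 * (M:ℝ)^20) * Real.exp (0.49245 * (M:ℝ)^20) := by gcongr
    _ = Real.exp (0.98735 * (M:ℝ)^20) := by rw [← Real.exp_add, ← Real.exp_add]; congr 1; ring
    _ ≤ _ := by gcongr; norm_num

lemma L_big (M : ℕ) (hM : 10 ≤ M) : (10000:ℝ) * M ≤ (M:ℝ)^20 := by
  have h : (10:ℝ) ≤ M := by exact_mod_cast hM
  calc (10000:ℝ) * M = 10^4 * M := by norm_num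
    _ ≤ (M:ℝ)^4 * M := by gcongr
    _ = (M:ℝ)^5 := by ring
    _ ≤ _ := pow_le_pow_right₀ (by linarith) (by norm_num)

lemma ev_poly1 (C c : ℝ) (hc : 0 < c) (K : ℕ) :
    ∃ M0 : ℕ, ∀ M : ℕ, M0 ≤ M → C * (M:ℝ)^K ≤ Real.exp (c * M) := by
  have h := (isLittleO_pow_exp_pos_mul_atTop K hc).const_mul_left C
  have h1 : ∀ᶠ x : ℝ in Filter.atTop, C * x^K ≤ Real.exp (c * x) := by
    filter_upwards [h.bound (c := 1) one_pos] with x hx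
    rw [one_mul, Real.norm_eq_abs, Real.norm_eq_abs, abs_of_pos (Real.exp_pos _)] at hx
    exact (le_abs_self _).trans hx
  exact Filter.eventually_atTop.mp (tendsto_natCast_atTop_atTop (R := ℝ) |>.eventually h1)

lemma delta_bound : ∃ C : ℝ, 0 < C ∧ ∀ M : ℕ, 10 ≤ M → ∀ r R : ℕ, 1 ≤ R → R ≤ r → r ≤ 2*R → Squarefree r → Real.exp M < r → r ≤ QQ M →
    tau r^7/r * (16/(1/(M:ℝ)^20) + 32*R^2/(UU M)) ≤ C * (M:ℝ)^20 * Real.exp (-(0.995 * M)) := by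
  obtain ⟨C, hC, hCb⟩ := pow_omega_le (2^7) (by norm_num) 0.005 (by norm_num)
  refine ⟨80 * C, by positivity, fun M hM r R hR hRr _ hsq hrM hrQ => ?_⟩
  have hM1 : (10:ℝ) ≤ M := by exact_mod_cast hM
  have hLb := L_big M hM
  set L := (M:ℝ)^20 with hL
  have hr0 : (0:ℝ) < r := lt_trans (Real.exp_pos _) hrM
  have hL1 : 1 ≤ L := by linarith
  have ht : tau r^7 ≤ C * (r:ℝ)^(0.005:ℝ) := by
    rw [tau_sq_free hsq, ← pow_mul, mul_comm _ 7, pow_mul]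
    exact hCb r hsq.ne_zero
  have hU : (0:ℝ) < UU M := by exact_mod_cast UU_one M
  have hRr' : (R:ℝ) ≤ r := by exact_mod_cast hRr
  have hrQ' : (r:ℝ) ≤ Real.exp (0.245 * L) := by
    have h : (r:ℝ) ≤ QQ M := by exact_mod_cast hrQ
    exact h.trans (QQ_le M)
  have h1 : (r:ℝ)^(-(0.995:ℝ)) ≤ Real.exp (-(0.995*M)) := by
    have := Real.rpow_le_rpow_of_nonpos (Real.exp_pos (M:ℝ)) hrM.le (show -(0.995:ℝ) ≤ 0 by norm_num)
    rw [← Real.exp_mul] at this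
    convert this using 2; ring
  have h2 : (r:ℝ)^(1.005:ℝ) ≤ Real.exp (0.246225 * L) := by
    have := Real.rpow_le_rpow hr0.le hrQ' (show (0:ℝ) ≤ 1.005 by norm_num)
    rw [← Real.exp_mul] at this
    convert this using 2; ring
  have h3 : 1 / (UU M : ℝ) ≤ 2 * Real.exp (-(0.24745 * L)) := by
    have := UU_ge M
    rw [Real.exp_neg, div_le_iff₀ hU]
    have he := Real.exp_pos (0.24745 * L)
    have h5 : 1 = 2 * (Real.exp (0.24745 * L))⁻¹ * (Real.exp (0.24745 * L)/2) := by field_simp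
    calc (1:ℝ) = 2 * (Real.exp (0.24745 * L))⁻¹ * (Real.exp (0.24745 * L)/2) := h5
      _ ≤ _ := by gcongr
  have e1 : (r:ℝ)^(0.005:ℝ) / r = (r:ℝ)^(-(0.995:ℝ)) := by
    rw [← Real.rpow_sub_one hr0.ne']; norm_num
  have e2 : (r:ℝ)^(-(0.995:ℝ)) * (r:ℝ)^2 = (r:ℝ)^(1.005:ℝ) := by
    rw [← Real.rpow_natCast, ← Real.rpow_add hr0]; norm_num
  calc tau r^7/r * (16/(1/L) + 32*R^2/(UU M)) ≤ (C * (r:ℝ)^(0.005:ℝ))/r * (16 * L + 32 * r^2 / UU M) := by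
        have : 16/(1/L) = 16 * L := by field_simp
        rw [this]
        gcongr
    _ = C * (16 * L * (r:ℝ)^(-(0.995:ℝ)) + 32 * (((r:ℝ)^(-(0.995:ℝ)) * (r:ℝ)^2) * (1/UU M))) := by
        rw [← e1]; ring
    _ ≤ C * (16 * L * Real.exp (-(0.995*M)) + 32 * (Real.exp (0.246225 * L) * (2 * Real.exp (-(0.24745 * L))))) := by
        rw [e2]; gcongr
    _ = C * (16 * L * Real.exp (-(0.995*M)) + 64 * Real.exp (-(0.001225 * L))) := by
        have : Real.exp (-(0.001225 * L)) = Real.exp (0.246225 * L) * Real.exp (-(0.24745 * L)) := by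
          rw [← Real.exp_add]; congr 1; ring
        rw [this]; ring
    _ ≤ C * (16 * L * Real.exp (-(0.995*M)) + 64 * (L * Real.exp (-(0.995*M)))) := by
        have : Real.exp (-(0.001225 * L)) ≤ 1 * Real.exp (-(0.995*M)) := by
          rw [one_mul]; exact Real.exp_le_exp.mpr (by linarith)
        have h6 : 1 * Real.exp (-(0.995*M)) ≤ L * Real.exp (-(0.995*M)) := by gcongr
        have h7 := this.trans h6
        apply mul_le_mul_of_nonneg_left _ hC.le
        linarith
    _ = _ := by ring

lemma logQ_le (M : ℕ) (hM : 10 ≤ M) : 1 + Real.log (QQ M) ≤ (M:ℝ)^20 := by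
  have hLb := L_big M hM
  have hM1 : (10:ℝ) ≤ M := by exact_mod_cast hM
  have h1 : Real.log (QQ M) ≤ 0.245 * (M:ℝ)^20 := by
    rcases Nat.eq_zero_or_pos (QQ M) with h | h
    · rw [h]; simp; positivity
    · rw [Real.log_le_iff_le_exp (by exact_mod_cast h)]
      exact QQ_le M
  linarith

lemma nlogQ_le (M : ℕ) (hM : 10 ≤ M) : ((Nat.log 2 (QQ M) : ℕ):ℝ) + 1 ≤ (M:ℝ)^20 := by
  have hLb := L_big M hM
  have hM1 : (10:ℝ) ≤ M := by exact_mod_cast hM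
  have h1 : ((Nat.log 2 (QQ M) : ℕ):ℝ) ≤ Real.log (QQ M) / Real.log 2 := by
    have := Real.natLog_le_logb (QQ M) 2
    simpa [Real.logb] using this
  have h2 := logQ_le M hM
  have h4 : Real.log (QQ M) ≤ 0.245 * (M:ℝ)^20 := by
    rcases Nat.eq_zero_or_pos (QQ M) with h | h
    · rw [h]; simp; positivity
    · rw [Real.log_le_iff_le_exp (by exact_mod_cast h)]
      exact QQ_le M
  have h3 := Real.log_two_gt_d9
  have h5 : Real.log (QQ M) / Real.log 2 ≤ 0.49 * (M:ℝ)^20 := by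
    rw [div_le_iff₀ (by linarith)]
    nlinarith [show 0 ≤ (M:ℝ)^20 by positivity]
  linarith

lemma aC_total (M : ℕ) (hM : 10 ≤ M) (z : ℂ) (hz : 1 + 1/(M:ℝ)^20 ≤ z.re) (hz3 : ‖z‖ ≤ 3) (Y : Finset (Σ D : ℕ, DirichletCharacter ℂ D))
    (hY : ∀ y ∈ Y, 0 < y.1 ∧ y.1 ≤ QQ M ∧ y.2 ≠ 1) :
    ∑ y ∈ Y, tau y.1^7/y.1 * ‖LSeries (tw (chn y.2) (aC (UU M) (UU M) (YY M))) z‖ ≤ 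
      40000 * 3^6 * ((M:ℝ)^20)^(2^7+6) * Real.exp (-(0.995 * M)) := by
  classical
  obtain ⟨J, hJ⟩ : ∃ J : ℕ, J = 2^7 := ⟨_, rfl⟩
  rw [← hJ]
  have hLb := L_big M hM
  have hM1 : (10:ℝ) ≤ M := by exact_mod_cast hM
  set L := (M:ℝ)^20 with hL
  have hL1 : 1 ≤ L := by linarith
  set Z := (YY M:ℝ)^(-(0.999:ℝ)) with hZ
  have hZ0 : 0 ≤ Z := by positivity
  have hZb : Z ≤ 2 * Real.exp (-(0.4919 * L)) := by
    have h1 := YY_ge M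
    have h2 := Real.rpow_le_rpow_of_nonpos (show 0 < Real.exp (0.49245 * L)/2 by positivity) h1 (show -(0.999:ℝ) ≤ 0 by norm_num)
    refine h2.trans ?_
    rw [Real.div_rpow (Real.exp_pos _).le (by norm_num), ← Real.exp_mul, div_eq_mul_inv, ← Real.rpow_neg (by norm_num), neg_neg, mul_comm]
    have h3 : (2:ℝ)^(0.999:ℝ) ≤ 2 := by
      conv_rhs => rw [← Real.rpow_one 2]
      exact Real.rpow_le_rpow_of_exponent_le (by norm_num) (by norm_num)
    apply mul_le_mul h3 (Real.exp_le_exp.mpr (by linarith)) (Real.exp_pos _).le (by norm_num)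
  have hP : (1 + 2/(1/L))^6 ≤ (3*L)^6 := by
    apply pow_le_pow_left₀ (by positivity)
    have : 2/(1/L) = 2 * L := by field_simp
    linarith
  have hsub : Y ⊆ (Icc 1 (QQ M)).sigma fun D => (univ : Finset (DirichletCharacter ℂ D)) := by
    intro y hy
    obtain ⟨h1, h2, _⟩ := hY y hy
    simp only [mem_sigma, mem_Icc, mem_univ, and_true]
    exact ⟨h1, h2⟩
  calc _ ≤ ∑ y ∈ Y, tau y.1^7/y.1 * (20000 * (y.1 * Z) * (3*L)^6) := by
        refine sum_le_sum fun y hy => mul_le_mul_of_nonneg_left ?_ (by have := tau_nonneg y.1; positivity)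
        obtain ⟨h1, h2, h3⟩ := hY y hy
        have : NeZero y.1 := ⟨h1.ne'⟩
        refine (aC_bound y.1 y.2 h3 (UU M) (UU M) (YY M) (YY_one M) (s := 1/L) (by positivity) z hz hz3).trans ?_
        gcongr
    _ ≤ ∑ y ∈ (Icc 1 (QQ M)).sigma fun D => (univ : Finset (DirichletCharacter ℂ D)), tau y.1^7/y.1 * (20000 * (y.1 * Z) * (3*L)^6) := by
        refine sum_le_sum_of_subset_of_nonneg hsub fun y _ _ => ?_
        have := tau_nonneg y.1
        positivity
    _ = ∑ D ∈ Icc 1 (QQ M), D.totient * (tau D^7/D * (20000 * (D * Z) * (3*L)^6)) := by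
        rw [sum_sigma]
        refine sum_congr rfl fun D hD => ?_
        rw [mem_Icc] at hD
        have : NeZero D := ⟨by omega⟩
        dsimp only
        rw [sum_const, card_univ, ← Nat.card_eq_fintype_card, DirichletCharacter.card_eq_totient_of_hasEnoughRootsOfUnity, nsmul_eq_mul]
    _ ≤ ∑ D ∈ Icc 1 (QQ M), tau D^7/D * (Real.exp (0.245*L) * (20000 * (Real.exp (0.245*L) * Z) * (3*L)^6)) := by
        refine sum_le_sum fun D hD => ?_
        rw [mem_Icc] at hD
        have h1 : (D:ℝ) ≤ Real.exp (0.245*L) := by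
          have : (D:ℝ) ≤ QQ M := by exact_mod_cast hD.2
          exact this.trans (QQ_le M)
        have h2 : (D.totient:ℝ) ≤ Real.exp (0.245*L) := by
          have : (D.totient:ℝ) ≤ D := by exact_mod_cast Nat.totient_le D
          exact this.trans h1
        have := tau_nonneg D
        rw [mul_left_comm]
        gcongr
    _ ≤ L^J * (Real.exp (0.245*L) * (20000 * (Real.exp (0.245*L) * (2 * Real.exp (-(0.4919 * L)))) * (3*L)^6)) := by
        rw [← sum_mul]
        have h0 : 0 ≤ 1 + Real.log (QQ M) := by
          have := Real.log_natCast_nonneg (QQ M)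
          linarith
        refine mul_le_mul ((tau_moment_inv 7 (QQ M)).trans ?_) ?_ (by positivity) (by positivity)
        · rw [hJ]; exact pow_le_pow_left₀ h0 (logQ_le M hM) _
        · gcongr
    _ = 40000 * 3^6 * L^(J+6) * (Real.exp (0.245*L) * Real.exp (0.245*L) * Real.exp (-(0.4919 * L))) := by
        rw [pow_add]; ring
    _ ≤ _ := by
        apply mul_le_mul_of_nonneg_left _ (by positivity)
        rw [← Real.exp_add, ← Real.exp_add]
        exact Real.exp_le_exp.mpr (by linarith)

lemma twBC_summable {D : ℕ} (χ : DirichletCharacter ℂ D) (U V Y : ℕ) (z : ℂ) (hz : 1 < z.re) :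
    LSeriesSummable (tw (chn χ) (aB U V)) z ∧ LSeriesSummable (tw (chn χ) (aC U V Y)) z := by
  have hg := chn_le χ
  have hm := chn_mul χ
  have c1 := LSeries_crude_summable _ (tw_crude _ hg (trle U afL) (fun n => (trle_abs _ _ n).trans (afL_b1 n))) z hz
  have c2 := LSeries_crude_summable _ (tw_crude _ hg (trle V afM) (fun n => (trle_abs _ _ n).trans (afM_b1 n))) z hz
  have c3 := LSeries_crude_summable _ (tw_crude _ hg (trgt Y afZ) (fun n => (trgt_abs _ _ n).trans (afZ_b1 n))) z hz
  have c4 := LSeries_crude_summable _ (tw_crude _ hg (trgt Y afG) (fun n => (trgt_abs _ _ n).trans (afG_b1 n))) z hz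
  have c5 := LSeries_crude_summable _ (tw_crude _ hg (trgt U afL) (fun n => (trgt_abs _ _ n).trans (afL_b1 n))) z hz
  have c6 := LSeries_crude_summable _ (tw_crude2 _ hg (afZ * trgt V afM) (bco_abs V)) z hz
  constructor
  · unfold aB
    rw [tw_mul _ hm]
    exact ArithmeticFunction.LSeriesSummable_mul c5 c6
  · unfold aC
    rw [tw_mul _ hm, tw_sub, tw_mul _ hm]
    refine ArithmeticFunction.LSeriesSummable_mul ?_ c2
    have hfun : (fun n => (tw (chn χ) (trgt Y afG) - tw (chn χ) (trle U afL) * tw (chn χ) (trgt Y afZ)) n) =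
        (fun n => tw (chn χ) (trgt Y afG) n) - fun n => (tw (chn χ) (trle U afL) * tw (chn χ) (trgt Y afZ)) n := by
      funext n; rw [af_sub_apply]; rfl
    rw [hfun]
    exact c4.sub (ArithmeticFunction.LSeriesSummable_mul c1 c3)

lemma E_total : ∃ M0 : ℕ, ∀ M : ℕ, M0 ≤ M → ∀ z : ℂ, 1 + 1/(M:ℝ)^20 ≤ z.re → ‖z‖ ≤ 3 → ∀ Y : Finset (Σ D : ℕ, DirichletCharacter ℂ D),
    (∀ y ∈ Y, 0 < y.1 ∧ y.1 ≤ QQ M ∧ Squarefree y.1 ∧ Real.exp M < y.2.conductor) →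
    12 * (M:ℝ)^2 * ∑ y ∈ Y, tau y.1^7/y.1 * ‖LSeries (tw (chn y.2) (aB (UU M) (UU M) + aC (UU M) (UU M) (YY M))) z‖ ≤ Real.exp (-(0.9 * M)) := by
  obtain ⟨C, hC, hCb⟩ := delta_bound
  obtain ⟨J, hJ⟩ : ∃ J : ℕ, J = 2^7 := ⟨_, rfl⟩
  obtain ⟨M1, h1⟩ := ev_poly1 (12 * (C * 5^6 + 40000 * 3^6)) 0.095 (by norm_num) (2 + 20 * (J + 8))
  refine ⟨max M1 10, fun M hM z hz hz3 Y hY => ?_⟩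
  rw [max_le_iff] at hM
  have hM1 : (10:ℝ) ≤ M := by exact_mod_cast hM.2
  specialize h1 M hM.1
  have hLb := L_big M hM.2
  have hlq := logQ_le M hM.2
  have hnq := nlogQ_le M hM.2
  have hC2 := aC_total M hM.2 z hz hz3 Y (fun y hy => by
    obtain ⟨a, b, c, d⟩ := hY y hy
    refine ⟨a, b, fun h => ?_⟩
    have hne : NeZero y.1 := ⟨a.ne'⟩
    rw [h, DirichletCharacter.conductor_one] at d
    have := Real.add_one_le_exp (M:ℝ)
    push_cast at d
    linarith)
  rw [← hJ] at hC2
  set L := (M:ℝ)^20 with hL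
  have hL1 : 1 ≤ L := by linarith
  have hB2 := aB_total (QQ M) (UU M) (UU_one M) (Real.exp M) (Real.one_le_exp (by positivity)) (s := 1/L) (by positivity) (by
    rw [div_le_one (by linarith)]; exact hL1) z hz (C * L * Real.exp (-(0.995*M))) (by positivity) (hCb M hM.2) Y hY
  rw [← hJ] at hB2
  have hB3 : ∑ y ∈ Y, tau y.1^7/y.1 * ‖LSeries (tw (chn y.2) (aB (UU M) (UU M))) z‖ ≤ C * 5^6 * L^(J+8) * Real.exp (-(0.995*M)) := by
    refine hB2.trans ?_
    have h0 : 0 ≤ 1 + Real.log (QQ M) := by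
      have := Real.log_natCast_nonneg (QQ M)
      linarith
    have h4 : 1 + 4/(1/L) ≤ 5 * L := by
      have : 4/(1/L) = 4 * L := by field_simp
      linarith
    calc _ ≤ L^J * (L * (C * L * Real.exp (-(0.995*M)) * (5*L)^6)) := by
          gcongr
      _ = _ := by rw [pow_add]; ring
  have hsum : ∑ y ∈ Y, tau y.1^7/y.1 * ‖LSeries (tw (chn y.2) (aB (UU M) (UU M) + aC (UU M) (UU M) (YY M))) z‖ ≤
      C * 5^6 * L^(J+8) * Real.exp (-(0.995*M)) + 40000 * 3^6 * L^(J+6) * Real.exp (-(0.995*M)) := by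
    refine le_trans ?_ (add_le_add hB3 hC2)
    rw [← sum_add_distrib]
    refine sum_le_sum fun y hy => ?_
    rw [← mul_add]
    have := tau_nonneg y.1
    apply mul_le_mul_of_nonneg_left _ (by positivity)
    have hz1 : 1 < z.re := by
      have : 0 < 1/L := by positivity
      linarith
    obtain ⟨s1, s2⟩ := twBC_summable y.2 (UU M) (UU M) (YY M) z hz1
    rw [tw_add]
    have hfun : (⇑(tw (chn y.2) (aB (UU M) (UU M)) + tw (chn y.2) (aC (UU M) (UU M) (YY M))) : ℕ → ℂ) =
      ⇑(tw (chn y.2) (aB (UU M) (UU M))) + ⇑(tw (chn y.2) (aC (UU M) (UU M) (YY M))) := by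
      funext n; simp
    rw [hfun, LSeries_add s1 s2]
    exact norm_add_le _ _
  have hmono : L^(J+6) ≤ L^(J+8) := pow_le_pow_right₀ hL1 (by omega)
  calc _ ≤ 12 * (M:ℝ)^2 * (C * 5^6 * L^(J+8) * Real.exp (-(0.995*M)) + 40000 * 3^6 * L^(J+8) * Real.exp (-(0.995*M))) := by
        apply mul_le_mul_of_nonneg_left _ (by positivity)
        refine hsum.trans (add_le_add le_rfl ?_)
        exact mul_le_mul_of_nonneg_right (mul_le_mul_of_nonneg_left hmono (by norm_num)) (Real.exp_pos _).le
    _ = (12 * (C * 5^6 + 40000 * 3^6) * (M:ℝ)^(2 + 20*(J+8))) * Real.exp (-(0.995*M)) := by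
        rw [pow_add (M:ℝ) 2, pow_mul, ← hL]; ring
    _ ≤ Real.exp (0.095*M) * Real.exp (-(0.995*M)) := mul_le_mul_of_nonneg_right h1 (Real.exp_pos _).le
    _ = _ := by rw [← Real.exp_add]; congr 1; ring

lemma large_part : ∃ M0 : ℕ, ∀ M : ℕ, M0 ≤ M → ∀ Y : Finset (Σ D : ℕ, DirichletCharacter ℂ D),
    (∀ y ∈ Y, 0 < y.1 ∧ y.1 ≤ QQ M ∧ Squarefree y.1 ∧ Real.exp M < y.2.conductor) →
    ∑ y ∈ Y, tau y.1^7/y.1 * ‖chS (fun n => (aB (UU M) (UU M) + aC (UU M) (UU M) (YY M)) n * Wt M n) y.2‖ ≤ Nk M * Real.exp (-(0.9 * M)) := by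
  obtain ⟨M1, h1⟩ := E_total
  refine ⟨max M1 10, fun M hM Y hY => ?_⟩
  rw [max_le_iff] at hM
  have hM1 : (10:ℝ) ≤ M := by exact_mod_cast hM.2
  have hMp : (0:ℝ) < M := by linarith
  set E := Real.exp (-(0.9 * M)) / (12 * (M:ℝ)^2) with hE
  have hu : (1:ℝ)/(M:ℝ)^2 ≤ 1/100 := by
    apply one_div_le_one_div_of_le (by norm_num); nlinarith
  have hu0 : 0 < (1:ℝ)/(M:ℝ)^2 := by positivity
  have hv : (1:ℝ)/(M:ℝ)^18 ≤ 1 := by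
    rw [div_le_one (by positivity)]; exact one_le_pow₀ (by linarith)
  have hv0 : 0 < (1:ℝ)/(M:ℝ)^18 := by positivity
  set ρ := (1/(M:ℝ)^18) * (1 - 1/(M:ℝ)^2) with hρ
  have huv : 1/(M:ℝ)^20 = (1/(M:ℝ)^18) * (1/(M:ℝ)^2) := by
    rw [div_mul_div_comm, ← pow_add]; norm_num
  have hρ0 : 0 < ρ := mul_pos hv0 (by linarith)
  have hρe : 1 + 1/(M:ℝ)^18 - ρ = 1 + 1/(M:ℝ)^20 := by rw [huv, hρ]; ring
  have hρ1 : ρ ≤ 1 := by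
    rw [hρ]; nlinarith
  have hk := kderiv Y (fun y => tau y.1^7/y.1) (fun y _ => by have := tau_nonneg y.1; positivity)
    (fun y n => tw (chn y.2) (aB (UU M) (UU M) + aC (UU M) (UU M) (YY M)) n) (M^2) (1 + 1/(M:ℝ)^18) ρ E hρ0 (by
      rw [hρe]; have : 0 < 1/(M:ℝ)^20 := by positivity
      linarith) (fun y _ z hz => by
      obtain ⟨s1, s2⟩ := twBC_summable y.2 (UU M) (UU M) (YY M) z hz
      rw [tw_add]
      have hfun : (fun n => (tw (chn y.2) (aB (UU M) (UU M)) + tw (chn y.2) (aC (UU M) (UU M) (YY M))) n) =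
        (fun n => tw (chn y.2) (aB (UU M) (UU M)) n) + fun n => tw (chn y.2) (aC (UU M) (UU M) (YY M)) n := by
        funext n; simp
      rw [hfun]
      exact s1.add s2) (fun z hz => by
      rw [mem_sphere_iff_norm] at hz
      have hre : |(z - ((1 + 1/(M:ℝ)^18 : ℝ):ℂ)).re| ≤ ρ := by rw [← hz]; exact Complex.abs_re_le_norm _
      rw [Complex.sub_re, Complex.ofReal_re, abs_le] at hre
      have hn : ‖z‖ ≤ 3 := by
        calc ‖z‖ = ‖(z - ((1 + 1/(M:ℝ)^18 : ℝ):ℂ)) + ((1 + 1/(M:ℝ)^18 : ℝ):ℂ)‖ := by rw [sub_add_cancel]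
          _ ≤ ρ + |1 + 1/(M:ℝ)^18| := by
            refine (norm_add_le _ _).trans (add_le_add hz.le ?_)
            rw [Complex.norm_real]; rfl
          _ ≤ 3 := by rw [abs_of_pos (by linarith)]; linarith
      have := h1 M hM.1 z (by linarith) hn Y hY
      rw [hE, le_div_iff₀ (by positivity)]
      linarith)
  have hkf := kfac_bound M (by omega)
  rw [← hρ] at hkf
  calc _ = ∑ y ∈ Y, tau y.1^7/y.1 * ‖∑' n : ℕ, tw (chn y.2) (aB (UU M) (UU M) + aC (UU M) (UU M) (YY M)) n * (((Real.log n : ℝ) : ℂ) ^ (M^2) * (n:ℂ) ^ (-((1 + 1/(M:ℝ)^18 : ℝ):ℂ)))‖ := by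
        refine sum_congr rfl fun y _ => ?_
        congr 2
        unfold chS
        refine tsum_congr fun n => ?_
        rw [← Wt_cast, tw_apply]
        simp only [chn]
        push_cast
        ring
    _ ≤ _ := hk
    _ = ((M^2).factorial / ρ^(M^2)) * E := by ring
    _ ≤ (12 * (M:ℝ)^2 * Nk M) * E := mul_le_mul_of_nonneg_right hkf (by positivity)
    _ = _ := by rw [hE]; field_simp

end PSLSieve
end

section
open Finset
namespace PSLSieve

/-- error term -/
noncomputable def ED (M D : ℕ) : ℝ :=
  ∑ p ∈ (PI M).filter (fun p => D ∣ p^2-1), wt M p - 2^D.primeFactors.card / (D.totient:ℝ) * mass M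

/-- the moduli -/
noncomputable def mods (M l1 : ℕ) : Finset ℕ := (Icc 1 (QQ M)).filter (fun D => Squarefree D ∧ ¬ 2 ∣ D ∧ ¬ l1 ∣ D)

lemma sq_one_iff (D n : ℕ) (hn : 1 ≤ n) : (n : ZMod D)^2 = 1 ↔ D ∣ n^2-1 := by
  have h1 : 1 ≤ n^2 := Nat.one_le_pow _ _ hn
  rw [← ZMod.natCast_eq_zero_iff, Nat.cast_sub h1, sub_eq_zero]
  push_cast
  rfl

lemma triv_sum (M : ℕ) (hM : 1 ≤ M) (t : ℕ → ℝ) (S : Finset ℕ) (hS : ∀ D ∈ S, Squarefree D)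
    (h1 : Summable (fun n : ℕ => |t n| * Wt M n * 64 ^ (n^2-1).primeFactors.card)) :
    ∑ D ∈ S, tau D^5 * (∑' n : ℕ, (if (n : ZMod D) ^ 2 = 1 then |t n * Wt M n| else 0)) ≤
      ∑' n : ℕ, |t n| * Wt M n * 64 ^ (n^2-1).primeFactors.card := by
  classical
  obtain ⟨h2, h3⟩ := sum_tW t h1
  have hs : ∀ D ∈ S, Summable (fun n : ℕ => tau D^5 * (if (n : ZMod D) ^ 2 = 1 then |t n * Wt M n| else 0)) := by
    intro D _
    refine Summable.mul_left _ (Summable.of_nonneg_of_le (fun n => ?_) (fun n => ?_) h2.abs)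
    · split_ifs <;> positivity
    · split_ifs
      · exact le_rfl
      · positivity
  simp_rw [← tsum_mul_left]
  rw [← Summable.tsum_finsetSum hs]
  refine Summable.tsum_le_tsum (fun n => ?_) (summable_sum hs) h1
  rcases Nat.lt_or_ge n 2 with hn | hn
  · have hW : Wt M n = 0 := by
      have : M ≠ 0 := by omega
      unfold Wt
      interval_cases n <;> simp [this]
    simp [hW]
  · have hne : n^2-1 ≠ 0 := by
      have : 2^2 ≤ n^2 := Nat.pow_le_pow_left hn 2
      omega
    have hW := Wt_nonneg M n
    calc ∑ D ∈ S, tau D^5 * (if (n : ZMod D) ^ 2 = 1 then |t n * Wt M n| else 0)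
        = ∑ D ∈ S.filter (fun D => (n : ZMod D) ^ 2 = 1), 32^D.primeFactors.card * |t n * Wt M n| := by
          rw [sum_filter]
          refine sum_congr rfl fun D hD => ?_
          split_ifs
          · rw [tau_sq_free (hS D hD), ← pow_mul, mul_comm _ 5, pow_mul]; norm_num
          · simp
      _ ≤ ∑ D ∈ (n^2-1).divisors.filter Squarefree, 32^D.primeFactors.card * |t n * Wt M n| := by
          refine sum_le_sum_of_subset_of_nonneg ?_ fun _ _ _ => by positivity
          intro D hD
          rw [mem_filter] at hD ⊢
          exact ⟨Nat.mem_divisors.mpr ⟨(sq_one_iff D n (by omega)).mp hD.2, hne⟩, hS D hD.1⟩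
      _ = 33^(n^2-1).primeFactors.card * |t n * Wt M n| := by
          rw [← sum_mul, sum_sqfree_div hne]; norm_num
      _ ≤ 64^(n^2-1).primeFactors.card * |t n * Wt M n| := by
          gcongr; norm_num
      _ = _ := by rw [abs_mul, abs_of_nonneg hW]; ring

lemma sqc_ratio (D : ℕ) (hD : Squarefree D) (h2 : ¬ 2 ∣ D) : tau D^5 * ((sqc D : ℝ)/D.totient) ≤ tau D^7/D := by
  have h0 := hD.ne_zero
  have hp : (0:ℝ) < D := by exact_mod_cast Nat.pos_of_ne_zero h0
  have hφ : (0:ℝ) < D.totient := by exact_mod_cast Nat.totient_pos.mpr (Nat.pos_of_ne_zero h0)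
  have ht := tau_nonneg D
  have e : (sqc D : ℝ) = tau D := by rw [sqc_eq D hD h2, tau_sq_free hD]; push_cast; rfl
  rw [e, ← mul_div_assoc, div_le_div_iff₀ hφ hp]
  calc tau D^5 * tau D * D ≤ tau D^5 * tau D * (tau D * D.totient) := by
        have := totient_mul_tau D h0
        gcongr
    _ = _ := by ring

lemma ED_eq (M D : ℕ) (hD : Squarefree D) (h2 : ¬ 2 ∣ D) :
    ED M D = (∑' n : ℕ, (if (n : ZMod D) ^ 2 = 1 then g0 M n else 0)) - (sqc D : ℝ) / D.totient * ∑' n, g0 M n := by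
  classical
  unfold ED
  rw [g0_tsum, sqc_eq D hD h2]
  congr 1
  · rw [tsum_eq_sum (s := PI M) fun n hn => by simp [g0, a0, hn], sum_filter]
    refine sum_congr rfl fun p hp => ?_
    have hpp := ((mem_PI M p).mp hp).1
    rw [if_congr (sq_one_iff D p hpp.one_le) rfl rfl]
    simp [g0, a0, hp, wt]
  · push_cast; rfl

theorem BV : ∃ M0 : ℕ, ∀ M : ℕ, M0 ≤ M → ∃ l1 : ℕ, l1.Prime ∧
    ∑ D ∈ mods M l1, tau D^5 * |ED M D| ≤ Nk M * Real.exp (-(M/2)) := by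
  classical
  obtain ⟨J, hJ⟩ : ∃ J : ℕ, J = 2^7 := ⟨_, rfl⟩
  obtain ⟨M1, h1⟩ := small_part
  obtain ⟨M2, h2⟩ := tail_bound
  obtain ⟨M3, h3⟩ := large_part
  obtain ⟨M4, h4⟩ := ev_poly1 7 0.4 (by norm_num) (20 * J)
  refine ⟨max (max M1 M2) (max (max M3 M4) 10), fun M hM => ?_⟩
  simp only [max_le_iff] at hM
  obtain ⟨l1, hl1, hsm⟩ := h1 M hM.1.1
  refine ⟨l1, hl1, ?_⟩
  have hM10 := hM.2.2
  have hM1 : (10:ℝ) ≤ M := by exact_mod_cast hM10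
  specialize h3 M hM.2.1.1
  specialize h4 M hM.2.1.2
  have hLb := L_big M hM10
  have hlq := logQ_le M hM10
  set t : ℕ → ℝ := fun n => afL n - aA (UU M) (UU M) (YY M) n - a0 M n with ht
  obtain ⟨hts, htb⟩ := h2 M hM.1.2 t
    (fun n => (t2_hyp M (UU M) (UU M) (YY M) n (UU_one M) (UU_one M) (YY_one M) (UVY_le M)).1)
    (fun n => (t2_hyp M (UU M) (UU M) (YY M) n (UU_one M) (UU_one M) (YY_one M) (UVY_le M)).2)
  obtain ⟨hs1, hs2⟩ := sum_tW t hts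
  have hNk : 0 ≤ Nk M := by unfold Nk; positivity
  set g1 : ℕ → ℝ := fun n => (aB (UU M) (UU M) + aC (UU M) (UU M) (YY M)) n * Wt M n with hg1
  have hg : ∀ n, g1 n = g0 M n + t n * Wt M n := by
    intro n
    have hv := congrArg (fun f : ArithmeticFunction ℝ => f n) (vaughan (UU M) (UU M) (YY M))
    simp only [ArithmeticFunction.add_apply] at hv
    simp only [hg1, ht, g0, ArithmeticFunction.add_apply]
    rw [hv]; ring
  let A : (D : ℕ) → Finset (DirichletCharacter ℂ D) := fun D => univ.filter (fun χ => χ ≠ 1 ∧ (χ.conductor:ℝ) ≤ Real.exp M)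
  let B : (D : ℕ) → Finset (DirichletCharacter ℂ D) := fun D => univ.filter (fun χ => χ ≠ 1 ∧ ¬ (χ.conductor:ℝ) ≤ Real.exp M)
  have hmem : ∀ D ∈ mods M l1, (1 ≤ D ∧ D ≤ QQ M) ∧ Squarefree D ∧ ¬ 2 ∣ D ∧ ¬ l1 ∣ D := by
    intro D hD
    simpa only [mods, mem_filter, mem_Icc] using hD
  set e10 := Real.exp (-(10*(M:ℝ))) with he10
  set T := ∑' n, |t n * Wt M n| with hT
  have hTb : T ≤ Nk M * e10 := hs2.trans htb
  have hT0 : 0 ≤ T := tsum_nonneg fun n => abs_nonneg _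
  set E2 := (Real.exp (M:ℝ))^2 with hE2
  have hE2p : 0 ≤ E2 := by positivity
  have hD : ∀ D ∈ mods M l1, tau D^5 * |ED M D| ≤ tau D^7/D * (E2 * (2 * Nk M * e10)) +
      tau D^7/D * ∑ χ ∈ B D, ‖chS g1 χ‖ + tau D^5 * (∑' n : ℕ, (if (n : ZMod D) ^ 2 = 1 then |t n * Wt M n| else 0)) +
      tau D^7/D * ((E2 + 1) * (Nk M * e10)) := by
    intro D hD
    obtain ⟨⟨hD1, hDQ⟩, hsq, h2D, hlD⟩ := hmem D hD
    have hne : NeZero D := ⟨by omega⟩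
    have hDe : (D:ℝ) < Real.exp (0.99 * (M:ℝ)^20) := by
      have : (D:ℝ) ≤ QQ M := by exact_mod_cast hDQ
      refine (this.trans (QQ_le M)).trans_lt (Real.exp_lt_exp.mpr (by linarith))
    have hr := sqc_ratio D hsq h2D
    have ht0 := tau_nonneg D
    have hb := ED_bound D (g0 M) (fun n => t n * Wt M n) g1 (g0_summable M) hs1 hg (fun n hn => by
      have hn2 : n ∈ PI M := by
        by_contra h
        exact hn (by simp [g0, a0, h])
      obtain ⟨hp, hI, _⟩ := (mem_PI M n).mp hn2
      rw [hp.coprime_iff_not_dvd]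
      intro hdv
      have h5 : (n:ℝ) ≤ D := by exact_mod_cast Nat.le_of_dvd (by omega) hdv
      have h6 : Real.exp (0.99 * (M:ℝ)^20) < n := by
        rwa [← Real.lt_log_iff_exp_lt (by exact_mod_cast hp.pos)]
      linarith) (A D) (B D) (by simp [A]) (by intro χ; simp only [A, B, mem_filter, mem_univ, true_and]; tauto)
    rw [← ED_eq M D hsq h2D] at hb
    have hcard : ((A D).card : ℝ) ≤ E2 := card_small D _ (Real.exp_pos _).le (A D) (fun χ hχ => by
      simp only [A, mem_filter] at hχ; exact hχ.2.2)
    have hsA : ∑ χ ∈ A D, ‖chS (g0 M) χ‖ ≤ E2 * (2 * Nk M * e10) := by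
      calc ∑ χ ∈ A D, ‖chS (g0 M) χ‖ ≤ ∑ χ ∈ A D, (2 * Nk M * e10) := by
            refine sum_le_sum fun χ hχ => ?_
            simp only [A, mem_filter] at hχ
            exact hsm D hne hlD hDe χ hχ.2.1 hχ.2.2
        _ = (A D).card * (2 * Nk M * e10) := by rw [sum_const, nsmul_eq_mul]
        _ ≤ _ := by gcongr
    have hB0 : 0 ≤ ∑ χ ∈ B D, ‖chS g1 χ‖ := sum_nonneg fun _ _ => norm_nonneg _
    calc tau D^5 * |ED M D| ≤ _ := mul_le_mul_of_nonneg_left hb (by positivity)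
      _ = (tau D^5 * ((sqc D : ℝ)/D.totient)) * ∑ χ ∈ A D, ‖chS (g0 M) χ‖ + (tau D^5 * ((sqc D : ℝ)/D.totient)) * ∑ χ ∈ B D, ‖chS g1 χ‖
          + tau D^5 * (∑' n : ℕ, (if (n : ZMod D) ^ 2 = 1 then |t n * Wt M n| else 0)) + (tau D^5 * ((sqc D : ℝ)/D.totient)) * (((A D).card + 1) * T) := by
          ring
      _ ≤ _ := by
          have hq : 0 ≤ tau D^7/D := by positivity
          have i1 : (tau D^5 * ((sqc D : ℝ)/D.totient)) * ∑ χ ∈ A D, ‖chS (g0 M) χ‖ ≤ tau D^7/D * (E2 * (2 * Nk M * e10)) :=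
            mul_le_mul hr hsA (sum_nonneg fun _ _ => norm_nonneg _) hq
          have i2 : (tau D^5 * ((sqc D : ℝ)/D.totient)) * ∑ χ ∈ B D, ‖chS g1 χ‖ ≤ tau D^7/D * ∑ χ ∈ B D, ‖chS g1 χ‖ :=
            mul_le_mul_of_nonneg_right hr hB0
          have i3 : (tau D^5 * ((sqc D : ℝ)/D.totient)) * (((A D).card + 1) * T) ≤ tau D^7/D * ((E2 + 1) * (Nk M * e10)) :=
            mul_le_mul hr (mul_le_mul (by linarith) hTb hT0 (by linarith)) (by positivity) hq
          linarith
  have hmom : ∑ D ∈ mods M l1, tau D^7/D ≤ ((M:ℝ)^20)^J := by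
    have h0 : 0 ≤ 1 + Real.log (QQ M) := by
      have := Real.log_natCast_nonneg (QQ M)
      linarith
    calc ∑ D ∈ mods M l1, tau D^7/D ≤ ∑ D ∈ Icc 1 (QQ M), tau D^7/D :=
          sum_le_sum_of_subset_of_nonneg (filter_subset _ _) fun D _ _ => by have := tau_nonneg D; positivity
      _ ≤ _ := tau_moment_inv 7 (QQ M)
      _ ≤ _ := by rw [hJ]; exact pow_le_pow_left₀ h0 hlq _
  have hlarge : ∑ D ∈ mods M l1, tau D^7/D * ∑ χ ∈ B D, ‖chS g1 χ‖ ≤ Nk M * Real.exp (-(0.9 * M)) := by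
    have := h3 ((mods M l1).sigma B) (fun y hy => by
      rw [mem_sigma] at hy
      obtain ⟨⟨hD1, hDQ⟩, hsq, h2D, hlD⟩ := hmem _ hy.1
      have h6 := hy.2
      simp only [B, mem_filter, not_le] at h6
      exact ⟨hD1, hDQ, hsq, h6.2.2⟩)
    rw [sum_sigma] at this
    simp_rw [mul_sum]
    exact this
  have htriv := triv_sum M (by omega) t (mods M l1) (fun D hD => (hmem D hD).2.1) hts
  have hE : E2 * e10 = Real.exp (-(8*(M:ℝ))) := by
    rw [hE2, he10, ← Real.exp_nat_mul, ← Real.exp_add]; congr 1; push_cast; ring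
  have hsplit := sum_le_sum hD
  rw [sum_add_distrib, sum_add_distrib, sum_add_distrib, ← sum_mul, ← sum_mul] at hsplit
  set P := ((M:ℝ)^20)^J with hP
  have hP1 : 1 ≤ P := one_le_pow₀ (one_le_pow₀ (by linarith))
  have f1 : (∑ D ∈ mods M l1, tau D^7/D) * (E2 * (2 * Nk M * e10)) ≤ P * (E2 * (2 * Nk M * e10)) :=
    mul_le_mul_of_nonneg_right hmom (by positivity)
  have f2 : (∑ D ∈ mods M l1, tau D^7/D) * ((E2 + 1) * (Nk M * e10)) ≤ P * ((E2 + 1) * (Nk M * e10)) :=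
    mul_le_mul_of_nonneg_right hmom (by positivity)
  have hE1 : 1 ≤ E2 := one_le_pow₀ (Real.one_le_exp (by positivity))
  have e9 : Real.exp (-(8*(M:ℝ))) ≤ Real.exp (-(0.9*(M:ℝ))) := Real.exp_le_exp.mpr (by linarith)
  have he10E : e10 ≤ E2 * e10 := le_mul_of_one_le_left (Real.exp_pos _).le hE1
  have hfin : ∑ D ∈ mods M l1, tau D^5 * |ED M D| ≤ Nk M * (6 * P * Real.exp (-(0.9*(M:ℝ)))) := by
    set x := Real.exp (-(0.9*(M:ℝ))) with hx
    have hx0 : 0 < x := Real.exp_pos _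
    have g1 : P * (E2 * (2 * Nk M * e10)) ≤ 2 * (Nk M * (P * x)) := by
      calc P * (E2 * (2 * Nk M * e10)) = 2 * (Nk M * (P * (E2 * e10))) := by ring
        _ ≤ _ := by rw [hE]; gcongr
    have g2 : P * ((E2 + 1) * (Nk M * e10)) ≤ 2 * (Nk M * (P * x)) := by
      calc P * ((E2 + 1) * (Nk M * e10)) = Nk M * (P * (E2 * e10)) + Nk M * (P * e10) := by ring
        _ ≤ Nk M * (P * x) + Nk M * (P * x) := by
            have : e10 ≤ x := by rw [hE] at he10E; exact he10E.trans e9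
            rw [hE]; gcongr
        _ = _ := by ring
    have g3 : Nk M * e10 ≤ Nk M * (P * x) := by
      apply mul_le_mul_of_nonneg_left _ hNk
      have : e10 ≤ x := by rw [hE] at he10E; exact he10E.trans e9
      nlinarith
    have g4 : Nk M * x ≤ Nk M * (P * x) := by
      apply mul_le_mul_of_nonneg_left _ hNk
      nlinarith
    have : Nk M * (6 * P * x) = 6 * (Nk M * (P * x)) := by ring
    rw [this]
    linarith
  refine hfin.trans (mul_le_mul_of_nonneg_left ?_ hNk)
  calc 6 * P * Real.exp (-(0.9*(M:ℝ))) ≤ Real.exp (0.4 * M) * Real.exp (-(0.9*(M:ℝ))) := by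
        apply mul_le_mul_of_nonneg_right _ (Real.exp_pos _).le
        rw [pow_mul, ← hP] at h4
        linarith
    _ = _ := by rw [← Real.exp_add]; congr 1; ring

end PSLSieve
end

section
open Finset
namespace PSLSieve

/-- expectation over random subsets -/
noncomputable def Ex (P : Finset ℕ) (g : ℕ → ℝ) (f : Finset ℕ → ℝ) : ℝ :=
  ∑ N ∈ P.powerset, (∏ l ∈ N, g l) * (∏ l ∈ P \ N, (1 - g l)) * f N

lemma Ex_prod (P : Finset ℕ) (g a b : ℕ → ℝ) :
    Ex P g (fun N => ∏ l ∈ P, if l ∈ N then a l else b l) = ∏ l ∈ P, (g l * a l + (1 - g l) * b l) := by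
  rw [Finset.prod_add]
  unfold Ex
  refine sum_congr rfl fun N hN => ?_
  rw [mem_powerset] at hN
  have : ∏ l ∈ P, (if l ∈ N then a l else b l) = (∏ l ∈ N, a l) * ∏ l ∈ P \ N, b l := by
    rw [← prod_sdiff hN, mul_comm]
    congr 1
    · exact prod_congr rfl fun l hl => by simp [hl]
    · exact prod_congr rfl fun l hl => by simp [(mem_sdiff.mp hl).2]
  dsimp only
  rw [this, prod_mul_distrib, prod_mul_distrib]
  ring

/-- orthogonal basis -/
noncomputable def psi (h : ℕ → ℝ) (r N : Finset ℕ) : ℝ := ∏ l ∈ r, if l ∈ N then -1 else h l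

lemma prod_sub_eq {P r : Finset ℕ} (hr : r ⊆ P) (f : ℕ → ℝ) : ∏ l ∈ r, f l = ∏ l ∈ P, if l ∈ r then f l else 1 := by
  rw [prod_ite_mem, inter_eq_right.mpr hr]

lemma Ex_psi (P : Finset ℕ) (g h : ℕ → ℝ) (hgh : ∀ l ∈ P, g l * (1 + h l) = h l) (Z r s : Finset ℕ) (hZ : Z ⊆ P)
    (hr : r ⊆ P) (hs : s ⊆ P) (hrZ : Disjoint r Z) (hsZ : Disjoint s Z) :
    Ex P g (fun N => (if Z ⊆ N then 1 else 0) * (psi h r N * psi h s N)) =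
      if r = s then (∏ l ∈ Z, g l) * ∏ l ∈ r, h l else 0 := by
  have e : (fun N : Finset ℕ => (if Z ⊆ N then (1:ℝ) else 0) * (psi h r N * psi h s N)) =
      fun N => ∏ l ∈ P, if l ∈ N then ((if l ∈ r then -1 else 1) * (if l ∈ s then -1 else 1) : ℝ)
        else ((if l ∈ Z then 0 else 1) * ((if l ∈ r then h l else 1) * (if l ∈ s then h l else 1)) : ℝ) := by
    funext N
    have hz : (if Z ⊆ N then (1:ℝ) else 0) = ∏ l ∈ Z, if l ∈ N then 1 else 0 := by
      split_ifs with hh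
      · exact (prod_eq_one fun l hl => by simp [hh hl]).symm
      · rw [not_subset] at hh
        obtain ⟨l, hl, hl2⟩ := hh
        exact (prod_eq_zero hl (by simp [hl2])).symm
    rw [hz, psi, psi, prod_sub_eq hZ, prod_sub_eq hr, prod_sub_eq hs, ← prod_mul_distrib, ← prod_mul_distrib]
    refine prod_congr rfl fun l _ => ?_
    by_cases h1 : l ∈ N <;> by_cases h2 : l ∈ Z <;> by_cases h3 : l ∈ r <;> by_cases h4 : l ∈ s <;> simp [h1, h2, h3, h4]
  rw [e, Ex_prod]
  split_ifs with hrs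
  · subst hrs
    rw [prod_sub_eq hZ, prod_sub_eq hr, ← prod_mul_distrib]
    refine prod_congr rfl fun l hl => ?_
    have := hgh l hl
    by_cases h2 : l ∈ Z
    · have h3 : l ∉ r := fun h => disjoint_left.mp hrZ h h2
      simp [h2, h3]
    · by_cases h3 : l ∈ r
      · simp [h2, h3]; linear_combination (1 - h l) * this
      · simp [h2, h3]
  · obtain ⟨l, hl⟩ : ∃ l, ¬ (l ∈ r ↔ l ∈ s) := by
      by_contra hh
      push Not at hh
      exact hrs (ext hh)
    have hlP : l ∈ P := by
      by_cases h3 : l ∈ r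
      · exact hr h3
      · by_cases h4 : l ∈ s
        · exact hs h4
        · exact absurd (by simp [h3, h4]) hl
    apply prod_eq_zero hlP
    have := hgh l hlP
    by_cases h3 : l ∈ r
    · have h4 : l ∉ s := fun h => hl (by simp [h, h3])
      have h2 : l ∉ Z := fun h => disjoint_left.mp hrZ h3 h
      simp [h2, h3, h4]; linear_combination -this
    · have h4 : l ∈ s := by tauto
      have h2 : l ∉ Z := fun h => disjoint_left.mp hsZ h4 h
      simp [h2, h3, h4]; linear_combination -this

/-- the sieve function -/
noncomputable def FF (P : Finset ℕ) (h : ℕ → ℝ) (y : Finset ℕ → ℝ) (N : Finset ℕ) : ℝ :=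
  ∑ r ∈ P.powerset, y r * psi h r N

lemma Ex_sum {ι : Type*} (P : Finset ℕ) (g : ℕ → ℝ) (S : Finset ι) (f : ι → Finset ℕ → ℝ) :
    Ex P g (fun N => ∑ i ∈ S, f i N) = ∑ i ∈ S, Ex P g (f i) := by
  unfold Ex
  rw [sum_comm]
  exact sum_congr rfl fun N _ => by rw [mul_sum]

lemma Ex_smul (P : Finset ℕ) (g : ℕ → ℝ) (c : ℝ) (f : Finset ℕ → ℝ) :
    Ex P g (fun N => c * f N) = c * Ex P g f := by
  unfold Ex
  rw [mul_sum]
  exact sum_congr rfl fun N _ => by ring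

lemma Ex_FF (P : Finset ℕ) (g h : ℕ → ℝ) (hgh : ∀ l ∈ P, g l * (1 + h l) = h l) (Z : Finset ℕ) (hZ : Z ⊆ P)
    (y : Finset ℕ → ℝ) (hy : ∀ r, ¬ Disjoint r Z → y r = 0) :
    Ex P g (fun N => (if Z ⊆ N then 1 else 0) * FF P h y N ^ 2) = (∏ l ∈ Z, g l) * ∑ r ∈ P.powerset, (∏ l ∈ r, h l) * y r ^ 2 := by
  have e : (fun N : Finset ℕ => (if Z ⊆ N then (1:ℝ) else 0) * FF P h y N ^ 2) = fun N => ∑ r ∈ P.powerset, ∑ s ∈ P.powerset,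
      (y r * y s) * ((if Z ⊆ N then 1 else 0) * (psi h r N * psi h s N)) := by
    funext N
    rw [pow_two, FF, sum_mul_sum, mul_sum]
    refine sum_congr rfl fun r _ => ?_
    rw [mul_sum]
    exact sum_congr rfl fun s _ => by ring
  rw [e, Ex_sum, mul_sum]
  refine sum_congr rfl fun r hr => ?_
  rw [Ex_sum]
  simp_rw [Ex_smul]
  by_cases h1 : Disjoint r Z
  · rw [sum_eq_single r]
    · rw [Ex_psi P g h hgh Z r r hZ (mem_powerset.mp hr) (mem_powerset.mp hr) h1 h1, if_pos rfl]
      ring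
    · intro s hs hsr
      by_cases h2 : Disjoint s Z
      · rw [Ex_psi P g h hgh Z r s hZ (mem_powerset.mp hr) (mem_powerset.mp hs) h1 h2, if_neg (Ne.symm hsr), mul_zero]
      · rw [hy s h2]; ring
    · intro h; exact absurd hr h
  · rw [hy r h1]; simp

/-- reduced vector -/
noncomputable def yq (y : Finset ℕ → ℝ) (q : ℕ) (r : Finset ℕ) : ℝ := if q ∈ r then 0 else y r - y (insert q r)

lemma FF_q (P : Finset ℕ) (h : ℕ → ℝ) (y : Finset ℕ → ℝ) (q : ℕ) (hq : q ∈ P) (N : Finset ℕ) (hN : q ∈ N) :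
    FF P h y N = FF P h (yq y q) N := by
  unfold FF
  have hP : P = insert q (P.erase q) := (insert_erase hq).symm
  have hni : q ∉ P.erase q := notMem_erase q P
  rw [hP, sum_powerset_insert hni, sum_powerset_insert hni, ← sum_add_distrib, ← sum_add_distrib]
  refine sum_congr rfl fun r hr => ?_
  have hqr : q ∉ r := fun hh => hni (mem_powerset.mp hr hh)
  have : psi h (insert q r) N = - psi h r N := by
    unfold psi
    rw [prod_insert hqr, if_pos hN]; ring
  simp only [yq, this, hqr, if_false, mem_insert_self, if_true]
  ring

lemma Ex_q (P : Finset ℕ) (g h : ℕ → ℝ) (hgh : ∀ l ∈ P, g l * (1 + h l) = h l) (q : ℕ) (hq : q ∈ P) (y : Finset ℕ → ℝ) :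
    Ex P g (fun N => (if {q} ⊆ N then 1 else 0) * FF P h y N ^ 2) = g q * ∑ r ∈ P.powerset, (∏ l ∈ r, h l) * yq y q r ^ 2 := by
  have := Ex_FF P g h hgh {q} (by simpa using hq) (yq y q) (fun r hr => by
    rw [disjoint_singleton_right, not_not] at hr
    simp [yq, hr])
  rw [prod_singleton] at this
  rw [← this]
  congr 1
  funext N
  by_cases h1 : {q} ⊆ N
  · rw [FF_q P h y q hq N (by simpa using h1)]
  · simp [h1]

/-- sieve weights -/
noncomputable def lam (P : Finset ℕ) (g h : ℕ → ℝ) (y : Finset ℕ → ℝ) (d : Finset ℕ) : ℝ :=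
  (∏ l ∈ d, (-(g l)⁻¹)) * ∑ r ∈ P.powerset, if d ⊆ r then (∏ l ∈ r, h l) * y r else 0

lemma FF_lam (P : Finset ℕ) (g h : ℕ → ℝ) (hgh : ∀ l ∈ P, g l * (1 + h l) = h l) (hg : ∀ l ∈ P, g l ≠ 0)
    (y : Finset ℕ → ℝ) (N : Finset ℕ) :
    FF P h y N = ∑ d ∈ P.powerset, lam P g h y d * (if d ⊆ N then 1 else 0) := by
  unfold lam
  simp_rw [mul_sum, sum_mul]
  rw [sum_comm]
  unfold FF
  refine sum_congr rfl fun r hr => ?_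
  rw [mem_powerset] at hr
  have h1 : ∑ d ∈ P.powerset, (∏ l ∈ d, (-(g l)⁻¹)) * (if d ⊆ r then (∏ l ∈ r, h l) * y r else 0) * (if d ⊆ N then 1 else 0)
      = ∑ d ∈ (r ∩ N).powerset, (∏ l ∈ d, (-(g l)⁻¹)) * ((∏ l ∈ r, h l) * y r) := by
    have hsub : (r ∩ N).powerset ⊆ P.powerset := powerset_mono.mpr (inter_subset_left.trans hr)
    rw [← sum_subset hsub]
    · refine sum_congr rfl fun d hd => ?_
      rw [mem_powerset, subset_inter_iff] at hd
      simp [hd.1, hd.2]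
    · intro d _ hd
      rw [mem_powerset, subset_inter_iff, not_and_or] at hd
      rcases hd with hd | hd <;> simp [hd]
  rw [h1, ← sum_mul]
  have h2 : ∑ d ∈ (r ∩ N).powerset, ∏ l ∈ d, (-(g l)⁻¹) = ∏ l ∈ r ∩ N, (1 + (-(g l)⁻¹)) := by
    rw [prod_one_add]
  rw [h2]
  have h3 : psi h r N = (∏ l ∈ r ∩ N, (1 + (-(g l)⁻¹))) * ∏ l ∈ r, h l := by
    have : ∏ l ∈ r ∩ N, (1 + (-(g l)⁻¹)) = ∏ l ∈ r, if l ∈ N then (1 + (-(g l)⁻¹)) else 1 := by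
      rw [prod_ite_mem]
    rw [this, ← prod_mul_distrib, psi]
    refine prod_congr rfl fun l hl => ?_
    split_ifs
    · have a := hgh l (hr hl)
      have b := hg l (hr hl)
      field_simp
      linear_combination -a
    · ring
  rw [h3]; ring

lemma Ex_ind (P : Finset ℕ) (g h : ℕ → ℝ) (hgh : ∀ l ∈ P, g l * (1 + h l) = h l) (D : Finset ℕ) (hD : D ⊆ P) :
    Ex P g (fun N => if D ⊆ N then 1 else 0) = ∏ l ∈ D, g l := by
  have := Ex_psi P g h hgh D ∅ ∅ hD (empty_subset _) (empty_subset _) (disjoint_empty_left _) (disjoint_empty_left _)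
  simpa [psi] using this

lemma sq_expand (P : Finset ℕ) (g h : ℕ → ℝ) (hgh : ∀ l ∈ P, g l * (1 + h l) = h l) (hg : ∀ l ∈ P, g l ≠ 0)
    (y : Finset ℕ → ℝ) (Z N : Finset ℕ) :
    (if Z ⊆ N then 1 else 0) * FF P h y N ^ 2 =
      ∑ d ∈ P.powerset, ∑ e ∈ P.powerset, (lam P g h y d * lam P g h y e) * (if d ∪ e ∪ Z ⊆ N then 1 else 0) := by
  rw [FF_lam P g h hgh hg, pow_two, sum_mul_sum, mul_sum]
  refine sum_congr rfl fun d _ => ?_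
  rw [mul_sum]
  refine sum_congr rfl fun e _ => ?_
  by_cases h1 : d ⊆ N <;> by_cases h2 : e ⊆ N <;> by_cases h3 : Z ⊆ N <;> simp [union_subset_iff, h1, h2, h3]

lemma sieve_id {ι : Type*} (S : Finset ι) (w : ι → ℝ) (Np : ι → Finset ℕ) (P : Finset ℕ) (g h : ℕ → ℝ)
    (hgh : ∀ l ∈ P, g l * (1 + h l) = h l) (hg : ∀ l ∈ P, g l ≠ 0) (mm : ℝ) (Er : Finset ℕ → ℝ)
    (hEr : ∀ D ⊆ P, ∑ p ∈ S, w p * (if D ⊆ Np p then 1 else 0) = (∏ l ∈ D, g l) * mm + Er D)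
    (y : Finset ℕ → ℝ) (Z : Finset ℕ) (hZ : Z ⊆ P) :
    ∑ p ∈ S, w p * ((if Z ⊆ Np p then 1 else 0) * FF P h y (Np p) ^ 2) =
      mm * Ex P g (fun N => (if Z ⊆ N then 1 else 0) * FF P h y N ^ 2) +
      ∑ d ∈ P.powerset, ∑ e ∈ P.powerset, (lam P g h y d * lam P g h y e) * Er (d ∪ e ∪ Z) := by
  simp_rw [sq_expand P g h hgh hg]
  simp_rw [Ex_sum, Ex_smul, mul_sum]
  rw [sum_comm, ← sum_add_distrib]
  refine sum_congr rfl fun d hd => ?_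
  rw [sum_comm, ← sum_add_distrib]
  refine sum_congr rfl fun e he => ?_
  have hsub : d ∪ e ∪ Z ⊆ P := union_subset (union_subset (mem_powerset.mp hd) (mem_powerset.mp he)) hZ
  rw [Ex_ind P g h hgh _ hsub]
  have := hEr _ hsub
  calc ∑ p ∈ S, w p * ((lam P g h y d * lam P g h y e) * (if d ∪ e ∪ Z ⊆ Np p then 1 else 0))
      = (lam P g h y d * lam P g h y e) * ∑ p ∈ S, w p * (if d ∪ e ∪ Z ⊆ Np p then 1 else 0) := by
        rw [mul_sum]; exact sum_congr rfl fun p _ => by ring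
    _ = _ := by rw [this]; ring

end PSLSieve
end

section
open Finset
namespace PSLSieve

noncomputable def gq (l : ℕ) : ℝ := 2 / ((l:ℝ) - 1)
noncomputable def hq (l : ℕ) : ℝ := 2 / ((l:ℝ) - 3)

lemma mertens1 (n : ℕ) (hn : 1 ≤ n) :
    ∑ p ∈ (Icc 1 n).filter Nat.Prime, Real.log p / p ≤ Real.log n + Real.log 4 := by
  have hn0 : (0:ℝ) < n := by exact_mod_cast hn
  have h1 : ∑ p ∈ (Icc 1 n).filter Nat.Prime, Real.log p * ((n / p : ℕ):ℝ) ≤ n * Real.log n := by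
    calc ∑ p ∈ (Icc 1 n).filter Nat.Prime, Real.log p * ((n / p : ℕ):ℝ)
        = ∑ p ∈ (Icc 1 n).filter Nat.Prime, ∑ k ∈ Ioc 0 n, if p ∣ k then Real.log p else 0 := by
          refine sum_congr rfl fun p _ => ?_
          rw [← sum_filter, sum_const, Nat.Ioc_filter_dvd_card_eq_div, nsmul_eq_mul, mul_comm]
      _ = ∑ k ∈ Ioc 0 n, ∑ p ∈ (Icc 1 n).filter Nat.Prime, if p ∣ k then Real.log p else 0 := sum_comm
      _ ≤ ∑ k ∈ Ioc 0 n, Real.log n := by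
          refine sum_le_sum fun k hk => ?_
          rw [mem_Ioc] at hk
          rw [← sum_filter]
          have e : ((Icc 1 n).filter Nat.Prime).filter (fun p => p ∣ k) = k.primeFactors := by
            ext p
            simp only [mem_filter, mem_Icc, Nat.mem_primeFactors]
            constructor
            · rintro ⟨⟨_, h⟩, h2⟩; exact ⟨h, h2, by omega⟩
            · rintro ⟨h, h2, _⟩; exact ⟨⟨⟨h.one_le, (Nat.le_of_dvd hk.1 h2).trans hk.2⟩, h⟩, h2⟩
          rw [e, ← Real.log_prod (fun p hp => by
            have := (Nat.prime_of_mem_primeFactors hp).pos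
            positivity)]
          have hd : ∏ p ∈ k.primeFactors, p ≤ n := (Nat.le_of_dvd hk.1 (Nat.prod_primeFactors_dvd k)).trans hk.2
          apply Real.log_le_log
          · exact prod_pos fun p hp => by exact_mod_cast (Nat.prime_of_mem_primeFactors hp).pos
          · rw [← Nat.cast_prod]; exact_mod_cast hd
      _ = n * Real.log n := by simp
  have h2 : ∑ p ∈ (Icc 1 n).filter Nat.Prime, Real.log p ≤ Real.log 4 * n := by
    have := Chebyshev.theta_le_log4_mul_x (x := (n:ℝ)) hn0.le
    rw [Chebyshev.theta, Nat.floor_natCast] at this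
    exact this
  have h3 : n * ∑ p ∈ (Icc 1 n).filter Nat.Prime, Real.log p / p ≤ n * (Real.log n + Real.log 4) := by
    calc n * ∑ p ∈ (Icc 1 n).filter Nat.Prime, Real.log p / p
        ≤ ∑ p ∈ (Icc 1 n).filter Nat.Prime, (Real.log p * ((n / p : ℕ):ℝ) + Real.log p) := by
          rw [mul_sum]
          refine sum_le_sum fun p hp => ?_
          rw [mem_filter] at hp
          have hp0 : (0:ℝ) < p := by exact_mod_cast hp.2.pos
          have hl := Real.log_natCast_nonneg p
          have : (n:ℝ)/p ≤ ((n / p : ℕ):ℝ) + 1 := by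
            rw [← Nat.floor_div_eq_div (K := ℝ)]
            exact (Nat.lt_floor_add_one _).le
          calc n * (Real.log p / p) = Real.log p * (n / p) := by ring
            _ ≤ Real.log p * (((n / p : ℕ):ℝ) + 1) := by gcongr
            _ = _ := by ring
      _ ≤ _ := by rw [sum_add_distrib]; linarith
  exact le_of_mul_le_mul_left h3 hn0

lemma hq_log (l : ℕ) (hl : 5 ≤ l) : hq l * Real.log l ≤ 2 * (Real.log l / l) + 30 * (l:ℝ)^(-(3/2:ℝ)) := by
  have h5 : (5:ℝ) ≤ l := by exact_mod_cast hl
  have h0 : (0:ℝ) < l := by linarith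
  have hlog : Real.log l ≤ 2 * (l:ℝ)^(1/2:ℝ) := by
    have := Real.log_le_rpow_div h0.le (show (0:ℝ) < 1/2 by norm_num)
    linarith
  have e : hq l * Real.log l = 2 * (Real.log l / l) + (6 / (l * ((l:ℝ)-3))) * Real.log l := by
    have : (l:ℝ) - 3 ≠ 0 := by linarith
    unfold hq
    field_simp
    ring
  rw [e]
  have h1 : (6 / (l * ((l:ℝ)-3))) ≤ 15 / (l:ℝ)^2 := by
    rw [div_le_div_iff₀ (by nlinarith) (by positivity)]
    nlinarith
  have h2 : (6 / (l * ((l:ℝ)-3))) * Real.log l ≤ 15 / (l:ℝ)^2 * (2 * (l:ℝ)^(1/2:ℝ)) :=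
    mul_le_mul h1 hlog (Real.log_natCast_nonneg l) (by positivity)
  have h3 : 15 / (l:ℝ)^2 * (2 * (l:ℝ)^(1/2:ℝ)) = 30 * (l:ℝ)^(-(3/2:ℝ)) := by
    have : (l:ℝ)^(-(3/2:ℝ)) = (l:ℝ)^(1/2:ℝ) / (l:ℝ)^2 := by
      rw [← Real.rpow_natCast, ← Real.rpow_sub h0]; norm_num
    rw [this]; ring
  linarith

lemma mertens_h : ∃ C : ℝ, 0 < C ∧ ∀ s : Finset ℕ, (∀ l ∈ s, l.Prime ∧ 5 ≤ l) → ∀ v : ℝ, 0 ≤ v →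
    ∑ l ∈ s.filter (fun l : ℕ => Real.log l ≤ v), hq l * Real.log l ≤ 2 * v + C := by
  have hsum : Summable (fun n : ℕ => 30 * (n:ℝ)^(-(3/2:ℝ))) :=
    (Real.summable_nat_rpow.mpr (by norm_num)).mul_left _
  have hl4 : 0 < Real.log 4 := Real.log_pos (by norm_num)
  refine ⟨2 * Real.log 4 + ∑' n : ℕ, 30 * (n:ℝ)^(-(3/2:ℝ)), ?_, fun s hs v hv => ?_⟩
  · have : 0 ≤ ∑' n : ℕ, 30 * (n:ℝ)^(-(3/2:ℝ)) := tsum_nonneg fun n => by positivity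
    linarith
  have hx1 : 1 ≤ Real.exp v := Real.one_le_exp hv
  set n := ⌊Real.exp v⌋₊ with hn
  have hn1 : 1 ≤ n := Nat.le_floor (by simpa using hx1)
  have hm := mertens1 n hn1
  have hlogn : Real.log n ≤ v := by
    rw [Real.log_le_iff_le_exp (by exact_mod_cast hn1)]
    exact Nat.floor_le (Real.exp_pos _).le
  calc ∑ l ∈ s.filter (fun l : ℕ => Real.log l ≤ v), hq l * Real.log l
      ≤ ∑ l ∈ s.filter (fun l : ℕ => Real.log l ≤ v), (2 * (Real.log l / l) + 30 * (l:ℝ)^(-(3/2:ℝ))) :=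
        sum_le_sum fun l hl => hq_log l (hs l (mem_filter.mp hl).1).2
    _ = 2 * ∑ l ∈ s.filter (fun l : ℕ => Real.log l ≤ v), Real.log l / l + ∑ l ∈ s.filter (fun l : ℕ => Real.log l ≤ v), 30 * (l:ℝ)^(-(3/2:ℝ)) := by
        rw [sum_add_distrib, mul_sum]
    _ ≤ 2 * ∑ p ∈ (Icc 1 n).filter Nat.Prime, Real.log p / p + ∑' n : ℕ, 30 * (n:ℝ)^(-(3/2:ℝ)) := by
        refine add_le_add (mul_le_mul_of_nonneg_left (sum_le_sum_of_subset_of_nonneg ?_ fun l _ _ => ?_) (by norm_num))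
          (hsum.sum_le_tsum _ fun l _ => by positivity)
        · intro l hl
          rw [mem_filter] at hl
          obtain ⟨hp, _⟩ := hs l hl.1
          rw [mem_filter, mem_Icc]
          refine ⟨⟨hp.one_le, Nat.le_floor ?_⟩, hp⟩
          rw [← Real.log_le_iff_le_exp (by exact_mod_cast hp.pos)]
          exact hl.2
        · exact div_nonneg (Real.log_natCast_nonneg l) (by positivity)
    _ ≤ _ := by linarith

lemma abel_int (s : Finset ℕ) (a u : ℕ → ℝ) (ha : ∀ l ∈ s, 0 ≤ a l) (α β C : ℝ) (hαβ : α ≤ β)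
    (hA : ∀ v, α ≤ v → v ≤ β → ∑ l ∈ s.filter (fun l => u l ≤ v), a l ≤ 2 * v + C)
    (w : ℝ → ℝ) (hw : ContinuousOn w (Set.Icc α β)) (hw0 : ∀ v, α ≤ v → v ≤ β → 0 ≤ w v) (hu : ∀ l ∈ s, u l ≤ β) :
    ∑ l ∈ s, a l * ∫ v in (max (u l) α)..β, w v ≤ ∫ v in α..β, (2 * v + C) * w v := by
  have hwint : IntervalIntegrable w MeasureTheory.volume α β := by
    apply ContinuousOn.intervalIntegrable; rwa [Set.uIcc_of_le hαβ]
  have hind : ∀ l, MeasureTheory.IntegrableOn ((Set.Ioi (u l)).indicator w) (Set.Ioc α β) := fun l =>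
    MeasureTheory.Integrable.indicator ((intervalIntegrable_iff_integrableOn_Ioc_of_le hαβ).mp hwint) measurableSet_Ioi
  have h1 : ∀ l ∈ s, ∫ v in (max (u l) α)..β, w v = ∫ v in Set.Ioc α β, (Set.Ioi (u l)).indicator w v := by
    intro l hl
    rw [MeasureTheory.setIntegral_indicator measurableSet_Ioi, intervalIntegral.integral_of_le (max_le (hu l hl) hαβ)]
    congr 2
    ext v
    simp only [Set.mem_Ioc, Set.mem_inter_iff, Set.mem_Ioi, max_lt_iff]
    tauto
  calc ∑ l ∈ s, a l * ∫ v in (max (u l) α)..β, w v = ∑ l ∈ s, ∫ v in Set.Ioc α β, a l * (Set.Ioi (u l)).indicator w v := by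
        refine sum_congr rfl fun l hl => ?_
        rw [h1 l hl, MeasureTheory.integral_const_mul]
    _ = ∫ v in Set.Ioc α β, ∑ l ∈ s, a l * (Set.Ioi (u l)).indicator w v := by
        rw [MeasureTheory.integral_finsetSum]
        exact fun l _ => (hind l).const_mul _
    _ ≤ ∫ v in Set.Ioc α β, (2 * v + C) * w v := by
        apply MeasureTheory.setIntegral_mono_on
        · exact MeasureTheory.integrable_finsetSum _ fun l _ => (hind l).const_mul _
        · rw [← intervalIntegrable_iff_integrableOn_Ioc_of_le hαβ]
          apply ContinuousOn.intervalIntegrable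
          rw [Set.uIcc_of_le hαβ]
          exact ContinuousOn.mul (by fun_prop) hw
        · exact measurableSet_Ioc
        · intro v hv
          have hw1 := hw0 v hv.1.le hv.2
          calc ∑ l ∈ s, a l * (Set.Ioi (u l)).indicator w v ≤ ∑ l ∈ s, (if u l ≤ v then a l else 0) * w v := by
                refine sum_le_sum fun l hl => ?_
                have := ha l hl
                by_cases hh : u l < v
                · rw [Set.indicator_of_mem (Set.mem_Ioi.mpr hh), if_pos hh.le]
                · rw [Set.indicator_of_notMem (by simpa using hh), mul_zero]
                  split_ifs <;> positivity
            _ = (∑ l ∈ s.filter (fun l => u l ≤ v), a l) * w v := by rw [sum_filter, sum_mul]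
            _ ≤ _ := mul_le_mul_of_nonneg_right (hA v hv.1.le hv.2) hw1
    _ = _ := by rw [intervalIntegral.integral_of_le hαβ]

lemma hq_nonneg (l : ℕ) (hl : 5 ≤ l) : 0 ≤ hq l := by
  have h5 : (5:ℝ) ≤ l := by exact_mod_cast hl
  unfold hq
  exact div_nonneg (by norm_num) (by linarith)

lemma gq_le_hq (l : ℕ) (hl : 5 ≤ l) : gq l ≤ hq l := by
  have h5 : (5:ℝ) ≤ l := by exact_mod_cast hl
  unfold hq gq
  exact div_le_div_of_nonneg_left (by norm_num) (by linarith) (by linarith)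

lemma gq_pos (l : ℕ) (hl : 5 ≤ l) : 0 < gq l := by
  have h5 : (5:ℝ) ≤ l := by exact_mod_cast hl
  unfold gq
  exact div_pos (by norm_num) (by linarith)

lemma sumA (C : ℝ) (s : Finset ℕ) (hs : ∀ l ∈ s, l.Prime ∧ 5 ≤ l)
    (hC : ∀ v : ℝ, 0 ≤ v → ∑ l ∈ s.filter (fun l : ℕ => Real.log l ≤ v), hq l * Real.log l ≤ 2 * v + C)
    (τ : ℝ) (hτ : 0 ≤ τ) :
    ∑ l ∈ s, hq l * Real.log l * max 0 (τ - Real.log l) ≤ τ^2 + C * τ := by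
  have h := abel_int (s.filter (fun l : ℕ => Real.log l ≤ τ)) (fun l => hq l * Real.log l) (fun l => Real.log l)
    (fun l hl => mul_nonneg (hq_nonneg l (hs l (mem_filter.mp hl).1).2) (Real.log_natCast_nonneg l)) 0 τ C hτ
    (fun v hv hvt => by
      refine le_trans (sum_le_sum_of_subset_of_nonneg ?_ fun l hl _ => ?_) (hC v hv)
      · exact filter_subset_filter _ (filter_subset _ _)
      · exact mul_nonneg (hq_nonneg l (hs l (mem_filter.mp hl).1).2) (Real.log_natCast_nonneg l))
    (fun _ => 1) continuousOn_const (fun _ _ _ => by norm_num) (fun l hl => (mem_filter.mp hl).2)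
  have e1 : ∫ v in (0:ℝ)..τ, (2 * v + C) * 1 = τ^2 + C * τ := by
    have : ∀ v ∈ Set.uIcc (0:ℝ) τ, HasDerivAt (fun v : ℝ => v^2 + C * v) ((2 * v + C) * 1) v := by
      intro v _
      have h1 := (hasDerivAt_pow 2 v).add ((hasDerivAt_id v).const_mul C)
      refine h1.congr_deriv ?_
      simp
    rw [intervalIntegral.integral_eq_sub_of_hasDerivAt this (Continuous.intervalIntegrable (by fun_prop) _ _)]
    ring
  rw [e1] at h
  refine le_trans (le_of_eq ?_) h
  rw [sum_filter]
  refine sum_congr rfl fun l hl => ?_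
  split_ifs with hh
  · rw [max_eq_left (Real.log_natCast_nonneg l)]
    simp [hh]
  · rw [max_eq_left (by linarith), mul_zero]

lemma sumB (C : ℝ) (s : Finset ℕ) (hs : ∀ l ∈ s, l.Prime ∧ 5 ≤ l)
    (hC : ∀ v : ℝ, 0 ≤ v → ∑ l ∈ s.filter (fun l : ℕ => Real.log l ≤ v), hq l * Real.log l ≤ 2 * v + C)
    (τ y : ℝ) (hτ : 0 < τ) (hy : τ ≤ y) (hsy : ∀ l ∈ s, Real.log l ≤ y) :
    ∑ l ∈ s, gq l * min (Real.log l) τ ^ 2 ≤ 2 * τ^2 + 2 * τ^2 * Real.log (y/τ) + C * τ := by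
  have hy0 : 0 < y := by linarith
  have hnn : ∀ l ∈ s, 0 ≤ hq l * Real.log l := fun l hl =>
    mul_nonneg (hq_nonneg l (hs l hl).2) (Real.log_natCast_nonneg l)
  have hcont : ContinuousOn (fun v : ℝ => τ^2 * (v^2)⁻¹) (Set.Icc τ y) := by
    apply ContinuousOn.mul continuousOn_const
    apply ContinuousOn.inv₀ (by fun_prop)
    intro v hv
    have : 0 < v := by linarith [hv.1]
    positivity
  have h := abel_int s (fun l => hq l * Real.log l) (fun l => Real.log l) hnn τ y C hy
    (fun v hv hvt => hC v (by linarith)) (fun v => τ^2 * (v^2)⁻¹) hcont (fun v _ _ => by positivity) hsy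
  have e1 : ∀ m, τ ≤ m → m ≤ y → ∫ v in m..y, τ^2 * (v^2)⁻¹ = τ^2 / m - τ^2 / y := by
    intro m hm hmy
    have : ∀ v ∈ Set.uIcc m y, HasDerivAt (fun v : ℝ => -(τ^2 * v⁻¹)) (τ^2 * (v^2)⁻¹) v := by
      intro v hv
      rw [Set.uIcc_of_le hmy] at hv
      have hv0 : v ≠ 0 := by have := hv.1; intro h; linarith
      have h1 := ((hasDerivAt_inv hv0).const_mul (τ^2)).neg
      refine h1.congr_deriv ?_
      ring
    rw [intervalIntegral.integral_eq_sub_of_hasDerivAt this]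
    · ring
    · apply ContinuousOn.intervalIntegrable
      rw [Set.uIcc_of_le hmy]
      exact hcont.mono (Set.Icc_subset_Icc_left hm)
  have e2 : ∫ v in τ..y, (2 * v + C) * (τ^2 * (v^2)⁻¹) = 2 * τ^2 * Real.log (y/τ) + C * (τ - τ^2 / y) := by
    have : ∀ v ∈ Set.uIcc τ y, HasDerivAt (fun v : ℝ => 2 * τ^2 * Real.log v - C * τ^2 * v⁻¹) ((2 * v + C) * (τ^2 * (v^2)⁻¹)) v := by
      intro v hv
      rw [Set.uIcc_of_le hy] at hv
      have hv0 : v ≠ 0 := by have := hv.1; intro h; linarith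
      have h1 := ((Real.hasDerivAt_log hv0).const_mul (2*τ^2)).sub ((hasDerivAt_inv hv0).const_mul (C * τ^2))
      refine h1.congr_deriv ?_
      field_simp
      ring
    rw [intervalIntegral.integral_eq_sub_of_hasDerivAt this]
    · rw [Real.log_div hy0.ne' hτ.ne']
      field_simp
      ring
    · apply ContinuousOn.intervalIntegrable
      rw [Set.uIcc_of_le hy]
      exact ContinuousOn.mul (by fun_prop) hcont
  rw [e2] at h
  have h2 := hC y hy0.le
  rw [filter_true_of_mem hsy] at h2
  have h3 : ∀ l ∈ s, gq l * min (Real.log l) τ ^ 2 ≤ (hq l * Real.log l) * (∫ v in (max (Real.log l) τ)..y, τ^2 * (v^2)⁻¹) + (hq l * Real.log l) * (τ^2 / y) := by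
    intro l hl
    have hl5 := (hs l hl).2
    rw [e1 _ (le_max_right _ _) (max_le (hsy l hl) hy), ← mul_add, sub_add_cancel]
    have h5 : (5:ℝ) ≤ l := by exact_mod_cast hl5
    have hlog : 0 < Real.log l := Real.log_pos (by linarith)
    have hm : min (Real.log l) τ ^ 2 ≤ Real.log l * (τ^2 / max (Real.log l) τ) := by
      rcases le_total (Real.log l) τ with hh | hh
      · rw [min_eq_left hh, max_eq_right hh, pow_two, pow_two, mul_div_assoc, div_self hτ.ne', mul_one]
        gcongr
      · rw [min_eq_right hh, max_eq_left hh]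
        apply le_of_eq; field_simp
    calc gq l * min (Real.log l) τ ^ 2 ≤ hq l * (Real.log l * (τ^2 / max (Real.log l) τ)) :=
          mul_le_mul (gq_le_hq l hl5) hm (by positivity) (hq_nonneg l hl5)
      _ = _ := by ring
  calc _ ≤ _ := sum_le_sum h3
    _ = ∑ l ∈ s, (hq l * Real.log l) * (∫ v in (max (Real.log l) τ)..y, τ^2 * (v^2)⁻¹) + (∑ l ∈ s, hq l * Real.log l) * (τ^2 / y) := by
        rw [sum_add_distrib, sum_mul]
    _ ≤ (2 * τ^2 * Real.log (y/τ) + C * (τ - τ^2 / y)) + (2 * y + C) * (τ^2 / y) := by gcongr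
    _ = _ := by field_simp; ring

end PSLSieve
end

section
open Finset
namespace PSLSieve

noncomputable def yy (A : ℝ) (r : Finset ℕ) : ℝ := max 0 (A - ∑ l ∈ r, Real.log (l:ℝ))

lemma yy_nonneg (A : ℝ) (r : Finset ℕ) : 0 ≤ yy A r := le_max_left _ _

lemma yy_insert (A : ℝ) (r : Finset ℕ) (q : ℕ) (hq : q ∉ r) : yy A (insert q r) = max 0 (yy A r - Real.log (q:ℝ)) := by
  have h0 : 0 ≤ Real.log (q:ℝ) := Real.log_natCast_nonneg q
  unfold yy
  rw [sum_insert hq]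
  rcases le_total 0 (A - ∑ l ∈ r, Real.log (l:ℝ)) with h | h
  · rw [max_eq_right h]; congr 1; ring
  · rw [max_eq_left h, max_eq_left (by linarith), max_eq_left (by linarith)]

lemma yy_le (A : ℝ) (hA : 0 ≤ A) (r : Finset ℕ) : yy A r ≤ A := by
  unfold yy
  refine max_le hA ?_
  have : 0 ≤ ∑ l ∈ r, Real.log (l:ℝ) := sum_nonneg fun l _ => Real.log_natCast_nonneg l
  linarith

lemma yq_yy (A : ℝ) (q : ℕ) (r : Finset ℕ) (hq : q ∉ r) : yq (yy A) q r = min (Real.log (q:ℝ)) (yy A r) := by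
  unfold yq
  rw [if_neg hq, yy_insert A r q hq]
  rcases le_total (Real.log (q:ℝ)) (yy A r) with h | h
  · rw [min_eq_left h, max_eq_right (by linarith)]; ring
  · rw [min_eq_right h, max_eq_left (by linarith)]; ring

lemma gh_id (l : ℕ) (hl : 5 ≤ l) : gq l * (1 + hq l) = hq l := by
  have h5 : (5:ℝ) ≤ l := by exact_mod_cast hl
  unfold gq hq
  have h1 : (l:ℝ) - 1 ≠ 0 := by intro h; linarith
  have h3 : (l:ℝ) - 3 ≠ 0 := by intro h; linarith
  field_simp
  ring

lemma prod_hq_nonneg (P : Finset ℕ) (hP : ∀ l ∈ P, l.Prime ∧ 5 ≤ l) (r : Finset ℕ) (hr : r ⊆ P) : 0 ≤ ∏ l ∈ r, hq l :=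
  prod_nonneg fun l hl => hq_nonneg l (hP l (hr hl)).2

noncomputable def SS1 (P : Finset ℕ) (A : ℝ) : ℝ := ∑ r ∈ P.powerset, (∏ l ∈ r, hq l) * yy A r
noncomputable def SS2 (P : Finset ℕ) (A : ℝ) : ℝ := ∑ r ∈ P.powerset, (∏ l ∈ r, hq l) * yy A r ^ 2

lemma sum_mem_powerset (P : Finset ℕ) (q : ℕ) (hq : q ∈ P) (F : Finset ℕ → ℝ) :
    ∑ r ∈ P.powerset, (if q ∈ r then F r else 0) = ∑ r ∈ P.powerset, (if q ∈ r then 0 else F (insert q r)) := by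
  have hP : P = insert q (P.erase q) := (insert_erase hq).symm
  have hni : q ∉ P.erase q := notMem_erase q P
  rw [hP, sum_powerset_insert hni, sum_powerset_insert hni, ← sum_add_distrib, ← sum_add_distrib]
  refine sum_congr rfl fun r hr => ?_
  have : q ∉ r := fun h => hni (mem_powerset.mp hr h)
  simp [this]

lemma SS1_le (C A : ℝ) (P : Finset ℕ) (hP : ∀ l ∈ P, l.Prime ∧ 5 ≤ l)
    (hC : ∀ v : ℝ, 0 ≤ v → ∑ l ∈ P.filter (fun l : ℕ => Real.log l ≤ v), hq l * Real.log l ≤ 2 * v + C) :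
    A * SS1 P A ≤ 2 * SS2 P A + C * SS1 P A := by
  have e1 : A * SS1 P A = SS2 P A + ∑ r ∈ P.powerset, ∑ l ∈ P, if l ∈ r then (∏ l ∈ r, hq l) * yy A r * Real.log (l:ℝ) else 0 := by
    unfold SS1 SS2
    rw [mul_sum, ← sum_add_distrib]
    refine sum_congr rfl fun r hr => ?_
    rw [← sum_filter, filter_mem_eq_inter, inter_eq_right.mpr (mem_powerset.mp hr), ← mul_sum]
    have : yy A r * (A - ∑ l ∈ r, Real.log (l:ℝ)) = yy A r ^ 2 := by
      unfold yy
      rcases le_total 0 (A - ∑ l ∈ r, Real.log (l:ℝ)) with h | h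
      · rw [max_eq_right h]; ring
      · rw [max_eq_left h]; ring
    rw [← this]; ring
  have e2 : ∑ r ∈ P.powerset, ∑ l ∈ P, (if l ∈ r then (∏ l ∈ r, hq l) * yy A r * Real.log (l:ℝ) else 0) ≤
      ∑ r ∈ P.powerset, ∑ l ∈ P, (∏ l ∈ r, hq l) * (hq l * Real.log (l:ℝ) * max 0 (yy A r - Real.log (l:ℝ))) := by
    rw [sum_comm, sum_comm (s := P.powerset)]
    refine sum_le_sum fun q hq' => ?_
    rw [sum_mem_powerset P q hq' (fun r => (∏ l ∈ r, hq l) * yy A r * Real.log (q:ℝ))]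
    refine sum_le_sum fun r hr => ?_
    have hn := prod_hq_nonneg P hP r (mem_powerset.mp hr)
    have hn2 := hq_nonneg q (hP q hq').2
    have h0 : 0 ≤ Real.log (q:ℝ) := Real.log_natCast_nonneg q
    have hm : 0 ≤ max 0 (yy A r - Real.log (q:ℝ)) := le_max_left _ _
    split_ifs with h
    · positivity
    · rw [yy_insert A r q h, prod_insert h]
      exact le_of_eq (by ring)
  have e3 : ∑ r ∈ P.powerset, ∑ l ∈ P, (∏ l ∈ r, hq l) * (hq l * Real.log (l:ℝ) * max 0 (yy A r - Real.log (l:ℝ))) ≤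
      SS2 P A + C * SS1 P A := by
    unfold SS1 SS2
    rw [mul_sum, ← sum_add_distrib]
    refine sum_le_sum fun r hr => ?_
    rw [← mul_sum]
    have := mul_le_mul_of_nonneg_left (sumA C P hP hC (yy A r) (yy_nonneg A r)) (prod_hq_nonneg P hP r (mem_powerset.mp hr))
    refine this.trans (le_of_eq (by ring))
  linarith

lemma logbound (A τ : ℝ) (hA : 0 < A) (hτ : 0 < τ) : Real.log (6 * A / τ) ≤ Real.log 12 - 1 + A / (2 * τ) := by
  have e : 6 * A / τ = 12 * (A / (2 * τ)) := by field_simp; ring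
  have hp : 0 < A / (2 * τ) := by positivity
  rw [e, Real.log_mul (by norm_num) hp.ne']
  have := Real.log_le_sub_one_of_pos hp
  linarith

lemma log12 : Real.log 12 ≤ 2.4954 := by
  have h : Real.log ((12:ℝ)^5) ≤ Real.log ((2:ℝ)^18) := Real.log_le_log (by norm_num) (by norm_num)
  rw [Real.log_pow, Real.log_pow] at h
  have := Real.log_two_lt_d9
  push_cast at h
  linarith

lemma T2_le (C A : ℝ) (hA : 0 < A) (hCp : 0 ≤ C) (P : Finset ℕ) (hP : ∀ l ∈ P, l.Prime ∧ 5 ≤ l)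
    (hC : ∀ v : ℝ, 0 ≤ v → ∑ l ∈ P.filter (fun l : ℕ => Real.log l ≤ v), hq l * Real.log l ≤ 2 * v + C)
    (hy : ∀ l ∈ P, Real.log (l:ℝ) ≤ 6 * A) :
    ∑ q ∈ P, gq q * ∑ r ∈ P.powerset, (∏ l ∈ r, hq l) * yq (yy A) q r ^ 2 ≤ 6.9908 * SS2 P A + 2 * C * SS1 P A := by
  have h1 : ∑ q ∈ P, gq q * ∑ r ∈ P.powerset, (∏ l ∈ r, hq l) * yq (yy A) q r ^ 2 ≤
      ∑ r ∈ P.powerset, (∏ l ∈ r, hq l) * ∑ q ∈ P, gq q * min (Real.log (q:ℝ)) (yy A r) ^ 2 := by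
    simp_rw [mul_sum]
    rw [sum_comm]
    refine sum_le_sum fun r hr => sum_le_sum fun q hq' => ?_
    have hn := prod_hq_nonneg P hP r (mem_powerset.mp hr)
    have hg := (gq_pos q (hP q hq').2).le
    by_cases h : q ∈ r
    · simp only [yq, if_pos h]
      rw [zero_pow (by norm_num), mul_zero, mul_zero]
      positivity
    · rw [yq_yy A q r h]
      exact le_of_eq (by ring)
  have h2 : ∀ r ∈ P.powerset, (∏ l ∈ r, hq l) * ∑ q ∈ P, gq q * min (Real.log (q:ℝ)) (yy A r) ^ 2 ≤
      (∏ l ∈ r, hq l) * (4.9908 * yy A r ^ 2 + A * yy A r + C * yy A r) := by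
    intro r hr
    refine mul_le_mul_of_nonneg_left ?_ (prod_hq_nonneg P hP r (mem_powerset.mp hr))
    rcases (yy_nonneg A r).eq_or_lt with h | h
    · rw [← h]
      refine le_of_eq ?_
      rw [sum_eq_zero fun q _ => ?_]
      · ring
      · rw [min_eq_right (Real.log_natCast_nonneg q)]; ring
    · have hle := yy_le A hA.le r
      have hb := sumB C P hP hC (yy A r) (6 * A) h (by linarith) hy
      set τ := yy A r
      have hl := mul_le_mul_of_nonneg_left (logbound A τ hA h) (by positivity : 0 ≤ 2 * τ^2)
      have e : 2 * τ^2 * (Real.log 12 - 1 + A / (2 * τ)) = 2 * τ^2 * (Real.log 12 - 1) + A * τ := by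
        field_simp
      have h12 := mul_le_mul_of_nonneg_left log12 (by positivity : 0 ≤ 2 * τ^2)
      nlinarith
  have h3 : ∑ r ∈ P.powerset, (∏ l ∈ r, hq l) * (4.9908 * yy A r ^ 2 + A * yy A r + C * yy A r) =
      4.9908 * SS2 P A + A * SS1 P A + C * SS1 P A := by
    unfold SS1 SS2
    rw [mul_sum, mul_sum, mul_sum, ← sum_add_distrib, ← sum_add_distrib]
    exact sum_congr rfl fun r _ => by ring
  have h4 := SS1_le C A P hP hC
  have := sum_le_sum h2
  linarith

lemma SS2_ge (A : ℝ) (hA : 0 ≤ A) (P : Finset ℕ) (hP : ∀ l ∈ P, l.Prime ∧ 5 ≤ l) : A^2 ≤ SS2 P A := by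
  unfold SS2
  have := single_le_sum (s := P.powerset) (f := fun r => (∏ l ∈ r, hq l) * yy A r ^ 2)
    (fun r hr => mul_nonneg (prod_hq_nonneg P hP r (mem_powerset.mp hr)) (sq_nonneg _)) (empty_mem_powerset P)
  refine le_trans (le_of_eq ?_) this
  simp [yy, hA]

/-- Main-term inequality of the weighted sieve. -/
lemma main_term : ∃ A0 : ℝ, ∀ A ≥ A0, ∀ P : Finset ℕ, (∀ l ∈ P, l.Prime ∧ 5 ≤ l) → (∀ l ∈ P, Real.log (l:ℝ) ≤ 6 * A) →
    ∑ q ∈ P, Ex P gq (fun N => (if {q} ⊆ N then 1 else 0) * FF P hq (yy A) N ^ 2) ≤ 6.995 * SS2 P A := by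
  obtain ⟨C, hC0, hC⟩ := mertens_h
  refine ⟨1 + 2001 * C, fun A hA P hP hy => ?_⟩
  have hA0 : 0 < A := by nlinarith
  rw [sum_congr rfl fun q hq' => Ex_q P gq hq (fun l hl => gh_id l (hP l hl).2) q hq' (yy A)]
  have h1 := T2_le C A hA0 hC0.le P hP (hC P hP) hy
  have h2 := SS1_le C A P hP (hC P hP)
  have h3 : 0 ≤ SS1 P A := sum_nonneg fun r hr => mul_nonneg (prod_hq_nonneg P hP r (mem_powerset.mp hr)) (yy_nonneg A r)
  have h5 := SS2_ge A hA0.le P hP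
  have h6 := sq_nonneg A
  have h4 : 2000 * C * SS1 P A ≤ (A - C) * SS1 P A := mul_le_mul_of_nonneg_right (by linarith) h3
  linarith

lemma main_term0 (A : ℝ) (P : Finset ℕ) (hP : ∀ l ∈ P, l.Prime ∧ 5 ≤ l) :
    Ex P gq (fun N => (if ∅ ⊆ N then 1 else 0) * FF P hq (yy A) N ^ 2) = SS2 P A := by
  rw [Ex_FF P gq hq (fun l hl => gh_id l (hP l hl).2) ∅ (empty_subset _) (yy A) (fun r hr => absurd (disjoint_empty_right r) hr)]
  simp [SS2]

end PSLSieve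
end

section
open Finset
namespace PSLSieve

lemma err_sum (P : Finset ℕ) (𝒟 Zs : Finset (Finset ℕ)) (h𝒟 : 𝒟 ⊆ P.powerset) (hZs : Zs ⊆ P.powerset)
    (lm E : Finset ℕ → ℝ) (B : ℝ) (hB : 0 ≤ B) (hlm : ∀ d ∈ P.powerset, |lm d| ≤ B * 2^d.card)
    (hE : ∀ Z ∈ Zs, ∀ d ∈ P.powerset, ∀ e ∈ P.powerset, lm d ≠ 0 → lm e ≠ 0 → d ∪ e ∪ Z ∈ 𝒟) :
    ∑ Z ∈ Zs, ∑ d ∈ P.powerset, ∑ e ∈ P.powerset, |(lm d * lm e) * E (d ∪ e ∪ Z)| ≤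
      B^2 * ∑ D ∈ 𝒟, 18^D.card * |E D| := by
  have h1 : ∀ Z ∈ Zs, ∀ d ∈ P.powerset, ∀ e ∈ P.powerset, |(lm d * lm e) * E (d ∪ e ∪ Z)| ≤
      ∑ D ∈ 𝒟, (B^2 * |E D|) * ((if Z ⊆ D then 1 else 0) * ((if d ⊆ D then 2^d.card else 0) * (if e ⊆ D then 2^e.card else 0))) := by
    intro Z hZ d hd e he
    have hnn : ∀ D ∈ 𝒟, 0 ≤ (B^2 * |E D|) * ((if Z ⊆ D then (1:ℝ) else 0) * ((if d ⊆ D then 2^d.card else 0) * (if e ⊆ D then 2^e.card else 0))) := by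
      intro D _
      split_ifs <;> positivity
    by_cases hd0 : lm d = 0
    · rw [hd0, zero_mul, zero_mul, abs_zero]; exact sum_nonneg hnn
    by_cases he0 : lm e = 0
    · rw [he0, mul_zero, zero_mul, abs_zero]; exact sum_nonneg hnn
    refine le_trans ?_ (single_le_sum hnn (hE Z hZ d hd e he hd0 he0))
    rw [if_pos subset_union_right, if_pos (subset_union_left.trans subset_union_left), if_pos (subset_union_right.trans subset_union_left),
      abs_mul, abs_mul]
    have := mul_le_mul (hlm d hd) (hlm e he) (abs_nonneg _) (by positivity)
    calc |lm d| * |lm e| * |E (d ∪ e ∪ Z)| ≤ (B * 2^d.card * (B * 2^e.card)) * |E (d ∪ e ∪ Z)| :=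
          mul_le_mul_of_nonneg_right this (abs_nonneg _)
      _ = _ := by ring
  refine (sum_le_sum fun Z hZ => sum_le_sum fun d hd => sum_le_sum fun e he => h1 Z hZ d hd e he).trans ?_
  have h2 : ∀ D ∈ 𝒟, ∑ d ∈ P.powerset, (if d ⊆ D then (2:ℝ)^d.card else 0) = 3^D.card := by
    intro D hD
    have hDP := mem_powerset.mp (h𝒟 hD)
    rw [← sum_filter]
    have : P.powerset.filter (fun d => d ⊆ D) = D.powerset := by
      ext d; simp only [mem_filter, mem_powerset]
      exact ⟨fun h => h.2, fun h => ⟨h.trans hDP, h⟩⟩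
    rw [this]
    have := Finset.prod_add (fun _ : ℕ => (2:ℝ)) (fun _ => 1) D
    simp only [prod_const, one_pow, mul_one] at this
    rw [← this]; norm_num
  have h3 : ∀ D ∈ 𝒟, ∑ Z ∈ Zs, (if Z ⊆ D then (1:ℝ) else 0) ≤ 2^D.card := by
    intro D hD
    rw [← sum_filter]
    have : Zs.filter (fun d => d ⊆ D) ⊆ D.powerset := by
      intro d; simp only [mem_filter, mem_powerset]
      exact fun h => h.2
    rw [sum_const, nsmul_eq_mul, mul_one]
    have h := card_le_card this
    rw [card_powerset] at h
    exact_mod_cast h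
  have e1 : ∑ Z ∈ Zs, ∑ d ∈ P.powerset, ∑ e ∈ P.powerset, ∑ D ∈ 𝒟, (B^2 * |E D|) * ((if Z ⊆ D then (1:ℝ) else 0) * ((if d ⊆ D then 2^d.card else 0) * (if e ⊆ D then 2^e.card else 0)))
      = ∑ D ∈ 𝒟, (B^2 * |E D|) * ((∑ Z ∈ Zs, if Z ⊆ D then (1:ℝ) else 0) * ((∑ d ∈ P.powerset, if d ⊆ D then 2^d.card else 0) * (∑ e ∈ P.powerset, if e ⊆ D then 2^e.card else 0))) := by
    simp_rw [sum_mul_sum, mul_sum]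
    rw [sum_comm' (s := 𝒟) (t' := Zs) (s' := fun _ => 𝒟) (t := fun _ => Zs) (by tauto)]
    refine sum_congr rfl fun Z _ => ?_
    rw [sum_comm (s := 𝒟)]
    refine sum_congr rfl fun d _ => ?_
    rw [sum_comm (s := 𝒟)]
  rw [e1, mul_sum]
  refine sum_le_sum fun D hD => ?_
  rw [h2 D hD]
  have := mul_le_mul_of_nonneg_right (h3 D hD) (by positivity : (0:ℝ) ≤ 3^D.card * 3^D.card)
  have := mul_le_mul_of_nonneg_left this (by positivity : 0 ≤ B^2 * |E D|)
  refine this.trans (le_of_eq ?_)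
  rw [← mul_pow, ← mul_pow]
  norm_num
  ring

lemma log_pr (P : Finset ℕ) (hP : ∀ l ∈ P, l.Prime ∧ 5 ≤ l) (r : Finset ℕ) (hr : r ⊆ P) :
    Real.log ((∏ l ∈ r, l : ℕ):ℝ) = ∑ l ∈ r, Real.log (l:ℝ) := by
  rw [Nat.cast_prod, Real.log_prod]
  intro l hl
  have := (hP l (hr hl)).1.ne_zero
  exact_mod_cast this

lemma pf_pr (P : Finset ℕ) (hP : ∀ l ∈ P, l.Prime ∧ 5 ≤ l) (r : Finset ℕ) (hr : r ⊆ P) :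
    (∏ l ∈ r, l).primeFactors = r :=
  Nat.primeFactors_prod fun l hl => (hP l (hr hl)).1

lemma sf_pr (P : Finset ℕ) (hP : ∀ l ∈ P, l.Prime ∧ 5 ≤ l) (r : Finset ℕ) (hr : r ⊆ P) :
    Squarefree (∏ l ∈ r, l) := by
  refine Finset.squarefree_prod_of_pairwise_isCoprime ?_ fun l hl => (hP l (hr hl)).1.squarefree
  intro a ha b hb hab
  exact Nat.coprime_iff_isRelPrime.mp ((Nat.coprime_primes (hP a (hr ha)).1 (hP b (hr hb)).1).mpr hab)

lemma hq_le (l : ℕ) (hl : 5 ≤ l) : hq l ≤ 8 / l := by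
  have h5 : (5:ℝ) ≤ l := by exact_mod_cast hl
  unfold hq
  rw [div_le_div_iff₀ (by linarith) (by linarith)]
  linarith

noncomputable def HH (P : Finset ℕ) (A : ℝ) : ℝ := ∑ r ∈ P.powerset.filter (fun r : Finset ℕ => ∑ l ∈ r, Real.log (l:ℝ) ≤ A), ∏ l ∈ r, hq l

lemma HH_le (P : Finset ℕ) (hP : ∀ l ∈ P, l.Prime ∧ 5 ≤ l) (A : ℝ) (hA : 0 ≤ A) : HH P A ≤ (1 + A)^8 := by
  set N := ⌊Real.exp A⌋₊ with hN
  have hmem : ∀ r ∈ P.powerset.filter (fun r : Finset ℕ => ∑ l ∈ r, Real.log (l:ℝ) ≤ A), (∏ l ∈ r, l) ∈ Icc 1 N := by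
    intro r hr
    obtain ⟨h1, h2⟩ := mem_filter.mp hr
    have h1 := mem_powerset.mp h1
    have hpos : 0 < ∏ l ∈ r, l := prod_pos fun l hl => (hP l (h1 hl)).1.pos
    rw [mem_Icc]
    refine ⟨hpos, Nat.le_floor ?_⟩
    rw [← log_pr P hP r h1] at h2
    rwa [← Real.log_le_iff_le_exp (by exact_mod_cast hpos)]
  have hinj : Set.InjOn (fun r : Finset ℕ => ∏ l ∈ r, l) (P.powerset.filter (fun r : Finset ℕ => ∑ l ∈ r, Real.log (l:ℝ) ≤ A) : Finset (Finset ℕ)) := by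
    intro a ha b hb hab
    have ha := mem_powerset.mp (mem_filter.mp (mem_coe.mp ha)).1
    have hb := mem_powerset.mp (mem_filter.mp (mem_coe.mp hb)).1
    rw [← pf_pr P hP a ha, ← pf_pr P hP b hb]
    exact congrArg _ hab
  calc HH P A ≤ ∑ r ∈ P.powerset.filter (fun r : Finset ℕ => ∑ l ∈ r, Real.log (l:ℝ) ≤ A), tau (∏ l ∈ r, l)^3 / ((∏ l ∈ r, l : ℕ):ℝ) := by
        refine sum_le_sum fun r hr => ?_
        have h1 := mem_powerset.mp (mem_filter.mp hr).1
        rw [tau_sq_free (sf_pr P hP r h1), pf_pr P hP r h1, ← pow_mul, mul_comm, pow_mul, Nat.cast_prod, ← prod_const, ← prod_div_distrib]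
        refine prod_le_prod (fun l hl => hq_nonneg l (hP l (h1 hl)).2) fun l hl => ?_
        refine (hq_le l (hP l (h1 hl)).2).trans (le_of_eq (by norm_num))
    _ = ∑ n ∈ (P.powerset.filter (fun r : Finset ℕ => ∑ l ∈ r, Real.log (l:ℝ) ≤ A)).image (fun r : Finset ℕ => ∏ l ∈ r, l), tau n^3 / (n:ℝ) := by
        rw [sum_image hinj]
    _ ≤ ∑ n ∈ Icc 1 N, tau n^3 / (n:ℝ) := by
        refine sum_le_sum_of_subset_of_nonneg ?_ fun n _ _ => ?_
        · intro n hn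
          obtain ⟨r, hr, rfl⟩ := mem_image.mp hn
          exact hmem r hr
        · have := tau_nonneg n
          positivity
    _ ≤ (1 + Real.log N)^(2^3) := tau_moment_inv 3 N
    _ ≤ (1 + A)^8 := by
        have h1 : 1 ≤ N := by rw [hN, Nat.one_le_floor_iff]; exact Real.one_le_exp hA
        have : Real.log N ≤ A := by
          rw [Real.log_le_iff_le_exp (by exact_mod_cast h1)]
          exact Nat.floor_le (Real.exp_pos _).le
        norm_num
        have h0 : 0 ≤ Real.log N := Real.log_natCast_nonneg N
        exact pow_le_pow_left₀ (by linarith) (by linarith) 8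

lemma yy_zero (A : ℝ) (r : Finset ℕ) (h : ¬ ∑ l ∈ r, Real.log (l:ℝ) ≤ A) : yy A r = 0 := by
  unfold yy
  exact max_eq_left (by linarith)

lemma log_mono_sub {d r : Finset ℕ} (h : d ⊆ r) : ∑ l ∈ d, Real.log (l:ℝ) ≤ ∑ l ∈ r, Real.log (l:ℝ) :=
  sum_le_sum_of_subset_of_nonneg h fun l _ _ => Real.log_natCast_nonneg l

lemma lam_zero (P : Finset ℕ) (A : ℝ) (d : Finset ℕ) (h : ¬ ∑ l ∈ d, Real.log (l:ℝ) ≤ A) : lam P gq hq (yy A) d = 0 := by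
  unfold lam
  rw [sum_eq_zero, mul_zero]
  intro r _
  split_ifs with hd
  · rw [yy_zero A r (fun h' => h ((log_mono_sub hd).trans h')), mul_zero]
  · rfl

lemma lam_bound (P : Finset ℕ) (hP : ∀ l ∈ P, l.Prime ∧ 5 ≤ l) (A : ℝ) (hA : 0 ≤ A) (d : Finset ℕ) (hd : d ∈ P.powerset) :
    |lam P gq hq (yy A) d| ≤ (A * (1 + A)^8) * 2^d.card := by
  have hdP := mem_powerset.mp hd
  have hpd := prod_hq_nonneg P hP d hdP
  have h1 : ∑ r ∈ P.powerset, (if d ⊆ r then (∏ l ∈ r, hq l) * yy A r else 0) ≤ (∏ l ∈ d, hq l) * (A * HH P A) := by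
    rw [← sum_filter]
    calc ∑ r ∈ P.powerset.filter (fun r => d ⊆ r), (∏ l ∈ r, hq l) * yy A r
        ≤ ∑ r ∈ P.powerset.filter (fun r => d ⊆ r), (∏ l ∈ d, hq l) * (A * if ∑ l ∈ r \ d, Real.log (l:ℝ) ≤ A then ∏ l ∈ r \ d, hq l else 0) := by
          refine sum_le_sum fun r hr => ?_
          obtain ⟨h1, h2⟩ := mem_filter.mp hr
          have h1 := mem_powerset.mp h1
          have hn := prod_hq_nonneg P hP (r \ d) (sdiff_subset.trans h1)
          split_ifs with h
          · rw [← prod_sdiff h2]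
            have := mul_le_mul_of_nonneg_left (yy_le A hA r) (mul_nonneg hn hpd)
            refine this.trans (le_of_eq (by ring))
          · rw [yy_zero A r (fun h' => h ((log_mono_sub sdiff_subset).trans h'))]
            simp
      _ = (∏ l ∈ d, hq l) * (A * ∑ r ∈ P.powerset.filter (fun r => d ⊆ r), if ∑ l ∈ r \ d, Real.log (l:ℝ) ≤ A then ∏ l ∈ r \ d, hq l else 0) := by
          rw [mul_sum, mul_sum]
      _ ≤ (∏ l ∈ d, hq l) * (A * HH P A) := by
          refine mul_le_mul_of_nonneg_left (mul_le_mul_of_nonneg_left ?_ hA) hpd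
          have hinj : Set.InjOn (fun r : Finset ℕ => r \ d) (P.powerset.filter (fun r => d ⊆ r) : Finset (Finset ℕ)) := by
            intro a ha b hb hab
            have ha := (mem_filter.mp (mem_coe.mp ha)).2
            have hb := (mem_filter.mp (mem_coe.mp hb)).2
            rw [← sdiff_union_of_subset ha, ← sdiff_union_of_subset hb]
            exact congrArg (· ∪ d) hab
          rw [← sum_image (g := fun r : Finset ℕ => r \ d) (f := fun s : Finset ℕ => if ∑ l ∈ s, Real.log (l:ℝ) ≤ A then ∏ l ∈ s, hq l else 0) hinj]
          unfold HH
          rw [sum_filter]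
          apply sum_le_sum_of_subset_of_nonneg
          · intro s hs
            obtain ⟨r, hr, rfl⟩ := mem_image.mp hs
            exact mem_powerset.mpr (sdiff_subset.trans (mem_powerset.mp (mem_filter.mp hr).1))
          · intro s hs _
            split_ifs
            · exact prod_hq_nonneg P hP s (mem_powerset.mp hs)
            · exact le_rfl
  have h0 : 0 ≤ ∑ r ∈ P.powerset, (if d ⊆ r then (∏ l ∈ r, hq l) * yy A r else 0) := by
    refine sum_nonneg fun r hr => ?_
    split_ifs
    · exact mul_nonneg (prod_hq_nonneg P hP r (mem_powerset.mp hr)) (yy_nonneg A r)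
    · exact le_rfl
  have hH := HH_le P hP A hA
  have h2 : |∏ l ∈ d, (-(gq l)⁻¹)| * ∏ l ∈ d, hq l ≤ 2^d.card := by
    rw [Finset.abs_prod, ← prod_mul_distrib, ← prod_const]
    refine prod_le_prod (fun l hl => mul_nonneg (abs_nonneg _) (hq_nonneg l (hP l (hdP hl)).2)) fun l hl => ?_
    have hl5 := (hP l (hdP hl)).2
    have h5 : (5:ℝ) ≤ l := by exact_mod_cast hl5
    have hg := gq_pos l hl5
    rw [abs_neg, abs_inv, abs_of_pos hg, inv_mul_le_iff₀ hg]
    unfold gq hq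
    rw [div_mul_eq_mul_div, div_le_div_iff₀ (by linarith) (by linarith)]
    linarith
  unfold lam
  rw [abs_mul, abs_of_nonneg h0]
  calc _ ≤ |∏ l ∈ d, (-(gq l)⁻¹)| * ((∏ l ∈ d, hq l) * (A * HH P A)) := mul_le_mul_of_nonneg_left h1 (abs_nonneg _)
    _ = (|∏ l ∈ d, (-(gq l)⁻¹)| * ∏ l ∈ d, hq l) * (A * HH P A) := by ring
    _ ≤ (|∏ l ∈ d, (-(gq l)⁻¹)| * ∏ l ∈ d, hq l) * (A * (1 + A)^8) :=
        mul_le_mul_of_nonneg_left (mul_le_mul_of_nonneg_left hH hA) (mul_nonneg (abs_nonneg _) hpd)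
    _ ≤ 2^d.card * (A * (1 + A)^8) := mul_le_mul_of_nonneg_right h2 (by positivity)
    _ = _ := by ring

end PSLSieve
end

section
open Finset
namespace PSLSieve

/-- sieve level (logarithm) -/
noncomputable def LA (M : ℕ) : ℝ := 0.030625 * (M:ℝ)^20

noncomputable def PP (M l1 : ℕ) : Finset ℕ :=
  (range (⌊Real.exp (6 * LA M)⌋₊ + 1)).filter (fun q => q.Prime ∧ 5 ≤ q ∧ q ≠ l1)

lemma mem_PP (M l1 q : ℕ) : q ∈ PP M l1 ↔ Real.log q ≤ 6 * LA M ∧ q.Prime ∧ 5 ≤ q ∧ q ≠ l1 := by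
  unfold PP
  rw [mem_filter, mem_range, Nat.lt_succ_iff]
  constructor
  · rintro ⟨h1, h2⟩
    refine ⟨?_, h2⟩
    rw [Real.log_le_iff_le_exp (by exact_mod_cast h2.1.pos)]
    exact (Nat.le_floor_iff (Real.exp_pos _).le).mp h1
  · rintro ⟨h1, h2⟩
    refine ⟨?_, h2⟩
    rw [Real.log_le_iff_le_exp (by exact_mod_cast h2.1.pos)] at h1
    exact Nat.le_floor h1

lemma hPP (M l1 : ℕ) : ∀ l ∈ PP M l1, l.Prime ∧ 5 ≤ l := fun l hl =>
  ⟨((mem_PP M l1 l).mp hl).2.1, ((mem_PP M l1 l).mp hl).2.2.1⟩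

noncomputable def Np (M l1 p : ℕ) : Finset ℕ := (PP M l1).filter (fun q => q ∣ p^2 - 1)

lemma sub_Np (M l1 p : ℕ) (D : Finset ℕ) (hD : D ⊆ PP M l1) : D ⊆ Np M l1 p ↔ (∏ l ∈ D, l) ∣ p^2 - 1 := by
  constructor
  · intro h
    refine Finset.prod_primes_dvd _ (fun l hl => (hPP M l1 l (hD hl)).1.prime) fun l hl => ?_
    exact (mem_filter.mp (h hl)).2
  · intro h l hl
    exact mem_filter.mpr ⟨hD hl, (dvd_prod_of_mem (fun l : ℕ => l) hl).trans h⟩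

lemma prod_gq (M l1 : ℕ) (D : Finset ℕ) (hD : D ⊆ PP M l1) :
    ∏ l ∈ D, gq l = 2^(∏ l ∈ D, l).primeFactors.card / ((∏ l ∈ D, l).totient : ℝ) := by
  have hpf := pf_pr (PP M l1) (hPP M l1) D hD
  have ht : (∏ l ∈ D, l).totient = ∏ l ∈ D, (l - 1) := by
    have := Nat.totient_eq_prod_factorization (n := ∏ l ∈ D, l) (sf_pr (PP M l1) (hPP M l1) D hD).ne_zero
    have h2 := Nat.totient_mul_prod_primeFactors (∏ l ∈ D, l)
    rw [hpf] at h2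
    have hpos : 0 < ∏ l ∈ D, l := prod_pos fun l hl => (hPP M l1 l (hD hl)).1.pos
    rw [mul_comm] at h2
    exact Nat.eq_of_mul_eq_mul_left hpos h2
  rw [hpf, ht, Nat.cast_prod, ← prod_const, ← prod_div_distrib]
  refine prod_congr rfl fun l hl => ?_
  have := (hPP M l1 l (hD hl)).2
  rw [Nat.cast_sub (by omega)]
  simp [gq]

lemma hEr (M l1 : ℕ) (D : Finset ℕ) (hD : D ⊆ PP M l1) :
    ∑ p ∈ PI M, wt M p * (if D ⊆ Np M l1 p then 1 else 0) = (∏ l ∈ D, gq l) * mass M + ED M (∏ l ∈ D, l) := by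
  rw [prod_gq M l1 D hD]
  unfold ED
  rw [sum_filter]
  simp_rw [sub_Np M l1 _ D hD, mul_ite, mul_one, mul_zero]
  ring

lemma mods_mem (M l1 : ℕ) (hl1 : l1.Prime) (D : Finset ℕ) (hD : D ⊆ PP M l1) (h : ∑ l ∈ D, Real.log (l:ℝ) ≤ 8 * LA M) :
    (∏ l ∈ D, l) ∈ mods M l1 := by
  have hpos : 0 < ∏ l ∈ D, l := prod_pos fun l hl => (hPP M l1 l (hD hl)).1.pos
  have hnd : ∀ q : ℕ, q.Prime → q ∉ PP M l1 → ¬ q ∣ ∏ l ∈ D, l := by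
    intro q hq' hq2 hdv
    have : q ∈ (∏ l ∈ D, l).primeFactors := Nat.mem_primeFactors.mpr ⟨hq', hdv, hpos.ne'⟩
    rw [pf_pr (PP M l1) (hPP M l1) D hD] at this
    exact hq2 (hD this)
  unfold mods
  rw [mem_filter, mem_Icc]
  refine ⟨⟨hpos, Nat.le_floor ?_⟩, sf_pr (PP M l1) (hPP M l1) D hD, hnd 2 Nat.prime_two ?_, hnd l1 hl1 ?_⟩
  · rw [← log_pr (PP M l1) (hPP M l1) D hD, Real.log_le_iff_le_exp (by exact_mod_cast hpos)] at h
    refine h.trans (Real.exp_le_exp.mpr ?_)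
    unfold LA; linarith
  · intro h2; have := (hPP M l1 2 h2).2; omega
  · intro h2; exact ((mem_PP M l1 l1).mp h2).2.2.2 rfl

lemma err_total (M l1 : ℕ) (hl1 : l1.Prime) (Zs : Finset (Finset ℕ)) (hZs : Zs ⊆ (PP M l1).powerset) (hc : ∀ Z ∈ Zs, Z.card ≤ 1) :
    ∑ Z ∈ Zs, |∑ d ∈ (PP M l1).powerset, ∑ e ∈ (PP M l1).powerset,
      (lam (PP M l1) gq hq (yy (LA M)) d * lam (PP M l1) gq hq (yy (LA M)) e) * ED M (∏ l ∈ d ∪ e ∪ Z, l)| ≤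
      (LA M * (1 + LA M)^8)^2 * ∑ D ∈ mods M l1, tau D^5 * |ED M D| := by
  have hA : 0 ≤ LA M := by unfold LA; positivity
  have hP := hPP M l1
  set P := PP M l1 with hPdef
  set 𝒟 := P.powerset.filter (fun r : Finset ℕ => ∑ l ∈ r, Real.log (l:ℝ) ≤ 8 * LA M) with h𝒟
  have h1 := err_sum P 𝒟 Zs (filter_subset _ _) hZs (lam P gq hq (yy (LA M))) (fun D => ED M (∏ l ∈ D, l))
    (LA M * (1 + LA M)^8) (by positivity) (lam_bound P hP (LA M) hA) (by
      intro Z hZ d hd e he hd0 he0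
      have hd' := mem_powerset.mp hd
      have he' := mem_powerset.mp he
      have hZ' := mem_powerset.mp (hZs hZ)
      refine mem_filter.mpr ⟨mem_powerset.mpr (union_subset (union_subset hd' he') hZ'), ?_⟩
      have a1 : ∑ l ∈ d, Real.log (l:ℝ) ≤ LA M := by
        by_contra h; exact hd0 (lam_zero P _ d h)
      have a2 : ∑ l ∈ e, Real.log (l:ℝ) ≤ LA M := by
        by_contra h; exact he0 (lam_zero P _ e h)
      have a3 : ∑ l ∈ Z, Real.log (l:ℝ) ≤ 6 * LA M := by
        have : ∑ l ∈ Z, Real.log (l:ℝ) ≤ Z.card • (6 * LA M) :=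
          sum_le_card_nsmul _ _ _ fun l hl => ((mem_PP M l1 l).mp (hZ' hl)).1
        refine this.trans ?_
        rw [nsmul_eq_mul]
        have : (Z.card : ℝ) ≤ 1 := by exact_mod_cast hc Z hZ
        nlinarith
      have u : ∀ a b : Finset ℕ, ∑ l ∈ a ∪ b, Real.log (l:ℝ) ≤ ∑ l ∈ a, Real.log (l:ℝ) + ∑ l ∈ b, Real.log (l:ℝ) := by
        intro a b
        rw [← sum_union_inter]
        have : 0 ≤ ∑ l ∈ a ∩ b, Real.log (l:ℝ) := sum_nonneg fun l _ => Real.log_natCast_nonneg l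
        linarith
      have u1 := u (d ∪ e) Z
      have u2 := u d e
      linarith)
  have h2 : ∑ D ∈ 𝒟, 18^D.card * |ED M (∏ l ∈ D, l)| ≤ ∑ D ∈ mods M l1, tau D^5 * |ED M D| := by
    calc ∑ D ∈ 𝒟, 18^D.card * |ED M (∏ l ∈ D, l)| ≤ ∑ D ∈ 𝒟, tau (∏ l ∈ D, l)^5 * |ED M (∏ l ∈ D, l)| := by
          refine sum_le_sum fun D hD => mul_le_mul_of_nonneg_right ?_ (abs_nonneg _)
          have hD' := mem_powerset.mp (mem_filter.mp hD).1
          rw [tau_sq_free (sf_pr P hP D hD'), pf_pr P hP D hD', ← pow_mul, mul_comm, pow_mul]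
          exact pow_le_pow_left₀ (by norm_num) (by norm_num) _
      _ = ∑ n ∈ 𝒟.image (fun r : Finset ℕ => ∏ l ∈ r, l), tau n^5 * |ED M n| := by
          rw [sum_image]
          intro a ha b hb hab
          have ha := mem_powerset.mp (mem_filter.mp (mem_coe.mp ha)).1
          have hb := mem_powerset.mp (mem_filter.mp (mem_coe.mp hb)).1
          rw [← pf_pr P hP a ha, ← pf_pr P hP b hb]
          exact congrArg _ hab
      _ ≤ _ := by
          refine sum_le_sum_of_subset_of_nonneg ?_ fun n _ _ => ?_
          · intro n hn
            obtain ⟨r, hr, rfl⟩ := mem_image.mp hn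
            obtain ⟨b1, b2⟩ := mem_filter.mp hr
            exact mods_mem M l1 hl1 r (mem_powerset.mp b1) b2
          · have := tau_nonneg n
            positivity
  have h3 := mul_le_mul_of_nonneg_left h2 (sq_nonneg (LA M * (1 + LA M)^8))
  refine le_trans (sum_le_sum fun Z _ => ?_) (h1.trans h3)
  refine (abs_sum_le_sum_abs _ _).trans (sum_le_sum fun d _ => ?_)
  exact abs_sum_le_sum_abs _ _

/-- Sieve conclusion. -/
theorem sieve_main : ∃ M0 : ℕ, ∀ M : ℕ, M0 ≤ M → ∃ l1 : ℕ, ∃ p ∈ PI M, (Np M l1 p).card ≤ 6 := by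
  obtain ⟨M1, hM1⟩ := BV
  obtain ⟨A0, hA0⟩ := main_term
  obtain ⟨M2, hM2⟩ := ev_poly1 100000 (1/2) (by norm_num) 320
  refine ⟨max (max M1 M2) (max 10 ⌈A0⌉₊), fun M hM => ?_⟩
  have hMM1 : M1 ≤ M := le_trans (le_trans (le_max_left _ _) (le_max_left _ _)) hM
  have hMM2 : M2 ≤ M := le_trans (le_trans (le_max_right _ _) (le_max_left _ _)) hM
  have hM10 : 10 ≤ M := le_trans (le_trans (le_max_left _ _) (le_max_right _ _)) hM
  have hMA : A0 ≤ (M:ℝ) := (Nat.le_ceil A0).trans (by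
    exact_mod_cast le_trans (le_trans (le_max_right _ _) (le_max_right _ _)) hM)
  obtain ⟨l1, hl1, hBV⟩ := hM1 M hMM1
  refine ⟨l1, ?_⟩
  have h10 : (10:ℝ) ≤ M := by exact_mod_cast hM10
  have hL := L_big M hM10
  have hAM : (M:ℝ) ≤ LA M := by unfold LA; linarith
  have hA0' : 0 < LA M := by linarith
  have hAL : 1 + LA M ≤ (M:ℝ)^20 := by unfold LA; linarith
  have hP := hPP M l1
  have hmt := hA0 (LA M) (by linarith) (PP M l1) hP (fun l hl => ((mem_PP M l1 l).mp hl).1)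
  have hmt0 := main_term0 (LA M) (PP M l1) hP
  have hid := sieve_id (PI M) (wt M) (Np M l1) (PP M l1) gq hq (fun l hl => gh_id l (hP l hl).2)
    (fun l hl => (gq_pos l (hP l hl).2).ne') (mass M) (fun D => ED M (∏ l ∈ D, l)) (hEr M l1) (yy (LA M))
  have hid0 := hid ∅ (empty_subset _)
  have hE0 := err_total M l1 hl1 {∅} (by simp) (by simp)
  have hE1 := err_total M l1 hl1 ((PP M l1).image (fun q => {q})) (by
    intro Z hZ
    obtain ⟨q, hq', rfl⟩ := mem_image.mp hZ
    simpa using hq') (by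
    intro Z hZ
    obtain ⟨q, hq', rfl⟩ := mem_image.mp hZ
    simp)
  rw [sum_singleton] at hE0
  rw [sum_image (by intro a _ b _ h; simpa using h)] at hE1
  set EB := (LA M * (1 + LA M)^8)^2 * ∑ D ∈ mods M l1, tau D^5 * |ED M D| with hEB
  have hsum : ∑ q ∈ PP M l1, ∑ p ∈ PI M, wt M p * ((if {q} ⊆ Np M l1 p then 1 else 0) * FF (PP M l1) hq (yy (LA M)) (Np M l1 p) ^ 2) ≤
      mass M * (6.995 * SS2 (PP M l1) (LA M)) + EB := by
    have hmass : 0 ≤ mass M := sum_nonneg fun p _ => wt_nonneg M p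
    rw [sum_congr rfl fun q hq' => hid {q} (by simpa using hq'), sum_add_distrib, ← mul_sum]
    refine add_le_add (mul_le_mul_of_nonneg_left hmt hmass) (le_trans (sum_le_sum fun q _ => le_abs_self _) hE1)
  have hsum0 : mass M * SS2 (PP M l1) (LA M) - EB ≤ ∑ p ∈ PI M, wt M p * FF (PP M l1) hq (yy (LA M)) (Np M l1 p) ^ 2 := by
    rw [hmt0] at hid0
    simp only [empty_subset, if_true, one_mul] at hid0
    rw [hid0]
    have := neg_abs_le (∑ d ∈ (PP M l1).powerset, ∑ e ∈ (PP M l1).powerset,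
      (lam (PP M l1) gq hq (yy (LA M)) d * lam (PP M l1) gq hq (yy (LA M)) e) * ED M (∏ l ∈ d ∪ e ∪ ∅, l))
    linarith
  have hcount : ∀ p, ∑ q ∈ PP M l1, (if ({q}:Finset ℕ) ⊆ Np M l1 p then (1:ℝ) else 0) = (Np M l1 p).card := by
    intro p
    simp_rw [singleton_subset_iff]
    rw [← sum_filter, filter_mem_eq_inter, inter_eq_right.mpr (show Np M l1 p ⊆ PP M l1 from filter_subset _ _)]
    simp
  by_contra hcon
  push Not at hcon
  have hbig : 7 * ∑ p ∈ PI M, wt M p * FF (PP M l1) hq (yy (LA M)) (Np M l1 p) ^ 2 ≤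
      ∑ q ∈ PP M l1, ∑ p ∈ PI M, wt M p * ((if {q} ⊆ Np M l1 p then 1 else 0) * FF (PP M l1) hq (yy (LA M)) (Np M l1 p) ^ 2) := by
    rw [sum_comm, mul_sum]
    refine sum_le_sum fun p hp => ?_
    rw [← mul_sum, ← sum_mul, hcount p]
    have h7 : (7:ℝ) ≤ (Np M l1 p).card := by exact_mod_cast hcon p hp
    have := mul_le_mul_of_nonneg_right h7 (mul_nonneg (wt_nonneg M p) (sq_nonneg (FF (PP M l1) hq (yy (LA M)) (Np M l1 p))))
    refine this.trans (le_of_eq (by ring))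
  have hml := mass_lower M hM10
  have hN := Nk_pos M (by omega)
  have hS2 := SS2_ge (LA M) hA0'.le (PP M l1) hP
  have hprod : Nk M / 16 * (LA M)^2 ≤ mass M * SS2 (PP M l1) (LA M) :=
    mul_le_mul hml hS2 (sq_nonneg _) (by linarith)
  have hEB2 : EB ≤ (LA M)^2 * (Nk M / 100000) := by
    have h1 : EB ≤ (LA M * (1 + LA M)^8)^2 * (Nk M * Real.exp (-(M/2))) :=
      mul_le_mul_of_nonneg_left hBV (sq_nonneg _)
    have h2 : ((1 + LA M)^8)^2 ≤ (M:ℝ)^320 := by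
      rw [← pow_mul]
      refine (pow_le_pow_left₀ (by linarith) hAL 16).trans (le_of_eq ?_)
      rw [← pow_mul]
    have h3 := hM2 M hMM2
    have h4 : (M:ℝ)^320 * Real.exp (-(M/2)) ≤ 1 / 100000 := by
      rw [Real.exp_neg, ← div_eq_mul_inv, div_le_div_iff₀ (Real.exp_pos _) (by norm_num)]
      have e : 1/2 * (M:ℝ) = M/2 := by ring
      rw [e] at h3
      linarith
    have h5 : ((1 + LA M)^8)^2 * Real.exp (-(M/2)) ≤ 1 / 100000 :=
      (mul_le_mul_of_nonneg_right h2 (Real.exp_pos _).le).trans h4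
    have h6 := mul_le_mul_of_nonneg_left h5 (by positivity : 0 ≤ (LA M)^2 * Nk M)
    refine h1.trans (le_trans (le_of_eq ?_) (h6.trans (le_of_eq ?_)))
    · rw [mul_pow]; ring
    · ring
  have hpos : 0 < Nk M * (LA M)^2 := by positivity
  nlinarith

end PSLSieve
end

section
open Finset
namespace PSLSieve

lemma big_count (M p : ℕ) (hM : 10 ≤ M) (hp : 2 ≤ p) (h : Real.log p ≤ 1.005 * (M:ℝ)^20) :
    ((p^2-1).primeFactors.filter (fun q : ℕ => 6 * LA M < Real.log q)).card ≤ 10 := by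
  by_contra hcon
  push Not at hcon
  set B := (p^2-1).primeFactors.filter (fun q : ℕ => 6 * LA M < Real.log q) with hB
  have hL := L_big M hM
  have h10 : (10:ℝ) ≤ M := by exact_mod_cast hM
  have hA : 0 < LA M := by unfold LA; linarith
  have h1 : B.card • (6 * LA M) ≤ ∑ q ∈ B, Real.log (q:ℝ) :=
    card_nsmul_le_sum _ _ _ fun q hq' => (mem_filter.mp hq').2.le
  have h4 : 4 ≤ p^2 := by nlinarith
  have h2 : ∑ q ∈ B, Real.log (q:ℝ) ≤ 2 * Real.log p := by
    have hprime : ∀ q ∈ B, q.Prime := fun q hq' => (Nat.mem_primeFactors.mp (mem_filter.mp hq').1).1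
    have hdv : (∏ q ∈ B, q) ∣ p^2 - 1 :=
      Finset.prod_primes_dvd _ (fun q hq' => (hprime q hq').prime) fun q hq' => (Nat.mem_primeFactors.mp (mem_filter.mp hq').1).2.1
    have hle : (∏ q ∈ B, q) ≤ p^2 := (Nat.le_of_dvd (by omega) hdv).trans (Nat.sub_le _ _)
    rw [← Real.log_prod (fun q hq' => by exact_mod_cast (hprime q hq').ne_zero), ← Nat.cast_prod]
    have hpos : 0 < ∏ q ∈ B, q := prod_pos fun q hq' => (hprime q hq').pos
    have : Real.log ((∏ q ∈ B, q : ℕ):ℝ) ≤ Real.log ((p:ℝ)^2) :=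
      Real.log_le_log (by exact_mod_cast hpos) (by exact_mod_cast hle)
    rw [Real.log_pow] at this
    exact_mod_cast this
  rw [nsmul_eq_mul] at h1
  have h11 : (11:ℝ) ≤ B.card := by exact_mod_cast hcon
  have h3 := mul_le_mul_of_nonneg_right h11 (by linarith : 0 ≤ 6 * LA M)
  unfold LA at *
  linarith

lemma final_count (M l1 p : ℕ) (hM : 10 ≤ M) (hpp : p.Prime) (h : Real.log p ≤ 1.005 * (M:ℝ)^20)
    (hN : (Np M l1 p).card ≤ 6) : (p * (p ^ 2 - 1) / 2).primeFactors.card ≤ 20 := by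
  have hp2 := hpp.two_le
  have h4 : 4 ≤ p^2 := by nlinarith
  have hne : p * (p^2-1) ≠ 0 := Nat.mul_ne_zero (by omega) (by omega)
  have hB := big_count M p hM hp2 h
  set B := (p^2-1).primeFactors.filter (fun q : ℕ => 6 * LA M < Real.log q) with hBdef
  have hsub : (p * (p ^ 2 - 1) / 2).primeFactors ⊆ ({p, 2, 3, l1} ∪ Np M l1 p) ∪ B := by
    intro q hq'
    obtain ⟨hqp, hqd, hq0⟩ := Nat.mem_primeFactors.mp hq'
    have h2 : 2 ∣ p * (p^2-1) := by
      rcases hpp.eq_two_or_odd with h | h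
      · rw [h]; norm_num
      · refine Dvd.dvd.mul_left ?_ p
        have : p^2 % 2 = 1 := by rw [Nat.pow_mod, h]
        omega
    have hqd' : q ∣ p * (p^2-1) := hqd.trans (Nat.div_dvd_of_dvd h2)
    simp only [mem_union, mem_insert, mem_singleton]
    by_cases e1 : q = p
    · simp [e1]
    by_cases e2 : q = 2
    · simp [e2]
    by_cases e3 : q = 3
    · simp [e3]
    by_cases e4 : q = l1
    · simp [e4]
    have hd : q ∣ p^2-1 := by
      rcases hqp.dvd_mul.mp hqd' with h | h
      · exact absurd ((Nat.prime_dvd_prime_iff_eq hqp hpp).mp h) e1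
      · exact h
    have h5 : 5 ≤ q := by
      by_contra hlt
      have := hqp.two_le
      interval_cases q
      · exact e2 rfl
      · exact e3 rfl
      · exact absurd hqp (by norm_num)
    by_cases hl : Real.log q ≤ 6 * LA M
    · left; right
      exact mem_filter.mpr ⟨(mem_PP M l1 q).mpr ⟨hl, hqp, h5, e4⟩, hd⟩
    · right
      exact mem_filter.mpr ⟨Nat.mem_primeFactors.mpr ⟨hqp, hd, by omega⟩, lt_of_not_ge hl⟩
  have hc := card_le_card hsub
  have c1 := card_union_le ({p, 2, 3, l1} ∪ Np M l1 p) B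
  have c2 := card_union_le ({p, 2, 3, l1} : Finset ℕ) (Np M l1 p)
  have c3 : ({p, 2, 3, l1} : Finset ℕ).card ≤ 4 := card_le_four
  omega

theorem final : {p : ℕ | p.Prime ∧ (p * (p ^ 2 - 1) / 2).primeFactors.card ≤ 20}.Infinite := by
  obtain ⟨M0, hM0⟩ := sieve_main
  refine Set.infinite_of_forall_exists_gt fun n => ?_
  obtain ⟨l1, p, hp, hN⟩ := hM0 (max M0 (max 10 n)) (le_max_left _ _)
  set M := max M0 (max 10 n) with hM
  have hM10 : 10 ≤ M := (le_max_left _ _).trans (le_max_right _ _)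
  have hMn : n ≤ M := (le_max_right _ _).trans (le_max_right _ _)
  obtain ⟨hpp, hI⟩ := (mem_PI M p).mp hp
  obtain ⟨h1, h2⟩ := hI
  refine ⟨p, ⟨hpp, final_count M l1 p hM10 hpp h2 hN⟩, ?_⟩
  have hL := L_big M hM10
  have hpos : (0:ℝ) < p := by exact_mod_cast hpp.pos
  have := Real.log_le_sub_one_of_pos hpos
  have h10 : (10:ℝ) ≤ M := by exact_mod_cast hM10
  have : (M:ℝ) < p := by linarith
  have : M < p := by exact_mod_cast this
  omega

end PSLSieve
end

/-- There are infinitely many primes `p` such that `p(p² - 1)/2` (the order of `PSL(2,p)`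
for `p ≥ 5`) has at most `20` distinct prime divisors. -/
theorem stmt_18 :
    {p : ℕ | p.Prime ∧ (p * (p ^ 2 - 1) / 2).primeFactors.card ≤ 20}.Infinite := by
  exact PSLSieve.final
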